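/- Let p be a prime number and let w ∈ SU(p) * F₂ be a group word in two variables with coefficients in the special unitary group SU(p). If the content ε(w) does not lie in the subgroup [F₂,F₂]^p·[F₂,[F₂,F₂]] of F₂ (the subgroup generated by the p-th powers of elements of the commutator subgroup [F₂,F₂] together with [F₂,[F₂,F₂]]), then the equation w(a,b) = 1 can be solved in SU(p): there exist a,b ∈ SU(p) such that the image of w under the homomorphism SU(p) * F₂ → SU(p) restricting to the identity on SU(p) and sending the two free generators to a and b is trivial. -/

import Mathlib

/-- The special unitary group `SU(p)`, realized as the subgroup of the unitary group
`U(p) = unitaryGroup (Fin p) ℂ` consisting of the matrices of determinant `1`. -/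
def SU (p : ℕ) : Subgroup (Matrix.unitaryGroup (Fin p) ℂ) where
  carrier := {A | (A : Matrix (Fin p) (Fin p) ℂ).det = 1}
  one_mem' := by simp
  mul_mem' := by
    intro a b ha hb
    simp only [Set.mem_setOf_eq, Matrix.UnitaryGroup.mul_val, Matrix.det_mul] at *
    rw [ha, hb, mul_one]
  inv_mem' := by
    intro a ha
    simp only [Set.mem_setOf_eq, Matrix.UnitaryGroup.inv_val] at *
    rw [Matrix.star_eq_conjTranspose, Matrix.det_conjTranspose, ha, star_one]

/-- The content homomorphism `Γ ∗ F₂ → F₂`, killing the coefficients. -/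
def contentHom (Γ : Type*) [Group Γ] :
    Monoid.Coprod Γ (FreeGroup (Fin 2)) →* FreeGroup (Fin 2) :=
  Monoid.Coprod.lift 1 (MonoidHom.id _)

section

/-- Cochains on a set: functions on nonempty tuples `x :: l`, of mixed degree. -/
@[ext] structure Coch (k X : Type*) where
  /-- The underlying function. -/
  toFun : X → List X → k

namespace Coch

instance {k X : Type*} : CoeFun (Coch k X) fun _ => X → List X → k := ⟨toFun⟩

theorem ext' {k X : Type*} {φ ψ : Coch k X} (h : ∀ x l, φ x l = ψ x l) : φ = ψ :=
  Coch.ext (funext fun x => funext fun l => h x l)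

/-- Prepend a vertex. -/
def sh {k X : Type*} (x : X) (φ : Coch k X) : Coch k X := ⟨fun y l => φ x (y :: l)⟩

@[simp] theorem sh_apply {k X : Type*} (x : X) (φ : Coch k X) (y : X) (l : List X) :
    (sh x φ) y l = φ x (y :: l) := rfl

variable {k X Y W : Type*} [CommRing k]

instance : Zero (Coch k X) := ⟨⟨fun _ _ => 0⟩⟩
instance : Add (Coch k X) := ⟨fun φ ψ => ⟨fun x l => φ x l + ψ x l⟩⟩
instance : Neg (Coch k X) := ⟨fun φ => ⟨fun x l => -φ x l⟩⟩
instance : Sub (Coch k X) := ⟨fun φ ψ => ⟨fun x l => φ x l - ψ x l⟩⟩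
instance {S : Type*} [SMul S k] : SMul S (Coch k X) := ⟨fun c φ => ⟨fun x l => c • φ x l⟩⟩

instance : AddCommGroup (Coch k X) :=
  Function.Injective.addCommGroup toFun (fun _ _ h => Coch.ext h) rfl (fun _ _ => rfl)
    (fun _ => rfl) (fun _ _ => rfl) (fun _ _ => rfl) (fun _ _ => rfl)

/-- The underlying function, as an additive homomorphism. -/
def toFunHom : Coch k X →+ (X → List X → k) where
  toFun := toFun
  map_zero' := rfl
  map_add' _ _ := rfl

instance : Module k (Coch k X) :=
  Function.Injective.module k toFunHom (fun _ _ h => Coch.ext h) (fun _ _ => rfl)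

@[simp] theorem zero_apply (x : X) (l : List X) : (0 : Coch k X) x l = 0 := rfl
@[simp] theorem add_apply (φ ψ : Coch k X) (x : X) (l : List X) :
    (φ + ψ) x l = φ x l + ψ x l := rfl
@[simp] theorem sub_apply (φ ψ : Coch k X) (x : X) (l : List X) :
    (φ - ψ) x l = φ x l - ψ x l := rfl
@[simp] theorem neg_apply (φ : Coch k X) (x : X) (l : List X) : (-φ) x l = -φ x l := rfl
@[simp] theorem smul_apply (c : k) (φ : Coch k X) (x : X) (l : List X) :
    (c • φ) x l = c * φ x l := rfl

theorem sum_apply {ι : Type*} (s : Finset ι) (φ : ι → Coch k X) (x : X) (l : List X) :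
    (∑ i ∈ s, φ i) x l = ∑ i ∈ s, φ i x l := by
  classical
  induction s using Finset.induction_on with
  | empty => simp
  | insert a s h ih => rw [Finset.sum_insert h, Finset.sum_insert h, add_apply, ih]

theorem sh_add (x : X) (φ ψ : Coch k X) : sh x (φ + ψ) = sh x φ + sh x ψ := rfl
theorem sh_sub (x : X) (φ ψ : Coch k X) : sh x (φ - ψ) = sh x φ - sh x ψ := rfl
theorem sh_smul (x : X) (c : k) (φ : Coch k X) : sh x (c • φ) = c • sh x φ := rfl
@[simp] theorem sh_zero (x : X) : sh x (0 : Coch k X) = 0 := rfl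

/-- The cup product. -/
def cup (φ ψ : Coch k X) : X → List X → k
  | x, [] => φ x [] * ψ x []
  | x, y :: l => φ x [] * ψ x (y :: l) + cup (sh x φ) ψ y l

instance : Mul (Coch k X) := ⟨fun φ ψ => ⟨cup φ ψ⟩⟩

/-- The unit cochain. -/
def unit : X → List X → k
  | _, [] => 1
  | _, _ :: _ => 0

instance : One (Coch k X) := ⟨⟨unit⟩⟩

@[simp] theorem mul_nil (φ ψ : Coch k X) (x : X) : (φ * ψ) x [] = φ x [] * ψ x [] := by
  change cup φ ψ x [] = _
  rw [cup]

theorem mul_cons (φ ψ : Coch k X) (x y : X) (l : List X) :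
    (φ * ψ) x (y :: l) = φ x [] * ψ x (y :: l) + (sh x φ * ψ) y l := by
  change cup φ ψ x (y :: l) = _
  rw [cup]; rfl

@[simp] theorem one_nil (x : X) : (1 : Coch k X) x [] = 1 := rfl
@[simp] theorem one_cons (x y : X) (l : List X) : (1 : Coch k X) x (y :: l) = 0 := rfl
@[simp] theorem sh_one (x : X) : sh x (1 : Coch k X) = 0 := rfl

theorem sh_mul (x : X) (φ ψ : Coch k X) :
    sh x (φ * ψ) = φ x [] • sh x ψ + sh x φ * ψ := by
  refine ext' fun y l => ?_
  simp [mul_cons]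

theorem add_mul' (φ φ' ψ : Coch k X) (x : X) (l : List X) :
    ((φ + φ') * ψ) x l = (φ * ψ) x l + (φ' * ψ) x l := by
  induction l generalizing φ φ' x with
  | nil => simp [add_mul]
  | cons y l ih => simp only [mul_cons, sh_add, ih, add_apply]; ring

theorem mul_add' (φ ψ ψ' : Coch k X) (x : X) (l : List X) :
    (φ * (ψ + ψ')) x l = (φ * ψ) x l + (φ * ψ') x l := by
  induction l generalizing φ x with
  | nil => simp [mul_add]
  | cons y l ih => simp only [mul_cons, ih, add_apply]; ring

theorem smul_mul' (c : k) (φ ψ : Coch k X) (x : X) (l : List X) :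
    ((c • φ) * ψ) x l = c * (φ * ψ) x l := by
  induction l generalizing φ x with
  | nil => simp [mul_assoc]
  | cons y l ih => simp only [mul_cons, sh_smul, ih, smul_apply]; ring

theorem mul_smul' (c : k) (φ ψ : Coch k X) (x : X) (l : List X) :
    (φ * (c • ψ)) x l = c * (φ * ψ) x l := by
  induction l generalizing φ x with
  | nil => simp; ring
  | cons y l ih => simp only [mul_cons, ih, smul_apply]; ring

theorem zero_mul' (ψ : Coch k X) (x : X) (l : List X) : ((0 : Coch k X) * ψ) x l = 0 := by
  have := smul_mul' 0 (0 : Coch k X) ψ x l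
  simpa using this

theorem mul_zero' (ψ : Coch k X) (x : X) (l : List X) : (ψ * (0 : Coch k X)) x l = 0 := by
  have := mul_smul' 0 ψ (0 : Coch k X) x l
  simpa using this

theorem mul_assoc' (φ ψ χ : Coch k X) (x : X) (l : List X) :
    (φ * ψ * χ) x l = (φ * (ψ * χ)) x l := by
  induction l generalizing φ x with
  | nil => simp [mul_assoc]
  | cons y l ih =>
    simp only [mul_cons, sh_mul, add_mul', smul_mul', ih, mul_nil]; ring

theorem one_mul' (ψ : Coch k X) (x : X) (l : List X) : ((1 : Coch k X) * ψ) x l = ψ x l := by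
  cases l with
  | nil => simp
  | cons y l => simp [mul_cons, zero_mul']

theorem mul_one' (φ : Coch k X) (x : X) (l : List X) : (φ * 1) x l = φ x l := by
  induction l generalizing φ x with
  | nil => simp
  | cons y l ih => simp [mul_cons, ih]

instance : Ring (Coch k X) where
  __ := (inferInstance : AddCommGroup (Coch k X))
  left_distrib φ ψ χ := ext' fun x l => mul_add' φ ψ χ x l
  right_distrib φ ψ χ := ext' fun x l => add_mul' φ ψ χ x l
  zero_mul φ := ext' fun x l => zero_mul' φ x l
  mul_zero φ := ext' fun x l => mul_zero' φ x l
  mul_assoc φ ψ χ := ext' fun x l => mul_assoc' φ ψ χ x l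
  one_mul φ := ext' fun x l => one_mul' φ x l
  mul_one φ := ext' fun x l => mul_one' φ x l

theorem smul_mul (c : k) (φ ψ : Coch k X) : (c • φ) * ψ = c • (φ * ψ) :=
  ext' fun x l => smul_mul' c φ ψ x l
theorem mul_smul (c : k) (φ ψ : Coch k X) : φ * (c • ψ) = c • (φ * ψ) :=
  ext' fun x l => mul_smul' c φ ψ x l

/-- The coboundary as a function. -/
def dFun (φ : Coch k X) : X → List X → k
  | _, [] => 0
  | x, y :: l => φ y l - dFun (sh x φ) y l - φ x [] * unit y l

theorem dFun_add (φ ψ : Coch k X) (x : X) (l : List X) :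
    dFun (φ + ψ) x l = dFun φ x l + dFun ψ x l := by
  induction l generalizing φ ψ x with
  | nil => simp [dFun]
  | cons y l ih => simp only [dFun, sh_add, ih, add_apply]; ring

theorem dFun_smul (c : k) (φ : Coch k X) (x : X) (l : List X) :
    dFun (c • φ) x l = c * dFun φ x l := by
  induction l generalizing φ x with
  | nil => simp [dFun]
  | cons y l ih => simp only [dFun, sh_smul, ih, smul_apply]; ring

/-- The coboundary. -/
def d : Coch k X →ₗ[k] Coch k X where
  toFun φ := ⟨dFun φ⟩
  map_add' φ ψ := ext' fun x l => dFun_add φ ψ x l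
  map_smul' c φ := ext' fun x l => dFun_smul c φ x l

@[simp] theorem d_nil (φ : Coch k X) (x : X) : d φ x [] = 0 := by
  change dFun φ x [] = 0
  rw [dFun]

theorem d_cons (φ : Coch k X) (x y : X) (l : List X) :
    d φ x (y :: l) = φ y l - d (sh x φ) y l - φ x [] * (1 : Coch k X) y l := by
  change dFun φ x (y :: l) = _
  rw [dFun]; rfl

theorem sh_d (x : X) (φ : Coch k X) : sh x (d φ) = φ - d (sh x φ) - φ x [] • 1 := by
  refine ext' fun y l => ?_
  simp [d_cons]

theorem d_pair (φ : Coch k X) (x y : X) : d φ x [y] = φ y [] - φ x [] := by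
  simp [d_cons]

theorem d_triple (φ : Coch k X) (x y z : X) :
    d φ x [y, z] = φ y [z] - φ x [z] + φ x [y] := by
  simp [d_cons]; ring

@[simp] theorem d_one : d (1 : Coch k X) = 0 := by
  refine ext' fun x l => ?_
  cases l with
  | nil => simp
  | cons y l => simp [d_cons]

@[simp] theorem d_d (φ : Coch k X) : d (d φ) = 0 := by
  refine ext' fun x l => ?_
  induction l generalizing φ x with
  | nil => simp
  | cons y l ih => rw [d_cons, sh_d]; simp [ih]

/-- The underlying function of the sign involution. -/
def barFun (φ : Coch k X) : Coch k X := ⟨fun x l => (-1) ^ l.length * φ x l⟩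

theorem barFun_apply (φ : Coch k X) (x : X) (l : List X) :
    barFun φ x l = (-1) ^ l.length * φ x l := rfl

theorem sh_barFun (x : X) (φ : Coch k X) : sh x (barFun φ) = (-1 : k) • barFun (sh x φ) := by
  refine ext' fun y l => ?_
  simp [barFun_apply, pow_succ]

/-- The sign involution. -/
def bar : Coch k X →+* Coch k X where
  toFun := barFun
  map_zero' := ext' fun x l => by simp [barFun_apply]
  map_one' := ext' fun x l => by cases l <;> simp [barFun_apply]
  map_add' φ ψ := ext' fun x l => by simp [barFun_apply, mul_add]
  map_mul' φ ψ := by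
    refine ext' fun x l => ?_
    induction l generalizing φ x with
    | nil => simp [barFun_apply]
    | cons y l ih =>
      have ih' := ih (sh x φ) y
      rw [barFun_apply] at ih' ⊢
      rw [mul_cons, mul_cons, sh_barFun, smul_mul', ← ih']
      simp only [barFun_apply, List.length_cons, List.length_nil, pow_succ, pow_zero]
      ring

@[simp] theorem bar_apply (φ : Coch k X) (x : X) (l : List X) :
    bar φ x l = (-1) ^ l.length * φ x l := rfl

theorem sh_bar (x : X) (φ : Coch k X) : sh x (bar φ) = (-1 : k) • bar (sh x φ) :=
  sh_barFun x φ

@[simp] theorem bar_bar (φ : Coch k X) : bar (bar φ) = φ :=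
  ext' fun x l => by simp [← mul_assoc, ← mul_pow]

theorem d_bar (φ : Coch k X) : d (bar φ) = -bar (d φ) := by
  refine ext' fun x l => ?_
  induction l generalizing φ x with
  | nil => simp
  | cons y l ih =>
    have ih' := ih (sh x φ) y
    simp only [neg_apply, bar_apply, List.length_cons] at ih' ⊢
    rw [d_cons, d_cons, sh_bar, map_smul, smul_apply, ih']
    simp only [bar_apply, List.length_nil, pow_succ]
    cases l <;> simp; ring

theorem d_mul (φ ψ : Coch k X) : d (φ * ψ) = d φ * ψ + bar φ * d ψ := by
  refine ext' fun x l => ?_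
  induction l generalizing φ x with
  | nil => simp
  | cons y l ih =>
    have ih' := ih (sh x φ) y
    simp only [add_apply, mul_cons, d_cons, d_nil, sh_mul, sh_d, sh_bar, map_add, map_smul,
      smul_apply, ih', mul_nil, sub_mul, smul_mul, sub_apply, one_mul, bar_apply,
      List.length_nil, pow_zero] at ih' ⊢
    ring

/-- Pullback along a map. -/
def pull (f : X → Y) : Coch k Y →+* Coch k X where
  toFun φ := ⟨fun x l => φ (f x) (l.map f)⟩
  map_zero' := rfl
  map_one' := ext' fun x l => by cases l <;> rfl
  map_add' _ _ := rfl
  map_mul' φ ψ := by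
    refine ext' fun x l => ?_
    induction l generalizing φ x with
    | nil => rfl
    | cons y l ih =>
      have ih' := ih (sh (f x) φ) y
      simp only [List.map_cons, List.map_nil, mul_cons] at ih' ⊢
      rw [ih']
      rfl

@[simp] theorem pull_apply (f : X → Y) (φ : Coch k Y) (x : X) (l : List X) :
    pull f φ x l = φ (f x) (l.map f) := rfl

theorem sh_pull (f : X → Y) (x : X) (φ : Coch k Y) : sh x (pull f φ) = pull f (sh (f x) φ) := rfl

theorem pull_pull (f : X → Y) (g : Y → W) (φ : Coch k W) :
    pull f (pull g φ) = pull (g ∘ f) φ := ext' fun x l => by simp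

theorem pull_d (f : X → Y) (φ : Coch k Y) : pull f (d φ) = d (pull f φ) := by
  refine ext' fun x l => ?_
  induction l generalizing φ x with
  | nil => simp
  | cons y l ih =>
    have ih' := ih (sh (f x) φ) y
    simp only [pull_apply, List.map_cons] at ih' ⊢
    rw [d_cons, d_cons, ih', sh_pull]
    cases l <;> simp

theorem pull_bar (f : X → Y) (φ : Coch k Y) : pull f (bar φ) = bar (pull f φ) :=
  ext' fun x l => by simp

/-- The underlying function of the prism operator. -/
def prismFun (f g : X → Y) (φ : Coch k Y) : X → List X → k
  | x, [] => φ (f x) [g x]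
  | x, y :: l => φ (f x) (g x :: g y :: l.map g) - prismFun f g (sh (f x) φ) y l

theorem prismFun_add (f g : X → Y) (φ ψ : Coch k Y) (x : X) (l : List X) :
    prismFun f g (φ + ψ) x l = prismFun f g φ x l + prismFun f g ψ x l := by
  induction l generalizing φ ψ x with
  | nil => simp [prismFun]
  | cons y l ih => simp only [prismFun, sh_add, ih, add_apply]; ring

theorem prismFun_smul (f g : X → Y) (c : k) (φ : Coch k Y) (x : X) (l : List X) :
    prismFun f g (c • φ) x l = c * prismFun f g φ x l := by
  induction l generalizing φ x with
  | nil => simp [prismFun]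
  | cons y l ih => simp only [prismFun, sh_smul, ih, smul_apply]; ring

/-- The prism operator between two maps. -/
def prism (f g : X → Y) : Coch k Y →ₗ[k] Coch k X where
  toFun φ := ⟨prismFun f g φ⟩
  map_add' φ ψ := ext' fun x l => prismFun_add f g φ ψ x l
  map_smul' c φ := ext' fun x l => prismFun_smul f g c φ x l

@[simp] theorem prism_nil (f g : X → Y) (φ : Coch k Y) (x : X) :
    prism f g φ x [] = φ (f x) [g x] := by
  change prismFun f g φ x [] = _
  rw [prismFun]

theorem prism_cons (f g : X → Y) (φ : Coch k Y) (x y : X) (l : List X) :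
    prism f g φ x (y :: l) =
      φ (f x) (g x :: g y :: l.map g) - prism f g (sh (f x) φ) y l := by
  change prismFun f g φ x (y :: l) = _
  rw [prismFun]; rfl

theorem sh_prism (f g : X → Y) (φ : Coch k Y) (x : X) :
    sh x (prism f g φ) = pull g (sh (g x) (sh (f x) φ)) - prism f g (sh (f x) φ) :=
  ext' fun y l => by simp [prism_cons]

theorem prism_one (f g : X → Y) : prism f g (1 : Coch k Y) = 0 := by
  refine ext' fun x l => ?_
  cases l with
  | nil => simp
  | cons y l => simp [prism_cons]

theorem prism_d (f g : X → Y) (φ : Coch k Y) :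
    d (prism f g φ) + prism f g (d φ) = pull g φ - pull f φ := by
  refine ext' fun x l => ?_
  induction l generalizing φ x with
  | nil => simp [d_pair]
  | cons y l ih =>
    have ih' := ih (sh (f x) φ) y
    simp only [add_apply, sub_apply, pull_apply, sh_apply] at ih' ⊢
    rw [d_cons, prism_cons, sh_prism, sh_d, map_sub, map_sub, map_sub, ← pull_d, map_smul,
      prism_one]
    simp only [sub_apply, pull_apply, prism_nil, d_cons, List.map_cons, smul_zero,
      zero_apply, sh_apply]
    have e : (1 : Coch k Y) (g y) (l.map g) = (1 : Coch k X) y l := by cases l <;> rfl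
    simp only [one_cons, e]
    linear_combination ih'

theorem prism_mul (f g : X → Y) (φ ψ : Coch k Y) :
    prism f g (φ * ψ) = prism f g φ * pull g ψ + bar (pull f φ) * prism f g ψ := by
  refine ext' fun x l => ?_
  induction l generalizing φ x with
  | nil => simp [mul_cons]; ring
  | cons y l ih =>
    have ih' := ih (sh (f x) φ) y
    simp only [add_apply] at ih' ⊢
    have e : (sh (g x) (sh (f x) φ) * ψ) (g y) (l.map g)
        = (pull g (sh (g x) (sh (f x) φ)) * pull g ψ) y l := by rw [← map_mul]; rfl
    rw [prism_cons, mul_cons, mul_cons, mul_cons, mul_cons, sh_mul, map_add, map_smul, sh_prism,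
      sh_bar, sh_pull, smul_mul, add_apply, ih', smul_apply, smul_apply, sub_mul, e]
    simp only [sub_apply, prism_nil, prism_cons, pull_apply, bar_apply, List.map_cons,
      List.map_nil, List.length_nil, pow_zero, sh_apply]
    ring

theorem pull_prism {Z : Type*} (f g : X → Y) (h : Z → X) (φ : Coch k Y) :
    pull h (prism f g φ) = prism (f ∘ h) (g ∘ h) φ := by
  refine ext' fun x l => ?_
  induction l generalizing φ x with
  | nil => simp
  | cons y l ih =>
    have ih' := ih (sh (f (h x)) φ) y
    simp only [pull_apply, List.map_cons] at ih' ⊢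
    rw [prism_cons, prism_cons, ih']
    simp

theorem prism_pull {Z : Type*} (f g : X → Y) (u : Y → Z) (φ : Coch k Z) :
    prism f g (pull u φ) = prism (u ∘ f) (u ∘ g) φ := by
  refine ext' fun x l => ?_
  induction l generalizing φ x with
  | nil => simp
  | cons y l ih =>
    have ih' := ih (sh (u (f x)) φ) y
    rw [prism_cons, prism_cons, sh_pull, ih']
    simp

end Coch

end

section

open Uniformity

/-- Differential graded rings, with the grading recorded by the sign involution. -/
class DGRing (R : Type*) extends Ring R where
  /-- The differential. -/
  d : R →+ R
  /-- The sign involution. -/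
  bar : R →+* R
  d_d : ∀ a, d (d a) = 0
  d_one : d 1 = 0
  d_bar : ∀ a, d (bar a) = -bar (d a)
  bar_bar : ∀ a, bar (bar a) = a
  d_mul : ∀ a b, d (a * b) = d a * b + bar a * d b

namespace DGRing

variable {R S T : Type*} [DGRing R] [DGRing S] [DGRing T]

attribute [simp] d_d d_one bar_bar

variable (R) in
/-- The subring of cocycles. -/
def cocycles : Subring R where
  carrier := {a | d a = 0}
  mul_mem' {a b} ha hb := by
    simp only [Set.mem_ofPred_eq] at *
    simp [d_mul, ha, hb]
  one_mem' := d_one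
  add_mem' {a b} ha hb := by
    simp only [Set.mem_ofPred_eq] at *
    simp [ha, hb]
  zero_mem' := map_zero _
  neg_mem' {a} ha := by
    simp only [Set.mem_ofPred_eq] at *
    simp [ha]

theorem mem_cocycles {a : R} : a ∈ cocycles R ↔ d a = 0 := Iff.rfl

variable (R) in
/-- The ideal of coboundaries. -/
def coboundaries : Ideal (cocycles R) where
  carrier := {a | ∃ b, d b = (a : R)}
  add_mem' := by
    rintro a b ⟨x, hx⟩ ⟨y, hy⟩
    exact ⟨x + y, by simp [hx, hy]⟩
  zero_mem' := ⟨0, by simp⟩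
  smul_mem' := by
    rintro c a ⟨x, hx⟩
    refine ⟨(bar : R →+* R) c * x, ?_⟩
    have hc : d (c : R) = 0 := c.2
    simp [d_mul, d_bar, hc, hx]

instance : (coboundaries R).IsTwoSided where
  mul_mem_of_left := by
    rintro a b ⟨x, hx⟩
    refine ⟨x * b, ?_⟩
    have hb : d (b : R) = 0 := b.2
    simp [d_mul, hb, hx]

variable (R) in
/-- The cohomology ring. -/
def H := cocycles R ⧸ coboundaries R

instance : Ring (H R) := inferInstanceAs (Ring (cocycles R ⧸ coboundaries R))

/-- The class of a cocycle. -/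
def cls (a : R) (ha : d a = 0) : H R := Ideal.Quotient.mk (coboundaries R) ⟨a, ha⟩

theorem cls_eq_iff {a b : R} (ha : d a = 0) (hb : d b = 0) :
    cls a ha = cls b hb ↔ ∃ c, d c = a - b := Ideal.Quotient.eq

theorem cls_eq_zero_iff {a : R} (ha : d a = 0) : cls a ha = 0 ↔ ∃ c, d c = a :=
  Ideal.Quotient.eq_zero_iff_mem

theorem cls_surj (x : H R) : ∃ (a : R) (ha : d a = 0), cls a ha = x := by
  obtain ⟨⟨a, ha⟩, rfl⟩ := Ideal.Quotient.mk_surjective x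
  exact ⟨a, ha, rfl⟩

theorem d_mul_eq_zero {a b : R} (ha : d a = 0) (hb : d b = 0) : d (a * b) = 0 := by
  simp [d_mul, ha, hb]
theorem d_add_eq_zero {a b : R} (ha : d a = 0) (hb : d b = 0) : d (a + b) = 0 := by
  simp [ha, hb]
theorem d_neg_eq_zero {a : R} (ha : d a = 0) : d (-a) = 0 := by
  simp [ha]
theorem d_pow_eq_zero {a : R} (ha : d a = 0) (n : ℕ) : d (a ^ n) = 0 :=
  (cocycles R).pow_mem ha n
theorem d_bar_eq_zero {a : R} (ha : d a = 0) : d ((bar : R →+* R) a) = 0 := by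
  simp [d_bar, ha]

theorem cls_mul {a b : R} (ha : d a = 0) (hb : d b = 0) :
    cls a ha * cls b hb = cls (a * b) (d_mul_eq_zero ha hb) := rfl
theorem cls_add {a b : R} (ha : d a = 0) (hb : d b = 0) :
    cls a ha + cls b hb = cls (a + b) (d_add_eq_zero ha hb) := rfl
theorem cls_neg {a : R} (ha : d a = 0) : -cls a ha = cls (-a) (d_neg_eq_zero ha) := rfl
theorem cls_pow {a : R} (ha : d a = 0) (n : ℕ) :
    cls a ha ^ n = cls (a ^ n) (d_pow_eq_zero ha n) := rfl
theorem cls_one : cls (1 : R) d_one = 1 := rfl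
theorem cls_congr {a b : R} (h : a = b) (ha : d a = 0) : cls a ha = cls b (h ▸ ha) := by
  subst h; rfl

/-- Cohomology is functorial. -/
def Hmap (f : R →+* S) (hf : ∀ a, f (d a) = d (f a)) : H R →+* H S :=
  Ideal.quotientMap (coboundaries S)
    ((f.comp (cocycles R).subtype).codRestrict (cocycles S) fun a => by
      have ha : d (a : R) = 0 := a.2
      simp [mem_cocycles, ← hf, ha])
    (by
      rintro a ⟨x, hx⟩
      exact ⟨f x, by rw [← hf, hx]; rfl⟩)

end DGRing

namespace Coch

variable {k X Y : Type*} [CommRing k]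

instance : DGRing (Coch k X) where
  d := d.toAddMonoidHom
  bar := bar
  d_d := d_d
  d_one := d_one
  d_bar := d_bar
  bar_bar := bar_bar
  d_mul := d_mul

variable (k X) in
/-- Locally vanishing cochains. -/
def Loc [UniformSpace X] : Ideal (Coch k X) where
  carrier := {φ | ∃ V ∈ 𝓤 X, ∀ S : Set X, S ×ˢ S ⊆ V → pull (Subtype.val : S → X) φ = 0}
  add_mem' := by
    rintro φ ψ ⟨V, hV, h⟩ ⟨V', hV', h'⟩
    refine ⟨V ∩ V', Filter.inter_mem hV hV', fun S hS => ?_⟩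
    rw [map_add, h S (hS.trans Set.inter_subset_left), h' S (hS.trans Set.inter_subset_right),
      add_zero]
  zero_mem' := ⟨Set.univ, Filter.univ_mem, fun S _ => map_zero _⟩
  smul_mem' := by
    rintro c φ ⟨V, hV, h⟩
    exact ⟨V, hV, fun S hS => by rw [smul_eq_mul, map_mul, h S hS, mul_zero]⟩

variable [UniformSpace X] [UniformSpace Y]

theorem mem_Loc {φ : Coch k X} : φ ∈ Loc k X ↔
    ∃ V ∈ 𝓤 X, ∀ S : Set X, S ×ˢ S ⊆ V → pull (Subtype.val : S → X) φ = 0 := Iff.rfl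

instance : (Loc k X).IsTwoSided where
  mul_mem_of_left := by
    rintro φ ψ ⟨V, hV, h⟩
    exact ⟨V, hV, fun S hS => by rw [map_mul, h S hS, zero_mul]⟩

theorem d_mem_Loc {φ : Coch k X} (h : φ ∈ Loc k X) : d φ ∈ Loc k X := by
  obtain ⟨V, hV, h⟩ := h
  exact ⟨V, hV, fun S hS => by rw [pull_d, h S hS, map_zero]⟩

theorem bar_mem_Loc {φ : Coch k X} (h : φ ∈ Loc k X) : bar φ ∈ Loc k X := by
  obtain ⟨V, hV, h⟩ := h
  exact ⟨V, hV, fun S hS => by rw [pull_bar, h S hS, map_zero]⟩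

theorem pull_mem_Loc {f : X → Y} (hf : UniformContinuous f) {φ : Coch k Y} (h : φ ∈ Loc k Y) :
    pull f φ ∈ Loc k X := by
  obtain ⟨V, hV, h⟩ := h
  refine ⟨_, hf hV, fun S hS => ?_⟩
  have e := h (f '' S) (by
    rintro ⟨_, _⟩ ⟨⟨x, hx, rfl⟩, ⟨y, hy, rfl⟩⟩
    exact hS (Set.mk_mem_prod hx hy))
  have e2 : f ∘ (Subtype.val : S → X) =
      (Subtype.val : f '' S → Y) ∘ (fun s : S => (⟨f s, s, s.2, rfl⟩ : f '' S)) := rfl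
  rw [pull_pull, e2, ← pull_pull, e, map_zero]

/-- Two maps are close at the scale `V`. -/
def Near (V : Set (Y × Y)) (f g : X → Y) : Prop :=
  ∃ U ∈ 𝓤 X, ∀ x y, (x, y) ∈ U →
    (f x, f y) ∈ V ∧ (f x, g y) ∈ V ∧ (g x, f y) ∈ V ∧ (g x, g y) ∈ V

theorem prism_mem_Loc {Y : Type*} {f g : X → Y} {V : Set (Y × Y)} (hfg : Near V f g) {φ : Coch k Y}
    (h : ∀ S : Set Y, S ×ˢ S ⊆ V → pull (Subtype.val : S → Y) φ = 0) :
    prism f g φ ∈ Loc k X := by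
  obtain ⟨U, hU, hUV⟩ := hfg
  refine ⟨U, hU, fun S hS => ?_⟩
  have e := h (f '' S ∪ g '' S) (by
    rintro ⟨_, _⟩ ⟨⟨x, hx, rfl⟩ | ⟨x, hx, rfl⟩, ⟨y, hy, rfl⟩ | ⟨y, hy, rfl⟩⟩
    · exact (hUV x y (hS (Set.mk_mem_prod hx hy))).1
    · exact (hUV x y (hS (Set.mk_mem_prod hx hy))).2.1
    · exact (hUV x y (hS (Set.mk_mem_prod hx hy))).2.2.1
    · exact (hUV x y (hS (Set.mk_mem_prod hx hy))).2.2.2)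
  have e2 : f ∘ (Subtype.val : S → X) = (Subtype.val : ↥(f '' S ∪ g '' S) → Y) ∘
      (fun s : S => ⟨f s, Or.inl ⟨s, s.2, rfl⟩⟩) := rfl
  have e3 : g ∘ (Subtype.val : S → X) = (Subtype.val : ↥(f '' S ∪ g '' S) → Y) ∘
      (fun s : S => ⟨g s, Or.inr ⟨s, s.2, rfl⟩⟩) := rfl
  rw [pull_prism, e2, e3, ← prism_pull, e, map_zero]

end Coch

open DGRing

section germs

variable (k X : Type*) [CommRing k] [UniformSpace X]

/-- Germs of cochains along the diagonal. -/
def Germ := Coch k X ⧸ Coch.Loc k X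

end germs

namespace Germ

variable {k X Y W : Type*} [CommRing k] [UniformSpace X] [UniformSpace Y] [UniformSpace W]

instance : Ring (Germ k X) := inferInstanceAs (Ring (Coch k X ⧸ Coch.Loc k X))

/-- The germ of a cochain. -/
def mk : Coch k X →+* Germ k X := Ideal.Quotient.mk (Coch.Loc k X)

theorem mk_surj (a : Germ k X) : ∃ φ, mk φ = a := Ideal.Quotient.mk_surjective a

theorem mk_eq_zero {φ : Coch k X} : mk φ = 0 ↔ φ ∈ Coch.Loc k X :=
  Ideal.Quotient.eq_zero_iff_mem

theorem mk_eq_mk {φ ψ : Coch k X} : mk φ = mk ψ ↔ φ - ψ ∈ Coch.Loc k X := Ideal.Quotient.eq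

/-- The differential on germs. -/
def dHom : Germ k X →+ Germ k X :=
  QuotientAddGroup.map (Coch.Loc k X).toAddSubgroup (Coch.Loc k X).toAddSubgroup
    (Coch.d (k := k) (X := X)).toAddMonoidHom fun _ h => Coch.d_mem_Loc h

/-- The sign involution on germs. -/
def barHom : Germ k X →+* Germ k X :=
  Ideal.quotientMap (Coch.Loc k X) Coch.bar fun _ h => Coch.bar_mem_Loc h

theorem dHom_mk (φ : Coch k X) : dHom (mk φ) = mk (Coch.d φ) := rfl
theorem barHom_mk (φ : Coch k X) : barHom (mk φ) = mk (Coch.bar φ) := rfl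

instance : DGRing (Germ k X) where
  d := dHom
  bar := barHom
  d_d a := by
    obtain ⟨φ, rfl⟩ := mk_surj a
    simp [dHom_mk]
  d_one := by rw [← map_one mk, dHom_mk, Coch.d_one, map_zero]
  d_bar a := by
    obtain ⟨φ, rfl⟩ := mk_surj a
    simp [dHom_mk, barHom_mk, Coch.d_bar]
  bar_bar a := by
    obtain ⟨φ, rfl⟩ := mk_surj a
    simp [barHom_mk]
  d_mul a b := by
    obtain ⟨φ, rfl⟩ := mk_surj a
    obtain ⟨ψ, rfl⟩ := mk_surj b
    simp only [← map_mul, dHom_mk, barHom_mk, ← map_add, Coch.d_mul]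

theorem d_mk (φ : Coch k X) : d (mk φ) = mk (Coch.d φ) := rfl
theorem bar_mk (φ : Coch k X) : (bar : Germ k X →+* _) (mk φ) = mk (Coch.bar φ) := rfl

/-- Pullback of germs. -/
def pull (f : X → Y) (hf : UniformContinuous f) : Germ k Y →+* Germ k X :=
  Ideal.quotientMap (Coch.Loc k X) (Coch.pull f) fun _ h => Coch.pull_mem_Loc hf h

theorem pull_mk (f : X → Y) (hf : UniformContinuous f) (φ : Coch k Y) :
    pull f hf (mk φ) = mk (Coch.pull f φ) := rfl

theorem pull_d (f : X → Y) (hf : UniformContinuous f) (a : Germ k Y) :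
    pull f hf (d a) = d (pull f hf a) := by
  obtain ⟨φ, rfl⟩ := mk_surj a
  simp only [d_mk, pull_mk, Coch.pull_d]

theorem pull_bar (f : X → Y) (hf : UniformContinuous f) (a : Germ k Y) :
    pull f hf ((bar : Germ k Y →+* _) a) = (bar : Germ k X →+* _) (pull f hf a) := by
  obtain ⟨φ, rfl⟩ := mk_surj a
  simp only [bar_mk, pull_mk, Coch.pull_bar]

theorem pull_pull (f : X → Y) (hf : UniformContinuous f) (g : Y → W) (hg : UniformContinuous g)
    (a : Germ k W) : pull f hf (pull g hg a) = pull (g ∘ f) (hg.comp hf) a := by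
  obtain ⟨φ, rfl⟩ := mk_surj a
  simp only [pull_mk, Coch.pull_pull]

theorem pull_id (a : Germ k X) : pull id uniformContinuous_id a = a := by
  obtain ⟨φ, rfl⟩ := mk_surj a
  rw [pull_mk]
  congr 1
  exact Coch.ext' fun x l => by simp

end Germ

/-- Alexander–Spanier cohomology of a uniform space. -/
abbrev HH (k X : Type*) [CommRing k] [UniformSpace X] := H (Germ k X)

namespace HH

variable {k X Y W : Type*} [CommRing k] [UniformSpace X] [UniformSpace Y] [UniformSpace W]

/-- Pullback in cohomology. -/
def pull (f : X → Y) (hf : UniformContinuous f) : HH k Y →+* HH k X :=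
  Hmap (Germ.pull f hf) (Germ.pull_d f hf)

theorem pull_cls (f : X → Y) (hf : UniformContinuous f) (a : Germ k Y) (ha : d a = 0) :
    pull f hf (cls a ha) = cls (Germ.pull f hf a) (by rw [← Germ.pull_d, ha, map_zero]) := rfl

theorem pull_pull (f : X → Y) (hf : UniformContinuous f) (g : Y → W) (hg : UniformContinuous g)
    (a : HH k W) : pull f hf (pull g hg a) = pull (g ∘ f) (hg.comp hf) a := by
  obtain ⟨a, ha, rfl⟩ := cls_surj a
  simp only [pull_cls, Germ.pull_pull]

theorem pull_id (a : HH k X) : pull id uniformContinuous_id a = a := by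
  obtain ⟨a, ha, rfl⟩ := cls_surj a
  simp only [pull_cls, Germ.pull_id]

theorem pull_congr {f g : X → Y} (h : f = g) (hf : UniformContinuous f) (a : HH k Y) :
    pull f hf a = pull g (h ▸ hf) a := by subst h; rfl

end HH

end

section

open Uniformity DGRing

namespace Coch

variable {k X Y T : Type*} [CommRing k] [UniformSpace X] [UniformSpace Y] [UniformSpace T]

theorem pull_sub_pull_of_near {Y : Type*} {f g : X → Y} {V : Set (Y × Y)} (hfg : Near V f g) {φ : Coch k Y}
    (h : ∀ S : Set Y, S ×ˢ S ⊆ V → pull (Subtype.val : S → Y) (d φ) = 0) :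
    (DGRing.d (Germ.mk (prism f g φ)) : Germ k X) = Germ.mk (pull g φ) - Germ.mk (pull f φ) := by
  rw [Germ.d_mk, ← map_sub, ← prism_d, map_add, Germ.mk_eq_zero.2 (prism_mem_Loc hfg h), add_zero]

end Coch

namespace HH

variable {k X Y T : Type*} [CommRing k] [UniformSpace X] [UniformSpace Y] [UniformSpace T]

theorem pull_eq_of_near {f g : X → Y} (hf : UniformContinuous f) (hg : UniformContinuous g)
    (h : ∀ V ∈ 𝓤 Y, Coch.Near V f g) (a : HH k Y) : pull f hf a = pull g hg a := by
  obtain ⟨a, ha, rfl⟩ := cls_surj a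
  obtain ⟨φ, rfl⟩ := Germ.mk_surj a
  obtain ⟨V, hV, hφ⟩ := Germ.mk_eq_zero.1 ha
  symm
  exact (cls_eq_iff _ _).2 ⟨_, Coch.pull_sub_pull_of_near (h V hV) hφ⟩

theorem uc_inc (t : T) : UniformContinuous fun x : X => (x, t) :=
  uniformContinuous_id.prodMk uniformContinuous_const

/-- Homotopy invariance. -/
theorem homotopy [PreconnectedSpace T] (a : HH k (X × T)) (s t : T) :
    pull (fun x => (x, s)) (uc_inc s) a = pull (fun x => (x, t)) (uc_inc t) a := by
  have key : IsLocallyConstant fun t => pull (fun x : X => (x, t)) (uc_inc t) a := by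
    rw [IsLocallyConstant.iff_eventually_eq]
    intro s
    obtain ⟨a, ha, rfl⟩ := cls_surj a
    obtain ⟨φ, rfl⟩ := Germ.mk_surj a
    obtain ⟨V, hV, hφ⟩ := Germ.mk_eq_zero.1 ha
    obtain ⟨U₁, hU₁, U₂, hU₂, hU⟩ := entourageProd_subset hV
    filter_upwards [UniformSpace.ball_mem_nhds s hU₂,
      UniformSpace.ball_mem_nhds s (symm_le_uniformity hU₂)] with t h1 h2
    refine (cls_eq_iff _ _).2 ⟨_, Coch.pull_sub_pull_of_near (f := fun x => (x, s))
      (g := fun x => (x, t)) ⟨U₁, hU₁, fun x y hxy => ?_⟩ hφ⟩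
    have h2 : (t, s) ∈ U₂ := h2
    exact ⟨hU ⟨hxy, refl_mem_uniformity hU₂⟩, hU ⟨hxy, h1⟩, hU ⟨hxy, h2⟩,
      hU ⟨hxy, refl_mem_uniformity hU₂⟩⟩
  exact key.apply_eq_of_preconnectedSpace s t

theorem one_ne_zero' [Nontrivial k] [Nonempty X] : (1 : HH k X) ≠ 0 := by
  rw [← cls_one, Ne, cls_eq_zero_iff]
  rintro ⟨a, ha⟩
  obtain ⟨φ, rfl⟩ := Germ.mk_surj a
  rw [Germ.d_mk, ← map_one Germ.mk, Germ.mk_eq_mk] at ha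
  obtain ⟨V, hV, h⟩ := ha
  obtain ⟨x⟩ := ‹Nonempty X›
  have := h {x} (by
    rintro ⟨a, b⟩ ⟨ha, hb⟩
    obtain rfl : a = x := ha
    obtain rfl : b = a := hb
    exact refl_mem_uniformity hV)
  have := congrArg (fun c : Coch k ({x} : Set X) => c ⟨x, rfl⟩ []) this
  simp at this

end HH

/-- A family of sets containing every sufficiently small nonempty set. -/
def UCover {X ι : Type*} [UniformSpace X] (U : ι → Set X) : Prop :=
  ∃ V ∈ 𝓤 X, ∀ A : Set X, A.Nonempty → A ×ˢ A ⊆ V → ∃ i, A ⊆ U i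

theorem UCover.of_fun {X ι : Type*} [UniformSpace X] [Finite ι] {f : ι → X → ℝ}
    (hf : ∀ i, UniformContinuous (f i)) {r r' : ℝ} (hr : r < r') (h : ∀ x, ∃ i, r' ≤ f i x) :
    UCover fun i => {x | r ≤ f i x} := by
  have hV : ∀ i, {z : X × X | |f i z.1 - f i z.2| < r' - r} ∈ 𝓤 X := fun i =>
    (hf i) (Metric.dist_mem_uniformity (sub_pos.2 hr))
  refine ⟨_, Filter.iInter_mem.2 hV, fun A ⟨x, hx⟩ hA => ?_⟩
  obtain ⟨i, hi⟩ := h x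
  refine ⟨i, fun y hy => ?_⟩
  have : |f i x - f i y| < r' - r := Set.mem_iInter.1 (hA (Set.mk_mem_prod hx hy)) i
  have := (abs_lt.1 this).2
  change r ≤ f i y
  linarith

namespace Germ

variable {k X Y T : Type*} [CommRing k] [UniformSpace X] [UniformSpace Y]

/-- Restriction to a subset. -/
abbrev res (S : Set X) : Germ k X →+* Germ k S := pull Subtype.val uniformContinuous_subtype_val

theorem res_surj (S : Set X) (b : Germ k S) : ∃ a : Germ k X, res S a = b := by
  obtain ⟨φ, rfl⟩ := mk_surj b
  rcases isEmpty_or_nonempty S with h | h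
  · refine ⟨0, ?_⟩
    rw [map_zero, ← map_zero mk]
    congr 1
    exact Coch.ext' fun x => isEmptyElim x
  · refine ⟨mk (Coch.pull (Function.invFun (Subtype.val : S → X)) φ), ?_⟩
    rw [pull_mk, Coch.pull_pull, Function.invFun_comp Subtype.val_injective]
    congr 1
    exact Coch.ext' fun x l => by simp

theorem res_mk_eq_zero {S : Set X} {φ : Coch k X} : res S (mk φ) = 0 ↔
    ∃ V ∈ 𝓤 X, ∀ A ⊆ S, A ×ˢ A ⊆ V → Coch.pull (Subtype.val : A → X) φ = 0 := by
  rw [pull_mk, mk_eq_zero, Coch.mem_Loc, uniformity_subtype]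
  constructor
  · rintro ⟨V, ⟨V', hV', hV⟩, h⟩
    refine ⟨V', hV', fun A hAS hA => ?_⟩
    have := h (Subtype.val ⁻¹' A) (by
      rintro ⟨⟨x, _⟩, ⟨y, _⟩⟩ ⟨hx, hy⟩
      exact hV (hA (Set.mk_mem_prod hx hy)))
    rw [Coch.pull_pull] at this
    have e : (Subtype.val : A → X) = (Subtype.val ∘ (Subtype.val : (Subtype.val ⁻¹' A : Set S) → S)) ∘
      fun a : A => (⟨⟨a, hAS a.2⟩, a.2⟩ : (Subtype.val ⁻¹' A : Set S)) := rfl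
    rw [e, ← Coch.pull_pull, this, map_zero]
  · rintro ⟨V, hV, h⟩
    refine ⟨_, ⟨V, hV, subset_rfl⟩, fun A hA => ?_⟩
    have := h (Subtype.val '' A) (by
      rintro _ ⟨x, _, rfl⟩
      exact x.2) (by
      rintro ⟨_, _⟩ ⟨⟨x, hx, rfl⟩, ⟨y, hy, rfl⟩⟩
      exact hA (Set.mk_mem_prod hx hy))
    rw [Coch.pull_pull]
    have e : (Subtype.val : S → X) ∘ (Subtype.val : A → S) =
      (Subtype.val : (Subtype.val '' A : Set X) → X) ∘ fun a => ⟨a.1.1, a.1, a.2, rfl⟩ := rfl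
    rw [e, ← Coch.pull_pull, this, map_zero]

theorem prod_eq_zero {n : ℕ} {a : Fin n → Germ k X} {U : Fin n → Set X} (hU : UCover U)
    (h : ∀ i, res (U i) (a i) = 0) : (List.ofFn a).prod = 0 := by
  choose φ hφ using fun i => mk_surj (a i)
  obtain rfl : (fun i => mk (φ i)) = a := funext hφ
  choose V hV hVφ using fun i => res_mk_eq_zero.1 (h i)
  obtain ⟨V', hV', hU⟩ := hU
  have e : List.ofFn (fun i => mk (φ i)) = (List.ofFn φ).map mk := by simp [List.map_ofFn]; rfl
  rw [e, ← map_list_prod, mk_eq_zero]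
  refine ⟨_, Filter.inter_mem hV' (Filter.iInter_mem.2 hV), fun A hA => ?_⟩
  rcases A.eq_empty_or_nonempty with rfl | hne
  · exact Coch.ext' fun x => isEmptyElim x
  obtain ⟨i, hi⟩ := hU A hne (hA.trans Set.inter_subset_left)
  rw [map_list_prod]
  apply List.prod_eq_zero
  rw [List.mem_map]
  exact ⟨φ i, List.mem_ofFn.2 ⟨i, rfl⟩,
    hVφ i A hi (hA.trans (Set.inter_subset_right.trans (Set.iInter_subset _ i)))⟩

end Germ

namespace HH

variable {k X Y T : Type*} [CommRing k] [UniformSpace X] [UniformSpace Y]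

/-- Restriction to a subset. -/
abbrev res (S : Set X) : HH k X →+* HH k S := pull Subtype.val uniformContinuous_subtype_val

theorem exists_rep_of_res_eq_zero {S : Set X} {a : HH k X} (h : res S a = 0) :
    ∃ (b : Germ k X) (hb : d b = 0), cls b hb = a ∧ Germ.res S b = 0 := by
  obtain ⟨a, ha, rfl⟩ := cls_surj a
  rw [pull_cls, cls_eq_zero_iff] at h
  obtain ⟨c, hc⟩ := h
  obtain ⟨c, rfl⟩ := Germ.res_surj S c
  refine ⟨a - d c, by simp [ha], (cls_eq_iff _ _).2 ⟨-c, by simp⟩, ?_⟩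
  rw [map_sub, Germ.pull_d, hc, sub_self]

theorem prod_eq_zero {n : ℕ} {a : Fin n → HH k X} {U : Fin n → Set X} (hU : UCover U)
    (h : ∀ i, res (U i) (a i) = 0) : (List.ofFn a).prod = 0 := by
  choose b hb hba hbr using fun i => exists_rep_of_res_eq_zero (h i)
  have e : Ideal.Quotient.mk (coboundaries (Germ k X))
      (List.ofFn fun i => (⟨b i, hb i⟩ : cocycles (Germ k X))).prod = (List.ofFn a).prod := by
    rw [map_list_prod, List.map_ofFn]
    congr 2
    exact funext hba
  have e2 : (List.ofFn fun i => (⟨b i, hb i⟩ : cocycles (Germ k X))).prod = 0 := by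
    apply Subtype.ext
    change (cocycles (Germ k X)).subtype _ = _
    rw [map_list_prod, List.map_ofFn]
    exact Germ.prod_eq_zero hU hbr
  rw [← e, e2]
  exact map_zero _

theorem mul_eq_zero_of_cover {S T : Set X} (hST : UCover ![S, T]) {a b : HH k X}
    (ha : res S a = 0) (hb : res T b = 0) : a * b = 0 := by
  have := prod_eq_zero (a := ![a, b]) hST (Fin.forall_fin_two.2 ⟨ha, hb⟩)
  simpa using this

end HH

end

section

open Uniformity DGRing

namespace Coch

variable {k X Y : Type*} [CommRing k]

/-- Cochains of degree `n`. -/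
def IsHom (n : ℕ) (φ : Coch k X) : Prop := ∀ x l, l.length ≠ n → φ x l = 0

theorem IsHom.sh {n : ℕ} {φ : Coch k X} (h : IsHom (n + 1) φ) (x : X) : IsHom n (sh x φ) :=
  fun y l hl => h x (y :: l) (by simpa using hl)

theorem IsHom.sh_zero {φ : Coch k X} (h : IsHom 0 φ) (x : X) : Coch.sh x φ = 0 :=
  ext' fun y l => h x (y :: l) (by simp)

theorem IsHom.pull {n : ℕ} {φ : Coch k Y} (h : IsHom n φ) (f : X → Y) : IsHom n (pull f φ) :=
  fun x l hl => h (f x) (l.map f) (by simpa using hl)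

theorem IsHom.d {n : ℕ} {φ : Coch k X} (h : IsHom n φ) : IsHom (n + 1) (d φ) := by
  intro x l hl
  induction n generalizing φ x l with
  | zero =>
    cases l with
    | nil => simp
    | cons y l =>
      rw [d_cons, h.sh_zero, map_zero, h y l (by simpa using hl)]
      cases l <;> simp at hl ⊢
  | succ n ih =>
    cases l with
    | nil => simp
    | cons y l =>
      rw [d_cons, ih (h.sh x) y l (by simpa using hl), h y l (by simpa using hl),
        h x [] (by simp)]
      simp

theorem IsHom.mul_cons_one {φ : Coch k X} (h : IsHom 1 φ) (ψ : Coch k X) (x y : X) (l : List X) :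
    (φ * ψ) x (y :: l) = φ x [y] * ψ y l := by
  rw [mul_cons, h x [] (by simp), zero_mul, zero_add]
  cases l with
  | nil => simp
  | cons z l => rw [mul_cons, (h.sh x).sh_zero]; simp

theorem IsHom.bar_one {φ : Coch k X} (h : IsHom 1 φ) : bar φ = -φ := by
  refine ext' fun x l => ?_
  by_cases hl : l.length = 1
  · simp [hl]
  · simp [h x l hl]

theorem IsHom.bar_two {φ : Coch k X} (h : IsHom 2 φ) : bar φ = φ := by
  refine ext' fun x l => ?_
  by_cases hl : l.length = 2
  · simp [hl]
  · simp [h x l hl]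

/-- The pointwise product of cochains. -/
def pmul (φ ψ : Coch k X) : Coch k X := ⟨fun x l => φ x l * ψ x l⟩

theorem IsHom.pmul {n : ℕ} {φ : Coch k X} (h : IsHom n φ) (ψ : Coch k X) : IsHom n (pmul φ ψ) :=
  fun x l hl => by simp [Coch.pmul, h x l hl]

theorem IsHom.trans_of_d {φ : Coch k X} (hd : Coch.d φ = 0) (x y z : X) :
    φ x [z] = φ x [y] + φ y [z] := by
  have := d_triple φ x y z
  rw [hd, zero_apply] at this
  linear_combination this

theorem anticomm {φ ψ : Coch k X} (h : IsHom 1 φ) (h' : IsHom 1 ψ) (hd : d φ = 0)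
    (hd' : d ψ = 0) : d (-pmul φ ψ) = φ * ψ + ψ * φ := by
  refine ext' fun x l => ?_
  rw [map_neg, neg_apply, add_apply]
  by_cases hl : l.length = 2
  · obtain ⟨y, z, rfl⟩ := List.length_eq_two.1 hl
    rw [d_triple, h.mul_cons_one, h'.mul_cons_one]
    simp only [pmul, IsHom.trans_of_d hd x y z, IsHom.trans_of_d hd' x y z]
    ring
  · rw [(h.pmul ψ).d x l hl]
    cases l with
    | nil => simp [h x [] (by simp), h' x [] (by simp)]
    | cons y l =>
      have hl' : l.length ≠ 1 := by simpa using hl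
      rw [h.mul_cons_one, h'.mul_cons_one, h y l hl', h' y l hl']
      simp

/-- Change of coefficients from the integers. -/
def cast (k : Type*) {X : Type*} [CommRing k] : Coch ℤ X →+* Coch k X where
  toFun φ := ⟨fun x l => φ x l⟩
  map_zero' := ext' fun x l => by simp
  map_add' φ ψ := ext' fun x l => by simp
  map_one' := ext' fun x l => by cases l <;> simp
  map_mul' φ ψ := by
    refine ext' fun x l => ?_
    change (((φ * ψ) x l : ℤ) : k) = _
    induction l generalizing φ x with
    | nil => simp
    | cons y l ih =>
      rw [mul_cons, mul_cons, Int.cast_add, ih (Coch.sh x φ) y]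
      simp; rfl

/-- The binomial coefficient cochain. -/
def choose2 (φ : Coch ℤ X) : Coch ℤ X := ⟨fun x l => φ x l * (φ x l - 1) / 2⟩

theorem cast_apply (φ : Coch ℤ X) (x : X) (l : List X) : cast k φ x l = φ x l := rfl

theorem pull_cast (f : X → Y) (φ : Coch ℤ Y) : pull f (cast k φ) = cast k (pull f φ) := rfl

theorem pull_choose2 (f : X → Y) (φ : Coch ℤ Y) : pull f (choose2 φ) = choose2 (pull f φ) := rfl

theorem d_cast (φ : Coch ℤ X) : d (cast k φ) = cast k (d φ) := by
  refine ext' fun x l => ?_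
  induction l generalizing φ x with
  | nil => simp [cast_apply]
  | cons y l ih =>
    have := ih (Coch.sh x φ) y
    rw [cast_apply] at this ⊢
    rw [d_cons, d_cons]
    change _ - d (cast k (Coch.sh x φ)) y l - _ = _
    rw [this]
    cases l <;> simp [cast_apply]

theorem d_choose2 {φ : Coch ℤ X} (h : IsHom 1 φ) (hd : d φ = 0) :
    d (choose2 φ) = -(φ ^ 2) := by
  have hc : IsHom 1 (choose2 φ) := fun x l hl => by simp [choose2, h x l hl]
  refine ext' fun x l => ?_
  rw [neg_apply, pow_two]
  by_cases hl : l.length = 2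
  · obtain ⟨y, z, rfl⟩ := List.length_eq_two.1 hl
    rw [d_triple, h.mul_cons_one]
    simp only [choose2, IsHom.trans_of_d hd x y z]
    have (a : ℤ) : 2 ∣ a * (a - 1) := by
      simpa using (Int.even_mul_pred_self a).two_dvd
    obtain ⟨m, hm⟩ := this (φ x [y])
    obtain ⟨n, hn⟩ := this (φ y [z])
    have e : (φ x [y] + φ y [z]) * (φ x [y] + φ y [z] - 1) = 2 * (m + n + φ x [y] * φ y [z]) := by
      linear_combination hm + hn
    rw [e, hm, hn, Int.mul_ediv_cancel_left _ two_ne_zero, Int.mul_ediv_cancel_left _ two_ne_zero,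
      Int.mul_ediv_cancel_left _ two_ne_zero]
    ring
  · rw [hc.d x l hl]
    cases l with
    | nil => simp [h x [] (by simp)]
    | cons y l =>
      have hl' : l.length ≠ 1 := by simpa using hl
      rw [h.mul_cons_one, h y l hl']
      simp

/-- The cup-one product with a cochain of degree two. -/
def cupOne (h : Coch k X) (φ : Coch k X) : X → List X → k
  | _, [] => 0
  | x, y :: l => (sh x h * sh x φ) y l - cupOne h (sh x φ) y l

/-- The cup-one product as a cochain. -/
def cupOneC (h φ : Coch k X) : Coch k X := ⟨cupOne h φ⟩

theorem cupOneC_nil (h φ : Coch k X) (x : X) : cupOneC h φ x [] = 0 := by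
  change cupOne h φ x [] = 0
  rw [cupOne]

theorem sh_cupOneC (h φ : Coch k X) (x : X) :
    sh x (cupOneC h φ) = sh x h * sh x φ - cupOneC h (sh x φ) := by
  refine ext' fun y l => ?_
  change cupOne h φ x (y :: l) = _
  rw [cupOne]; rfl

theorem cupOneC_cons (h φ : Coch k X) (x y : X) (l : List X) :
    cupOneC h φ x (y :: l) = (sh x h * sh x φ) y l - cupOneC h (sh x φ) y l :=
  congrArg (fun c => c y l) (sh_cupOneC h φ x)

theorem cupOneC_sub (h φ ψ : Coch k X) : cupOneC h (φ - ψ) = cupOneC h φ - cupOneC h ψ := by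
  refine ext' fun x l => ?_
  induction l generalizing φ ψ x with
  | nil => simp [cupOneC_nil]
  | cons y l ih =>
    have := ih (sh x φ) (sh x ψ) y
    simp only [sub_apply] at this ⊢
    rw [cupOneC_cons, cupOneC_cons, cupOneC_cons, sh_sub, this, mul_sub, sub_apply]
    ring

theorem cupOneC_zero (h : Coch k X) : cupOneC h 0 = 0 := by
  simpa using cupOneC_sub h 0 0

theorem cupOneC_smul_one (h : Coch k X) (c : k) : cupOneC h (c • 1) = 0 := by
  refine ext' fun x l => ?_
  cases l with
  | nil => simp [cupOneC_nil]
  | cons y l => rw [cupOneC_cons, sh_smul, sh_one, smul_zero, cupOneC_zero]; simp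

theorem pull_cupOneC (f : X → Y) (h φ : Coch k Y) :
    pull f (cupOneC h φ) = cupOneC (pull f h) (pull f φ) := by
  refine ext' fun x l => ?_
  induction l generalizing φ x with
  | nil => simp [cupOneC_nil]
  | cons y l ih =>
    have := ih (sh (f x) φ) y
    rw [pull_apply] at this ⊢
    rw [List.map_cons, cupOneC_cons, cupOneC_cons, this, sh_pull, sh_pull, ← map_mul]
    rfl

theorem d_cupOneC {h : Coch k X} (hh : IsHom 2 h) (hd : d h = 0) (φ : Coch k X) :
    d (cupOneC h φ) + cupOneC h (d φ) = h * φ - φ * h := by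
  refine ext' fun x l => ?_
  induction l generalizing φ x with
  | nil => simp [cupOneC_nil, hh x [] (by simp)]
  | cons y l ih =>
    have ih' := ih (sh x φ) y
    have h0 : h x [] = 0 := hh x [] (by simp)
    have e : d (sh x h * sh x φ) = h * sh x φ - sh x h * d (sh x φ) := by
      have : d (sh x h) = h := by
        have := sh_d x h
        rw [hd, sh_zero, h0] at this
        rw [zero_smul, sub_zero] at this
        exact (sub_eq_zero.1 this.symm).symm
      rw [d_mul, this, (hh.sh x).bar_one, neg_mul, sub_eq_add_neg]
    simp only [add_apply, sub_apply] at ih' ⊢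
    rw [d_cons, cupOneC_cons, cupOneC_nil, sh_cupOneC, map_sub, e, sh_d, cupOneC_sub, cupOneC_sub,
      cupOneC_smul_one, mul_sub, mul_sub, mul_smul, mul_one, mul_cons, mul_cons, h0]
    simp only [sub_apply, smul_apply, zero_apply, sh_apply]
    linear_combination ih'

end Coch

namespace Germ

variable {k X : Type*} [CommRing k] [UniformSpace X]

theorem d_mk_eq_zero_iff {φ : Coch k X} : d (mk φ) = 0 ↔
    ∃ V ∈ 𝓤 X, ∀ A : Set X, A ×ˢ A ⊆ V → Coch.d (Coch.pull (Subtype.val : A → X) φ) = 0 := by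
  rw [d_mk, mk_eq_zero, Coch.mem_Loc]
  simp only [Coch.pull_d]

end Germ

namespace HH

variable {k X : Type*} [CommRing k] [UniformSpace X]

theorem anticomm {φ ψ : Coch k X} (h : φ.IsHom 1) (h' : ψ.IsHom 1) (hd : d (Germ.mk φ) = 0)
    (hd' : d (Germ.mk ψ) = 0) :
    cls (Germ.mk φ) hd * cls (Germ.mk ψ) hd' = -(cls (Germ.mk ψ) hd' * cls (Germ.mk φ) hd) := by
  rw [← add_eq_zero_iff_eq_neg, cls_mul, cls_mul, cls_add]
  refine (cls_eq_zero_iff _).2 ⟨Germ.mk (-Coch.pmul φ ψ), ?_⟩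
  obtain ⟨V, hV, hφ⟩ := Germ.d_mk_eq_zero_iff.1 hd
  obtain ⟨V', hV', hψ⟩ := Germ.d_mk_eq_zero_iff.1 hd'
  rw [Germ.d_mk, ← map_mul, ← map_mul, ← map_add, Germ.mk_eq_mk]
  refine ⟨_, Filter.inter_mem hV hV', fun A hA => ?_⟩
  have := Coch.anticomm (h.pull _) (h'.pull _) (hφ A (hA.trans Set.inter_subset_left))
    (hψ A (hA.trans Set.inter_subset_right))
  rw [map_sub, Coch.pull_d, map_add, map_mul, map_mul, ← this, sub_eq_zero]
  rfl

theorem sq_eq_zero {φ : Coch ℤ X} (h : φ.IsHom 1) (hd : d (Germ.mk φ) = 0)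
    (hd' : d (Germ.mk (Coch.cast k φ)) = 0) : cls (Germ.mk (Coch.cast k φ)) hd' ^ 2 = 0 := by
  rw [cls_pow]
  refine (cls_eq_zero_iff _).2 ⟨Germ.mk (-Coch.cast k (Coch.choose2 φ)), ?_⟩
  obtain ⟨V, hV, hφ⟩ := Germ.d_mk_eq_zero_iff.1 hd
  rw [Germ.d_mk, ← map_pow, Germ.mk_eq_mk]
  refine ⟨_, hV, fun A hA => ?_⟩
  rw [map_sub, Coch.pull_d, map_pow, map_neg, Coch.pull_cast, Coch.pull_cast, Coch.pull_choose2,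
    map_neg, Coch.d_cast, Coch.d_choose2 (h.pull _) (hφ A hA)]
  simp

theorem commute_two {φ : Coch k X} (h : φ.IsHom 2) (hd : d (Germ.mk φ) = 0) (a : HH k X) :
    Commute (cls (Germ.mk φ) hd) a := by
  obtain ⟨a, ha, rfl⟩ := cls_surj a
  obtain ⟨ψ, rfl⟩ := Germ.mk_surj a
  change _ * _ = _ * _
  rw [cls_mul, cls_mul]
  refine (cls_eq_iff _ _).2 ⟨Germ.mk (Coch.cupOneC φ ψ), ?_⟩
  obtain ⟨V, hV, hφ⟩ := Germ.d_mk_eq_zero_iff.1 hd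
  obtain ⟨V', hV', hψ⟩ := Germ.d_mk_eq_zero_iff.1 ha
  rw [Germ.d_mk, ← map_mul, ← map_mul, ← map_sub, Germ.mk_eq_mk]
  refine ⟨_, Filter.inter_mem hV hV', fun A hA => ?_⟩
  have := Coch.d_cupOneC (h.pull _) (hφ A (hA.trans Set.inter_subset_left))
    (Coch.pull (Subtype.val : A → X) ψ)
  rw [hψ A (hA.trans Set.inter_subset_right), Coch.cupOneC_zero, add_zero] at this
  rw [map_sub, Coch.pull_d, Coch.pull_cupOneC, this, map_sub, map_mul, map_mul, sub_self]

end HH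

end

section

open Uniformity DGRing

namespace Coch

variable {k X Y : Type*} [CommRing k]

/-- All vertices of a tuple are pairwise close. -/
def Small (V : Set (X × X)) (x : X) (l : List X) : Prop :=
  ∀ a ∈ x :: l, ∀ b ∈ x :: l, (a, b) ∈ V

theorem Small.mono {V V' : Set (X × X)} (h : V ⊆ V') {x : X} {l : List X} (hs : Small V x l) :
    Small V' x l := fun a ha b hb => h (hs a ha b hb)

theorem Small.sub {V : Set (X × X)} {x y : X} {l m : List X} (hs : Small V x l)
    (h : ∀ a ∈ y :: m, a ∈ x :: l) : Small V y m :=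
  fun a ha b hb => hs a (h a ha) b (h b hb)

theorem Small.map {f : X → Y} {V : Set (Y × Y)} {x : X} {l : List X}
    (hs : Small {q | (f q.1, f q.2) ∈ V} x l) : Small V (f x) (l.map f) := by
  intro a ha b hb
  rw [← List.map_cons, List.mem_map] at ha hb
  obtain ⟨a, ha, rfl⟩ := ha
  obtain ⟨b, hb, rfl⟩ := hb
  exact hs a ha b hb

theorem mem_Loc_of_small [UniformSpace X] {φ : Coch k X}
    (h : ∃ V ∈ 𝓤 X, ∀ x l, Small V x l → φ x l = 0) : φ ∈ Loc k X := by
  obtain ⟨V, hV, h⟩ := h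
  refine ⟨V, hV, fun S hS => ext' fun x l => h _ _ ?_⟩
  intro a ha b hb
  rw [← List.map_cons, List.mem_map] at ha hb
  obtain ⟨a, ha, rfl⟩ := ha
  obtain ⟨b, hb, rfl⟩ := hb
  exact hS ⟨a.2, b.2⟩

/-- The rounding of a real cochain. -/
noncomputable def rnd (c : Coch ℝ X) : Coch ℤ X := ⟨fun x l => round (c x l)⟩

theorem rnd_apply (c : Coch ℝ X) (x : X) (l : List X) : rnd c x l = round (c x l) := rfl

theorem IsHom.add {n : ℕ} {φ ψ : Coch k X} (h : IsHom n φ) (h' : IsHom n ψ) : IsHom n (φ + ψ) :=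
  fun x l hl => by simp [h x l hl, h' x l hl]

theorem IsHom.sub {n : ℕ} {φ ψ : Coch k X} (h : IsHom n φ) (h' : IsHom n ψ) : IsHom n (φ - ψ) :=
  fun x l hl => by simp [h x l hl, h' x l hl]

theorem IsHom.neg {n : ℕ} {φ : Coch k X} (h : IsHom n φ) : IsHom n (-φ) :=
  fun x l hl => by simp [h x l hl]

theorem IsHom.rnd {n : ℕ} {c : Coch ℝ X} (h : IsHom n c) : IsHom n (rnd c) :=
  fun x l hl => by simp [rnd_apply, h x l hl]

theorem IsHom.cast {n : ℕ} {c : Coch ℤ X} (h : IsHom n c) : IsHom n (cast k c) :=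
  fun x l hl => by simp [cast_apply, h x l hl]

/-- The cochain of degree zero given by a function. -/
def c0 (g : X → k) : Coch k X := ⟨fun x l => match l with | [] => g x | _ => 0⟩

/-- The cochain of degree one given by a function. -/
def c1 (g : X → X → k) : Coch k X := ⟨fun x l => match l with | [y] => g x y | _ => 0⟩

@[simp] theorem c0_nil (g : X → k) (x : X) : c0 g x [] = g x := rfl
@[simp] theorem c1_single (g : X → X → k) (x y : X) : c1 g x [y] = g x y := rfl

theorem isHom_c0 (g : X → k) : IsHom 0 (c0 g) := by
  intro x l hl
  cases l with
  | nil => simp at hl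
  | cons y l => rfl

theorem isHom_c1 (g : X → X → k) : IsHom 1 (c1 g) := by
  intro x l hl
  match l with
  | [] => rfl
  | [y] => simp at hl
  | y :: z :: l => rfl

theorem IsHom.ext_zero {φ ψ : Coch k X} (h : IsHom 0 φ) (h' : IsHom 0 ψ)
    (e : ∀ x, φ x [] = ψ x []) : φ = ψ := by
  refine ext' fun x l => ?_
  cases l with
  | nil => exact e x
  | cons y l => rw [h _ _ (by simp), h' _ _ (by simp)]

theorem IsHom.ext_one {φ ψ : Coch k X} (h : IsHom 1 φ) (h' : IsHom 1 ψ)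
    (e : ∀ x y, φ x [y] = ψ x [y]) : φ = ψ := by
  refine ext' fun x l => ?_
  by_cases hl : l.length = 1
  · obtain ⟨y, rfl⟩ := List.length_eq_one_iff.1 hl
    exact e x y
  · rw [h _ _ hl, h' _ _ hl]

theorem pull_c0 (f : X → Y) (g : Y → k) : pull f (c0 g) = c0 (g ∘ f) :=
  ((isHom_c0 g).pull f).ext_zero (isHom_c0 _) fun _ => rfl

theorem pull_c1 (f : X → Y) (g : Y → Y → k) : pull f (c1 g) = c1 fun x y => g (f x) (f y) :=
  ((isHom_c1 g).pull f).ext_one (isHom_c1 _) fun _ _ => rfl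

theorem d_c0 (g : X → k) : d (c0 g) = c1 fun x y => g y - g x :=
  ((isHom_c0 g).d).ext_one (isHom_c1 _) fun _ _ => by simp [d_pair]

theorem c1_sub (g g' : X → X → k) : c1 g - c1 g' = c1 fun x y => g x y - g' x y :=
  ((isHom_c1 g).sub (isHom_c1 g')).ext_one (isHom_c1 _) fun _ _ => rfl

theorem c1_add (g g' : X → X → k) : c1 g + c1 g' = c1 fun x y => g x y + g' x y :=
  ((isHom_c1 g).add (isHom_c1 g')).ext_one (isHom_c1 _) fun _ _ => rfl

theorem c0_sub (g g' : X → k) : c0 g - c0 g' = c0 fun x => g x - g' x :=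
  ((isHom_c0 g).sub (isHom_c0 g')).ext_zero (isHom_c0 _) fun _ => rfl

variable [UniformSpace X] [UniformSpace Y]

/-- Homogeneous real cochains which are asymptotically integral. -/
def NearInt (m : ℕ) (c : Coch ℝ X) : Prop :=
  IsHom m c ∧ ∀ ε > 0, ∃ V ∈ 𝓤 X, ∀ x l, Small V x l → ∃ n : ℤ, |c x l - n| < ε

theorem NearInt.add {m : ℕ} {c c' : Coch ℝ X} (h : NearInt m c) (h' : NearInt m c') :
    NearInt m (c + c') := by
  refine ⟨h.1.add h'.1, fun ε hε => ?_⟩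
  obtain ⟨V, hV, H⟩ := h.2 (ε / 2) (by linarith)
  obtain ⟨V', hV', H'⟩ := h'.2 (ε / 2) (by linarith)
  refine ⟨_, Filter.inter_mem hV hV', fun x l hs => ?_⟩
  obtain ⟨n, hn⟩ := H x l (hs.mono Set.inter_subset_left)
  obtain ⟨n', hn'⟩ := H' x l (hs.mono Set.inter_subset_right)
  refine ⟨n + n', ?_⟩
  rw [abs_lt] at hn hn' ⊢
  push_cast
  rw [add_apply]
  constructor <;> linarith [hn.1, hn.2, hn'.1, hn'.2]

theorem NearInt.neg {m : ℕ} {c : Coch ℝ X} (h : NearInt m c) : NearInt m (-c) := by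
  refine ⟨h.1.neg, fun ε hε => ?_⟩
  obtain ⟨V, hV, H⟩ := h.2 ε hε
  refine ⟨V, hV, fun x l hs => ?_⟩
  obtain ⟨n, hn⟩ := H x l hs
  refine ⟨-n, ?_⟩
  rw [← abs_neg, neg_apply]
  push_cast
  rwa [show -(-c x l - -(n : ℝ)) = c x l - n by ring]

theorem NearInt.sub {m : ℕ} {c c' : Coch ℝ X} (h : NearInt m c) (h' : NearInt m c') :
    NearInt m (c - c') := by
  rw [sub_eq_add_neg]
  exact h.add h'.neg

theorem NearInt.pull {m : ℕ} {c : Coch ℝ Y} (h : NearInt m c) {f : X → Y}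
    (hf : UniformContinuous f) : NearInt m (pull f c) := by
  refine ⟨h.1.pull f, fun ε hε => ?_⟩
  obtain ⟨V, hV, H⟩ := h.2 ε hε
  exact ⟨_, hf hV, fun x l hs => H _ _ hs.map⟩

theorem abs_d_le {X : Type*} {c : Coch ℝ X} {ε : ℝ} (hε : 0 ≤ ε) {V : Set (X × X)}
    (H : ∀ x l, Small V x l → |c x l| ≤ ε) (x : X) (l : List X) (hs : Small V x l) :
    |d c x l| ≤ (2 * l.length + 1) * ε := by
  induction l generalizing x c V with
  | nil => simp [hε]
  | cons y l ih =>
    rw [d_cons]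
    have h1 := H y l (hs.sub (by simp +contextual))
    have h2 := ih (c := Coch.sh x c) (V := {q | Small V x (y :: l) ∧ q.1 ∈ y :: l ∧ q.2 ∈ y :: l})
      (fun z m hz => by
        refine H x (z :: m) (hs.sub fun a ha => ?_)
        rcases List.mem_cons.1 ha with rfl | ha
        · simp
        · exact List.mem_cons_of_mem _ (hz a ha a ha).2.1) y (fun a ha b hb => ⟨hs, ha, hb⟩)
    have h3 : |c x [] * (1 : Coch ℝ X) y l| ≤ ε := by
      have := H x [] (hs.sub (by simp))
      cases l <;> simpa using (by assumption)
    rw [abs_le] at *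
    push_cast [List.length_cons]
    constructor <;> nlinarith [h1.1, h1.2, h2.1, h2.2, h3.1, h3.2]

theorem NearInt.d_cast_rnd_sub {m : ℕ} {c : Coch ℝ X} (h : NearInt m c) {ε : ℝ} (hε : 0 < ε) :
    ∃ V ∈ 𝓤 X, ∀ x l, Small V x l → |d c x l - (Coch.d (rnd c) x l : ℤ)| < ε := by
  obtain ⟨V, hV, H⟩ := h.2 (ε / (2 * (m + 1) + 2)) (by positivity)
  refine ⟨V, hV, fun x l hs => ?_⟩
  by_cases hl : l.length = m + 1
  · have e : Coch.d c x l - (Coch.d (rnd c) x l : ℤ) = Coch.d (c - cast ℝ (rnd c)) x l := by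
      rw [map_sub, d_cast]; rfl
    rw [e]
    refine (abs_d_le (ε := ε / (2 * (m + 1) + 2)) (by positivity) (fun x l hs => ?_) x l
      hs).trans_lt ?_
    · obtain ⟨n, hn⟩ := H x l hs
      exact (round_le (c x l) n).trans hn.le
    · rw [hl, mul_div_assoc', div_lt_iff₀ (by positivity)]
      push_cast
      nlinarith
  · rw [h.1.d x l hl, h.1.rnd.d x l hl]
    simpa using hε

theorem NearInt.d {m : ℕ} {c : Coch ℝ X} (h : NearInt m c) : NearInt (m + 1) (d c) := by
  refine ⟨h.1.d, fun ε hε => ?_⟩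
  obtain ⟨V, hV, H⟩ := h.d_cast_rnd_sub hε
  exact ⟨V, hV, fun x l hs => ⟨_, H x l hs⟩⟩

theorem round_eq_of_abs_lt {a : ℝ} {n : ℤ} (h : |a - n| < 1 / 2) : round a = n := by
  rw [abs_lt] at h
  rw [round_eq, Int.floor_eq_iff]
  constructor <;> linarith [h.1, h.2]

theorem NearInt.of_cover {ι : Type*} [Finite ι] {U : ι → Set X} (hU : UCover U) {m : ℕ}
    {c : Coch ℝ X} (hc : IsHom m c)
    (h : ∀ i, NearInt m (Coch.pull (Subtype.val : U i → X) c)) : NearInt m c := by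
  refine ⟨hc, fun ε hε => ?_⟩
  choose V hV H using fun i => (h i).2 ε hε
  have : ∀ i, ∃ W ∈ 𝓤 X, ∀ a b : U i, ((a : X), (b : X)) ∈ W → (a, b) ∈ V i := by
    intro i
    have := hV i
    rw [uniformity_subtype, Filter.mem_comap] at this
    obtain ⟨W, hW, hWV⟩ := this
    exact ⟨W, hW, fun a b hab => hWV hab⟩
  choose W hW hWV using this
  obtain ⟨V₀, hV₀, hcov⟩ := hU
  refine ⟨V₀ ∩ ⋂ i, W i, Filter.inter_mem hV₀ (Filter.iInter_mem.2 hW), fun x l hs => ?_⟩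
  obtain ⟨i, hi⟩ := hcov {a | a ∈ x :: l} ⟨x, by simp⟩
    (by rintro ⟨a, b⟩ ⟨ha, hb⟩; exact (hs a ha b hb).1)
  have hx : x ∈ U i := hi (by simp)
  obtain ⟨l', rfl⟩ : ∃ l' : List (U i), l'.map Subtype.val = l :=
    ⟨l.attach.map fun a => ⟨a.1, hi (List.mem_cons_of_mem _ a.2)⟩, by simp⟩
  refine H i ⟨x, hx⟩ l' fun a ha b hb => hWV i a b ?_
  have hm : ∀ a ∈ (⟨x, hx⟩ : U i) :: l', (a : X) ∈ x :: l'.map Subtype.val := by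
    intro a ha
    rw [show x :: l'.map Subtype.val = ((⟨x, hx⟩ : U i) :: l').map Subtype.val from rfl]
    exact List.mem_map_of_mem ha
  exact Set.mem_iInter.1 (hs _ (hm a ha) _ (hm b hb)).2 i

end Coch

namespace Germ

open Coch (NearInt IsHom rnd)

variable {k X Y : Type*} [CommRing k] [UniformSpace X] [UniformSpace Y]

theorem mk_eq_of_small {φ ψ : Coch k X}
    (h : ∃ V ∈ 𝓤 X, ∀ x l, Coch.Small V x l → φ x l = ψ x l) : mk φ = mk ψ := by
  refine mk_eq_mk.2 (Coch.mem_Loc_of_small ?_)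
  obtain ⟨V, hV, h⟩ := h
  exact ⟨V, hV, fun x l hs => by rw [Coch.sub_apply, h x l hs, sub_self]⟩

variable (k) in
/-- The germ of the rounding of a real cochain. -/
noncomputable def rd (c : Coch ℝ X) : Germ k X := mk (Coch.cast k (rnd c))

theorem rd_eq_of_near {c : Coch ℝ X} {b : Coch ℤ X}
    (h : ∃ V ∈ 𝓤 X, ∀ x l, Coch.Small V x l → |c x l - b x l| < 1 / 2) :
    rd k c = mk (Coch.cast k b) := by
  obtain ⟨V, hV, h⟩ := h
  refine mk_eq_of_small ⟨V, hV, fun x l hs => ?_⟩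
  rw [Coch.cast_apply, Coch.cast_apply, Coch.rnd_apply, Coch.round_eq_of_abs_lt (h x l hs)]

theorem rd_cast (b : Coch ℤ X) : rd k (Coch.cast ℝ b) = mk (Coch.cast k b) :=
  rd_eq_of_near ⟨_, Filter.univ_mem, fun x l _ => by simp [Coch.cast_apply]⟩

theorem rd_zero : rd k (0 : Coch ℝ X) = 0 := by
  simpa using rd_cast (k := k) (0 : Coch ℤ X)

theorem rd_add {m : ℕ} {c c' : Coch ℝ X} (h : NearInt m c) (h' : NearInt m c') :
    rd k (c + c') = rd k c + rd k c' := by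
  rw [rd_eq_of_near (b := rnd c + rnd c'), map_add, map_add]; · rfl
  obtain ⟨V, hV, H⟩ := h.2 (1 / 4) (by norm_num)
  obtain ⟨V', hV', H'⟩ := h'.2 (1 / 4) (by norm_num)
  refine ⟨_, Filter.inter_mem hV hV', fun x l hs => ?_⟩
  obtain ⟨n, hn⟩ := H x l (hs.mono Set.inter_subset_left)
  obtain ⟨n', hn'⟩ := H' x l (hs.mono Set.inter_subset_right)
  rw [Coch.add_apply, Coch.add_apply, Coch.rnd_apply, Coch.rnd_apply,
    Coch.round_eq_of_abs_lt (hn.trans (by norm_num)),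
    Coch.round_eq_of_abs_lt (hn'.trans (by norm_num))]
  rw [abs_lt] at hn hn' ⊢
  push_cast
  constructor <;> linarith [hn.1, hn.2, hn'.1, hn'.2]

theorem rd_neg {m : ℕ} {c : Coch ℝ X} (h : NearInt m c) : rd k (-c) = -rd k c := by
  rw [eq_neg_iff_add_eq_zero, ← rd_add h.neg h, neg_add_cancel, rd_zero]

theorem rd_sub {m : ℕ} {c c' : Coch ℝ X} (h : NearInt m c) (h' : NearInt m c') :
    rd k (c - c') = rd k c - rd k c' := by
  rw [sub_eq_add_neg, rd_add h h'.neg, rd_neg h', sub_eq_add_neg]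

theorem d_rd {m : ℕ} {c : Coch ℝ X} (h : NearInt m c) : d (rd k c) = rd k (Coch.d c) := by
  rw [rd_eq_of_near (c := Coch.d c) (h.d_cast_rnd_sub (by norm_num)), rd, d_mk, Coch.d_cast]

theorem pull_rd (f : X → Y) (hf : UniformContinuous f) (c : Coch ℝ Y) :
    pull f hf (rd k c) = rd k (Coch.pull f c) := by
  rw [rd, pull_mk, Coch.pull_cast]; rfl

theorem d_rd_d_of_near {m : ℕ} {c : Coch ℝ X} (h : NearInt m (Coch.d c)) :
    d (rd k (Coch.d c)) = 0 := by
  rw [d_rd h, Coch.d_d, rd_zero]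

theorem bar_mk_zero {φ : Coch k X} (h : IsHom 0 φ) : (bar : Germ k X →+* _) (mk φ) = mk φ := by
  rw [bar_mk]
  congr 1
  refine Coch.ext' fun x l => ?_
  by_cases hl : l.length = 0
  · simp [hl]
  · simp [h x l hl]

theorem bar_mk_one {φ : Coch k X} (h : IsHom 1 φ) : (bar : Germ k X →+* _) (mk φ) = -mk φ := by
  rw [bar_mk, h.bar_one, map_neg]

theorem bar_mk_two {φ : Coch k X} (h : IsHom 2 φ) : (bar : Germ k X →+* _) (mk φ) = mk φ := by
  rw [bar_mk, h.bar_two]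

theorem bar_rd_zero {c : Coch ℝ X} (h : IsHom 0 c) : (bar : Germ k X →+* _) (rd k c) = rd k c :=
  bar_mk_zero h.rnd.cast

theorem bar_rd_one {c : Coch ℝ X} (h : IsHom 1 c) : (bar : Germ k X →+* _) (rd k c) = -rd k c :=
  bar_mk_one h.rnd.cast

theorem bar_rd_two {c : Coch ℝ X} (h : IsHom 2 c) : (bar : Germ k X →+* _) (rd k c) = rd k c :=
  bar_mk_two h.rnd.cast

end Germ

end

section

open Uniformity DGRing

namespace UCover

variable {X Y ι : Type*} [UniformSpace X] [UniformSpace Y]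

theorem comap {U : ι → Set Y} (hU : UCover U) {f : X → Y} (hf : UniformContinuous f) :
    UCover fun i => f ⁻¹' U i := by
  obtain ⟨V, hV, h⟩ := hU
  refine ⟨_, hf hV, fun A hA hAV => ?_⟩
  obtain ⟨i, hi⟩ := h (f '' A) (hA.image f) (by
    rintro ⟨_, _⟩ ⟨⟨x, hx, rfl⟩, ⟨y, hy, rfl⟩⟩
    exact hAV (Set.mk_mem_prod hx hy))
  exact ⟨i, Set.image_subset_iff.1 hi⟩

end UCover

namespace Germ

variable {k X Y T : Type*} [CommRing k] [UniformSpace X] [UniformSpace Y]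

theorem res_pull {f : X → Y} (hf : UniformContinuous f) {U : Set Y} {a : Germ k Y}
    (h : res U a = 0) : res (f ⁻¹' U) (pull f hf a) = 0 := by
  have hr : UniformContinuous (U.restrictPreimage f) :=
    (hf.comp uniformContinuous_subtype_val).subtype_mk _
  have e := pull_pull (U.restrictPreimage f) hr (Subtype.val : U → Y)
    uniformContinuous_subtype_val a
  rw [h, map_zero] at e
  rw [pull_pull, e]
  rfl

theorem pull_congr {f g : X → Y} (h : f = g) (hf : UniformContinuous f) (a : Germ k Y) :
    pull f hf a = pull g (h ▸ hf) a := by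
  subst h; rfl

end Germ

section kap

variable {R S : Type*} [DGRing R] [DGRing S]

/-- The telescoping primitive of `h ^ n - ∏ (h - d α)`. -/
def kap (h : R) : List R → R
  | [] => 0
  | α :: as => α * h ^ as.length + (h - d α) * kap h as

theorem d_kap {h : R} (hh : d h = 0) (hb : (bar : R →+* R) h = h) (as : List R)
    (has : ∀ α ∈ as, (bar : R →+* R) α = -α) :
    d (kap h as) = h ^ as.length - (as.map fun α => h - d α).prod := by
  induction as with
  | nil => simp [kap]
  | cons α as ih =>
    have ih' := ih fun β hβ => has β (List.mem_cons_of_mem _ hβ)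
    have hα := has α (by simp)
    have hbd : (bar : R →+* R) (d α) = d α := by
      have := d_bar α
      rw [hα, map_neg] at this
      exact (neg_injective this).symm
    rw [kap, map_add, d_mul, d_mul, map_sub, map_sub, hb, hbd, hh, d_d, ih', d_pow_eq_zero hh,
      List.length_cons, List.map_cons, List.prod_cons, pow_succ']
    noncomm_ring

theorem kap_map (f : R →+* S) (hf : ∀ a, f (d a) = d (f a)) (h : R) (as : List R) :
    f (kap h as) = kap (f h) (as.map f) := by
  induction as with
  | nil => simp [kap]
  | cons α as ih => simp [kap, ih, hf]

end kap

section LS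

variable {k X Y : Type*} [CommRing k] [UniformSpace X] [UniformSpace Y]

/-- A family of local trivialisations of `h`. -/
structure LS {n : ℕ} (h : Germ k X) (α : Fin n → Germ k X) : Prop where
  d_h : d h = 0
  bar_h : (bar : Germ k X →+* _) h = h
  bar_α : ∀ i, (bar : Germ k X →+* _) (α i) = -α i
  cover : ∃ U : Fin n → Set X, UCover U ∧ ∀ i, Germ.res (U i) (h - d (α i)) = 0

namespace LS

variable {n : ℕ} {h : Germ k X} {α β γ : Fin n → Germ k X}

theorem d_kap (H : LS h α) : d (kap h (List.ofFn α)) = h ^ n := by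
  rw [_root_.d_kap H.d_h H.bar_h, List.length_ofFn, List.map_ofFn]
  · obtain ⟨U, hU, e⟩ := H.cover
    rw [show ((fun α => h - d α) ∘ α) = fun i => h - d (α i) from rfl,
      Germ.prod_eq_zero hU e, sub_zero]
  · intro a ha
    obtain ⟨i, rfl⟩ := List.mem_ofFn.1 ha
    exact H.bar_α i

theorem pow_eq_zero (H : LS h α) : cls h H.d_h ^ n = 0 := by
  rw [cls_pow]
  exact (cls_eq_zero_iff _).2 ⟨_, H.d_kap⟩

/-- The difference class of two families of local trivialisations. -/
def dif (H : LS h α) (H' : LS h β) : HH k X :=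
  cls (kap h (List.ofFn α) - kap h (List.ofFn β)) (by rw [map_sub, H.d_kap, H'.d_kap, sub_self])

theorem dif_self (H : LS h α) (H' : LS h α) : dif H H' = 0 :=
  (cls_eq_zero_iff _).2 ⟨0, by simp⟩

theorem dif_add (H : LS h α) (H' : LS h β) (H'' : LS h γ) :
    dif H H' + dif H' H'' = dif H H'' := by
  rw [dif, dif, cls_add]
  exact cls_congr (by abel) _

theorem comap (H : LS h α) {f : Y → X} (hf : UniformContinuous f) :
    LS (Germ.pull f hf h) fun i => Germ.pull f hf (α i) where
  d_h := by rw [← Germ.pull_d, H.d_h, map_zero]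
  bar_h := by rw [← Germ.pull_bar, H.bar_h]
  bar_α i := by rw [← Germ.pull_bar, H.bar_α, map_neg]
  cover := by
    obtain ⟨U, hU, e⟩ := H.cover
    refine ⟨_, hU.comap hf, fun i => ?_⟩
    rw [← Germ.pull_d, ← map_sub]
    exact Germ.res_pull hf (e i)

theorem pull_dif (H : LS h α) (H' : LS h β) {f : Y → X} (hf : UniformContinuous f) :
    HH.pull f hf (dif H H') = dif (H.comap hf) (H'.comap hf) := by
  rw [dif, HH.pull_cls]
  refine cls_congr ?_ _
  rw [map_sub, kap_map _ (Germ.pull_d f hf), kap_map _ (Germ.pull_d f hf), List.map_ofFn,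
    List.map_ofFn]
  rfl

theorem dif_congr {h' : Germ k X} {α' β' : Fin n → Germ k X} (H : LS h α) (H' : LS h β)
    (K : LS h' α') (K' : LS h' β') (eh : h = h') (ea : α = α') (eb : β = β') :
    dif H H' = dif K K' := by
  subst eh ea eb; rfl

/-- The jump function on the interval. -/
noncomputable def jump : Germ k (X × unitInterval) :=
  Germ.mk (Coch.c0 fun q => if q.2 = 0 then 0 else 1)

theorem pull_jump_zero (hf : UniformContinuous fun x : X => (x, (0 : unitInterval))) :
    Germ.pull (fun x => (x, (0 : unitInterval))) hf (jump : Germ k (X × unitInterval)) = 0 := by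
  rw [jump, Germ.pull_mk, Coch.pull_c0, ← map_zero Germ.mk]
  congr 1
  exact (Coch.isHom_c0 _).ext_zero (fun _ _ _ => rfl) fun x => by simp

theorem pull_jump_one (hf : UniformContinuous fun x : X => (x, (1 : unitInterval))) :
    Germ.pull (fun x => (x, (1 : unitInterval))) hf (jump : Germ k (X × unitInterval)) = 1 := by
  rw [jump, Germ.pull_mk, Coch.pull_c0, ← map_one Germ.mk]
  congr 1
  refine (Coch.isHom_c0 _).ext_zero (fun x l hl => ?_) fun x => by simp
  cases l <;> simp at hl ⊢

theorem dif_eq_zero (H : LS h α) (H' : LS h β) {U : Fin n → Set X} (hU : UCover U)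
    (m : Fin n → Germ k X) (hm : ∀ i, (bar : Germ k X →+* _) (m i) = m i)
    (e : ∀ i, Germ.res (U i) (h - d (α i)) = 0)
    (e' : ∀ i, Germ.res (U i) (β i - α i - d (m i)) = 0) : dif H H' = 0 := by
  have hp : UniformContinuous (Prod.fst : X × unitInterval → X) := uniformContinuous_fst
  set P := Germ.pull (k := k) (Prod.fst : X × unitInterval → X) hp with hP
  have hPd : ∀ a, P (d a) = d (P a) := Germ.pull_d _ hp
  have hPb : ∀ a, P ((bar : Germ k X →+* _) a) = (bar : Germ k (X × unitInterval) →+* _) (P a) :=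
    Germ.pull_bar _ hp
  have hj : (bar : Germ k (X × unitInterval) →+* _) jump = jump :=
    Germ.bar_mk_zero (Coch.isHom_c0 _)
  have hbd : ∀ i, (bar : Germ k X →+* _) (d (m i)) = -d (m i) := by
    intro i
    have := d_bar (m i)
    rw [hm] at this
    exact neg_eq_iff_eq_neg.1 this.symm
  have K : LS (P h) fun i => P (α i) + jump * P (β i - α i - d (m i)) + d (jump * P (m i)) := by
    refine ⟨(H.comap hp).d_h, (H.comap hp).bar_h, fun i => ?_, _, hU.comap hp, fun i => ?_⟩
    · have e1 : d ((bar : Germ k (X × unitInterval) →+* _) (jump * P (m i))) =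
        -(bar : Germ k (X × unitInterval) →+* _) (d (jump * P (m i))) := d_bar _
      rw [map_mul, hj, ← hPb, hm] at e1
      rw [map_add, map_add, map_mul, hj, ← hPb, ← hPb, map_sub (bar : Germ k X →+* _) (β i - α i),
        map_sub (bar : Germ k X →+* _) (β i), H.bar_α, H'.bar_α, hbd,
        (show (bar : Germ k (X × unitInterval) →+* _) (d (jump * P (m i))) = -d (jump * P (m i)) from
          neg_eq_iff_eq_neg.1 e1.symm), show -β i - -α i - -d (m i) = -(β i - α i - d (m i)) by abel, map_neg,
        map_neg, mul_neg]
      abel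
    · have r1 := Germ.res_pull hp (e i)
      have r2 := Germ.res_pull hp (e' i)
      rw [map_add, d_d, add_zero, map_add, ← sub_sub, ← hPd, ← map_sub P, map_sub,
        Germ.pull_d, map_mul, hP, r1, r2]
      simp
  have L := H.comap hp
  have hom := HH.homotopy (dif L K) (0 : unitInterval) 1
  have hid : ∀ (t : unitInterval) (ht : UniformContinuous fun x : X => (x, t)) (a : Germ k X),
      Germ.pull (fun x => (x, t)) ht (P a) = a := by
    intro t ht a
    rw [hP, Germ.pull_pull]
    exact Germ.pull_id a
  rw [pull_dif, pull_dif] at hom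
  have z : dif (L.comap (HH.uc_inc (0 : unitInterval))) (K.comap (HH.uc_inc (0 : unitInterval)))
      = dif H H := by
    refine dif_congr _ _ _ _ (hid _ _ _) (funext fun i => hid _ _ _) (funext fun i => ?_)
    rw [map_add, map_add, map_mul, Germ.pull_d, map_mul, pull_jump_zero, hid]
    simp
  have o : dif (L.comap (HH.uc_inc (1 : unitInterval))) (K.comap (HH.uc_inc (1 : unitInterval)))
      = dif H H' := by
    refine dif_congr _ _ _ _ (hid _ _ _) (funext fun i => hid _ _ _) (funext fun i => ?_)
    rw [map_add, map_add, map_mul, Germ.pull_d, map_mul, pull_jump_one, hid, hid, hid]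
    rw [one_mul, one_mul]
    abel
  rw [← o, ← hom, z, dif_self]

theorem dif_shift {n : ℕ} {α β : Fin (n + 1) → Germ k X} (H : LS h α) (H' : LS h β)
    {τ : Germ k X} (hτ : d τ = 0) (h0 : α 0 = β 0 - τ) (hs : ∀ i : Fin n, α i.succ = β i.succ) :
    dif H H' = -cls τ hτ * cls h H.d_h ^ n := by
  rw [dif, cls_neg, cls_pow, cls_mul]
  refine cls_congr ?_ _
  rw [List.ofFn_succ, List.ofFn_succ, kap, kap, h0, map_sub, hτ, funext hs]
  simp [sub_mul]

end LS

end LS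

end

section

open Uniformity DGRing

theorem uc_iff_dist {X E : Type*} [UniformSpace X] [PseudoMetricSpace E] {f : X → E} :
    UniformContinuous f ↔ ∀ ε > 0, ∃ V ∈ 𝓤 X, ∀ x y, (x, y) ∈ V → dist (f x) (f y) < ε := by
  constructor
  · exact fun hf ε hε => ⟨_, hf (Metric.dist_mem_uniformity hε), fun x y h => h⟩
  · intro h
    refine Metric.uniformity_basis_dist.tendsto_right_iff.2 fun ε hε => ?_
    obtain ⟨V, hV, h⟩ := h ε hε
    exact Filter.mem_of_superset hV fun p hp => h p.1 p.2 hp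

section phase

/-- The normalized exponential. -/
noncomputable def ee (t : ℝ) : ℂ := Complex.exp (2 * Real.pi * t * Complex.I)

/-- The normalized argument. -/
noncomputable def ph (z : ℂ) : ℝ := Complex.arg z / (2 * Real.pi)

theorem ee_add (s t : ℝ) : ee (s + t) = ee s * ee t := by
  rw [ee, ee, ee, ← Complex.exp_add]
  push_cast
  ring_nf

@[simp] theorem ee_zero : ee 0 = 1 := by simp [ee]

@[simp] theorem norm_ee (t : ℝ) : ‖ee t‖ = 1 := by
  rw [ee, show (2 * Real.pi * t * Complex.I : ℂ) = ((2 * Real.pi * t : ℝ) : ℂ) * Complex.I by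
    push_cast; ring, Complex.norm_exp_ofReal_mul_I]

theorem ee_ne_zero (t : ℝ) : ee t ≠ 0 := Complex.exp_ne_zero _

theorem ee_sub_mul (s t : ℝ) : ee (s - t) * ee t = ee s := by rw [← ee_add, sub_add_cancel]

@[simp] theorem ee_int (n : ℤ) : ee n = 1 := by
  rw [ee, show (2 * Real.pi * (n : ℝ) * Complex.I : ℂ) = n * (2 * Real.pi * Complex.I) by
    push_cast; ring, Complex.exp_int_mul_two_pi_mul_I]

theorem norm_mul_ee_ph (z : ℂ) : (‖z‖ : ℂ) * ee (ph z) = z := by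
  have : (2 * Real.pi * ((Complex.arg z / (2 * Real.pi) : ℝ)) * Complex.I : ℂ) =
      Complex.arg z * Complex.I := by
    have : (Real.pi : ℂ) ≠ 0 := by exact_mod_cast Real.pi_ne_zero
    push_cast
    field_simp
  rw [ee, ph, this, Complex.norm_mul_exp_arg_mul_I]

theorem ee_ph {z : ℂ} (hz : ‖z‖ = 1) : ee (ph z) = z := by
  have := norm_mul_ee_ph z
  rwa [hz, Complex.ofReal_one, one_mul] at this

theorem abs_sub_round_le (t : ℝ) : |t - round t| ≤ ‖ee t - 1‖ := by
  set u := t - round t with hu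
  have e : ee t = ee u := by
    rw [show t = u + (round t : ℤ) by rw [hu]; ring, ee_add, ee_int, mul_one]
  have hu2 : |u| ≤ 1 / 2 := abs_sub_round t
  rw [e, ee, show (2 * Real.pi * u * Complex.I : ℂ) = Complex.I * ((2 * Real.pi * u : ℝ) : ℂ) by
    push_cast; ring, Complex.norm_exp_I_mul_ofReal_sub_one, Real.norm_eq_abs, abs_mul,
    show 2 * Real.pi * u / 2 = Real.pi * u by ring]
  have hpi := Real.pi_pos
  have h1 : 2 / Real.pi * (Real.pi * |u|) ≤ Real.sin (Real.pi * |u|) :=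
    Real.mul_le_sin (by positivity) (by nlinarith)
  have h2 : 2 / Real.pi * (Real.pi * |u|) = 2 * |u| := by field_simp
  have h3 : |Real.sin (Real.pi * u)| = |Real.sin (Real.pi * |u|)| := by
    rcases abs_cases u with ⟨h, _⟩ | ⟨h, _⟩ <;> rw [h]
    rw [mul_neg, Real.sin_neg, abs_neg]
  rw [h3]
  have := le_abs_self (Real.sin (Real.pi * |u|))
  have := abs_nonneg u
  rw [abs_two]
  linarith

theorem exists_int_of_ee_eq_one {t : ℝ} (h : ee t = 1) : ∃ n : ℤ, t = n := by
  have := abs_sub_round_le t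
  rw [h, sub_self, norm_zero, abs_nonpos_iff, sub_eq_zero] at this
  exact ⟨_, this⟩

end phase

namespace Coch

variable {X : Type*} [UniformSpace X]

theorem nearInt_c1 {g : X → X → ℝ}
    (H : ∀ ε > 0, ∃ V ∈ 𝓤 X, ∀ x y, (x, y) ∈ V → ‖ee (g x y) - 1‖ < ε) : NearInt 1 (c1 g) := by
  refine ⟨isHom_c1 _, fun ε hε => ?_⟩
  obtain ⟨V, hV, h⟩ := H ε hε
  refine ⟨V, hV, fun x l hs => ?_⟩
  by_cases hl : l.length = 1
  · obtain ⟨y, rfl⟩ := List.length_eq_one_iff.1 hl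
    exact ⟨_, (abs_sub_round_le _).trans_lt (h x y (hs x (by simp) y (by simp)))⟩
  · exact ⟨0, by simpa [isHom_c1 g x l hl] using hε⟩

theorem nearInt_c0 {g : X → ℝ} (H : ∀ x, ee (g x) = 1) : NearInt 0 (c0 g) := by
  refine ⟨isHom_c0 _, fun ε hε => ⟨_, Filter.univ_mem, fun x l _ => ?_⟩⟩
  cases l with
  | nil =>
    obtain ⟨n, hn⟩ := exists_int_of_ee_eq_one (H x)
    exact ⟨n, by simpa [hn] using hε⟩
  | cons y l => exact ⟨0, by simpa [isHom_c0 g x (y :: l) (by simp)] using hε⟩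

end Coch

variable {B C T : Type*} [UniformSpace B] [UniformSpace C] [UniformSpace T] {n : ℕ}

/-- A nowhere vanishing vector valued section of the line bundle with transition phases `φ`. -/
structure Sec (φ : B → B → ℝ) (s : B → Fin n → ℂ) : Prop where
  near : ∀ ε > 0, ∃ V ∈ 𝓤 B, ∀ x y, (x, y) ∈ V → ∀ i, ‖s y i - ee (φ x y) * s x i‖ < ε
  nz : ∃ δ > 0, ∀ x, ∃ i, δ ≤ ‖s x i‖

namespace Sec

open Coch Germ

variable (k : Type*) [CommRing k]

/-- The two-cocycle of transition phases. -/
noncomputable def hh (φ : B → B → ℝ) : Germ k B := rd k (Coch.d (c1 φ))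

/-- The trivialisation given by a coordinate of a section. -/
noncomputable def al (φ : B → B → ℝ) (s : B → Fin n → ℂ) (i : Fin n) : Germ k B :=
  rd k (c1 φ - Coch.d (c0 fun x => ph (s x i)))

variable {φ : B → B → ℝ} {s s' s'' : B → Fin n → ℂ}

theorem comap (S : Sec φ s) {f : C → B} (hf : UniformContinuous f) :
    Sec (fun x y => φ (f x) (f y)) fun x => s (f x) where
  near ε hε := by
    obtain ⟨V, hV, h⟩ := S.near ε hε
    exact ⟨_, hf hV, fun x y hxy => h _ _ hxy⟩
  nz := by
    obtain ⟨δ, hδ, h⟩ := S.nz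
    exact ⟨δ, hδ, fun x => h _⟩

theorem pull_hh {f : C → B} (hf : UniformContinuous f) :
    Germ.pull f hf (hh k φ) = hh k fun x y => φ (f x) (f y) := by
  rw [hh, pull_rd, Coch.pull_d, pull_c1]; rfl

theorem pull_al {f : C → B} (hf : UniformContinuous f) (i : Fin n) :
    Germ.pull f hf (al k φ s i) = al k (fun x y => φ (f x) (f y)) (fun x => s (f x)) i := by
  rw [al, pull_rd, map_sub, Coch.pull_d, pull_c1, pull_c0]; rfl

theorem uniformContinuous_norm (S : Sec φ s) (i : Fin n) : UniformContinuous fun x => ‖s x i‖ := by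
  refine uc_iff_dist.2 fun ε hε => ?_
  obtain ⟨V, hV, h⟩ := S.near ε hε
  refine ⟨V, hV, fun x y hxy => ?_⟩
  have := abs_norm_sub_norm_le (s y i) (ee (φ x y) * s x i)
  rw [norm_mul, norm_ee, one_mul] at this
  rw [dist_comm]
  exact this.trans_lt (h x y hxy i)

/-- The set where a coordinate is large. -/
def big (s : B → Fin n → ℂ) (δ : ℝ) (i : Fin n) : Set B := {x | δ ≤ ‖s x i‖}

theorem exists_ucover (S : Sec φ s) : ∃ δ > 0, UCover (big s δ) := by
  obtain ⟨δ, hδ, h⟩ := S.nz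
  exact ⟨δ / 2, by linarith, UCover.of_fun S.uniformContinuous_norm (by linarith) h⟩

theorem nearInt_big (S : Sec φ s) {δ : ℝ} (hδ : 0 < δ) (i : Fin n) :
    NearInt 1 (Coch.pull (Subtype.val : big s δ i → B)
      (c1 φ - Coch.d (c0 fun x => ph (s x i)))) := by
  rw [d_c0, c1_sub, pull_c1]
  refine nearInt_c1 fun ε hε => ?_
  obtain ⟨V, hV, h⟩ := S.near (δ * ε / 2) (by positivity)
  refine ⟨_, uniformContinuous_subtype_val hV, fun x y hxy => ?_⟩
  have h1 := h _ _ hxy i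
  have hx : δ ≤ ‖s x i‖ := x.2
  obtain ⟨x, hx'⟩ := x
  obtain ⟨y, hy'⟩ := y
  simp only at h1 hx ⊢
  set t := φ x y - (ph (s y i) - ph (s x i)) with ht
  have e1 : ee (φ x y) * s x i = ee t * ee (ph (s y i)) * ‖s x i‖ := by
    conv_lhs => rw [← norm_mul_ee_ph (s x i)]
    rw [← ee_add, show t + ph (s y i) = φ x y + ph (s x i) by rw [ht]; ring, ee_add]
    ring
  have h2 : |‖s y i‖ - ‖s x i‖| < δ * ε / 2 := by
    refine lt_of_le_of_lt ?_ h1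
    have := abs_norm_sub_norm_le (s y i) (ee (φ x y) * s x i)
    rwa [norm_mul, norm_ee, one_mul] at this
  have h3 : ‖(ee t - 1) * ‖s x i‖‖ < δ * ε := by
    have : (ee t - 1) * ‖s x i‖ * ee (ph (s y i)) =
        -(s y i - ee (φ x y) * s x i) + ((‖s y i‖ - ‖s x i‖ : ℝ) : ℂ) * ee (ph (s y i)) := by
      rw [e1]
      conv_rhs => enter [1, 1, 1]; rw [← norm_mul_ee_ph (s y i)]
      push_cast
      ring
    have := congrArg norm this
    rw [norm_mul _ (ee _), norm_ee, mul_one] at this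
    rw [this]
    refine (norm_add_le _ _).trans_lt ?_
    rw [norm_neg, norm_mul, norm_ee, mul_one, Complex.norm_real, Real.norm_eq_abs]
    linarith
  rw [norm_mul, Complex.norm_real, norm_norm] at h3
  have := norm_nonneg (ee t - 1)
  by_contra hcon
  push Not at hcon
  nlinarith

theorem nearInt_d (S : Sec φ s) : NearInt 2 (Coch.d (c1 φ)) := by
  obtain ⟨δ, hδ, hU⟩ := S.exists_ucover
  refine NearInt.of_cover hU (isHom_c1 φ).d fun i => ?_
  have := (S.nearInt_big hδ i).d
  rwa [← Coch.pull_d, map_sub, Coch.d_d, sub_zero] at this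

theorem res_big (S : Sec φ s) {δ : ℝ} (hδ : 0 < δ) (i : Fin n) :
    res (big s δ i) (hh k φ - d (al k φ s i)) = 0 := by
  rw [map_sub, Germ.pull_d, al, hh, pull_rd, pull_rd, d_rd (S.nearInt_big hδ i), ← Coch.pull_d,
    map_sub Coch.d, Coch.d_d, sub_zero, sub_self]

theorem ls (S : Sec φ s) : LS (hh k φ) (al k φ s) where
  d_h := d_rd_d_of_near S.nearInt_d
  bar_h := bar_rd_two (isHom_c1 _).d
  bar_α i := bar_rd_one ((isHom_c1 _).sub (isHom_c0 _).d)
  cover := by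
    obtain ⟨δ, hδ, hU⟩ := S.exists_ucover
    exact ⟨_, hU, S.res_big k hδ⟩

end Sec

section Delta

open Coch Germ Sec Classical

variable (k : Type*) [CommRing k] {φ : B → B → ℝ} {s s' s'' : B → Fin n → ℂ}

/-- The difference class of two sections. -/
noncomputable def Delta (φ : B → B → ℝ) (s s' : B → Fin n → ℂ) : HH k B :=
  if h : Sec φ s ∧ Sec φ s' then LS.dif (h.1.ls k) (h.2.ls k) else 0

theorem Delta_eq (S : Sec φ s) (S' : Sec φ s') :
    Delta k φ s s' = LS.dif (S.ls k) (S'.ls k) := dif_pos ⟨S, S'⟩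

theorem Delta_self : Delta k φ s s = 0 := by
  by_cases S : Sec φ s
  · rw [Delta_eq k S S, LS.dif_self]
  · exact dif_neg fun h => S h.1

theorem Delta_add (S : Sec φ s) (S' : Sec φ s') (S'' : Sec φ s'') :
    Delta k φ s s' + Delta k φ s' s'' = Delta k φ s s'' := by
  rw [Delta_eq k S S', Delta_eq k S' S'', Delta_eq k S S'', LS.dif_add]

theorem pull_Delta (S : Sec φ s) (S' : Sec φ s') {f : C → B} (hf : UniformContinuous f) :
    HH.pull f hf (Delta k φ s s') =
      Delta k (fun x y => φ (f x) (f y)) (fun x => s (f x)) fun x => s' (f x) := by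
  rw [Delta_eq k S S', Delta_eq k (S.comap hf) (S'.comap hf), LS.pull_dif]
  exact LS.dif_congr _ _ _ _ (pull_hh k hf) (funext fun i => pull_al k hf i)
    (funext fun i => pull_al k hf i)

theorem Delta_homotopy [PreconnectedSpace T] {s s' : B × T → Fin n → ℂ}
    (S : Sec (fun x y => φ x.1 y.1) s) (S' : Sec (fun x y => φ x.1 y.1) s') (t t' : T) :
    Delta k φ (fun x => s (x, t)) (fun x => s' (x, t)) =
      Delta k φ (fun x => s (x, t')) (fun x => s' (x, t')) := by
  have := HH.homotopy (Delta k (fun x y : B × T => φ x.1 y.1) s s') t t'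
  rwa [pull_Delta k S S', pull_Delta k S S'] at this

theorem Delta_eq_zero [PreconnectedSpace T] {s : B × T → Fin n → ℂ}
    (S : Sec (fun x y => φ x.1 y.1) s) (t t' : T) :
    Delta k φ (fun x => s (x, t)) (fun x => s (x, t')) = 0 := by
  have S' : Sec (fun x y => φ x.1 y.1) fun x : B × T => s (x.1, t') :=
    (S.comap (f := fun x : B × T => (x.1, t'))
      ((HH.uc_inc t').comp uniformContinuous_fst))
  rw [Delta_homotopy k S S' t t', Delta_self]

/-- The degree one class of a map to the circle. -/
noncomputable def tauG (l : B → Circle) : Germ k B := rd k (Coch.d (c0 fun x => ph (l x)))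

theorem nearInt_tau {l : B → Circle} (hl : UniformContinuous l) :
    NearInt 1 (Coch.d (c0 fun x => ph (l x))) := by
  rw [d_c0]
  refine nearInt_c1 fun ε hε => ?_
  obtain ⟨V, hV, h⟩ := uc_iff_dist.1 hl ε hε
  refine ⟨V, hV, fun x y hxy => ?_⟩
  have h1 := h x y hxy
  rw [dist_comm] at h1
  replace h1 : dist (l y : ℂ) (l x : ℂ) < ε := h1
  rw [Complex.dist_eq] at h1
  have e := ee_sub_mul (ph (l y)) (ph (l x))
  rw [ee_ph (Circle.norm_coe _), ee_ph (Circle.norm_coe _)] at e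
  rw [← e] at h1
  calc _ = ‖(ee (ph (l y) - ph (l x)) - 1) * l x‖ := by
        rw [norm_mul, Circle.norm_coe, mul_one]
    _ < ε := by rwa [sub_mul, one_mul]

theorem d_tauG {l : B → Circle} (hl : UniformContinuous l) : d (tauG k l) = 0 :=
  d_rd_d_of_near (nearInt_tau hl)

/-- The degree one class of a map to the circle. -/
noncomputable def tau (l : B → Circle) (hl : UniformContinuous l) : HH k B :=
  cls (tauG k l) (d_tauG k hl)

theorem pull_tau {l : B → Circle} (hl : UniformContinuous l) {f : C → B}
    (hf : UniformContinuous f) : HH.pull f hf (tau k l hl) = tau k (fun x => l (f x)) (hl.comp hf) := by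
  rw [tau, HH.pull_cls]
  refine cls_congr ?_ _
  rw [tauG, pull_rd, Coch.pull_d, pull_c0]; rfl

theorem tau_mul {l l' : B → Circle} (hl : UniformContinuous l) (hl' : UniformContinuous l')
    (h : UniformContinuous fun x => l x * l' x) :
    tau k (fun x => l x * l' x) h = tau k l hl + tau k l' hl' := by
  rw [tau, tau, tau, cls_add, cls_eq_iff]
  have hn : NearInt 0 (c0 fun x => ph ((l x * l' x : Circle) : ℂ) - ph (l x) - ph (l' x)) := by
    refine nearInt_c0 fun x => ?_
    have e := ee_sub_mul (ph ((l x * l' x : Circle) : ℂ) - ph (l x)) (ph (l' x))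
    have e' := ee_sub_mul (ph ((l x * l' x : Circle) : ℂ)) (ph (l x))
    rw [ee_ph (Circle.norm_coe _)] at e
    rw [ee_ph (Circle.norm_coe _), ee_ph (Circle.norm_coe _), Circle.coe_mul] at e'
    rw [← mul_left_inj' (Circle.coe_ne_zero (l' x)), ← mul_left_inj' (Circle.coe_ne_zero (l x))]
    rw [e, Circle.coe_mul, e']
    ring
  refine ⟨rd k (c0 fun x => ph ((l x * l' x : Circle) : ℂ) - ph (l x) - ph (l' x)), ?_⟩
  rw [d_rd hn, ← c0_sub, ← c0_sub, map_sub, map_sub,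
    rd_sub ((nearInt_tau h).sub (nearInt_tau hl)) (nearInt_tau hl'),
    rd_sub (nearInt_tau h) (nearInt_tau hl)]
  rw [tauG, tauG, tauG]
  abel

theorem tau_sq {l : B → Circle} (hl : UniformContinuous l) : tau k l hl ^ 2 = 0 :=
  HH.sq_eq_zero (φ := rnd _) (isHom_c0 _).d.rnd
    (by have := d_tauG ℤ hl; exact this) _

theorem tau_anticomm {l l' : B → Circle} (hl : UniformContinuous l) (hl' : UniformContinuous l') :
    tau k l hl * tau k l' hl' = -(tau k l' hl' * tau k l hl) :=
  HH.anticomm (isHom_c0 _).d.rnd.cast (isHom_c0 _).d.rnd.cast _ _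

/-- Multiplying one coordinate of a section by a circle valued function. -/
theorem Delta_shift {s s' : B → Fin (n + 1) → ℂ} (S : Sec φ s) (S' : Sec φ s') {l : B → Circle}
    (hl : UniformContinuous l) (h0 : ∀ x, s' x 0 = l x * s x 0)
    (hs : ∀ x (i : Fin n), s' x i.succ = s x i.succ) :
    Delta k φ s' s = -tau k l hl * cls (hh k φ) (S.ls k).d_h ^ n := by
  let γ : Fin (n + 1) → Germ k B := Fin.cons (al k φ s 0 - tauG k l) fun i => al k φ s i.succ
  have hγb : ∀ i, (bar : Germ k B →+* _) (γ i) = -γ i := by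
    refine Fin.cases ?_ fun i => ?_
    · change (bar : Germ k B →+* _) (al k φ s 0 - tauG k l) = -(al k φ s 0 - tauG k l)
      rw [map_sub, (S.ls k).bar_α 0, tauG, bar_rd_one (isHom_c0 _).d]
      abel
    · exact (S.ls k).bar_α i.succ
  obtain ⟨δ, hδ, hU⟩ := S.exists_ucover
  have hγd : ∀ i, d (γ i) = d (al k φ s i) := by
    refine Fin.cases ?_ fun i => rfl
    change d (al k φ s 0 - tauG k l) = _
    rw [map_sub, d_tauG k hl, sub_zero]
  have G : LS (hh k φ) γ := by
    refine ⟨(S.ls k).d_h, (S.ls k).bar_h, hγb, _, hU, fun i => ?_⟩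
    rw [hγd]
    exact S.res_big k hδ i
  have hbig : big s' δ = big s δ := by
    funext i
    ext x
    refine Fin.cases ?_ (fun i => ?_) i
    · change δ ≤ ‖s' x 0‖ ↔ δ ≤ ‖s x 0‖
      rw [h0, norm_mul, Circle.norm_coe, one_mul]
    · change δ ≤ ‖s' x i.succ‖ ↔ δ ≤ ‖s x i.succ‖
      rw [hs]
  set N : B → ℝ := fun x => ph (s' x 0) - ph (l x) - ph (s x 0) with hN
  have z : LS.dif G (S'.ls k) = 0 := by
    refine LS.dif_eq_zero G (S'.ls k) hU (Fin.cons (-rd k (c0 N)) 0) ?_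
      (fun i => by rw [hγd]; exact S.res_big k hδ i) ?_
    · refine Fin.cases ?_ fun i => ?_
      · change (bar : Germ k B →+* _) (-rd k (c0 N)) = -rd k (c0 N)
        rw [map_neg, bar_rd_zero (isHom_c0 _)]
      · exact map_zero _
    · refine Fin.cases ?_ fun i => ?_
      · change res (big s δ 0) (al k φ s' 0 - (al k φ s 0 - tauG k l) - d (-rd k (c0 N))) = 0
        have n1 := S.nearInt_big hδ 0
        have n2 := S'.nearInt_big hδ 0
        rw [hbig] at n2
        have n3 := (nearInt_tau hl).pull (uniformContinuous_subtype_val (p := (· ∈ big s δ 0)))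
        have n4 : NearInt 0 (Coch.pull (Subtype.val : big s δ 0 → B) (c0 N)) := by
          rw [pull_c0]
          refine nearInt_c0 fun x => ?_
          have hx : δ ≤ ‖s x 0‖ := x.2
          have hx0 : (‖s x 0‖ : ℂ) ≠ 0 := by
            have : ‖s x 0‖ ≠ 0 := by linarith
            exact_mod_cast this
          have e1 := norm_mul_ee_ph (s' x 0)
          have e2 := norm_mul_ee_ph (s x 0)
          have e3 := ee_ph (Circle.norm_coe (l x))
          have e4 : ee (ph (s' x 0)) = ee (N x) * (ee (ph (s x 0)) * ee (ph (l x))) := by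
            rw [← ee_add, ← ee_add]
            congr 1
            rw [hN]; ring
          rw [h0, norm_mul, Circle.norm_coe, one_mul] at e1
          rw [h0] at e4
          rw [e4, e3] at e1
          have hs0 : s x 0 ≠ 0 := by
            intro h
            rw [h, norm_zero] at hx
            linarith
          have : ee (N x) * ((l x : ℂ) * s x 0) = 1 * ((l x : ℂ) * s x 0) := by
            conv_rhs => rw [one_mul, ← e1]
            conv_lhs => rw [← e2]
            ring
          exact mul_right_cancel₀ (mul_ne_zero (Circle.coe_ne_zero _) hs0) this
        rw [map_sub, map_sub, map_sub, Germ.pull_d, map_neg, map_neg, al, al, tauG, pull_rd,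
          pull_rd, pull_rd, pull_rd, d_rd n4, sub_neg_eq_add, ← rd_sub n1 n3, ← rd_sub n2 (n1.sub n3),
          ← rd_add (n2.sub (n1.sub n3)) n4.d]
        rw [← Coch.pull_d, ← map_sub, ← map_sub, ← map_add]
        refine (congrArg (fun c => rd k (Coch.pull (Subtype.val : big s δ 0 → B) c)) ?_).trans
          ((congrArg (rd k) (map_zero _)).trans rd_zero)
        rw [hN, ← c0_sub, ← c0_sub, map_sub, map_sub]
        abel
      · change res (big s δ i.succ) (al k φ s' i.succ - al k φ s i.succ - DGRing.d 0) = 0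
        have : al k φ s' i.succ = al k φ s i.succ := by simp only [al, hs]
        rw [this]
        simp
  rw [Delta_eq k S' S, ← LS.dif_add (S'.ls k) G (S.ls k)]
  have z' : LS.dif (S'.ls k) G = 0 := by
    have := LS.dif_add G (S'.ls k) G
    rwa [z, LS.dif_self, zero_add] at this
  rw [z', zero_add]
  exact LS.dif_shift G (S.ls k) (d_tauG k hl) rfl fun i => rfl

end Delta

end

section

open Uniformity DGRing

/-- The uniformity is fine enough for `φ` to be the transition phases of a line bundle. -/
def Phase {B : Type*} [UniformSpace B] (φ : B → B → ℝ) : Prop := Coch.NearInt 2 (Coch.d (Coch.c1 φ))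

section PhaseClass

open Coch Germ Sec Classical

variable {B C : Type*} [UniformSpace B] [UniformSpace C] (k : Type*) [CommRing k]
  {φ ψ : B → B → ℝ} {n : ℕ}

theorem Sec.phase {s : B → Fin n → ℂ} (S : Sec φ s) : Phase φ := S.nearInt_d

theorem Phase.d_hh (h : Phase φ) : d (hh k φ) = 0 := d_rd_d_of_near h

/-- The first Chern class of the line bundle with transition phases `φ`. -/
noncomputable def cc (φ : B → B → ℝ) : HH k B :=
  if h : Phase φ then cls (hh k φ) (h.d_hh k) else 0

theorem cc_eq (h : Phase φ) : cc k φ = cls (hh k φ) (h.d_hh k) := dif_pos h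

theorem Coch.c1_neg {B : Type*} (φ : B → B → ℝ) : c1 (fun x y => -φ x y) = -c1 φ := by
  refine IsHom.ext_one (isHom_c1 _) (isHom_c1 _).neg fun x y => ?_
  simp [c1]

theorem Phase.add (h : Phase φ) (h' : Phase ψ) : Phase fun x y => φ x y + ψ x y := by
  unfold Phase
  rw [← c1_add φ ψ, map_add]
  exact NearInt.add h h'

theorem Phase.neg (h : Phase φ) : Phase fun x y => -φ x y := by
  unfold Phase
  rw [c1_neg, map_neg]
  exact NearInt.neg h

theorem Phase.comap (h : Phase φ) {f : C → B} (hf : UniformContinuous f) :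
    Phase fun x y => φ (f x) (f y) := by
  have := NearInt.pull h hf
  rwa [Coch.pull_d, pull_c1] at this

theorem Phase.zero : Phase fun _ _ : B => (0 : ℝ) := by
  have : c1 (fun _ _ : B => (0 : ℝ)) = 0 := by
    refine IsHom.ext_one (isHom_c1 _) (by intro x l _; rfl) fun x y => ?_
    simp [c1]
  unfold Phase
  rw [this, map_zero]
  exact ⟨fun x l _ => rfl, fun ε hε => ⟨_, Filter.univ_mem, fun x l _ => ⟨0, by simpa using hε⟩⟩⟩

theorem cc_add (h : Phase φ) (h' : Phase ψ) :
    cc k (fun x y => φ x y + ψ x y) = cc k φ + cc k ψ := by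
  rw [cc_eq k (h.add h'), cc_eq k h, cc_eq k h', cls_add]
  refine cls_congr ?_ _
  rw [hh, hh, hh, ← c1_add φ ψ, map_add, rd_add h h']

theorem cc_neg (h : Phase φ) : cc k (fun x y => -φ x y) = -cc k φ := by
  rw [cc_eq k h.neg, cc_eq k h, cls_neg]
  refine cls_congr ?_ _
  rw [hh, hh, c1_neg, map_neg, rd_neg h]

theorem pull_cc (h : Phase φ) {f : C → B} (hf : UniformContinuous f) :
    HH.pull f hf (cc k φ) = cc k fun x y => φ (f x) (f y) := by
  rw [cc_eq k h, cc_eq k (h.comap hf), HH.pull_cls]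
  exact cls_congr (pull_hh k hf) _

theorem cc_congr_near (h : Phase φ) (H : NearInt 1 (c1 fun x y => ψ x y - φ x y)) :
    cc k ψ = cc k φ := by
  have e : c1 ψ = c1 φ + c1 fun x y => ψ x y - φ x y := by
    rw [c1_add]; congr 1; ext x y; simp
  have h' : Phase ψ := by
    unfold Phase
    rw [e, map_add]
    exact NearInt.add h H.d
  rw [cc_eq k h, cc_eq k h', cls_eq_iff]
  refine ⟨rd k (c1 fun x y => ψ x y - φ x y), ?_⟩
  rw [d_rd H, hh, hh, e, map_add, rd_add h H.d, add_sub_cancel_left]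

theorem cc_pow_eq_zero {s : B → Fin n → ℂ} (S : Sec φ s) : cc k φ ^ n = 0 := by
  rw [cc_eq k S.phase]
  exact (S.ls k).pow_eq_zero

theorem cc_commute (φ : B → B → ℝ) (a : HH k B) : Commute (cc k φ) a := by
  by_cases h : Phase φ
  · rw [cc_eq k h]
    exact HH.commute_two (isHom_c1 φ).d.rnd.cast _ a
  · rw [cc, dif_neg h]; exact Commute.zero_left a

theorem cc_eq_of_sec {s : B → Fin n → ℂ} (S : Sec φ s) (S' : Sec ψ s) : cc k ψ = cc k φ := by
  refine cc_congr_near k S.phase (nearInt_c1 fun ε hε => ?_)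
  obtain ⟨δ, hδ, hs⟩ := S.nz
  obtain ⟨V, hV, h⟩ := S.near (δ * ε / 2) (by positivity)
  obtain ⟨V', hV', h'⟩ := S'.near (δ * ε / 2) (by positivity)
  refine ⟨_, Filter.inter_mem hV hV', fun x y hxy => ?_⟩
  obtain ⟨i, hi⟩ := hs x
  have h1 := h x y hxy.1 i
  have h2 := h' x y hxy.2 i
  have e : ‖ee (ψ x y - φ x y) - 1‖ * ‖s x i‖ < δ * ε := by
    calc _ = ‖(s y i - ee (φ x y) * s x i) - (s y i - ee (ψ x y) * s x i)‖ := by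
          rw [← mul_one ‖ee _ - 1‖, ← norm_ee (φ x y), ← norm_mul, ← norm_mul, sub_mul, ee_sub_mul]
          congr 1
          ring
      _ ≤ _ := norm_sub_le _ _
      _ < _ := by linarith
  have := norm_nonneg (ee (ψ x y - φ x y) - 1)
  by_contra hcon
  push Not at hcon
  nlinarith

end PhaseClass

/-- A bounded, possibly vanishing, section of the line bundle with transition phases `φ`. -/
structure PS {B : Type*} [UniformSpace B] (φ : B → B → ℝ) (f : B → ℂ) : Prop where
  bdd : ∃ C, ∀ x, ‖f x‖ ≤ C
  near : ∀ ε > 0, ∃ V ∈ 𝓤 B, ∀ x y, (x, y) ∈ V → ‖f y - ee (φ x y) * f x‖ < ε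

theorem ee_neg (t : ℝ) : ee (-t) = star (ee t) := by
  rw [ee, ee]
  simp [← Complex.exp_conj, Complex.conj_ofNat]

namespace PS

variable {B C : Type*} [UniformSpace B] [UniformSpace C] {φ ψ : B → B → ℝ} {f g : B → ℂ} {n : ℕ}

theorem bdd_pos (h : PS φ f) : ∃ C > 0, ∀ x, ‖f x‖ ≤ C := by
  obtain ⟨C, hC⟩ := h.bdd
  exact ⟨max C 1, by simp, fun x => (hC x).trans (le_max_left _ _)⟩

theorem congr (h : PS φ f) (H : ∀ x y, φ x y = ψ x y) : PS ψ f := by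
  rwa [show ψ = φ from funext fun x => funext fun y => (H x y).symm]

theorem congr_fun (h : PS φ f) (H : ∀ x, f x = g x) : PS φ g := by
  rwa [show g = f from funext fun x => (H x).symm]

theorem comap (h : PS φ f) {F : C → B} (hF : UniformContinuous F) :
    PS (fun x y => φ (F x) (F y)) fun x => f (F x) where
  bdd := let ⟨C, hC⟩ := h.bdd; ⟨C, fun _ => hC _⟩
  near ε hε := by
    obtain ⟨V, hV, h⟩ := h.near ε hε
    exact ⟨_, hF hV, fun x y hxy => h _ _ hxy⟩

theorem add (h : PS φ f) (h' : PS φ g) : PS φ fun x => f x + g x where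
  bdd := by
    obtain ⟨C, hC⟩ := h.bdd
    obtain ⟨C', hC'⟩ := h'.bdd
    exact ⟨C + C', fun x => (norm_add_le _ _).trans (add_le_add (hC x) (hC' x))⟩
  near ε hε := by
    obtain ⟨V, hV, h⟩ := h.near (ε / 2) (by positivity)
    obtain ⟨V', hV', h'⟩ := h'.near (ε / 2) (by positivity)
    refine ⟨_, Filter.inter_mem hV hV', fun x y hxy => ?_⟩
    have h1 := h x y hxy.1
    have h2 := h' x y hxy.2
    calc _ = ‖(f y - ee (φ x y) * f x) + (g y - ee (φ x y) * g x)‖ := by congr 1; ring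
      _ ≤ _ := norm_add_le _ _
      _ < ε := by linarith

theorem mul (h : PS φ f) (h' : PS ψ g) : PS (fun x y => φ x y + ψ x y) fun x => f x * g x where
  bdd := by
    obtain ⟨C, hC0, hC⟩ := h.bdd_pos
    obtain ⟨C', hC0', hC'⟩ := h'.bdd_pos
    refine ⟨C * C', fun x => ?_⟩
    rw [norm_mul]
    exact mul_le_mul (hC x) (hC' x) (norm_nonneg _) hC0.le
  near ε hε := by
    obtain ⟨C, hC0, hC⟩ := h.bdd_pos
    obtain ⟨C', hC0', hC'⟩ := h'.bdd_pos
    obtain ⟨V, hV, h⟩ := h.near (ε / 2 / C') (by positivity)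
    obtain ⟨V', hV', h'⟩ := h'.near (ε / 2 / C) (by positivity)
    refine ⟨_, Filter.inter_mem hV hV', fun x y hxy => ?_⟩
    have h1 := h x y hxy.1
    have h2 := h' x y hxy.2
    rw [lt_div_iff₀ hC0'] at h1
    rw [lt_div_iff₀ hC0] at h2
    rw [ee_add]
    calc _ = ‖(f y - ee (φ x y) * f x) * g y +
          ee (φ x y) * (f x * (g y - ee (ψ x y) * g x))‖ := by congr 1; ring
      _ ≤ _ := norm_add_le _ _
      _ < ε := by
        rw [norm_mul, norm_mul (ee _), norm_ee, one_mul, norm_mul]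
        have := mul_le_mul_of_nonneg_left (hC' y) (norm_nonneg (f y - ee (φ x y) * f x))
        have := mul_le_mul_of_nonneg_right (hC x) (norm_nonneg (g y - ee (ψ x y) * g x))
        linarith

theorem conj (h : PS φ f) : PS (fun x y => -φ x y) fun x => star (f x) where
  bdd := by
    obtain ⟨C, hC⟩ := h.bdd
    exact ⟨C, fun x => by rw [norm_star]; exact hC x⟩
  near ε hε := by
    obtain ⟨V, hV, h⟩ := h.near ε hε
    refine ⟨V, hV, fun x y hxy => ?_⟩
    rw [ee_neg, ← star_mul', ← star_sub, norm_star]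
    exact h x y hxy

theorem const (c : ℂ) : PS (fun _ _ : B => 0) fun _ => c where
  bdd := ⟨_, fun _ => le_rfl⟩
  near ε hε := ⟨_, Filter.univ_mem, fun x y _ => by simpa using hε⟩

theorem of_uc (h : UniformContinuous f) (hb : ∃ C, ∀ x, ‖f x‖ ≤ C) :
    PS (fun _ _ : B => 0) f where
  bdd := hb
  near ε hε := by
    obtain ⟨V, hV, h⟩ := uc_iff_dist.1 h ε hε
    refine ⟨V, hV, fun x y hxy => ?_⟩
    have := h x y hxy
    rwa [dist_comm, Complex.dist_eq, ← one_mul (f x), ← ee_zero] at this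

theorem uc (h : PS (fun _ _ : B => 0) f) : UniformContinuous f := by
  refine uc_iff_dist.2 fun ε hε => ?_
  obtain ⟨V, hV, h⟩ := h.near ε hε
  refine ⟨V, hV, fun x y hxy => ?_⟩
  have := h x y hxy
  rwa [ee_zero, one_mul, ← Complex.dist_eq, dist_comm] at this

theorem uc' (h : PS φ f) (H : ∀ x y, φ x y = 0) : UniformContinuous f := (h.congr H).uc

theorem mul_uc (h : PS φ f) (h' : PS (fun _ _ => 0) g) : PS φ fun x => f x * g x :=
  (h.mul h').congr fun _ _ => add_zero _

theorem uc_mul (h' : PS (fun _ _ => 0) g) (h : PS φ f) : PS φ fun x => g x * f x :=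
  (h'.mul h).congr fun _ _ => zero_add _

theorem const_mul (c : ℂ) (h : PS φ f) : PS φ fun x => c * f x := (const c).uc_mul h

theorem neg (h : PS φ f) : PS φ fun x => -f x :=
  (h.const_mul (-1)).congr_fun fun _ => neg_one_mul _

theorem sub (h : PS φ f) (h' : PS φ g) : PS φ fun x => f x - g x :=
  (h.add h'.neg).congr_fun fun _ => (sub_eq_add_neg _ _).symm

theorem zero : PS φ fun _ => 0 where
  bdd := ⟨0, by simp⟩
  near ε hε := ⟨_, Filter.univ_mem, fun x y _ => by simpa using hε⟩

theorem sum {ι : Type*} (S : Finset ι) {f : ι → B → ℂ} (h : ∀ i ∈ S, PS φ (f i)) :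
    PS φ fun x => ∑ i ∈ S, f i x := by
  classical
  induction S using Finset.induction_on with
  | empty => simpa using zero
  | insert a S ha ih =>
    refine ((h a (Finset.mem_insert_self _ _)).add
      (ih fun i hi => h i (Finset.mem_insert_of_mem hi))).congr_fun fun x => ?_
    rw [Finset.sum_insert ha]

theorem pow (h : PS φ f) (m : ℕ) : PS (fun x y => m * φ x y) fun x => f x ^ m := by
  induction m with
  | zero => exact ((const 1).congr fun _ _ => by simp).congr_fun fun _ => (pow_zero _).symm
  | succ m ih =>
    exact ((ih.mul h).congr fun _ _ => by push_cast; ring).congr_fun fun _ => (pow_succ _ _).symm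

theorem sec {s : B → Fin n → ℂ} (h : ∀ i, PS φ fun x => s x i) (hs : ∃ δ > 0, ∀ x, ∃ i, δ ≤ ‖s x i‖) :
    Sec φ s where
  near ε hε := by
    choose V hV H using fun i => (h i).near ε hε
    exact ⟨⋂ i, V i, (Filter.iInter_mem).2 hV, fun x y hxy i => H i x y (Set.mem_iInter.1 hxy i)⟩
  nz := hs

/-- A section whose norm is bounded below has a large coordinate. -/
theorem exists_big {B : Type*} {s : B → Fin n → ℂ} {c : ℝ} (hc : 0 < c) (hs : ∀ x, c ≤ ∑ i, ‖s x i‖ ^ 2) :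
    ∃ δ > 0, ∀ x, ∃ i, δ ≤ ‖s x i‖ := by
  refine ⟨√(c / (n + 1)), by positivity, fun x => ?_⟩
  by_contra! H
  have : ∑ i, ‖s x i‖ ^ 2 ≤ ∑ i : Fin n, c / (n + 1) := by
    refine Finset.sum_le_sum fun i _ => ?_
    have := (Real.lt_sqrt (norm_nonneg _)).1 (H i)
    exact this.le
  simp only [Finset.sum_const, Finset.card_univ, Fintype.card_fin, nsmul_eq_mul] at this
  have h2 := (hs x).trans this
  have : n * (c / (n + 1)) < c := by
    rw [← mul_div_assoc, div_lt_iff₀ (by positivity)]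
    nlinarith
  linarith

theorem normSq {s : B → Fin n → ℂ} (h : ∀ i, PS φ fun x => s x i) :
    UniformContinuous fun x => ∑ i, ‖s x i‖ ^ 2 := by
  have h1 : PS (fun _ _ => 0) fun x => ∑ i, s x i * star (s x i) :=
    sum _ fun i _ => ((h i).mul (h i).conj).congr fun _ _ => add_neg_cancel _
  have h2 := Complex.uniformContinuous_re.comp h1.uc
  refine h2.congr fun x => ?_
  simp [Complex.mul_conj, Complex.normSq_eq_norm_sq, -Complex.ofReal_pow]

end PS

theorem cc_eq_zero {B : Type*} [UniformSpace B] (k : Type*) [CommRing k] {φ : B → B → ℝ} {f : B → ℂ}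
    (h : PS φ f) (hf : ∃ δ > 0, ∀ x, δ ≤ ‖f x‖) : cc k φ = 0 := by
  have S : Sec φ fun x (_ : Fin 1) => f x :=
    PS.sec (fun _ => h) (let ⟨δ, hδ, H⟩ := hf; ⟨δ, hδ, fun x => ⟨0, H x⟩⟩)
  simpa using cc_pow_eq_zero k S

section Line

variable {X ι : Type*} [Fintype ι]

/-- The transition phases of the line spanned by a vector. -/
noncomputable def lph (v : X → ι → ℂ) (x y : X) : ℝ := ph (∑ i, v y i * star (v x i))

theorem norm_le_of_sum_sq {w : ι → ℂ} {c : ℝ} (h : ∑ i, ‖w i‖ ^ 2 = c) (i : ι) : ‖w i‖ ≤ c + 1 := by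
  have h1 : ‖w i‖ ^ 2 ≤ c := by
    rw [← h]
    exact Finset.single_le_sum (f := fun i => ‖w i‖ ^ 2) (fun i _ => by positivity)
      (Finset.mem_univ i)
  nlinarith [sq_nonneg (‖w i‖ - 1), norm_nonneg (w i)]

theorem sum_mul_star {w : ι → ℂ} {c : ℝ} (h : ∑ i, ‖w i‖ ^ 2 = c) : ∑ i, w i * star (w i) = c := by
  rw [← h]
  simp [Complex.mul_conj, Complex.normSq_eq_norm_sq]

theorem lph_est {v w : ι → ℂ} {c η : ℝ} (hc : 0 < c) (hv : ∑ i, ‖v i‖ ^ 2 = c)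
    (hw : ∑ i, ‖w i‖ ^ 2 = c) (h : ∀ i j, ‖w i * star (w j) - v i * star (v j)‖ ≤ η) (j : ι) :
    c * ‖w j - ee (ph (∑ i, w i * star (v i))) * v j‖ ≤
      (Fintype.card ι * (c + 1) + Fintype.card ι ^ 2 * (c + 1) ^ 2 / c * (c + 1)) * η := by
  set a := ∑ i, w i * star (v i) with ha
  set N : ℝ := (Fintype.card ι : ℝ) with hN
  have hη : 0 ≤ η := (norm_nonneg _).trans (h j j)
  have hv' := norm_le_of_sum_sq hv
  have hw' := norm_le_of_sum_sq hw
  have h1 : ‖c * w j - a * v j‖ ≤ N * (c + 1) * η := by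
    have : c * w j - a * v j = ∑ i, w i * star (w i * star (w j) - v i * star (v j)) := by
      rw [← sum_mul_star hw, ha, Finset.sum_mul, Finset.sum_mul, ← Finset.sum_sub_distrib]
      refine Finset.sum_congr rfl fun i _ => ?_
      simp only [star_sub, star_mul', star_star]
      ring
    rw [this]
    refine (norm_sum_le _ _).trans ?_
    refine (Finset.sum_le_sum fun i _ => (?_ : _ ≤ (c + 1) * η)).trans_eq ?_
    · rw [norm_mul, norm_star]
      exact mul_le_mul (hw' i) (h i j) (norm_nonneg _) (by linarith)
    · simp [hN, mul_assoc]
  have h2 : |‖a‖ - c| ≤ N ^ 2 * (c + 1) ^ 2 / c * η := by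
    have e : a * star a - c * c = ∑ i, ∑ j, (w i * star (w j) - v i * star (v j)) *
        (star (v i) * v j) := by
      have : (c * c : ℂ) = (∑ i, v i * star (v i)) * ∑ j, star (v j) * v j := by
        simp_rw [mul_comm (star _)]
        rw [sum_mul_star hv]
      rw [this, ha, star_sum, Finset.sum_mul_sum, Finset.sum_mul_sum, ← Finset.sum_sub_distrib]
      refine Finset.sum_congr rfl fun i _ => ?_
      rw [← Finset.sum_sub_distrib]
      refine Finset.sum_congr rfl fun j _ => ?_
      simp only [star_mul', star_star]
      ring
    have e2 : ‖a * star a - c * c‖ = |‖a‖ - c| * (‖a‖ + c) := by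
      have : a * star a - c * c = (((‖a‖ - c) * (‖a‖ + c) : ℝ) : ℂ) := by
        rw [Complex.star_def, Complex.mul_conj, Complex.normSq_eq_norm_sq]
        push_cast; ring
      rw [this, Complex.norm_real, Real.norm_eq_abs, abs_mul, abs_of_nonneg (by positivity : 0 ≤ ‖a‖ + c)]
    have e3 : ‖a * star a - c * c‖ ≤ N ^ 2 * (c + 1) ^ 2 * η := by
      rw [e]
      refine (norm_sum_le _ _).trans ((Finset.sum_le_sum fun i _ =>
        (norm_sum_le _ _).trans (Finset.sum_le_sum fun j _ =>
          (?_ : _ ≤ η * ((c + 1) * (c + 1))))).trans_eq ?_)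
      · rw [norm_mul, norm_mul, norm_star]
        exact mul_le_mul (h i j) (mul_le_mul (hv' i) (hv' j) (norm_nonneg _) (by linarith))
          (by positivity) hη
      · simp [hN]; ring
    rw [e2] at e3
    rw [div_mul_eq_mul_div, le_div_iff₀ hc]
    refine le_trans ?_ e3
    exact mul_le_mul_of_nonneg_left (by linarith [norm_nonneg a]) (abs_nonneg _)
  have h3 : c * (w j - ee (ph a) * v j) = (c * w j - a * v j) +
      ((‖a‖ - c : ℝ) : ℂ) * (ee (ph a) * v j) := by
    conv_rhs => enter [1, 2]; rw [← norm_mul_ee_ph a]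
    push_cast
    ring
  calc _ = ‖c * (w j - ee (ph a) * v j)‖ := by
        rw [norm_mul, Complex.norm_real, Real.norm_eq_abs, abs_of_pos hc]
    _ ≤ _ := h3 ▸ norm_add_le _ _
    _ ≤ N * (c + 1) * η + N ^ 2 * (c + 1) ^ 2 / c * η * (c + 1) := by
        refine add_le_add h1 ?_
        rw [norm_mul, norm_mul, norm_ee, one_mul, Complex.norm_real, Real.norm_eq_abs]
        exact mul_le_mul h2 (hv' j) (norm_nonneg _) (by positivity)
    _ = _ := by ring

theorem lph_ps [UniformSpace X] {v : X → ι → ℂ} {c : ℝ} (hc : 0 < c) (hv : ∀ x, ∑ i, ‖v x i‖ ^ 2 = c)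
    (hu : ∀ i j, UniformContinuous fun x => v x i * star (v x j)) (j : ι) :
    PS (lph v) fun x => v x j where
  bdd := ⟨_, fun x => norm_le_of_sum_sq (hv x) j⟩
  near ε hε := by
    set K : ℝ := Fintype.card ι * (c + 1) + Fintype.card ι ^ 2 * (c + 1) ^ 2 / c * (c + 1) with hK
    have hK0 : 0 ≤ K := by positivity
    choose V hV H using fun i j => uc_iff_dist.1 (hu i j) (c * ε / (K + 1)) (by positivity)
    refine ⟨⋂ i, ⋂ j, V i j, (Filter.iInter_mem).2 fun i => (Filter.iInter_mem).2 (hV i),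
      fun x y hxy => ?_⟩
    have := lph_est hc (hv x) (hv y) (η := c * ε / (K + 1)) (fun i j => by
      have := H i j x y (Set.mem_iInter.1 (Set.mem_iInter.1 hxy i) j)
      rw [dist_comm, Complex.dist_eq] at this
      exact this.le) j
    rw [← hK] at this
    have h2 : K * (c * ε / (K + 1)) < c * ε := by
      rw [← mul_div_assoc, div_lt_iff₀ (by positivity)]
      nlinarith [mul_pos hc hε]
    have h3 := this.trans_lt h2
    exact lt_of_mul_lt_mul_left h3 hc.le

end Line

end

section

open Uniformity DGRing

/-- The point of the circle with a given normalized argument. -/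
noncomputable def circ (t : ℝ) : Circle := Circle.exp (2 * Real.pi * t)

theorem coe_circ (t : ℝ) : (circ t : ℂ) = ee t := by
  rw [circ, Circle.coe_exp, ee]
  push_cast
  rfl

theorem circ_add (s t : ℝ) : circ (s + t) = circ s * circ t :=
  Subtype.ext (by rw [Circle.coe_mul, coe_circ, coe_circ, coe_circ, ee_add])

theorem circ_int (n : ℤ) : circ n = 1 := Subtype.ext (by rw [coe_circ, ee_int, Circle.coe_one])

theorem circ_zero : circ 0 = 1 := by simpa using circ_int 0

theorem circ_pow (t : ℝ) (n : ℕ) : circ t ^ n = circ (n * t) := by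
  induction n with
  | zero => simp [circ_zero]
  | succ n ih => rw [pow_succ, ih, ← circ_add]; congr 1; push_cast; ring

namespace Coch

variable {k A : Type*} [CommRing k]

/-- The slices of a product with the circle at the roots of unity. -/
noncomputable def slice (N i : ℕ) (a : A) : A × Circle := (a, circ (i / N))

theorem slice_self {N : ℕ} (hN : N ≠ 0) : (slice N N : A → _) = slice N 0 := by
  ext1 a
  rw [slice, slice, div_self (by exact_mod_cast hN)]
  simpa [circ_zero] using circ_int 1

/-- Integration over a polygon inscribed in the circle. -/
noncomputable def integ (N : ℕ) : Coch k (A × Circle) →ₗ[k] Coch k A :=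
  ∑ i ∈ Finset.range N, (prism (slice N i) (slice N (i + 1)) - prism (slice N i) (slice N i))

theorem integ_eq (N : ℕ) (φ : Coch k (A × Circle)) : integ N φ = ∑ i ∈ Finset.range N,
    (prism (slice N i) (slice N (i + 1)) φ - prism (slice N i) (slice N i) φ) := by
  simp [integ]

theorem d_integ {N : ℕ} (hN : N ≠ 0) (φ : Coch k (A × Circle)) : d (integ N φ) = -integ N (d φ) := by
  rw [eq_neg_iff_add_eq_zero, integ_eq, integ_eq, map_sum, ← Finset.sum_add_distrib]
  have : ∀ i, d (prism (slice N i) (slice N (i + 1)) φ - prism (slice N i) (slice N i) φ) +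
      (prism (slice N i) (slice N (i + 1)) (d φ) - prism (slice N i) (slice N i) (d φ)) =
      pull (slice N (i + 1)) φ - pull (slice N i) φ := fun i => by
    rw [map_sub, ← sub_zero (_ - pull (slice N i) φ), ← sub_self (pull (slice N i) φ),
      ← prism_d, ← prism_d]
    abel
  simp_rw [this]
  rw [Finset.sum_range_sub fun i => pull (slice N i) φ, slice_self hN, sub_self]

theorem integ_fst_mul {N : ℕ} (hN : N ≠ 0) (a : Coch k A) (φ : Coch k (A × Circle)) :
    integ N (pull Prod.fst a * φ) = bar a * integ N φ := by
  have e : ∀ i, (Prod.fst ∘ slice N i : A → A) = id := fun i => rfl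
  have : ∀ i, prism (slice N i) (slice N (i + 1)) (pull Prod.fst a * φ) -
      prism (slice N i) (slice N i) (pull Prod.fst a * φ) =
      bar a * (prism (slice N i) (slice N (i + 1)) φ - prism (slice N i) (slice N i) φ) +
      prism id id a * (pull (slice N (i + 1)) φ - pull (slice N i) φ) := fun i => by
    rw [prism_mul, prism_mul, prism_pull, prism_pull, pull_pull, e, e]
    have : pull id a = a := ext' fun x l => by simp
    rw [this]
    noncomm_ring
  rw [integ_eq, integ_eq]
  simp_rw [this]
  rw [Finset.sum_add_distrib, ← Finset.mul_sum, ← Finset.mul_sum,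
    Finset.sum_range_sub fun i => pull (slice N i) φ, slice_self hN, sub_self, mul_zero, add_zero]

theorem integ_one (N : ℕ) : integ N (1 : Coch k (A × Circle)) = 0 := by
  rw [integ_eq]
  simp [prism_one]

theorem integ_fst {N : ℕ} (hN : N ≠ 0) (a : Coch k A) : integ N (pull Prod.fst a) = 0 := by
  rw [← mul_one (pull Prod.fst a), integ_fst_mul hN, integ_one, mul_zero]

theorem integ_pow {q M : ℕ} (hq : (q : k) = 0) (hM : M ≠ 0) (hq0 : q ≠ 0)
    (φ : Coch k (A × Circle)) :
    integ (M * q) (pull (fun x => (x.1, x.2 ^ q)) φ) = 0 := by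
  have hq' : (q : ℝ) ≠ 0 := by exact_mod_cast hq0
  have hM' : (M : ℝ) ≠ 0 := by exact_mod_cast hM
  have e : ∀ i, ((fun x : A × Circle => (x.1, x.2 ^ q)) ∘ slice (M * q) i) = slice M i := by
    intro i
    ext1 a
    simp only [slice, Function.comp, circ_pow]
    congr 2
    push_cast
    field_simp
  rw [integ_eq]
  simp_rw [prism_pull, e]
  set f : ℕ → Coch k A := fun i => prism (slice M i) (slice M (i + 1)) φ -
    prism (slice M i) (slice M i) φ with hf
  have per : ∀ i, (slice M (i + M) : A → _) = slice M i := by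
    intro i
    ext1 a
    simp only [slice]
    rw [Nat.cast_add, add_div, div_self hM', circ_add]
    have := circ_int 1
    push_cast at this
    rw [this, mul_one]
  have hper : ∀ i, f (i + M) = f i := fun i => by
    simp only [hf, per, add_right_comm i M 1]
  have : ∀ r, ∑ i ∈ Finset.range (M * r), f i = r • ∑ i ∈ Finset.range M, f i := by
    intro r
    induction r with
    | zero => simp
    | succ r ih =>
      rw [Nat.mul_succ, Finset.sum_range_add, ih, succ_nsmul]
      congr 1
      refine Finset.sum_congr rfl fun i _ => ?_
      clear ih
      induction r with
      | zero => simp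
      | succ r ih => rw [Nat.mul_succ, add_right_comm, hper, ih]
  rw [this, ← Nat.cast_smul_eq_nsmul k, hq, zero_smul]

theorem integ_mem_Loc [UniformSpace A] {φ : Coch k (A × Circle)} (h : φ ∈ Loc k (A × Circle)) :
    ∃ N₀, ∀ N ≥ N₀, integ N φ ∈ Loc k A := by
  obtain ⟨V, hV, h⟩ := h
  rw [uniformity_prod_eq_comap_prod, Filter.mem_comap] at hV
  obtain ⟨W, hW, hWV⟩ := hV
  obtain ⟨U, hU, E, hE, hUE⟩ := Filter.mem_prod_iff.1 hW
  obtain ⟨ε, hε, hεE⟩ := Metric.mem_uniformity_dist.1 hE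
  have hc : Filter.Tendsto (fun N : ℕ => ‖ee (1 / N) - 1‖) Filter.atTop (nhds 0) := by
    have h1 : Continuous fun t : ℝ => ‖ee t - 1‖ := by unfold ee; fun_prop
    have h2 := (h1.tendsto 0).comp (tendsto_const_div_atTop_nhds_zero_nat 1)
    simpa [Function.comp_def] using h2
  obtain ⟨N₀, hN₀⟩ := Filter.eventually_atTop.1 (hc.eventually (gt_mem_nhds hε))
  refine ⟨N₀, fun N hN => ?_⟩
  have hd : ∀ i : ℕ, dist (circ ((i + 1 : ℕ) / N)) (circ (i / N)) < ε := fun i => by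
    change dist (_ : ℂ) _ < ε
    rw [coe_circ, coe_circ, Complex.dist_eq]
    have := hN₀ N hN
    calc _ = ‖(ee (1 / N) - 1) * ee (i / N)‖ := by
          rw [sub_mul, ← ee_add, one_mul]
          congr 3
          push_cast
          ring
      _ < ε := by rwa [norm_mul, norm_ee, mul_one]
  have hmem : ∀ x y : A, (x, y) ∈ U → ∀ s t : Circle, dist s t < ε → ((x, s), (y, t)) ∈ V :=
    fun x y hxy s t hst => hWV (hUE (Set.mk_mem_prod hxy (hεE hst)))
  rw [integ_eq]
  refine sum_mem fun i _ => sub_mem ?_ ?_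
  · refine prism_mem_Loc (V := V) ⟨U, hU, fun x y hxy => ⟨?_, ?_, ?_, ?_⟩⟩ h
    · exact hmem _ _ hxy _ _ (by rwa [dist_self])
    · exact hmem _ _ hxy _ _ (by rw [dist_comm]; exact hd i)
    · exact hmem _ _ hxy _ _ (hd i)
    · exact hmem _ _ hxy _ _ (by rwa [dist_self])
  · refine prism_mem_Loc (V := V) ⟨U, hU, fun x y hxy => ⟨?_, ?_, ?_, ?_⟩⟩ h <;>
    exact hmem _ _ hxy _ _ (by rwa [dist_self])

theorem prism_eq_zero_of_isHom_zero {X Y : Type*} {f g : X → Y} {φ : Coch k Y} (h : φ.IsHom 0) :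
    prism f g φ = 0 := by
  refine ext' fun x l => ?_
  induction l generalizing φ x with
  | nil => simpa using h _ _ (by simp)
  | cons y l ih =>
    rw [prism_cons, h _ _ (by simp), h.sh_zero]
    simp

theorem prism_cons_eq_zero_of_isHom_one {X Y : Type*} {f g : X → Y} {φ : Coch k Y} (h : φ.IsHom 1)
    (x y : X) (l : List X) : prism f g φ x (y :: l) = 0 := by
  rw [prism_cons, h _ _ (by simp), prism_eq_zero_of_isHom_zero (h.sh _)]
  simp

theorem integ_tau {N : ℕ} (hN : 3 ≤ N) :
    integ N (Coch.cast k (rnd (d (c0 fun x : A × Circle => ph (x.2 : ℂ))))) = -1 := by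
  have hN' : (3 : ℝ) ≤ N := by exact_mod_cast hN
  have hN0 : (N : ℝ) ≠ 0 := by positivity
  have hH : (Coch.cast k (rnd (d (c0 fun x : A × Circle => ph (x.2 : ℂ))))).IsHom 1 :=
    (isHom_c0 _).d.rnd.cast
  set u : ℕ → ℝ := fun i => ph (circ (i / N) : ℂ) with hu
  have hm : ∀ i, ∃ m : ℤ, u (i + 1) - u i - 1 / N = m := fun i => by
    apply exists_int_of_ee_eq_one
    have hui : ∀ i, ee (u i) = ee (i / N) := fun i => by
      rw [hu]; exact (ee_ph (Circle.norm_coe _)).trans (coe_circ _)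
    have e1 := ee_sub_mul (u (i + 1) - u i) (1 / N)
    have e2 := ee_sub_mul (u (i + 1)) (u i)
    rw [hui, hui, Nat.cast_succ, add_div, ee_add, mul_comm (ee (i / N)) (ee (1 / N))] at e2
    rw [← mul_left_inj' (ee_ne_zero (1 / N)), ← mul_left_inj' (ee_ne_zero (i / N)), one_mul, ← e2,
      e1]
  choose m hm using hm
  have hr : ∀ i, round (u (i + 1) - u i) = m i := fun i => by
    rw [show u (i + 1) - u i = m i + 1 / N by rw [← hm]; ring, round_intCast_add]
    rw [show round (1 / (N : ℝ)) = 0 from ?_, add_zero]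
    rw [round_eq_zero_iff]
    constructor
    · have : (0 : ℝ) ≤ 1 / N := by positivity
      linarith
    · rw [div_lt_div_iff₀ (by linarith) (by norm_num)]
      linarith
  refine ext' fun x l => ?_
  rw [integ_eq, sum_apply]
  cases l with
  | cons y l =>
    simp [prism_cons_eq_zero_of_isHom_one hH]
  | nil =>
    have : ∀ i, (prism (slice N i) (slice N (i + 1))
        (Coch.cast k (rnd (d (c0 fun x : A × Circle => ph (x.2 : ℂ))))) -
        prism (slice N i) (slice N i)
        (Coch.cast k (rnd (d (c0 fun x : A × Circle => ph (x.2 : ℂ)))))) x [] = m i := fun i => by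
      rw [sub_apply, prism_nil, prism_nil, cast_apply, cast_apply]
      simp only [rnd, d_pair, c0, slice, sub_self]
      rw [← hr i]
      simp [hu]
    simp_rw [this]
    have hs : ∑ i ∈ Finset.range N, (m i : ℝ) = -1 := by
      simp_rw [← hm]
      rw [Finset.sum_sub_distrib, Finset.sum_range_sub]
      simp [hu, hN0, div_self, circ_zero]
      have := circ_int 1
      push_cast at this
      rw [this]
      simp
    have hs' : ∑ i ∈ Finset.range N, m i = -1 := by exact_mod_cast hs
    rw [← Int.cast_sum, hs']
    simp
end Coch

section Circle

open Germ

variable {A : Type*} [UniformSpace A]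

theorem uc_circle_pow (q : ℕ) : UniformContinuous fun z : Circle => z ^ q :=
  CompactSpace.uniformContinuous_of_continuous (continuous_pow q)

theorem uc_pow_snd (q : ℕ) : UniformContinuous fun x : A × Circle => (x.1, x.2 ^ q) :=
  uniformContinuous_fst.prodMk ((uc_circle_pow q).comp uniformContinuous_snd)

theorem HH.eq_zero_of_circle {k : Type*} [CommRing k] {q : ℕ} (hq : (q : k) = 0) (hq0 : q ≠ 0)
    {a b : HH k A} {c : HH k (A × Circle)}
    (h : HH.pull Prod.fst uniformContinuous_fst a * tau k (fun x : A × Circle => x.2)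
      uniformContinuous_snd + HH.pull Prod.fst uniformContinuous_fst b =
      HH.pull (fun x : A × Circle => (x.1, x.2 ^ q)) (uc_pow_snd q) c) : a = 0 := by
  obtain ⟨a, ha, rfl⟩ := cls_surj a
  obtain ⟨b, hb, rfl⟩ := cls_surj b
  obtain ⟨c, hc, rfl⟩ := cls_surj c
  obtain ⟨α, rfl⟩ := mk_surj a
  obtain ⟨β, rfl⟩ := mk_surj b
  obtain ⟨γ, rfl⟩ := mk_surj c
  rw [HH.pull_cls, HH.pull_cls, HH.pull_cls, tau, cls_mul, cls_add, cls_eq_iff] at h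
  obtain ⟨e, he⟩ := h
  obtain ⟨ε, rfl⟩ := mk_surj e
  rw [tauG, rd, pull_mk, pull_mk, pull_mk, d_mk, ← map_mul, ← map_add, ← map_sub, mk_eq_mk] at he
  obtain ⟨N₀, hN⟩ := Coch.integ_mem_Loc he
  set N := (max N₀ 3) * q with hNq
  have hq1 : 1 ≤ q := Nat.one_le_iff_ne_zero.2 hq0
  have h3 : max N₀ 3 ≤ N := Nat.le_mul_of_pos_right _ hq1
  have hN3 : 3 ≤ N := (le_max_right _ _).trans h3
  have hN1 := hN N ((le_max_left _ _).trans h3)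
  have hN0 : N ≠ 0 := by omega
  rw [map_sub, map_sub, map_add, Coch.integ_fst_mul hN0, Coch.integ_tau hN3, Coch.integ_fst hN0,
    hNq, Coch.integ_pow hq (by have := le_max_right N₀ 3; omega) hq0, ← hNq] at hN1
  have h4 : Coch.integ N (Coch.d ε) = -Coch.d (Coch.integ N ε) := by rw [Coch.d_integ hN0, neg_neg]
  rw [h4, add_zero, sub_zero, mul_neg_one, sub_neg_eq_add, neg_add_eq_sub, ← mk_eq_mk] at hN1
  refine (cls_eq_zero_iff _).2 ⟨mk (-Coch.bar (Coch.integ N ε)), ?_⟩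
  rw [d_mk, map_neg, Coch.d_bar, neg_neg, ← bar_mk, ← hN1, bar_mk, Coch.bar_bar]

theorem HH.eq_zero_of_mul_tau {k : Type*} [CommRing k] {q : ℕ} (hq : (q : k) = 0) (hq0 : q ≠ 0)
    {a : HH k A} (h : HH.pull Prod.fst uniformContinuous_fst a *
      tau k (fun x : A × Circle => x.2) uniformContinuous_snd = 0) : a = 0 :=
  HH.eq_zero_of_circle hq hq0 (b := 0) (c := 0) (by rw [h, map_zero, map_zero, zero_add])

variable {X : Type*} [UniformSpace X] {k : Type*} [CommRing k]

theorem PS.nearInt {φ : X → X → ℝ} {s : X → ℂ} (h : PS φ s) (hs : ∀ x, ‖s x‖ = 1) :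
    Coch.NearInt 1 (Coch.c1 φ - Coch.d (Coch.c0 fun x => ph (s x))) := by
  rw [Coch.d_c0, Coch.c1_sub]
  refine Coch.nearInt_c1 fun ε hε => ?_
  obtain ⟨V, hV, h⟩ := h.near ε hε
  refine ⟨V, hV, fun x y hxy => ?_⟩
  have h1 := h x y hxy
  rw [norm_sub_rev] at h1
  have e1 := ee_sub_mul (φ x y) (ph (s y) - ph (s x))
  have e2 := ee_sub_mul (ph (s y)) (ph (s x))
  rw [ee_ph (hs _), ee_ph (hs _)] at e2
  calc _ = ‖(ee (φ x y - (ph (s y) - ph (s x))) - 1) * s y‖ := by rw [norm_mul, hs, mul_one]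
    _ = ‖ee (φ x y) * s x - s y‖ := by rw [sub_mul, one_mul, ← e1, mul_assoc, e2]
    _ < ε := h1

/-- If the line bundle is trivial along a family of loops starting with a constant loop and ending
with a `q`-fold loop, where the trivialisation turns once around at the start and is constant at
the end, then its class is independent of the classes of the base. -/
theorem HH.eq_zero_of_mul_cc {q : ℕ} (hq : (q : k) = 0) (hq0 : q ≠ 0) {φ : X → X → ℝ}
    (hφ : Phase φ) {γ : Circle × unitInterval → X} (hγ : UniformContinuous γ)
    {s : Circle × unitInterval → ℂ} (hs : PS (fun x y => φ (γ x) (γ y)) s) (hs1 : ∀ x, ‖s x‖ = 1)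
    {x₀ : X} (hx₀ : φ x₀ x₀ = 0) (hγ0 : ∀ z, γ (z, 0) = x₀) (hs0 : ∀ z : Circle, s (z, 0) = z)
    {γ₁ : Circle → X} (hγ₁u : UniformContinuous γ₁) (hγ1 : ∀ z, γ (z, 1) = γ₁ (z ^ q))
    (hs1' : ∀ z, s (z, 1) = 1) (hs₁ : PS (fun x y => φ (γ₁ x) (γ₁ y)) fun _ => 1)
    {a : HH k A} (h : HH.pull Prod.fst uniformContinuous_fst a *
      HH.pull Prod.snd uniformContinuous_snd (cc k φ) = 0) : a = 0 := by
  obtain ⟨a, ha, rfl⟩ := cls_surj a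
  rw [cc_eq k hφ, HH.pull_cls, HH.pull_cls, cls_mul, cls_eq_zero_iff] at h
  obtain ⟨η, hη⟩ := h
  set N := Coch.c1 (fun x y => φ (γ x) (γ y)) - Coch.d (Coch.c0 fun x => ph (s x)) with hN
  have hNn : Coch.NearInt 1 N := hs.nearInt hs1
  set n : Germ k (Circle × unitInterval) := rd k N with hn
  have hdn : d n = Germ.pull γ hγ (Sec.hh k φ) := by
    rw [hn, d_rd hNn, hN, map_sub, Coch.d_d, sub_zero, Sec.pull_hh]; rfl
  set N₁ := Coch.c1 (fun x y => φ (γ₁ x) (γ₁ y)) - Coch.d (Coch.c0 fun _ => ph 1) with hN₁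
  have hN₁n : Coch.NearInt 1 N₁ := hs₁.nearInt fun _ => by simp
  set n₁ : Germ k Circle := rd k N₁ with hn₁
  have hdn₁ : d n₁ = Germ.pull γ₁ hγ₁u (Sec.hh k φ) := by
    rw [hn₁, d_rd hN₁n, hN₁, map_sub, Coch.d_d, sub_zero, Sec.pull_hh]; rfl
  have hba : d ((bar : Germ k A →+* _) a) = 0 := d_bar_eq_zero ha
  have hcl : ∀ {W : Type _} [UniformSpace W] (f : W → A) (hf : UniformContinuous f) (g : W → X)
      (hg : UniformContinuous g) (m : Germ k W), d m = Germ.pull g hg (Sec.hh k φ) →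
      d (Germ.pull (fun w => (f w, g w)) (hf.prodMk hg) η -
        Germ.pull f hf ((bar : Germ k A →+* _) a) * m) = 0 := by
    intro W _ f hf g hg m hm
    rw [map_sub, ← Germ.pull_d, hη, d_mul, ← Germ.pull_d, hba, map_zero, zero_mul, zero_add,
      ← Germ.pull_bar, bar_bar, map_mul, Germ.pull_pull, Germ.pull_pull, hm]
    exact sub_self _
  set j : (A × Circle) × unitInterval → A × X := fun w => (w.1.1, γ (w.1.2, w.2)) with hj
  have hf : UniformContinuous fun w : (A × Circle) × unitInterval => w.1.1 :=
    uniformContinuous_fst.comp uniformContinuous_fst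
  have hg' : UniformContinuous fun w : (A × Circle) × unitInterval => (w.1.2, w.2) :=
    (uniformContinuous_snd.comp uniformContinuous_fst).prodMk uniformContinuous_snd
  have hg := hγ.comp hg'
  have hm : d (Germ.pull _ hg' n) = Germ.pull _ hg (Sec.hh k φ) := by
    rw [← Germ.pull_d, hdn, Germ.pull_pull]
  have hom := HH.homotopy (cls _ (hcl _ hf _ hg _ hm)) 0 1
  rw [HH.pull_cls, HH.pull_cls] at hom
  have hx0 : UniformContinuous fun x : A => x₀ := uniformContinuous_const
  have hb : d (Germ.pull (fun x : A => (x, x₀)) (uniformContinuous_id.prodMk hx0) η) = 0 := by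
    have := hcl id uniformContinuous_id (fun _ : A => x₀) hx0 0 (by
      rw [map_zero, Sec.pull_hh, Sec.hh]
      have : Coch.c1 (fun _ _ : A => φ x₀ x₀) = 0 :=
        (Coch.isHom_c1 _).ext_one (fun _ _ _ => rfl) fun _ _ => by simp [hx₀]
      rw [this, map_zero, rd_zero])
    rwa [mul_zero, sub_zero] at this
  have hξ₁ := hcl (fun x : A × Circle => x.1) uniformContinuous_fst (fun x => γ₁ x.2)
    (hγ₁u.comp uniformContinuous_snd) (Germ.pull Prod.snd uniformContinuous_snd n₁) (by
      rw [← Germ.pull_d, hdn₁, Germ.pull_pull]; rfl)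
  have hi : ∀ t : unitInterval, UniformContinuous fun x : A × Circle => (x.2, t) := fun t =>
    uniformContinuous_snd.prodMk uniformContinuous_const
  have hn0 : Germ.pull (fun x : A × Circle => (x.2, (0 : unitInterval))) (hi 0) n =
      -tauG k fun x : A × Circle => x.2 := by
    rw [hn, pull_rd, tauG, ← rd_neg (nearInt_tau uniformContinuous_snd), hN, map_sub,
      Coch.pull_d, Coch.pull_c1, Coch.pull_c0]
    have h0 : Coch.c1 (fun x y : A × Circle => φ (γ (x.2, 0)) (γ (y.2, 0))) = 0 :=
      (Coch.isHom_c1 _).ext_one (fun _ _ _ => rfl) fun _ _ => by simp [hγ0, hx₀]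
    rw [h0, zero_sub]
    congr 4
    funext x
    simp [hs0]
  have hn1 : Germ.pull (fun x : A × Circle => (x.2, (1 : unitInterval))) (hi 1) n =
      Germ.pull (fun x : A × Circle => x.2 ^ q) ((uc_circle_pow q).comp uniformContinuous_snd)
        n₁ := by
    rw [hn, hn₁, pull_rd, pull_rd, hN, hN₁, map_sub, map_sub, Coch.pull_d, Coch.pull_d,
      Coch.pull_c1, Coch.pull_c0, Coch.pull_c1, Coch.pull_c0]
    simp only [hγ1]
    congr 4
    funext x
    simp [hs1']
  have key : cls ((bar : Germ k A →+* _) a) hba = 0 := by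
    refine HH.eq_zero_of_circle hq hq0 (b := cls _ hb) (c := cls _ hξ₁) ?_
    rw [HH.pull_cls, HH.pull_cls, HH.pull_cls, tau, cls_mul, cls_add]
    refine Eq.trans ?_ (hom.trans ?_)
    · refine cls_congr ?_ _
      simp only [map_sub, map_mul, Germ.pull_pull]
      have e1 : Germ.pull ((fun w : (A × Circle) × unitInterval => (w.1.2, w.2)) ∘
          fun x => (x, 0)) (hg'.comp (uniformContinuous_id.prodMk uniformContinuous_const)) n =
          -tauG k fun x : A × Circle => x.2 := hn0
      have e2 : ((fun w : (A × Circle) × unitInterval =>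
          (w.1.1, (γ ∘ fun w : (A × Circle) × unitInterval => (w.1.2, w.2)) w)) ∘
          fun x => (x, 0)) = (fun x => (x, x₀)) ∘ Prod.fst := by
        funext x; simp [hγ0]
      rw [e1, Germ.pull_congr e2, mul_neg, sub_neg_eq_add, add_comm]
      rfl
    · refine cls_congr ?_ _
      simp only [map_sub, map_mul, Germ.pull_pull]
      have e1 : Germ.pull ((fun w : (A × Circle) × unitInterval => (w.1.2, w.2)) ∘
          fun x => (x, 1)) (hg'.comp (uniformContinuous_id.prodMk uniformContinuous_const)) n =
          Germ.pull (fun x : A × Circle => x.2 ^ q)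
            ((uc_circle_pow q).comp uniformContinuous_snd) n₁ := hn1
      have e2 : ((fun w : (A × Circle) × unitInterval =>
          (w.1.1, (γ ∘ fun w : (A × Circle) × unitInterval => (w.1.2, w.2)) w)) ∘
          fun x => (x, 1)) = (fun w : A × Circle => (w.1, γ₁ w.2)) ∘ fun x => (x.1, x.2 ^ q) := by
        funext x; simp [hγ1]
      rw [e1, Germ.pull_congr e2]
      rfl
  obtain ⟨c, hc⟩ := (cls_eq_zero_iff _).1 key
  refine (cls_eq_zero_iff _).2 ⟨-(bar : Germ k A →+* _) c, ?_⟩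
  rw [map_neg, d_bar, neg_neg, hc, bar_bar]

end Circle

end

section

open Uniformity DGRing

theorem DGRing.d_sum_eq_zero {R ι : Type*} [DGRing R] (S : Finset ι) {a : ι → R}
    (ha : ∀ i, d (a i) = 0) : d (∑ i ∈ S, a i) = 0 := by
  rw [map_sum]
  exact Finset.sum_eq_zero fun i _ => ha i

theorem DGRing.cls_sum {R ι : Type*} [DGRing R] (S : Finset ι) {a : ι → R} (ha : ∀ i, d (a i) = 0) :
    ∑ i ∈ S, cls (a i) (ha i) = cls (∑ i ∈ S, a i) (d_sum_eq_zero S ha) := by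
  classical
  induction S using Finset.induction_on with
  | empty => exact (cls_congr Finset.sum_empty (d_sum_eq_zero ∅ ha)).symm
  | insert i S hi ih =>
    rw [Finset.sum_insert hi, ih, cls_add]
    exact cls_congr (Finset.sum_insert hi).symm _

section Fibre

open Coch Germ

variable {A B : Type*} [UniformSpace A] [UniformSpace B] {k : Type*} [CommRing k] {m : ℕ}

theorem Coch.integ_pull (N : ℕ) (f : B → A) (φ : Coch k (A × Circle)) :
    integ N (Coch.pull (fun x : B × Circle => (f x.1, x.2)) φ) = Coch.pull f (integ N φ) := by
  rw [integ_eq, integ_eq, map_sum]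
  refine Finset.sum_congr rfl fun i _ => ?_
  rw [map_sub, pull_prism, pull_prism, prism_pull, prism_pull]
  rfl

theorem HH.uc_base {T : Type*} [UniformSpace T] {f : B → A} (hf : UniformContinuous f) :
    UniformContinuous fun x : B × T => (f x.1, x.2) :=
  (hf.comp uniformContinuous_fst).prodMk uniformContinuous_snd

/-- Integrating a relation over the circle. -/
theorem HH.circle_rel {f : B → A} (hf : UniformContinuous f) {c e : HH k B} {u : Fin m → HH k B}
    {D : Fin m → HH k (A × Circle)}
    (h : HH.pull Prod.fst uniformContinuous_fst c * tau k (fun x : B × Circle => x.2)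
      uniformContinuous_snd + HH.pull Prod.fst uniformContinuous_fst e =
      ∑ j, HH.pull Prod.fst uniformContinuous_fst (u j) *
        HH.pull (fun x : B × Circle => (f x.1, x.2)) (HH.uc_base hf) (D j)) :
    ∃ b : Fin m → HH k A, c = ∑ j, u j * HH.pull f hf (b j) := by
  obtain ⟨c, hc, rfl⟩ := cls_surj c
  obtain ⟨e, he, rfl⟩ := cls_surj e
  choose u' hu' hu using fun j => cls_surj (u j)
  choose D' hD' hD using fun j => cls_surj (D j)
  obtain rfl := funext hu
  obtain rfl := funext hD
  obtain ⟨γ, rfl⟩ := mk_surj c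
  obtain ⟨η, rfl⟩ := mk_surj e
  choose υ hυ using fun j => mk_surj (u' j)
  choose δ hδ using fun j => mk_surj (D' j)
  obtain rfl := funext hυ
  obtain rfl := funext hδ
  simp only [HH.pull_cls, tau, cls_mul, cls_add] at h
  rw [cls_sum, cls_eq_iff] at h
  obtain ⟨ε, hε⟩ := h
  obtain ⟨ε, rfl⟩ := mk_surj ε
  simp only [tauG, rd, pull_mk, d_mk, ← map_mul, ← map_add, ← map_sum, ← map_sub] at hε
  rw [mk_eq_mk] at hε
  simp only [d_mk, mk_eq_zero] at hD'
  obtain ⟨N₀, hN⟩ := Coch.integ_mem_Loc hε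
  choose N₁ hN₁ using fun j => Coch.integ_mem_Loc (hD' j)
  set N := max (max N₀ 3) (Finset.univ.sup N₁) with hNd
  have hN0 : N ≠ 0 := by
    have : 3 ≤ N := (le_max_right _ _).trans (le_max_left _ _)
    omega
  have h1 := hN N ((le_max_left _ _).trans (le_max_left _ _))
  have h2 : ∀ j, d (Germ.mk (k := k) (Coch.bar (Coch.integ N (δ j)))) = 0 := fun j => by
    have := hN₁ j N ((Finset.le_sup (Finset.mem_univ j)).trans (le_max_right _ _))
    rw [← mk_eq_zero] at this
    rw [d_mk, Coch.d_bar, map_neg, ← bar_mk,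
      Coch.d_integ hN0, map_neg, this, neg_zero, map_zero, neg_zero]
  refine ⟨fun j => -cls _ (h2 j), ?_⟩
  simp only [map_neg, HH.pull_cls, mul_neg, cls_mul]
  rw [Finset.sum_neg_distrib, eq_neg_iff_add_eq_zero, cls_sum, cls_add, cls_eq_zero_iff]
  refine ⟨Germ.mk (-Coch.bar (Coch.integ N ε)), ?_⟩
  have e1 : Coch.integ N (Coch.d ε) = -Coch.d (Coch.integ N ε) := by
    rw [Coch.d_integ hN0, neg_neg]
  simp only [map_sub, map_add, map_sum, Coch.integ_fst_mul hN0, Coch.integ_pull, e1,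
    Coch.integ_fst hN0, Coch.integ_tau ((le_max_right _ _).trans (le_max_left _ _) : 3 ≤ N)] at h1
  rw [← mk_eq_mk] at h1
  have h3 := congrArg (bar : Germ k B →+* _) h1
  simp only [map_sub, map_add, map_sum, map_mul, bar_mk, Coch.bar_bar, map_neg, map_one,
    map_zero] at h3
  simp only [pull_mk, d_mk, Coch.d_bar, map_neg, neg_neg, Coch.pull_bar]
  rw [← neg_inj, h3]
  simp only [mul_neg, mul_one]
  abel

end Fibre

end

section

open Uniformity DGRing

section Suspension

open Coch Germ

variable {A B X : Type*} [UniformSpace A] [UniformSpace B] [UniformSpace X] {k : Type*} [CommRing k]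
  {m : ℕ}

theorem Germ.exists_prim {α : Germ k (X × unitInterval)} (hα : d α = 0) :
    ∃ θ : Germ k (X × unitInterval),
      d θ = α - Germ.pull Prod.fst uniformContinuous_fst
        (Germ.pull (fun x => (x, (0 : unitInterval))) (HH.uc_inc 0) α) ∧
      Germ.pull (fun x => (x, (0 : unitInterval))) (HH.uc_inc 0) θ = 0 := by
  have hm : UniformContinuous fun w : (X × unitInterval) × unitInterval => (w.1.1, w.1.2 * w.2) := by
    have h : UniformContinuous fun w : unitInterval × unitInterval => w.1 * w.2 :=
      CompactSpace.uniformContinuous_of_continuous continuous_mul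
    exact (uniformContinuous_fst.comp uniformContinuous_fst).prodMk
      (h.comp ((uniformContinuous_snd.comp uniformContinuous_fst).prodMk uniformContinuous_snd))
  have hom := HH.homotopy (HH.pull _ hm (cls α hα)) 1 0
  simp only [HH.pull_cls] at hom
  rw [cls_eq_iff] at hom
  obtain ⟨θ, hθ⟩ := hom
  have hθ' : d θ = α - Germ.pull Prod.fst uniformContinuous_fst
        (Germ.pull (fun x => (x, (0 : unitInterval))) (HH.uc_inc 0) α) := by
    rw [hθ]
    congr 1
    · rw [Germ.pull_pull, Germ.pull_congr (g := id), Germ.pull_id]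
      funext x; simp
    · rw [Germ.pull_pull, Germ.pull_pull]
      refine Germ.pull_congr ?_ _ _
      funext x; simp
  have e : ∀ β : Germ k (X × unitInterval),
      Germ.pull (fun x => (x, (0 : unitInterval))) (HH.uc_inc 0)
        (Germ.pull Prod.fst uniformContinuous_fst
        (Germ.pull (fun x => (x, (0 : unitInterval))) (HH.uc_inc 0) β)) =
      Germ.pull (fun x => (x, (0 : unitInterval))) (HH.uc_inc 0) β := fun β => by
    rw [Germ.pull_pull, Germ.pull_pull]; rfl
  refine ⟨θ - Germ.pull Prod.fst uniformContinuous_fst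
    (Germ.pull (fun x => (x, (0 : unitInterval))) (HH.uc_inc 0) θ), ?_, ?_⟩
  · rw [map_sub, ← Germ.pull_d, ← Germ.pull_d, hθ', map_sub, e, sub_self, map_zero, sub_zero]
  · rw [map_sub, e, sub_self]

/-- A relation over `B × X`, where `X` carries a sphere on which the class of `φ` is a generator,
allows to divide by that class. -/
theorem HH.sphere_rel {φ : X → X → ℝ} (hφ : Phase φ) {γ : Circle × unitInterval → X}
    (hγ : UniformContinuous γ) {s : Circle × unitInterval → ℂ}
    (hs : PS (fun x y => φ (γ x) (γ y)) s) (hs1 : ∀ x, ‖s x‖ = 1)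
    {x₀ x₁ : X} (hx₀ : φ x₀ x₀ = 0) (hx₁ : φ x₁ x₁ = 0) (hγ0 : ∀ z, γ (z, 0) = x₀)
    (hγ1 : ∀ z, γ (z, 1) = x₁) (hs0 : ∀ z : Circle, s (z, 0) = z) (hs1' : ∀ z, s (z, 1) = 1)
    {f : B → A} (hf : UniformContinuous f) {c e : HH k B} {u : Fin m → HH k B}
    {C : Fin m → HH k (A × X)}
    (h : HH.pull Prod.fst uniformContinuous_fst c *
        HH.pull Prod.snd uniformContinuous_snd (cc k φ) +
        HH.pull Prod.fst uniformContinuous_fst e =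
      ∑ j, HH.pull Prod.fst uniformContinuous_fst (u j) *
        HH.pull (fun x : B × X => (f x.1, x.2)) (HH.uc_base hf) (C j)) :
    ∃ b : Fin m → HH k A, c = ∑ j, u j * HH.pull f hf (b j) := by
  obtain ⟨c, hc, rfl⟩ := cls_surj c
  obtain ⟨e, he, rfl⟩ := cls_surj e
  choose u' hu' hu using fun j => cls_surj (u j)
  choose C' hC' hC using fun j => cls_surj (C j)
  obtain rfl := funext hu
  obtain rfl := funext hC
  rw [cc_eq k hφ] at h
  simp only [HH.pull_cls, cls_mul, cls_add] at h
  rw [cls_sum, cls_eq_iff] at h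
  obtain ⟨η, hη⟩ := h
  set N := Coch.c1 (fun x y => φ (γ x) (γ y)) - Coch.d (Coch.c0 fun x => ph (s x)) with hN
  have hNn : Coch.NearInt 1 N := hs.nearInt hs1
  set n : Germ k (Circle × unitInterval) := rd k N with hn
  have hdn : d n = Germ.pull γ hγ (Sec.hh k φ) := by
    rw [hn, d_rd hNn, hN, map_sub, Coch.d_d, sub_zero, Sec.pull_hh]; rfl
  have hi : ∀ t : unitInterval, UniformContinuous fun x : B × Circle => (x.2, t) := fun t =>
    uniformContinuous_snd.prodMk uniformContinuous_const
  have hn0 : Germ.pull (fun x : B × Circle => (x.2, (0 : unitInterval))) (hi 0) n =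
      -tauG k fun x : B × Circle => x.2 := by
    rw [hn, pull_rd, tauG, ← rd_neg (nearInt_tau uniformContinuous_snd), hN, map_sub,
      Coch.pull_d, Coch.pull_c1, Coch.pull_c0]
    have h0 : Coch.c1 (fun x y : B × Circle => φ (γ (x.2, 0)) (γ (y.2, 0))) = 0 :=
      (Coch.isHom_c1 _).ext_one (fun _ _ _ => rfl) fun _ _ => by simp [hγ0, hx₀]
    rw [h0, zero_sub]
    congr 4
    funext x
    simp [hs0]
  have hn1 : Germ.pull (fun x : B × Circle => (x.2, (1 : unitInterval))) (hi 1) n = 0 := by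
    rw [hn, pull_rd, hN, map_sub, Coch.pull_d, Coch.pull_c1, Coch.pull_c0]
    have h0 : Coch.c1 (fun x y : B × Circle => φ (γ (x.2, 1)) (γ (y.2, 1))) = 0 :=
      (Coch.isHom_c1 _).ext_one (fun _ _ _ => rfl) fun _ _ => by simp [hγ1, hx₁]
    have h1 : Coch.d (Coch.c0 ((fun x => ph (s x)) ∘ fun x : B × Circle => (x.2, 1))) = 0 := by
      rw [Coch.d_c0]
      exact (Coch.isHom_c1 _).ext_one (fun _ _ _ => rfl) fun _ _ => by simp [hs1']
    rw [h0, h1, sub_zero, rd_zero]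
  have hB : UniformContinuous fun w : (B × Circle) × unitInterval => w.1.1 :=
    uniformContinuous_fst.comp uniformContinuous_fst
  have hp : UniformContinuous fun w : (B × Circle) × unitInterval => (w.1.2, w.2) :=
    (uniformContinuous_snd.comp uniformContinuous_fst).prodMk uniformContinuous_snd
  have hX := hγ.comp hp
  have hA : UniformContinuous fun w : (A × Circle) × unitInterval => w.1.1 :=
    uniformContinuous_fst.comp uniformContinuous_fst
  have hAX : UniformContinuous fun w : (A × Circle) × unitInterval => (w.1.1, γ (w.1.2, w.2)) :=
    hA.prodMk (hγ.comp ((uniformContinuous_snd.comp uniformContinuous_fst).prodMk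
      uniformContinuous_snd))
  have hfW : UniformContinuous fun w : (B × Circle) × unitInterval => ((f w.1.1, w.1.2), w.2) :=
    ((hf.comp hB).prodMk (uniformContinuous_snd.comp uniformContinuous_fst)).prodMk
      uniformContinuous_snd
  choose θ hθ hθ0 using fun j => Germ.exists_prim (k := k)
    (α := Germ.pull _ hAX (C' j)) (by rw [← Germ.pull_d, hC', map_zero])
  set cW := Germ.pull _ hB c with hcW
  set eW := Germ.pull _ hB e with heW
  set uW := fun j => Germ.pull _ hB (u' j) with huW
  set θW := fun j => Germ.pull _ hfW (θ j) with hθW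
  set xW := Germ.pull _ hX (Sec.hh k φ) with hxW
  set θx := Germ.pull _ hp n + Germ.pull Prod.fst uniformContinuous_fst
    (tauG k fun x : B × Circle => x.2) with hθx
  have hcst : ∀ {W : Type _} [UniformSpace W] (g : W → B), UniformContinuous g → ∀ y : X,
      UniformContinuous fun w => (g w, y) := fun g hg y => hg.prodMk uniformContinuous_const
  have hcst' : ∀ {W : Type _} [UniformSpace W] (g : W → A), UniformContinuous g → ∀ y : X,
      UniformContinuous fun w => (g w, y) := fun g hg y => hg.prodMk uniformContinuous_const
  have E1 : d (Germ.pull _ (hB.prodMk hX) η) = cW * xW + eW -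
      ∑ j, uW j * Germ.pull _ ((hf.comp hB).prodMk hX) (C' j) := by
    rw [← Germ.pull_d, hη]
    simp only [map_sub, map_add, map_mul, map_sum, Germ.pull_pull]
    rfl
  have hh0 : ∀ {W : Type _} [UniformSpace W],
      Germ.pull (fun _ : W => x₀) uniformContinuous_const (Sec.hh k φ) = 0 := by
    intro W _
    rw [Sec.pull_hh, Sec.hh]
    have : Coch.c1 (fun _ _ : W => φ x₀ x₀) = 0 :=
      (Coch.isHom_c1 _).ext_one (fun _ _ _ => rfl) fun _ _ => by simp [hx₀]
    rw [this, map_zero, rd_zero]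
  have E2 : d (Germ.pull _ (hcst _ hB x₀) η) = eW -
      ∑ j, uW j * Germ.pull _ (hcst' _ (hf.comp hB) x₀) (C' j) := by
    rw [← Germ.pull_d, hη]
    simp only [map_sub, map_add, map_mul, map_sum, Germ.pull_pull]
    have : Germ.pull (Prod.snd ∘ fun w : (B × Circle) × unitInterval => (w.1.1, x₀))
      (uniformContinuous_snd.comp (hcst _ hB x₀)) (Sec.hh k φ) = 0 := hh0
    rw [this, mul_zero, zero_add]
    rfl
  have E3 : d θx = xW := by
    rw [hθx, map_add, ← Germ.pull_d, ← Germ.pull_d, hdn, d_tauG k uniformContinuous_snd, map_zero,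
      add_zero, Germ.pull_pull]
  have E4 : ∀ j, d (θW j) = Germ.pull _ ((hf.comp hB).prodMk hX) (C' j) -
      Germ.pull _ (hcst' _ (hf.comp hB) x₀) (C' j) := by
    intro j
    rw [hθW, ← Germ.pull_d, hθ, map_sub, Germ.pull_pull, Germ.pull_pull, Germ.pull_pull,
      Germ.pull_pull]
    congr 1
    refine Germ.pull_congr ?_ _ _
    funext w; simp [hγ0]
  have hdc : d cW = 0 := by rw [hcW, ← Germ.pull_d, hc, map_zero]
  have hdu : ∀ j, d (uW j) = 0 := fun j => by rw [huW, ← Germ.pull_d, hu', map_zero]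
  set ζ := Germ.pull _ (hB.prodMk hX) η - Germ.pull _ (hcst _ hB x₀) η -
    ((bar : Germ k _ →+* _) cW * θx - ∑ j, (bar : Germ k _ →+* _) (uW j) * θW j) with hζ
  have hdζ : d ζ = 0 := by
    rw [hζ]
    simp only [map_sub, map_sum, DGRing.d_mul, DGRing.d_bar, hdc, hdu, E1, E2, E3, E4,
      DGRing.bar_bar, neg_zero,
      map_zero, zero_mul, zero_add, mul_sub, Finset.sum_sub_distrib]
    abel
  have hom := HH.homotopy (cls ζ hdζ) 1 0
  rw [HH.pull_cls, HH.pull_cls, cls_eq_iff] at hom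
  obtain ⟨ω, hω⟩ := hom
  have R0 : Germ.pull (fun x : B × Circle => (x, (0 : unitInterval))) (HH.uc_inc 0) ζ = 0 := by
    have a1 : Germ.pull (fun x : B × Circle => (x, (0 : unitInterval))) (HH.uc_inc 0)
        (Germ.pull _ (hB.prodMk hX) η) = Germ.pull (fun x : B × Circle => (x, (0 : unitInterval)))
        (HH.uc_inc 0) (Germ.pull _ (hcst _ hB x₀) η) := by
      rw [Germ.pull_pull, Germ.pull_pull]
      refine Germ.pull_congr ?_ _ _
      funext x; simp [hγ0]
    have a2 : Germ.pull (fun x : B × Circle => (x, (0 : unitInterval))) (HH.uc_inc 0) θx = 0 := by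
      rw [hθx, map_add, Germ.pull_pull, Germ.pull_pull]
      have := hn0
      change Germ.pull _ _ n + Germ.pull id _ _ = 0
      rw [Germ.pull_id]
      exact (congrArg (· + _) hn0).trans (neg_add_cancel _)
    have a3 : ∀ j, Germ.pull (fun x : B × Circle => (x, (0 : unitInterval))) (HH.uc_inc 0)
        (θW j) = 0 := fun j => by
      have : Germ.pull (fun x : B × Circle => (f x.1, x.2)) (HH.uc_base hf)
        (Germ.pull (fun x => (x, (0 : unitInterval))) (HH.uc_inc 0) (θ j)) = 0 := by
        rw [hθ0, map_zero]
      rw [Germ.pull_pull] at this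
      rw [hθW, Germ.pull_pull]
      exact this
    rw [hζ]
    simp only [map_sub, map_sum, map_mul, a1, a2, a3, mul_zero, sub_self, Finset.sum_const_zero]
  have hη1 : UniformContinuous fun x : B => (x, x₁) := hcst id uniformContinuous_id x₁
  have hη0 : UniformContinuous fun x : B => (x, x₀) := hcst id uniformContinuous_id x₀
  have R1 : Germ.pull (fun x : B × Circle => (x, (1 : unitInterval))) (HH.uc_inc 1) ζ =
      Germ.pull Prod.fst uniformContinuous_fst (Germ.pull _ hη1 η - Germ.pull _ hη0 η) -
      (Germ.pull Prod.fst uniformContinuous_fst ((bar : Germ k _ →+* _) c) *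
        (tauG k fun x : B × Circle => x.2) -
        ∑ j, Germ.pull Prod.fst uniformContinuous_fst ((bar : Germ k _ →+* _) (u' j)) *
        Germ.pull (fun x : B × Circle => (f x.1, x.2)) (HH.uc_base hf)
        (Germ.pull (fun x => (x, (1 : unitInterval))) (HH.uc_inc 1) (θ j))) := by
    have a1 : Germ.pull (fun x : B × Circle => (x, (1 : unitInterval))) (HH.uc_inc 1)
        (Germ.pull _ (hB.prodMk hX) η) =
        Germ.pull Prod.fst uniformContinuous_fst (Germ.pull _ hη1 η) := by
      rw [Germ.pull_pull, Germ.pull_pull]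
      refine Germ.pull_congr ?_ _ _
      funext x; simp [hγ1]
    have a2 : Germ.pull (fun x : B × Circle => (x, (1 : unitInterval))) (HH.uc_inc 1) θx =
        tauG k fun x : B × Circle => x.2 := by
      rw [hθx, map_add, Germ.pull_pull, Germ.pull_pull]
      change Germ.pull _ _ n + Germ.pull id _ _ = _
      rw [Germ.pull_id]
      exact (congrArg (· + _) hn1).trans (zero_add _)
    rw [hζ]
    simp only [map_sub, map_sum, map_mul, a1, a2]
    simp only [hcW, huW, hθW, Germ.pull_bar, Germ.pull_pull]
    rfl
  have hA1 : UniformContinuous fun a : A => ((a, (1 : Circle)), (1 : unitInterval)) :=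
    (uniformContinuous_id.prodMk uniformContinuous_const).prodMk uniformContinuous_const
  set ε := fun j => Germ.pull _ hA1 (θ j) with hε
  have hdθ1 : ∀ j, d (Germ.pull (fun x => (x, (1 : unitInterval))) (HH.uc_inc 1) (θ j)) =
      Germ.pull Prod.fst uniformContinuous_fst (Germ.pull _ (HH.uc_inc x₁) (C' j)
       - Germ.pull _ (HH.uc_inc x₀) (C' j)) := fun j => by
    rw [← Germ.pull_d, hθ]
    simp only [map_sub, Germ.pull_pull]
    congr 1
    · refine Germ.pull_congr ?_ _ _
      funext x; simp [hγ1]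
    · refine Germ.pull_congr ?_ _ _
      funext x; simp [hγ0]
  have hdε : ∀ j, d (ε j) = Germ.pull _ (HH.uc_inc x₁) (C' j)
       - Germ.pull _ (HH.uc_inc x₀) (C' j) := fun j => by
    have := congrArg (Germ.pull (fun a : A => (a, (1 : Circle))) (HH.uc_inc 1)) (hdθ1 j)
    rw [Germ.pull_d, Germ.pull_pull, Germ.pull_pull] at this
    refine Eq.trans this ?_
    change Germ.pull id _ _ = _
    rw [Germ.pull_id]
  set D := fun j => Germ.pull (fun x => (x, (1 : unitInterval))) (HH.uc_inc 1) (θ j) -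
    Germ.pull Prod.fst uniformContinuous_fst (ε j) with hDd
  have hdD : ∀ j, d (D j) = 0 := fun j => by
    rw [hDd, map_sub, hdθ1, ← Germ.pull_d, hdε, sub_self]
  set η' := Germ.pull _ hη1 η - Germ.pull _ hη0 η +
    ∑ j, (bar : Germ k _ →+* _) (u' j) * Germ.pull f hf (ε j) with hη'
  have F : ∀ x : X, φ x x = 0 → ∀ hx : UniformContinuous fun b : B => (b, x),
      d (Germ.pull _ hx η) = e - ∑ j, u' j * Germ.pull f hf
        (Germ.pull _ (HH.uc_inc x) (C' j)) := by
    intro x hx hxu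
    have hh0 : Germ.pull (fun _ : B => x) uniformContinuous_const (Sec.hh k φ) = 0 := by
      rw [Sec.pull_hh, Sec.hh]
      have : Coch.c1 (fun _ _ : B => φ x x) = 0 :=
        (Coch.isHom_c1 _).ext_one (fun _ _ _ => rfl) fun _ _ => by simp [hx]
      rw [this, map_zero, rd_zero]
    rw [← Germ.pull_d, hη]
    simp only [map_sub, map_add, map_mul, map_sum, Germ.pull_pull]
    have t1 : Germ.pull (Prod.snd ∘ fun b : B => (b, x))
      (uniformContinuous_snd.comp hxu) (Sec.hh k φ) = 0 := hh0
    have t2 : ∀ a : Germ k B, Germ.pull (Prod.fst ∘ fun b : B => (b, x))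
      (uniformContinuous_fst.comp hxu) a = a := fun a => Germ.pull_id a
    simp only [t1, mul_zero, zero_add, t2]
    rfl
  have hdη' : d η' = 0 := by
    rw [hη']
    simp only [map_add, map_sub, map_sum, F x₀ hx₀, F x₁ hx₁, DGRing.d_mul, DGRing.d_bar, hu',
      DGRing.bar_bar, neg_zero, map_zero, zero_mul, zero_add, ← Germ.pull_d, hdε, mul_sub,
      Finset.sum_sub_distrib]
    abel
  have key := HH.circle_rel (k := k) (m := m) hf (c := cls _ (d_bar_eq_zero hc)) (e := -cls η' hdη')
    (u := fun j => cls _ (d_bar_eq_zero (hu' j))) (D := fun j => cls _ (hdD j)) (by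
      simp only [HH.pull_cls, tau, cls_mul, cls_neg, cls_add, map_neg]
      rw [cls_sum, cls_eq_iff]
      refine ⟨-ω, ?_⟩
      rw [map_neg, hω, R0, R1, hη', hDd]
      simp only [map_sub, map_add, map_sum, map_mul, mul_sub, Finset.sum_sub_distrib,
        Germ.pull_pull]
      have : ∀ j, Germ.pull (f ∘ Prod.fst) (hf.comp uniformContinuous_fst) (ε j) =
        Germ.pull (Prod.fst ∘ fun x : B × Circle => (f x.1, x.2))
          (uniformContinuous_fst.comp (HH.uc_base hf)) (ε j) := fun j => rfl
      simp only [this]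
      abel)
  obtain ⟨b, hb⟩ := key
  choose b' hb' hbb using fun j => cls_surj (b j)
  obtain rfl := funext hbb
  refine ⟨fun j => cls _ (d_bar_eq_zero (hb' j)), ?_⟩
  simp only [HH.pull_cls, cls_mul] at hb ⊢
  rw [cls_sum, cls_eq_iff] at hb ⊢
  obtain ⟨κ, hκ⟩ := hb
  refine ⟨-(bar : Germ k _ →+* _) κ, ?_⟩
  rw [map_neg, DGRing.d_bar, neg_neg, hκ]
  simp only [map_sub, map_sum, map_mul, DGRing.bar_bar, Germ.pull_bar]

end Suspension

end

section

open Uniformity DGRing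

/-- Unit vectors; the uniformity only sees the lines they span. -/
structure PVec (n : ℕ) where
  v : Fin n → ℂ
  norm_sq : ∑ i, ‖v i‖ ^ 2 = 1

noncomputable instance (n : ℕ) : UniformSpace (PVec n) :=
  UniformSpace.comap (fun w i j => w.v i * star (w.v j))
    (inferInstanceAs (UniformSpace (Fin n → Fin n → ℂ)))

section

variable {B C : Type*} [UniformSpace B] [UniformSpace C] {n : ℕ} {φ ψ : B → B → ℝ}

theorem PVec.uc_iff {f : B → PVec n} :
    UniformContinuous f ↔ ∀ i j, UniformContinuous fun x => (f x).v i * star ((f x).v j) := by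
  have h : IsUniformInducing fun (w : PVec n) i j => w.v i * star (w.v j) := ⟨rfl⟩
  rw [h.uniformContinuous_iff]
  simp only [uniformContinuous_pi]
  rfl

theorem PVec.ext {x y : PVec n} (h : x.v = y.v) : x = y := by
  cases x; cases y; simp_all

theorem PVec.uc_entry (i j : Fin n) : UniformContinuous fun x : PVec n => x.v i * star (x.v j) :=
  PVec.uc_iff.1 uniformContinuous_id i j

/-- The transition phases of the tautological line bundle. -/
noncomputable def pph (n : ℕ) : PVec n → PVec n → ℝ := lph PVec.v

theorem pph_self (x : PVec n) : pph n x x = 0 := by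
  rw [pph, lph, sum_mul_star x.norm_sq]
  simp [ph]

theorem PVec.ps (i : Fin n) : PS (pph n) fun x => x.v i :=
  lph_ps one_pos PVec.norm_sq PVec.uc_entry i

/-- Vector valued sections of a line bundle whose norm is bounded below. -/
structure VSec (φ : B → B → ℝ) (s : B → Fin n → ℂ) : Prop where
  ps : ∀ i, PS φ fun x => s x i
  low : ∃ c > 0, ∀ x, c ≤ ∑ i, ‖s x i‖ ^ 2

theorem VSec.sec {s : B → Fin n → ℂ} (h : VSec φ s) : Sec φ s :=
  PS.sec h.ps (let ⟨_, hc, H⟩ := h.low; PS.exists_big hc H)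

theorem VSec.comap {s : B → Fin n → ℂ} (h : VSec φ s) {f : C → B} (hf : UniformContinuous f) :
    VSec (fun x y => φ (f x) (f y)) fun x => s (f x) where
  ps i := (h.ps i).comap hf
  low := let ⟨c, hc, H⟩ := h.low; ⟨c, hc, fun _ => H _⟩

theorem PVec.vsec : VSec (pph n) PVec.v where
  ps := PVec.ps
  low := ⟨1, one_pos, fun x => x.norm_sq.ge⟩

theorem PVec.phase : Phase (pph n) := PVec.vsec.sec.phase

/-- The generator of the cohomology of projective space. -/
noncomputable def hP (k : Type*) [CommRing k] (n : ℕ) : HH k (PVec n) := cc k (pph n)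

theorem hP_pow (k : Type*) [CommRing k] (n : ℕ) : hP k n ^ n = 0 := cc_pow_eq_zero k PVec.vsec.sec

theorem uc_comp_Icc {u : B → ℝ} (hu : UniformContinuous u) {F : ℝ → ℝ} {c C : ℝ}
    (hF : ContinuousOn F (Set.Icc c C)) (h : ∀ x, u x ∈ Set.Icc c C) :
    UniformContinuous fun x => F (u x) := by
  have h1 := isCompact_Icc.uniformContinuousOn_of_continuous hF
  rw [uniformContinuousOn_iff_restrict] at h1
  exact h1.comp (hu.subtype_mk h)

/-- The normalised section. -/
noncomputable def VSec.map {s : B → Fin n → ℂ} (h : VSec φ s) (x : B) : PVec n where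
  v i := ((√(∑ i, ‖s x i‖ ^ 2))⁻¹ : ℝ) * s x i
  norm_sq := by
    obtain ⟨c, hc, H⟩ := h.low
    have := hc.trans_le (H x)
    simp_rw [norm_mul, mul_pow, ← Finset.mul_sum, Complex.norm_real, Real.norm_eq_abs, sq_abs,
      inv_pow]
    rw [Real.sq_sqrt this.le, inv_mul_cancel₀ this.ne']

theorem VSec.map_v_of_unit {s : B → Fin n → ℂ} (h : VSec φ s) (x : B) (hx : ∑ i, ‖s x i‖ ^ 2 = 1) :
    (h.map x).v = s x := by
  funext i
  simp [VSec.map, hx]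

theorem VSec.map_ps {s : B → Fin n → ℂ} (h : VSec φ s) (i : Fin n) :
    PS φ fun x => (h.map x).v i := by
  obtain ⟨c, hc, H⟩ := h.low
  choose C hC using fun i => (h.ps i).bdd
  have h1 : UniformContinuous fun x => (√(∑ i, ‖s x i‖ ^ 2))⁻¹ := by
    refine uc_comp_Icc (F := fun t => (√t)⁻¹) (c := c) (C := ∑ i, C i ^ 2) (PS.normSq h.ps) ?_
      fun x => ⟨H x, Finset.sum_le_sum fun i _ => ?_⟩
    · refine ContinuousOn.inv₀ Real.continuous_sqrt.continuousOn fun t ht => ?_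
      exact (Real.sqrt_pos.2 (hc.trans_le ht.1)).ne'
    · have := hC i x
      gcongr
  refine PS.uc_mul (PS.of_uc (Complex.isometry_ofReal.uniformContinuous.comp h1) ⟨(√c)⁻¹, fun x => ?_⟩)
    (h.ps i)
  simp only [Complex.norm_real, Real.norm_eq_abs, abs_inv]
  rw [abs_of_nonneg (Real.sqrt_nonneg _)]
  have := Real.sqrt_pos.2 hc
  gcongr
  exact H x

theorem VSec.map_uc {s : B → Fin n → ℂ} (h : VSec φ s) : UniformContinuous h.map :=
  PVec.uc_iff.2 fun i j => ((h.map_ps i).mul (h.map_ps j).conj).uc' fun _ _ => add_neg_cancel _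

theorem VSec.pull_hP (k : Type*) [CommRing k] {s : B → Fin n → ℂ} (h : VSec φ s) :
    HH.pull h.map h.map_uc (hP k n) = cc k φ := by
  rw [hP, pull_cc k PVec.phase]
  have h1 : VSec φ fun x => (h.map x).v := ⟨h.map_ps, 1, one_pos, fun x => (h.map x).norm_sq.ge⟩
  exact cc_eq_of_sec k h1.sec (PVec.vsec.comap h.map_uc).sec

/-- The unit sphere. -/
def usphere (n : ℕ) : Set (Fin n → ℂ) := {v | ∑ i, ‖v i‖ ^ 2 = 1}

theorem isCompact_usphere (n : ℕ) : IsCompact (usphere n) := by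
  refine Metric.isCompact_of_isClosed_isBounded (isClosed_eq (by fun_prop) continuous_const) ?_
  refine (Metric.isBounded_iff_subset_closedBall 0).2 ⟨2, fun v hv => ?_⟩
  rw [mem_closedBall_zero_iff, pi_norm_le_iff_of_nonneg (by norm_num)]
  intro i
  have := norm_le_of_sum_sq hv i
  linarith

theorem usphere_low {m : ℕ} {F : (Fin m → ℂ) × (Fin n → ℂ) → ℝ} (hF : Continuous F)
    (h : ∀ v ∈ usphere m, ∀ w ∈ usphere n, 0 < F (v, w)) :
    ∃ c > 0, ∀ v : PVec m, ∀ w : PVec n, c ≤ F (v.v, w.v) := by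
  obtain ⟨c, hc, H⟩ := ((isCompact_usphere m).prod (isCompact_usphere n)).exists_forall_le'
    hF.continuousOn (a := 0) fun x hx => h _ hx.1 _ hx.2
  exact ⟨c, hc, fun v w => H (v.v, w.v) ⟨v.norm_sq, w.norm_sq⟩⟩

end

end

section

open Uniformity DGRing

theorem UniformContinuous.of_eq {X Y : Type*} [UniformSpace X] [UniformSpace Y] {f g : X → Y}
    (h : UniformContinuous f) (H : ∀ x, f x = g x) : UniformContinuous g := by
  rwa [← funext H]

section Sphere

/-- The unit vector `(λ̄ cos (πt/2), sin (πt/2))`. -/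
noncomputable def cylVec (x : Circle × unitInterval) : Fin 2 → ℂ :=
  ![star (x.1 : ℂ) * (Real.cos (Real.pi * x.2 / 2) : ℝ), (Real.sin (Real.pi * x.2 / 2) : ℝ)]

theorem cylVec_norm (x : Circle × unitInterval) : ∑ i, ‖cylVec x i‖ ^ 2 = 1 := by
  simp only [cylVec, Fin.sum_univ_two, Matrix.cons_val_zero, Matrix.cons_val_one, norm_mul,
    norm_star, Circle.norm_coe, one_mul, Complex.norm_real, Real.norm_eq_abs, sq_abs]
  exact Real.cos_sq_add_sin_sq _

theorem cylVec_continuous (i : Fin 2) : Continuous fun x => cylVec x i := by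
  fin_cases i
  · exact (continuous_star.comp (continuous_subtype_val.comp continuous_fst)).mul
      (Complex.continuous_ofReal.comp (Real.continuous_cos.comp (by fun_prop)))
  · exact Complex.continuous_ofReal.comp (Real.continuous_sin.comp (by fun_prop))

open Classical in
/-- The trivialisation of the tautological bundle over the cylinder. -/
noncomputable def cylSec (x : Circle × unitInterval) : ℂ := if x.2 = 0 then (x.1 : ℂ) else 1

theorem norm_cylSec (x : Circle × unitInterval) : ‖cylSec x‖ = 1 := by
  unfold cylSec
  split_ifs
  · exact Circle.norm_coe _
  · exact norm_one

theorem cylSec_zero (z : Circle) : cylSec (z, 0) = z := by simp [cylSec]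

theorem cylSec_one (z : Circle) : cylSec (z, 1) = 1 := by simp [cylSec]

/-- The two-sphere as a quotient of the cylinder. -/
noncomputable def cylMap (x : Circle × unitInterval) : PVec 2 where
  v i := cylSec x * cylVec x i
  norm_sq := by simp_rw [norm_mul, norm_cylSec, one_mul, cylVec_norm]

theorem cylMap_uc : UniformContinuous cylMap := by
  refine PVec.uc_iff.2 fun i j => ?_
  have h : Continuous fun x : Circle × unitInterval => cylVec x i * star (cylVec x j) :=
    (cylVec_continuous i).mul (continuous_star.comp (cylVec_continuous j))
  have h1 := CompactSpace.uniformContinuous_of_continuous h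
  refine h1.of_eq fun x => ?_
  have : cylSec x * star (cylSec x) = 1 := by
    rw [Complex.star_def, Complex.mul_conj, Complex.normSq_eq_norm_sq, norm_cylSec]
    simp
  simp only [cylMap, star_mul']
  linear_combination (-cylVec x i * star (cylVec x j)) * this

theorem cylSec_ps : PS (fun x y => pph 2 (cylMap x) (cylMap y)) cylSec := by
  have h : PS (fun x y => pph 2 (cylMap x) (cylMap y)) fun x =>
      ∑ i, (cylMap x).v i * star (cylVec x i) := by
    refine PS.sum _ fun i _ => ((PVec.ps i).comap cylMap_uc).mul_uc
      (PS.of_uc (f := fun x => star (cylVec x i)) (CompactSpace.uniformContinuous_of_continuous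
        (continuous_star.comp (cylVec_continuous i))) ⟨2, fun x => ?_⟩)
    have := norm_le_of_sum_sq (cylVec_norm x) i
    rw [norm_star]
    linarith
  refine h.congr_fun fun x => ?_
  simp only [cylMap, mul_assoc]
  rw [← Finset.mul_sum, sum_mul_star (cylVec_norm x)]
  simp

theorem cylMap_zero (z : Circle) : cylMap (z, 0) = cylMap (1, 0) := by
  refine PVec.ext (funext fun i => ?_)
  have : (z : ℂ) * star (z : ℂ) = 1 := by
    rw [Complex.star_def, Complex.mul_conj, Complex.normSq_eq_norm_sq, Circle.norm_coe]
    simp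
  fin_cases i
  · simpa [cylMap, cylSec, cylVec] using this
  · simp [cylMap, cylSec, cylVec]

theorem cylMap_one (z : Circle) : cylMap (z, 1) = cylMap (1, 1) := by
  refine PVec.ext (funext fun i => ?_)
  fin_cases i <;> simp [cylMap, cylSec, cylVec]

variable {A B : Type*} [UniformSpace A] [UniformSpace B] {k : Type*} [CommRing k] {m : ℕ}

theorem HH.rel_P2 {f : B → A} (hf : UniformContinuous f) {c e : HH k B} {u : Fin m → HH k B}
    {C : Fin m → HH k (A × PVec 2)}
    (h : HH.pull Prod.fst uniformContinuous_fst c *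
        HH.pull Prod.snd uniformContinuous_snd (hP k 2) +
        HH.pull Prod.fst uniformContinuous_fst e =
      ∑ j, HH.pull Prod.fst uniformContinuous_fst (u j) *
        HH.pull (fun x : B × PVec 2 => (f x.1, x.2)) (HH.uc_base hf) (C j)) :
    ∃ b : Fin m → HH k A, c = ∑ j, u j * HH.pull f hf (b j) :=
  HH.sphere_rel PVec.phase cylMap_uc cylSec_ps norm_cylSec (pph_self _) (pph_self _)
    cylMap_zero cylMap_one cylSec_zero cylSec_one hf h

theorem HH.eq_zero_of_mul_hP2 {c : HH k A} (h : HH.pull Prod.fst uniformContinuous_fst c *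
    HH.pull (Prod.snd : A × PVec 2 → _) uniformContinuous_snd (hP k 2) = 0) : c = 0 := by
  obtain ⟨b, hb⟩ := HH.rel_P2 (m := 0) (u := fun j => j.elim0) (C := fun j => j.elim0) (e := 0)
    uniformContinuous_id (by simpa using h)
  simpa using hb

end Sphere

end

section

open Uniformity DGRing

section CastInv

variable {k X A B C : Type*} [CommRing k] [UniformSpace X] [UniformSpace A] [UniformSpace B]
  [UniformSpace C]

theorem HH.natCast_eq (X : Type*) [UniformSpace X] {i j : ℕ} (h : (i : k) = j) :
    (i : HH k X) = j := by
  have e : (i : Germ k X) = j := by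
    have : (i : Coch k X) = j := by
      rw [← nsmul_one, ← nsmul_one, ← Nat.cast_smul_eq_nsmul k, ← Nat.cast_smul_eq_nsmul k, h]
    rw [← map_natCast Germ.mk, this, map_natCast]
  exact congrArg (Ideal.Quotient.mk (coboundaries (Germ k X)))
    (show (i : cocycles (Germ k X)) = j from Subtype.ext (by push_cast; exact e))

/-- The natural number `n` is invertible in `k`, with a natural number as inverse. -/
def NInv (k : Type*) [CommRing k] (n : ℕ) : Prop := ∃ m : ℕ, ((m * n : ℕ) : k) = 1

theorem NInv.exists_inv {n : ℕ} (h : NInv k n) : ∃ m : ℕ, ∀ {X : Type*} [UniformSpace X],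
    (m : HH k X) * n = 1 := by
  obtain ⟨m, hm⟩ := h
  refine ⟨m, fun {X} _ => ?_⟩
  rw [← Nat.cast_mul, HH.natCast_eq X (j := 1) (by simpa using hm), Nat.cast_one]

theorem NInv.cancel {n : ℕ} (h : NInv k n) {a : HH k X} (ha : n * a = 0) : a = 0 := by
  obtain ⟨m, hm⟩ := h.exists_inv
  rw [← one_mul a, ← hm, mul_assoc, ha, mul_zero]

/-- Pullback along the first projection. -/
abbrev HH.fst : HH k A →+* HH k (A × B) := HH.pull Prod.fst uniformContinuous_fst

/-- Pullback along the second projection. -/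
abbrev HH.snd : HH k B →+* HH k (A × B) := HH.pull Prod.snd uniformContinuous_snd

/-- The class of a map to projective space. -/
noncomputable def hL (k : Type*) [CommRing k] {n : ℕ} (f : A → PVec n) (hf : UniformContinuous f) :
    HH k A := HH.pull f hf (hP k n)

variable {n : ℕ}

theorem hL_eq (k : Type*) [CommRing k] (f : A → PVec n) (hf : UniformContinuous f) :
    hL k f hf = cc k fun x y => pph n (f x) (f y) := pull_cc k PVec.phase hf

theorem hL_commute (f : A → PVec n) (hf : UniformContinuous f) (a : HH k A) :
    Commute (hL k f hf) a := by
  rw [hL_eq]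
  exact cc_commute k _ a

theorem pull_hL {f : A → PVec n} (hf : UniformContinuous f) {g : C → A} (hg : UniformContinuous g) :
    HH.pull g hg (hL k f hf) = hL k (fun x => f (g x)) (hf.comp hg) := HH.pull_pull _ _ _ _ _

theorem VSec.hL_map {φ : B → B → ℝ} {s : B → Fin n → ℂ} (h : VSec φ s) :
    hL k h.map h.map_uc = cc k φ := h.pull_hP k

theorem add_pow_of_sq_zero {R : Type*} [Ring R] {x h : R} (hx : x ^ 2 = 0) (c : Commute x h) (m : ℕ) :
    (x + h) ^ (m + 1) = h ^ (m + 1) + (m + 1 : ℕ) * (x * h ^ m) := by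
  have h1 : x * x = 0 := by rw [← sq, hx]
  induction m with
  | zero => simp [add_comm]
  | succ m ih =>
    rw [pow_succ', ih]
    have e : x * h ^ (m + 1) = h * (x * h ^ m) := by
      rw [← mul_assoc, ← c.eq, mul_assoc, ← pow_succ']
    have e1 : x * (((m + 1 : ℕ) : R) * (x * h ^ m)) = 0 := by
      rw [← mul_assoc, ← (Nat.cast_commute (m + 1) x).eq, mul_assoc, ← mul_assoc x, h1, zero_mul,
        mul_zero]
    have e2 : h * (((m + 1 : ℕ) : R) * (x * h ^ m)) = ((m + 1 : ℕ) : R) * (x * h ^ (m + 1)) := by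
      rw [e, ← mul_assoc, ← (Nat.cast_commute (m + 1) h).eq, mul_assoc]
    rw [add_mul, mul_add, mul_add, e1, e2, ← pow_succ' h]
    push_cast
    simp only [add_mul, one_mul]
    abel

end CastInv

section PolyMul

variable {A : Type*} [UniformSpace A] {k : Type*} [CommRing k] {n : ℕ}

/-- Multiplication of the polynomial with coefficients `V` by a linear polynomial. -/
noncomputable def polyMul (w : Fin 2 → ℂ) (V : Fin n → ℂ) (i : Fin (n + 1)) : ℂ :=
  w 0 * (Fin.snoc V 0 : Fin (n + 1) → ℂ) i + w 1 * (Fin.cons 0 V : Fin (n + 1) → ℂ) i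

theorem PS.snoc {B : Type*} [UniformSpace B] {φ : B → B → ℝ} {V : B → Fin n → ℂ}
    (h : ∀ i, PS φ fun x => V x i) (i : Fin (n + 1)) :
    PS φ fun x => (Fin.snoc (V x) 0 : Fin (n + 1) → ℂ) i := by
  induction i using Fin.lastCases with
  | last => simpa using PS.zero
  | cast i => simpa using h i

theorem PS.cons {B : Type*} [UniformSpace B] {φ : B → B → ℝ} {V : B → Fin n → ℂ}
    (h : ∀ i, PS φ fun x => V x i) (i : Fin (n + 1)) :
    PS φ fun x => (Fin.cons 0 (V x) : Fin (n + 1) → ℂ) i := by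
  induction i using Fin.cases with
  | zero => simpa using PS.zero
  | succ i => simpa using h i

theorem polyMul_ps {B : Type*} [UniformSpace B] {φ ψ : B → B → ℝ} {w : B → Fin 2 → ℂ}
    {V : B → Fin n → ℂ} (hw : ∀ i, PS φ fun x => w x i) (h : ∀ i, PS ψ fun x => V x i)
    (i : Fin (n + 1)) : PS (fun x y => φ x y + ψ x y) fun x => polyMul (w x) (V x) i :=
  ((hw 0).mul (PS.snoc h i)).add ((hw 1).mul (PS.cons h i))

theorem polyMul_ne_zero {w : Fin 2 → ℂ} {V : Fin n → ℂ} (hw : w ≠ 0) (hV : V ≠ 0) :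
    polyMul w V ≠ 0 := by
  intro h
  apply hV
  have hs : ∀ i : Fin n, w 0 * V i + w 1 * (Fin.cons 0 V : Fin (n + 1) → ℂ) i.castSucc = 0 :=
    fun i => by simpa [polyMul] using congrFun h i.castSucc
  have hc : ∀ i : Fin n, w 0 * (Fin.snoc V 0 : Fin (n + 1) → ℂ) i.succ + w 1 * V i = 0 :=
    fun i => by simpa [polyMul] using congrFun h i.succ
  by_cases h0 : w 0 = 0
  · have h1 : w 1 ≠ 0 := fun h1 => hw (funext (Fin.forall_fin_two.2 ⟨h0, h1⟩))
    funext i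
    simpa [h0, h1] using hc i
  · have key : ∀ i : Fin (n + 1), (Fin.cons 0 V : Fin (n + 1) → ℂ) i = 0 := by
      intro i
      induction i using Fin.induction with
      | zero => simp
      | succ i ih => simpa [ih, h0] using hs i
    funext i
    simpa using key i.succ

theorem polyMul_low : ∃ c > 0, ∀ (w : PVec 2) (V : PVec n), c ≤ ∑ i, ‖polyMul w.v V.v i‖ ^ 2 := by
  refine usphere_low (F := fun x => ∑ i, ‖polyMul x.1 x.2 i‖ ^ 2) ?_ fun w hw V hV => ?_
  · refine continuous_finsetSum _ fun i _ => ?_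
    have h1 : Continuous fun x : (Fin 2 → ℂ) × (Fin n → ℂ) => (Fin.snoc x.2 0 : Fin (n + 1) → ℂ) i := by
      induction i using Fin.lastCases with
      | last => simpa using continuous_const
      | cast i => simp only [Fin.snoc_castSucc]; fun_prop
    have h2 : Continuous fun x : (Fin 2 → ℂ) × (Fin n → ℂ) => (Fin.cons 0 x.2 : Fin (n + 1) → ℂ) i := by
      induction i using Fin.cases with
      | zero => simpa using continuous_const
      | succ i => simp only [Fin.cons_succ]; fun_prop
    unfold polyMul
    fun_prop
  · have hne : polyMul w V ≠ 0 := polyMul_ne_zero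
      (by rintro rfl; simp [usphere] at hw) (by rintro rfl; simp [usphere] at hV)
    obtain ⟨i, hi⟩ := Function.ne_iff.1 hne
    exact Finset.sum_pos' (fun i _ => by positivity) ⟨i, Finset.mem_univ _, pow_pos (norm_pos_iff.2 hi) 2⟩

theorem polyMul_vsec : VSec (fun x y : PVec 2 × PVec n => pph 2 x.1 y.1 + pph n x.2 y.2)
    fun x => polyMul x.1.v x.2.v where
  ps := polyMul_ps (fun i => (PVec.ps i).comap uniformContinuous_fst)
    fun i => (PVec.ps i).comap uniformContinuous_snd
  low := let ⟨c, hc, h⟩ := polyMul_low; ⟨c, hc, fun _ => h _ _⟩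

/-- Multiplication by linear polynomials, as a map of projective spaces. -/
noncomputable def muP : PVec 2 × PVec n → PVec (n + 1) := polyMul_vsec.map

theorem muP_uc : UniformContinuous (muP (n := n)) := polyMul_vsec.map_uc

theorem hL_muP (k : Type*) [CommRing k] : hL k muP (muP_uc (n := n)) =
    hL k Prod.fst uniformContinuous_fst + hL k Prod.snd uniformContinuous_snd := by
  rw [show hL k muP (muP_uc (n := n)) = _ from VSec.hL_map polyMul_vsec, hL_eq, hL_eq]
  exact cc_add k (PVec.phase.comap uniformContinuous_fst) (PVec.phase.comap uniformContinuous_snd)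

/-- The map `A × (P¹ × Pⁿ⁻¹) → A × Pⁿ`. -/
noncomputable def muA (x : (A × PVec 2) × PVec n) : A × PVec (n + 1) := (x.1.1, muP (x.1.2, x.2))

theorem muA_uc : UniformContinuous (muA (A := A) (n := n)) :=
  (uniformContinuous_fst.comp uniformContinuous_fst).prodMk
    (muP_uc.comp ((uniformContinuous_snd.comp uniformContinuous_fst).prodMk uniformContinuous_snd))

theorem pull_muA_fst (a : HH k A) : HH.pull muA muA_uc (HH.fst a : HH k (A × PVec (n + 1))) =
    HH.fst (HH.fst a) := by
  rw [HH.pull_pull, HH.pull_pull]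
  rfl

theorem pull_muA_snd : HH.pull muA muA_uc (HH.snd (hP k (n + 1)) : HH k (A × PVec (n + 1))) =
    HH.fst (HH.snd (hP k 2)) + HH.snd (hP k n) := by
  have h1 : UniformContinuous fun x : (A × PVec 2) × PVec n => (x.1.2, x.2) :=
    (uniformContinuous_snd.comp uniformContinuous_fst).prodMk uniformContinuous_snd
  have := congrArg (HH.pull _ h1) (hL_muP k (n := n))
  rw [map_add, pull_hL, pull_hL, pull_hL] at this
  rw [HH.pull_pull, HH.pull_pull]
  exact this

theorem HH.snd_hP_commute (a : HH k (A × PVec n)) : Commute (HH.snd (hP k n)) a :=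
  hL_commute _ uniformContinuous_snd a

theorem HH.eq_zero_of_mul_hP_pow : ∀ (n : ℕ) {A : Type*} [UniformSpace A]
    (_ : ∀ i, 0 < i → i ≤ n → NInv k i) {a : HH k A}
    (_ : HH.fst a * (HH.snd (hP k (n + 1)) : HH k (A × PVec (n + 1))) ^ n = 0), a = 0
  | 0, A, _, hn, a, h => by
    have h1 := congrArg (HH.pull _ (HH.uc_inc (X := A) (⟨fun _ => 1, by simp⟩ : PVec 1))) h
    rw [pow_zero, mul_one, HH.pull_pull, map_zero] at h1
    exact (HH.pull_id a).symm.trans h1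
  | n + 1, A, _, hn, a, h => by
    have h1 := congrArg (HH.pull muA muA_uc) h
    rw [map_mul, map_pow, pull_muA_fst, pull_muA_snd, map_zero, add_pow_of_sq_zero,
      ← map_pow HH.snd, hP_pow, map_zero, zero_add, ← map_natCast HH.fst, ← mul_assoc, ← mul_assoc,
      ← map_mul, ← map_mul] at h1
    · have h2 := HH.eq_zero_of_mul_hP_pow n (fun i hi hi' => hn i hi (hi'.trans n.le_succ)) h1
      rw [(Nat.commute_cast (HH.fst a : HH k (A × PVec 2)) (n + 1)).eq, mul_assoc] at h2
      exact HH.eq_zero_of_mul_hP2 ((hn (n + 1) n.succ_pos le_rfl).cancel h2)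
    · rw [← map_pow, ← map_pow, hP_pow, map_zero, map_zero]
    · exact (HH.snd_hP_commute _).symm

end PolyMul

end

section

open Uniformity DGRing

section Line

variable {A B : Type*} [UniformSpace A] [UniformSpace B] {k : Type*} [CommRing k] {n : ℕ}
  {φ : B → B → ℝ} {s s' : B → Fin n → ℂ}

theorem norm_sq_line (a b : ℂ) (t : ℝ) : ‖((1 - t : ℝ) : ℂ) * a + (t : ℝ) * b‖ ^ 2 =
    (1 - t) ^ 2 * ‖a‖ ^ 2 + t ^ 2 * ‖b‖ ^ 2 + 2 * t * (1 - t) * (b * star a).re := by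
  rw [← Complex.normSq_eq_norm_sq, ← Complex.normSq_eq_norm_sq, ← Complex.normSq_eq_norm_sq]
  simp [Complex.normSq_apply]
  ring

/-- The straight line between two sections of the same line bundle. -/
noncomputable def lineSec (s s' : B → Fin n → ℂ) (x : B × unitInterval) (i : Fin n) : ℂ :=
  ((1 - x.2 : ℝ) : ℂ) * s x.1 i + (x.2 : ℝ) * s' x.1 i

theorem VSec.lineSec_ps (S : VSec φ s) (S' : VSec φ s') (i : Fin n) :
    PS (fun x y : B × unitInterval => φ x.1 y.1) fun x => lineSec s s' x i := by
  have hu : UniformContinuous fun x : B × unitInterval => ((x.2 : ℝ) : ℂ) :=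
    Complex.isometry_ofReal.uniformContinuous.comp
      (uniformContinuous_subtype_val.comp uniformContinuous_snd)
  have hu' : UniformContinuous fun x : B × unitInterval => ((1 - x.2 : ℝ) : ℂ) :=
    (uniformContinuous_const.sub hu).of_eq (f := fun x => 1 - _) fun x => by push_cast; rfl
  have hb : ∀ t : unitInterval, ‖((t : ℝ) : ℂ)‖ ≤ 1 := fun t => by
    rw [Complex.norm_real, Real.norm_eq_abs, abs_of_nonneg t.2.1]; exact t.2.2
  exact (PS.uc_mul (.of_uc hu' ⟨1, fun x => hb (unitInterval.symm x.2)⟩)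
    ((S.ps i).comap uniformContinuous_fst)).add
    (PS.uc_mul (.of_uc hu ⟨1, fun x => hb x.2⟩) ((S'.ps i).comap uniformContinuous_fst))

theorem VSec.line (S : VSec φ s) (S' : VSec φ s') (h : ∀ x, 0 ≤ (∑ i, s' x i * star (s x i)).re) :
    VSec (fun x y : B × unitInterval => φ x.1 y.1) (lineSec s s') where
  ps := S.lineSec_ps S'
  low := by
    obtain ⟨c, hc, H⟩ := S.low
    obtain ⟨c', hc', H'⟩ := S'.low
    refine ⟨min c c' / 2, by positivity, fun ⟨x, t⟩ => ?_⟩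
    have ht := t.2
    simp only [lineSec, norm_sq_line, Finset.sum_add_distrib, ← Finset.mul_sum]
    rw [← Complex.re_sum]
    have h1 : min c c' ≤ ∑ i, ‖s x i‖ ^ 2 := (min_le_left _ _).trans (H x)
    have h2 : min c c' ≤ ∑ i, ‖s' x i‖ ^ 2 := (min_le_right _ _).trans (H' x)
    have h3 : 0 < min c c' := lt_min hc hc'
    have h4 : 0 ≤ 2 * (t : ℝ) * (1 - t) * (∑ i, s' x i * star (s x i)).re :=
      mul_nonneg (mul_nonneg (mul_nonneg two_pos.le ht.1) (sub_nonneg.2 ht.2)) (h x)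
    nlinarith [mul_le_mul_of_nonneg_left h1 (sq_nonneg (1 - (t : ℝ))),
      mul_le_mul_of_nonneg_left h2 (sq_nonneg (t : ℝ)),
      mul_nonneg h3.le (sq_nonneg (2 * (t : ℝ) - 1))]

theorem VSec.pull_eq_of_line (S : VSec φ s) (S' : VSec φ s')
    (h : ∀ x, 0 ≤ (∑ i, s' x i * star (s x i)).re) {F : B → A} (hF : UniformContinuous F)
    (a : HH k (A × PVec n)) :
    HH.pull (fun x => (F x, S.map x)) (hF.prodMk S.map_uc) a =
      HH.pull (fun x => (F x, S'.map x)) (hF.prodMk S'.map_uc) a := by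
  have hL := S.line S' h
  have hG : UniformContinuous fun x : B × unitInterval => (F x.1, hL.map x) :=
    (hF.comp uniformContinuous_fst).prodMk hL.map_uc
  have key := HH.homotopy (HH.pull _ hG a) 0 1
  rw [HH.pull_pull, HH.pull_pull] at key
  refine (HH.pull_congr (funext fun x => ?_) _ _).trans
    (key.trans (HH.pull_congr (funext fun x => ?_) _ _))
  · exact Prod.ext rfl (PVec.ext (funext fun i => by simp [VSec.map, lineSec]))
  · exact Prod.ext rfl (PVec.ext (funext fun i => by simp [VSec.map, lineSec]))

theorem VSec.map_congr {C : Type*} [UniformSpace C] {ψ : C → C → ℝ} {r : C → Fin n → ℂ}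
    (h : VSec φ s) (h' : VSec ψ r) {x : B} {y : C} (e : s x = r y) : h.map x = h'.map y :=
  PVec.ext (funext fun i => by simp only [VSec.map, e])

theorem PVec.vsec_comap_map {f : B → PVec n} (hf : UniformContinuous f) :
    (PVec.vsec.comap hf).map = f :=
  funext fun x => PVec.ext (VSec.map_v_of_unit _ x (f x).norm_sq)

end Line

section Rho

variable {A : Type*} [UniformSpace A] {k : Type*} [CommRing k] {n : ℕ}

/-- The adjoint of multiplication by a linear polynomial. -/
noncomputable def rho (w : Fin 2 → ℂ) (v : Fin (n + 1) → ℂ) (i : Fin n) : ℂ :=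
  star (w 0) * v i.castSucc + star (w 1) * v i.succ

/-- Evaluation of a polynomial at a point of the projective line. -/
noncomputable def ev (w : Fin 2 → ℂ) (v : Fin (n + 1) → ℂ) : ℂ :=
  ∑ i, v i * ((-w 0) ^ (i : ℕ) * w 1 ^ (n - i))

theorem sum_polyMul_mul_star (w : Fin 2 → ℂ) (V : Fin n → ℂ) (v : Fin (n + 1) → ℂ) :
    ∑ i, polyMul w V i * star (v i) = ∑ i, V i * star (rho w v i) := by
  simp only [polyMul, add_mul, Finset.sum_add_distrib]
  rw [Fin.sum_univ_castSucc, Fin.sum_univ_succ (fun i => w 1 * _ * _)]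
  simp only [Fin.snoc_castSucc, Fin.snoc_last, Fin.cons_zero, Fin.cons_succ, mul_zero, zero_mul,
    add_zero, zero_add, ← Finset.sum_add_distrib]
  refine Finset.sum_congr rfl fun i _ => ?_
  simp only [rho, star_add, star_mul', star_star]
  ring

theorem eq_zero_of_rho_of_ev {w : Fin 2 → ℂ} (hw : w ≠ 0) {v : Fin (n + 1) → ℂ}
    (h : rho w v = 0) (he : ev w v = 0) : v = 0 := by
  have h' : ∀ i : Fin n, star (w 0) * v i.castSucc + star (w 1) * v i.succ = 0 := congrFun h
  by_cases h1 : w 1 = 0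
  · have h0 : w 0 ≠ 0 := fun h0 => hw (funext (Fin.forall_fin_two.2 ⟨h0, h1⟩))
    have hc : ∀ i : Fin n, v i.castSucc = 0 := fun i => by simpa [h1, h0] using h' i
    funext i
    induction i using Fin.lastCases with
    | cast i => exact hc i
    | last => simpa [ev, Fin.sum_univ_castSucc, hc, h0] using he
  · have hs : star (w 1) ≠ 0 := star_ne_zero.2 h1
    have hv : ∀ i : Fin (n + 1), v i = (-(star (w 0) / star (w 1))) ^ (i : ℕ) * v 0 := by
      intro i
      induction i using Fin.induction with
      | zero => simp
      | succ i ih =>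
        have := h' i
        rw [ih] at this
        rw [Fin.val_succ, pow_succ]
        field_simp
        simp only [Fin.val_castSucc] at this
        linear_combination this
    have h2 : ev w v = v 0 * (w 1 ^ n * ((∑ i : Fin (n + 1), (‖w 0 / w 1‖ ^ 2) ^ (i : ℕ) : ℝ) : ℂ)) := by
      push_cast
      simp_rw [ev, Finset.mul_sum]
      refine Finset.sum_congr rfl fun i _ => ?_
      have e : (‖w 0 / w 1‖ : ℂ) ^ 2 = star (w 0) / star (w 1) * (w 0 / w 1) := by
        rw [← Complex.conj_mul']; simp
      rw [hv i, e, mul_pow, neg_pow, neg_pow (w 0), ← pow_sub_mul_pow (w 1) (Fin.is_le i), div_pow (w 0)]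
      have e3 : ((-1 : ℂ) ^ (i : ℕ)) * (-1) ^ (i : ℕ) = 1 := by rw [← mul_pow]; simp
      have e4 : w 1 ^ (i : ℕ) ≠ 0 := pow_ne_zero _ h1
      field_simp
      linear_combination ((star (w 0) / star (w 1)) ^ (i : ℕ) * v 0 * w 0 ^ (i : ℕ)) * e3
    have h3 : 0 < ∑ i : Fin (n + 1), (‖w 0 / w 1‖ ^ 2) ^ (i : ℕ) :=
      Finset.sum_pos' (fun i _ => by positivity) ⟨0, Finset.mem_univ _, by simp⟩
    rw [h2] at he
    have h4 : v 0 = 0 := by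
      rcases mul_eq_zero.1 he with h | h
      · exact h
      · rcases mul_eq_zero.1 h with h | h
        · exact absurd h (pow_ne_zero _ h1)
        · exact absurd (Complex.ofReal_eq_zero.1 h) h3.ne'
    funext i
    rw [hv i, h4, mul_zero]
    rfl

theorem rho_ev_low : ∃ c > 0, ∀ (w : PVec 2) (v : PVec (n + 1)),
    c ≤ ∑ i, ‖rho w.v v.v i‖ ^ 2 + ‖ev w.v v.v‖ ^ 2 := by
  refine usphere_low (F := fun x => ∑ i, ‖rho x.1 x.2 i‖ ^ 2 + ‖ev x.1 x.2‖ ^ 2) ?_ fun w hw v hv => ?_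
  · unfold rho ev
    fun_prop
  · by_contra! H
    have h1 : 0 ≤ ∑ i, ‖rho w v i‖ ^ 2 := Finset.sum_nonneg fun i _ => by positivity
    have h2 : 0 ≤ ‖ev w v‖ ^ 2 := by positivity
    have h3 : ∑ i, ‖rho w v i‖ ^ 2 = 0 := by dsimp only at H; linarith
    have h4 : ‖ev w v‖ ^ 2 = 0 := by dsimp only at H; linarith
    have hw0 : w ≠ 0 := by rintro rfl; simp [usphere] at hw
    have h5 := eq_zero_of_rho_of_ev hw0 (v := v)
      (funext fun i => by
        have := (Finset.sum_eq_zero_iff_of_nonneg fun i _ => by positivity).1 h3 i (Finset.mem_univ _)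
        simpa using this) (by simpa using h4)
    subst h5
    simp [usphere] at hv

theorem rho_ps (i : Fin n) : PS (fun x y : PVec (n + 1) × PVec 2 => -pph 2 x.2 y.2 + pph (n + 1) x.1 y.1)
    fun x => rho x.2.v x.1.v i :=
  (((PVec.ps 0).comap uniformContinuous_snd).conj.mul ((PVec.ps _).comap uniformContinuous_fst)).add
    (((PVec.ps 1).comap uniformContinuous_snd).conj.mul ((PVec.ps _).comap uniformContinuous_fst))

theorem ev_ps : PS (fun x y : PVec (n + 1) × PVec 2 => pph (n + 1) x.1 y.1 + n * pph 2 x.2 y.2)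
    fun x => ev x.2.v x.1.v := by
  refine PS.sum _ fun i _ => ?_
  have h0 := ((PVec.ps (n := 2) 0).comap (uniformContinuous_snd (α := PVec (n + 1)))).neg.pow i
  have h1 := ((PVec.ps (n := 2) 1).comap (uniformContinuous_snd (α := PVec (n + 1)))).pow (n - i)
  refine (((PVec.ps i).comap uniformContinuous_fst).mul (h0.mul h1)).congr fun x y => ?_
  rw [Nat.cast_sub (Fin.is_le i)]
  ring

theorem Phase.nsmul {B : Type*} [UniformSpace B] {φ : B → B → ℝ} (h : Phase φ) (m : ℕ) :
    Phase fun x y => m * φ x y := by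
  induction m with
  | zero => simpa using Phase.zero
  | succ m ih => simpa [add_mul] using ih.add h

theorem cc_nsmul {B : Type*} [UniformSpace B] {φ : B → B → ℝ} (h : Phase φ) (m : ℕ) :
    cc k (fun x y => m * φ x y) = m * cc k φ := by
  induction m with
  | zero => simpa using cc_eq_zero k (PS.const 1) ⟨1, one_pos, fun _ => by simp⟩
  | succ m ih =>
    have := cc_add k (h.nsmul m) h
    rw [ih] at this
    simpa [add_mul] using this

/-- Forgetting the vector. -/
def forgetP (x : (A × PVec n) × PVec 2) : A × PVec 2 := (x.1.1, x.2)

theorem forgetP_uc : UniformContinuous (forgetP (A := A) (n := n)) :=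
  HH.uc_base uniformContinuous_fst

section

variable {S : Type*} [UniformSpace S] {fA : S → A} {fv : S → PVec (n + 1)} {fw : S → PVec 2}
  {δ : ℝ}

theorem rho_vsec (hv : UniformContinuous fv) (hw : UniformContinuous fw) (hδ : 0 < δ)
    (hS : ∀ x, δ ≤ ∑ i, ‖rho (fw x).v (fv x).v i‖ ^ 2) :
    VSec (fun x y => -pph 2 (fw x) (fw y) + pph (n + 1) (fv x) (fv y))
      fun x => rho (fw x).v (fv x).v where
  ps i := by
    have := (rho_ps (n := n) i).comap (hv.prodMk hw)
    exact this
  low := ⟨δ, hδ, hS⟩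

theorem HH.pull_of_eq_muP {c : HH k (A × PVec (n + 1))} {C : Fin n → HH k (A × PVec 2)}
    (hC : HH.pull muA muA_uc c = ∑ j, HH.fst (C j) * HH.snd (hP k n) ^ (j : ℕ))
    (hA : UniformContinuous fA) (hw : UniformContinuous fw) {F : S → PVec (n + 1)}
    (hF : UniformContinuous F) {G : S → PVec n} (hG : UniformContinuous G)
    (e : ∀ x, F x = muP (fw x, G x)) :
    HH.pull (fun x => (fA x, F x)) (hA.prodMk hF) c =
      ∑ j, HH.pull (fun x => (fA x, fw x)) (hA.prodMk hw) (C j) * hL k G hG ^ (j : ℕ) := by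
  obtain rfl : F = fun x => muP (fw x, G x) := funext e
  have hg := (hA.prodMk hw).prodMk hG
  have e2 : HH.pull _ (hA.prodMk hF) c = HH.pull _ hg (HH.pull muA muA_uc c) := by
    rw [HH.pull_pull]
    rfl
  rw [e2, hC, map_sum]
  refine Finset.sum_congr rfl fun j _ => ?_
  rw [map_mul, map_pow, HH.pull_pull, HH.pull_pull]
  rfl

theorem HH.pull_rho {c : HH k (A × PVec (n + 1))} {C : Fin n → HH k (A × PVec 2)}
    (hC : HH.pull muA muA_uc c = ∑ j, HH.fst (C j) * HH.snd (hP k n) ^ (j : ℕ))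
    (hA : UniformContinuous fA) (hv : UniformContinuous fv) (hw : UniformContinuous fw) (hδ : 0 < δ)
    (hS : ∀ x, δ ≤ ∑ i, ‖rho (fw x).v (fv x).v i‖ ^ 2) :
    HH.pull (fun x => (fA x, fv x)) (hA.prodMk hv) c =
      ∑ j, HH.pull (fun x => (fA x, fw x)) (hA.prodMk hw) (C j) *
        (hL k fv hv - hL k fw hw) ^ (j : ℕ) := by
  have S1 := PVec.vsec.comap hv
  have S2 := rho_vsec hv hw hδ hS
  have S3' := polyMul_vsec.comap (hw.prodMk S2.map_uc)
  have S3 : VSec (fun x y => pph (n + 1) (fv x) (fv y)) fun x => polyMul (fw x).v (S2.map x).v :=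
    ⟨fun i => (polyMul_ps (fun i => (PVec.ps i).comap hw) S2.map_ps i).congr fun x y => by ring, S3'.low⟩
  have key := S1.pull_eq_of_line S3 (fun x => by
    rw [sum_polyMul_mul_star]
    simp only [VSec.map, mul_assoc]
    rw [← Finset.mul_sum, sum_mul_star rfl, ← Complex.ofReal_mul, Complex.ofReal_re]
    positivity) hA c
  have e1 : HH.pull (fun x => (fA x, fv x)) (hA.prodMk hv) c =
      HH.pull (fun x => (fA x, S1.map x)) (hA.prodMk S1.map_uc) c :=
    HH.pull_congr (by rw [PVec.vsec_comap_map hv]) _ _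
  have e3 := S2.hL_map (k := k)
  rw [cc_add k (PVec.phase.comap hw).neg (PVec.phase.comap hv), cc_neg k (PVec.phase.comap hw),
    ← hL_eq k _ hw, ← hL_eq k _ hv, neg_add_eq_sub] at e3
  rw [e1, key, ← e3]
  exact HH.pull_of_eq_muP hC hA hw S3.map_uc S2.map_uc fun x => VSec.map_congr S3 polyMul_vsec rfl

theorem hL_add_nsmul_eq_zero (hv : UniformContinuous fv) (hw : UniformContinuous fw) (hδ : 0 < δ)
    (hS : ∀ x, δ ≤ ‖ev (fw x).v (fv x).v‖ ^ 2) : hL k fv hv + n * hL k fw hw = 0 := by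
  have h := cc_eq_zero k (ev_ps.comap (hv.prodMk hw)) ⟨√δ, Real.sqrt_pos.2 hδ, fun x =>
    Real.sqrt_le_iff.2 ⟨norm_nonneg _, hS x⟩⟩
  rwa [cc_add k (PVec.phase.comap hv) ((PVec.phase.comap hw).nsmul n), cc_nsmul (PVec.phase.comap hw),
      ← hL_eq k _ hw, ← hL_eq k _ hv] at h

end

theorem HH.res_rho {c : HH k (A × PVec (n + 1))} {C : Fin n → HH k (A × PVec 2)}
    (hC : HH.pull muA muA_uc c = ∑ j, HH.fst (C j) * HH.snd (hP k n) ^ (j : ℕ)) {δ : ℝ} (hδ : 0 < δ)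
    {S : Set ((A × PVec (n + 1)) × PVec 2)} (hS : ∀ x ∈ S, δ ≤ ∑ i, ‖rho x.2.v x.1.2.v i‖ ^ 2) :
    HH.res S (HH.fst c - ∑ j, HH.pull forgetP forgetP_uc (C j) *
      (HH.fst (HH.snd (hP k (n + 1))) - HH.snd (hP k 2)) ^ (j : ℕ)) = 0 := by
  have hv : UniformContinuous fun x : S => (x : (A × PVec (n + 1)) × PVec 2).1.2 :=
    uniformContinuous_snd.comp (uniformContinuous_fst.comp uniformContinuous_subtype_val)
  have hw : UniformContinuous fun x : S => (x : (A × PVec (n + 1)) × PVec 2).2 :=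
    uniformContinuous_snd.comp uniformContinuous_subtype_val
  have hA : UniformContinuous fun x : S => (x : (A × PVec (n + 1)) × PVec 2).1.1 :=
    uniformContinuous_fst.comp (uniformContinuous_fst.comp uniformContinuous_subtype_val)
  rw [map_sub, HH.pull_pull, map_sum, sub_eq_zero]
  refine (HH.pull_rho hC hA hv hw hδ fun x => hS _ x.2).trans (Finset.sum_congr rfl fun j _ => ?_)
  rw [map_mul, map_pow, map_sub, HH.pull_pull, HH.pull_pull, HH.pull_pull, HH.pull_pull]
  rfl

theorem HH.res_ev {δ : ℝ} (hδ : 0 < δ)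
    {S : Set ((A × PVec (n + 1)) × PVec 2)} (hS : ∀ x ∈ S, δ ≤ ‖ev x.2.v x.1.2.v‖ ^ 2) :
    HH.res S (HH.fst (HH.snd (hP k (n + 1))) + (n : HH k _) * HH.snd (hP k 2)) = 0 := by
  have hv : UniformContinuous fun x : S => (x : (A × PVec (n + 1)) × PVec 2).1.2 :=
    uniformContinuous_snd.comp (uniformContinuous_fst.comp uniformContinuous_subtype_val)
  have hw : UniformContinuous fun x : S => (x : (A × PVec (n + 1)) × PVec 2).2 :=
    uniformContinuous_snd.comp uniformContinuous_subtype_val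
  rw [map_add, map_mul, map_natCast, HH.pull_pull, HH.pull_pull, HH.pull_pull]
  exact hL_add_nsmul_eq_zero hv hw hδ fun x => hS _ x.2

theorem HH.rho_rel {c : HH k (A × PVec (n + 1))} {C : Fin n → HH k (A × PVec 2)}
    (hC : HH.pull muA muA_uc c = ∑ j, HH.fst (C j) * HH.snd (hP k n) ^ (j : ℕ)) :
    (HH.fst c - ∑ j, HH.pull forgetP forgetP_uc (C j) *
      (HH.fst (HH.snd (hP k (n + 1))) - HH.snd (hP k 2)) ^ (j : ℕ)) *
      (HH.fst (HH.snd (hP k (n + 1))) + (n : HH k _) * HH.snd (hP k 2)) = 0 := by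
  obtain ⟨c₀, hc₀, H⟩ := rho_ev_low (n := n)
  have hcov : UCover fun i : Fin 2 => {x : (A × PVec (n + 1)) × PVec 2 | c₀ / 4 ≤
      ![fun x => ∑ i, ‖rho x.2.v x.1.2.v i‖ ^ 2, fun x => ‖ev x.2.v x.1.2.v‖ ^ 2] i x} := by
    have hq : UniformContinuous fun x : (A × PVec (n + 1)) × PVec 2 => (x.1.2, x.2) :=
      (uniformContinuous_snd.comp uniformContinuous_fst).prodMk uniformContinuous_snd
    refine UCover.of_fun (Fin.forall_fin_two.2 ⟨?_, ?_⟩) (r' := c₀ / 2) (by linarith) fun x => ?_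
    · exact PS.normSq fun i => (rho_ps i).comap hq
    · refine (PS.normSq (n := 1) (s := fun x _ => ev x.2.v x.1.2.v) fun i => ev_ps.comap hq).of_eq
        fun x => by simp
    · by_contra! h
      have h0 := h 0
      have h1 := h 1
      have := H x.2 x.1.2
      simp only [Matrix.cons_val_zero, Matrix.cons_val_one] at h0 h1
      linarith
  have hcov' : UCover ![{x : (A × PVec (n + 1)) × PVec 2 | c₀ / 4 ≤ ∑ i, ‖rho x.2.v x.1.2.v i‖ ^ 2},
      {x | c₀ / 4 ≤ ‖ev x.2.v x.1.2.v‖ ^ 2}] := by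
    convert hcov using 1
    exact funext (Fin.forall_fin_two.2 ⟨rfl, rfl⟩)
  exact HH.mul_eq_zero_of_cover hcov' (HH.res_rho hC (δ := c₀ / 4) (by positivity) fun x hx => hx)
    (HH.res_ev (δ := c₀ / 4) (by positivity) fun x hx => hx)

end Rho

end

section

open Uniformity DGRing

theorem sub_pow_mul_of_sq_zero {R : Type*} [Ring R] {x h : R} (hx : x * x = 0) (c : Commute x h)
    {n : ℕ} : ∀ {j : ℕ}, j ≤ n →
      (h - x) ^ j * (h + n * x) = h ^ (j + 1) + h ^ j * ((n - j : ℕ) * x)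
  | 0, _ => by simp
  | j + 1, hj => by
    have ih := sub_pow_mul_of_sq_zero (n := n) hx c (Nat.le_of_succ_le hj)
    have e : n - j = (n - (j + 1)) + 1 := by omega
    have e1 : x * h ^ (j + 1) = h ^ (j + 1) * x := (c.pow_right _).eq
    have e2 : x * (h ^ j * (((n - j : ℕ) : R) * x)) = 0 := by
      rw [← mul_assoc, (c.pow_right j).eq, mul_assoc, ← mul_assoc x, ← (Nat.cast_commute _ x).eq,
        mul_assoc, hx, mul_zero, mul_zero]
    rw [pow_succ', mul_assoc, ih, sub_mul, mul_add, mul_add, e2, e1, ← mul_assoc h (h ^ j),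
      ← pow_succ', ← pow_succ', e]
    push_cast
    simp only [add_mul, mul_add, one_mul]
    abel

section Gen

variable {k : Type*} [CommRing k]

theorem HH.nsmul_mul_eq {n : ℕ} {A : Type*} [UniformSpace A] {c : HH k (A × PVec (n + 1))}
    {C : Fin n → HH k (A × PVec 2)}
    (hC : HH.pull muA muA_uc c = ∑ j, HH.fst (C j) * HH.snd (hP k n) ^ (j : ℕ)) :
    ∃ b : Fin (n + 1) → HH k A, (n : HH k _) * c = ∑ j : Fin (n + 1), HH.snd (hP k (n + 1)) ^ (j : ℕ) * HH.fst (b j) := by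
  have h1 := HH.rho_rel hC
  have hx : (HH.snd (hP k 2) : HH k ((A × PVec (n + 1)) × PVec 2)) * HH.snd (hP k 2) = 0 := by
    rw [← map_mul, ← sq, hP_pow, map_zero]
  have hc := HH.snd_hP_commute (A := A × PVec (n + 1)) (n := 2)
    (HH.fst (HH.snd (hP k (n + 1))))
  have hH : ∀ b : HH k ((A × PVec (n + 1)) × PVec 2), Commute (HH.fst (HH.snd (hP k (n + 1)))) b := by
    intro b
    rw [HH.pull_pull]
    exact hL_commute _ _ b
  rw [sub_mul, sub_eq_zero, Finset.sum_mul] at h1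
  refine HH.rel_P2 (c := (n : HH k _) * c) (e := c * HH.snd (hP k (n + 1)))
    (u := fun j : Fin (n + 1) => HH.snd (hP k (n + 1)) ^ (j : ℕ))
    (C := fun j => (Fin.cons 0 C : Fin (n + 1) → _) j +
      (Fin.snoc (fun j : Fin n => ((n - j : ℕ) : HH k _) * HH.snd (hP k 2) * C j) 0 : Fin (n + 1) → _) j)
    (f := Prod.fst) uniformContinuous_fst ?_
  simp only [map_add, mul_add, Finset.sum_add_distrib]
  rw [Fin.sum_univ_succ, Fin.sum_univ_castSucc (fun j : Fin (n + 1) => _ * (HH.pull _ _)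
    ((Fin.snoc _ _ : Fin (n + 1) → _) j))]
  simp only [Fin.cons_zero, Fin.cons_succ, Fin.snoc_castSucc, Fin.snoc_last, map_zero, mul_zero,
    zero_add, add_zero, ← Finset.sum_add_distrib]
  trans HH.fst c * (HH.fst (HH.snd (hP k (n + 1))) + (n : HH k _) * HH.snd (hP k 2))
  · rw [map_mul, map_mul, map_natCast, mul_add, ← mul_assoc (HH.fst c),
      ← (Nat.cast_commute n (HH.fst c)).eq]
    exact add_comm _ _
  · rw [h1]
    refine Finset.sum_congr rfl fun j _ => ?_
    have e0 : HH.pull (fun x : (A × PVec (n + 1)) × PVec 2 => (x.1.1, x.2)) forgetP_uc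
        (HH.snd (hP k 2)) = HH.snd (hP k 2) := HH.pull_pull _ _ _ _ _
    have e1 : HH.pull (fun x : (A × PVec (n + 1)) × PVec 2 => (x.1.1, x.2)) forgetP_uc (C j) =
      HH.pull forgetP forgetP_uc (C j) := rfl
    rw [mul_assoc, sub_pow_mul_of_sq_zero hx hc j.2.le, map_mul, map_mul, map_natCast, e0, e1, mul_add,
      map_pow, map_pow, Fin.val_succ, Fin.val_castSucc]
    refine congrArg₂ (· + ·) ((hH _).pow_left _).eq.symm ?_
    rw [((hH _).pow_left _).eq, ← mul_assoc, ← mul_assoc, ← mul_assoc,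
      ← (Nat.cast_commute (n - j) (HH.pull forgetP forgetP_uc (C j))).eq, ← mul_assoc,
      mul_assoc _ _ (HH.snd (hP k 2)), ← (HH.snd_hP_commute (HH.pull forgetP forgetP_uc (C j))).eq]
    simp only [mul_assoc]
    rw [((hH _).pow_left _).eq]
    simp only [mul_assoc]

theorem PVec.near_all (V : Set (PVec 1 × PVec 1)) (hV : V ∈ 𝓤 (PVec 1)) (x y : PVec 1) : (x, y) ∈ V := by
  have e : ∀ x : PVec 1, x.v 0 * star (x.v 0) = 1 := fun x => by
    have := sum_mul_star x.norm_sq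
    simpa using this
  obtain ⟨U, hU, h⟩ := (Filter.mem_comap).1 hV
  refine h (?_ : (_, _) ∈ U)
  change (fun i j => x.v i * star (x.v j), fun i j => y.v i * star (y.v j)) ∈ U
  have : (fun i j => x.v i * star (x.v j)) = fun i j => y.v i * star (y.v j) := by
    funext i j
    rw [Subsingleton.elim i 0, Subsingleton.elim j 0, e, e]
  rw [this]
  exact refl_mem_uniformity hU

theorem HH.exists_repr : ∀ (n : ℕ) {A : Type*} [UniformSpace A]
    (_ : ∀ i, 0 < i → i ≤ n → NInv k i) (c : HH k (A × PVec (n + 1))),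
    ∃ a : Fin (n + 1) → HH k A, c = ∑ j, HH.fst (a j) * HH.snd (hP k (n + 1)) ^ (j : ℕ)
  | 0, A, _, hn, c => by
    let e : PVec 1 := ⟨fun _ => 1, by simp⟩
    refine ⟨fun _ => HH.pull _ (HH.uc_inc (X := A) e) c, ?_⟩
    rw [Finset.sum_eq_single (0 : Fin (0 + 1)) (fun j _ h => absurd (Fin.ext (by omega)) h)
      (fun h => absurd (Finset.mem_univ _) h), Fin.val_zero, pow_zero, mul_one, HH.pull_pull]
    symm
    refine (HH.pull_eq_of_near _ uniformContinuous_id (fun V hV => ?_) c).trans (HH.pull_id c)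
    rw [uniformity_prod, Filter.mem_inf_iff] at hV
    obtain ⟨_, ⟨U, hU, h1⟩, _, ⟨W, hW, h2⟩, rfl⟩ := hV
    exact ⟨_, uniformContinuous_fst hU, fun x y hxy =>
      ⟨⟨h1 hxy, h2 (PVec.near_all W hW _ _)⟩, ⟨h1 hxy, h2 (PVec.near_all W hW _ _)⟩,
        ⟨h1 hxy, h2 (PVec.near_all W hW _ _)⟩, ⟨h1 hxy, h2 (PVec.near_all W hW _ _)⟩⟩⟩
  | n + 1, A, _, hn, c => by
    obtain ⟨C, hC⟩ := HH.exists_repr n (fun i hi hi' => hn i hi (hi'.trans n.le_succ))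
      (HH.pull muA muA_uc c)
    obtain ⟨b, hb⟩ := HH.nsmul_mul_eq hC
    obtain ⟨m, hm⟩ := (hn (n + 1) n.succ_pos le_rfl).exists_inv
    refine ⟨fun j => m * b j, ?_⟩
    rw [← one_mul c, ← hm, mul_assoc, hb, Finset.mul_sum]
    refine Finset.sum_congr rfl fun j _ => ?_
    rw [((HH.snd_hP_commute _).pow_left _).eq, map_mul, map_natCast, mul_assoc]

theorem HH.coeff_eq_zero {n : ℕ} {A : Type*} [UniformSpace A] (hn : ∀ i, 0 < i → i ≤ n → NInv k i)
    (a : Fin (n + 1) → HH k A)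
    (h : ∑ j, HH.fst (a j) * HH.snd (hP k (n + 1)) ^ (j : ℕ) = 0) : ∀ j, a j = 0 := by
  suffices H : ∀ m, ∀ hm : m < n + 1, a ⟨m, hm⟩ = 0 from fun j => H j j.2
  intro m
  induction m using Nat.strong_induction_on with
  | _ m ih =>
    intro hm
    refine HH.eq_zero_of_mul_hP_pow n hn ?_
    have h0 := congrArg (· * (HH.snd (hP k (n + 1)) : HH k (A × PVec (n + 1))) ^ (n - m)) h
    simp only [zero_mul, Finset.sum_mul, mul_assoc, ← pow_add] at h0
    rw [Finset.sum_eq_single ⟨m, hm⟩] at h0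
    · rw [← h0]
      congr 3
      simp only
      omega
    · intro j _ hj
      rcases lt_trichotomy (j : ℕ) m with hlt | heq | hgt
      · rw [show a j = 0 from ih j hlt j.2, map_zero, zero_mul]
      · exact absurd (Fin.ext heq) hj
      · rw [← map_pow, show (j : ℕ) + (n - m) = n + 1 + (j - m - 1) by omega, pow_add, hP_pow,
          zero_mul, map_zero, mul_zero]
    · simp

end Gen

end

section

open Uniformity DGRing

namespace Coch

variable {k X Y : Type*} [CommRing k]

/-- The last vertex of a simplex. -/
def lst {X : Type*} : X → List X → X
  | x, [] => x
  | _, y :: l => lst y l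

/-- Multiplying a cochain by the value of a one-cochain on the edge from `w` to the last vertex. -/
def lastMul (τ : Coch k X) (w : X) (φ : Coch k X) : Coch k X := ⟨fun y l => φ y l * τ w [lst y l]⟩

/-- Multiplying a cochain by the value of a one-cochain on the longest edge. -/
def edgeMul (τ : Coch k X) (φ : Coch k X) : Coch k X := ⟨fun y l => φ y l * τ y [lst y l]⟩

theorem sh_edgeMul (τ φ : Coch k X) (x : X) : sh x (edgeMul τ φ) = lastMul τ x (sh x φ) := rfl

theorem sh_lastMul (τ φ : Coch k X) (w x : X) : sh x (lastMul τ w φ) = lastMul τ w (sh x φ) := rfl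

theorem lst_map (f : X → Y) (x : X) (l : List X) : lst (f x) (l.map f) = f (lst x l) := by
  induction l generalizing x with
  | nil => rfl
  | cons y l ih => exact ih y

theorem pull_edgeMul (f : X → Y) (τ φ : Coch k Y) :
    pull f (edgeMul τ φ) = edgeMul (pull f τ) (pull f φ) := by
  refine ext' fun x l => ?_
  simp only [edgeMul, pull_apply, List.map_cons, List.map_nil]
  rw [← lst_map f]

theorem edgeMul_zero (τ : Coch k X) : edgeMul τ 0 = 0 := ext' fun _ _ => zero_mul _

theorem d_lastMul {τ : Coch k X} (h : IsHom 1 τ) (hd : d τ = 0) (w : X) (φ : Coch k X) :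
    d (lastMul τ w φ) = lastMul τ w (d φ) + bar φ * τ := by
  refine ext' fun x l => ?_
  induction l generalizing φ x with
  | nil => simp [lastMul, h x [] (by simp)]
  | cons y l ih =>
    have ih' := ih (sh x φ) y
    rw [add_apply] at ih' ⊢
    rw [d_cons, sh_lastMul, ih', mul_cons, sh_bar, smul_mul, smul_apply, bar_apply]
    have e : ∀ ψ : Coch k X, lastMul τ w ψ x (y :: l) = ψ x (y :: l) * τ w [lst y l] := fun _ => rfl
    have e' : ∀ ψ : Coch k X, lastMul τ w ψ y l = ψ y l * τ w [lst y l] := fun _ => rfl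
    rw [e, e', e', d_cons]
    have e0 : lastMul τ w φ x [] = φ x [] * τ w [x] := rfl
    rw [e0]
    have t := IsHom.trans_of_d hd w x (lst y l)
    rcases l with - | ⟨z, l⟩
    · simp only [one_nil, List.length_nil, pow_zero, lst] at t ⊢
      rw [t]
      ring
    · simp only [one_cons, h x (y :: z :: l) (by simp)]
      ring

theorem d_edgeMul {τ : Coch k X} (h : IsHom 1 τ) (hd : d τ = 0) (φ : Coch k X) :
    d (edgeMul τ φ) = edgeMul τ (d φ) + bar φ * τ - τ * φ := by
  refine ext' fun x l => ?_
  rw [sub_apply, add_apply]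
  have t0 : τ x [x] = 0 := by simpa using IsHom.trans_of_d hd x x x
  cases l with
  | nil => simp [edgeMul, h x [] (by simp)]
  | cons y l =>
    have e : ∀ ψ : Coch k X, edgeMul τ ψ x (y :: l) = ψ x (y :: l) * τ x [lst y l] := fun _ => rfl
    have e' : ∀ ψ : Coch k X, edgeMul τ ψ y l = ψ y l * τ y [lst y l] := fun _ => rfl
    have e'' : ∀ ψ : Coch k X, lastMul τ x ψ y l = ψ y l * τ x [lst y l] := fun _ => rfl
    have e0 : edgeMul τ φ x [] = φ x [] * τ x [x] := rfl
    have t := IsHom.trans_of_d hd x y (lst y l)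
    rw [d_cons, sh_edgeMul, d_lastMul h hd, add_apply, e, e', e'', e0, d_cons, mul_cons, sh_bar,
      smul_mul, smul_apply, bar_apply, h.mul_cons_one, t0, t]
    rcases l with - | ⟨z, l⟩
    · simp only [one_nil, List.length_nil, pow_zero, lst] at t ⊢
      have t1 : τ y [y] = 0 := by simpa using IsHom.trans_of_d hd y y y
      rw [t1]
      ring
    · simp only [one_cons, h x (y :: z :: l) (by simp)]
      ring

end Coch

section

variable {k X : Type*} [CommRing k] [UniformSpace X]

theorem HH.graded_comm {φ : Coch k X} (h : φ.IsHom 1) (hd : d (Germ.mk φ) = 0) {a : Germ k X}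
    (ha : d a = 0) :
    cls (Germ.mk φ) hd * cls a ha = cls _ (d_bar_eq_zero ha) * cls (Germ.mk φ) hd := by
  obtain ⟨ψ, rfl⟩ := Germ.mk_surj a
  rw [cls_mul, cls_mul, eq_comm]
  refine (cls_eq_iff _ _).2 ⟨Germ.mk (Coch.edgeMul φ ψ), ?_⟩
  obtain ⟨V, hV, hφ⟩ := Germ.d_mk_eq_zero_iff.1 hd
  obtain ⟨V', hV', hψ⟩ := Germ.d_mk_eq_zero_iff.1 ha
  rw [Germ.d_mk, Germ.bar_mk, ← map_mul, ← map_mul, ← map_sub, Germ.mk_eq_mk]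
  refine ⟨_, Filter.inter_mem hV hV', fun A hA => ?_⟩
  have := Coch.d_edgeMul (h.pull _) (hφ A (hA.trans Set.inter_subset_left))
    (Coch.pull (Subtype.val : A → X) ψ)
  rw [hψ A (hA.trans Set.inter_subset_right), Coch.edgeMul_zero, zero_add] at this
  rw [map_sub, Coch.pull_d, Coch.pull_edgeMul, this, map_sub, map_mul, map_mul, Coch.pull_bar,
    sub_self]

theorem tau_mul_cls {l : X → Circle} (hl : UniformContinuous l) {a : Germ k X} (ha : d a = 0) :
    tau k l hl * cls a ha = cls _ (d_bar_eq_zero ha) * tau k l hl :=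
  HH.graded_comm (Coch.isHom_c0 _).d.rnd.cast _ ha

theorem tau_const (z : Circle) : tau k (fun _ : X => z) uniformContinuous_const = 0 := by
  rw [tau, cls_eq_zero_iff]
  refine ⟨0, ?_⟩
  rw [map_zero, tauG, Coch.d_c0]
  have : (Coch.c1 fun _ _ : X => ph (z : ℂ) - ph z) = 0 := by
    refine Coch.ext' fun x l => ?_
    rcases l with - | ⟨y, - | ⟨_, _⟩⟩ <;> simp [Coch.c1]
  rw [this, Germ.rd_zero]

theorem tau_congr {l l' : X → Circle} (h : l = l') (hl : UniformContinuous l) :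
    tau k l hl = tau k l' (h ▸ hl) := by subst h; rfl

theorem HH.unit_eq {q : ℕ} [NeZero q] (c : HH (ZMod q) Unit) : ∃ m : ℕ, c = m := by
  obtain ⟨a, ha, rfl⟩ := cls_surj c
  obtain ⟨φ, rfl⟩ := Germ.mk_surj a
  have hd : Coch.d φ = 0 := by
    rw [Germ.d_mk, Germ.mk_eq_zero] at ha
    obtain ⟨V, hV, h⟩ := ha
    have := h Set.univ (by
      rintro ⟨x, y⟩ -
      exact refl_mem_uniformity hV)
    refine Coch.ext' fun x l => ?_
    have e := congrArg (fun c : Coch (ZMod q) (Set.univ : Set Unit) =>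
      c ⟨(), trivial⟩ (l.map fun _ => ⟨(), trivial⟩)) this
    rw [List.eq_replicate_of_mem (a := ()) (l := l) (fun _ _ => rfl)]
    simpa [Coch.pull_apply] using e
  have h1 := Coch.sh_d () φ
  rw [hd, Coch.sh_zero] at h1
  refine ⟨(φ () []).val, ?_⟩
  have h2 : (((φ () []).val : ℕ) : Coch (ZMod q) Unit) = φ () [] • 1 := by
    rw [← nsmul_one, ← Nat.cast_smul_eq_nsmul (ZMod q), ZMod.natCast_zmod_val]
  have h3 : Germ.mk (φ () [] • 1 : Coch (ZMod q) Unit) = ((φ () []).val : ℕ) := by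
    rw [← h2, map_natCast]
  have h4 : d (Germ.mk (φ () [] • 1 : Coch (ZMod q) Unit)) = 0 := by
    rw [h3]
    exact natCast_mem (cocycles (Germ (ZMod q) Unit)) _
  have : ((φ () []).val : HH (ZMod q) Unit) = cls _ h4 := by
    rw [cls_congr h3]
    exact (map_natCast (Ideal.Quotient.mk (coboundaries (Germ (ZMod q) Unit))) _).symm
  rw [this]
  refine (cls_eq_iff _ _).2 ⟨Germ.mk (Coch.sh () φ), ?_⟩
  rw [Germ.d_mk, ← map_sub]
  congr 1
  rw [eq_comm, ← sub_eq_zero, sub_right_comm]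
  exact h1.symm

/-- The straight path on the circle. -/
noncomputable def circLine (z w : Circle) (t : ℝ) : Circle :=
  Circle.exp (Complex.arg ((1 - t) * z + t * w : ℂ))

theorem coe_circLine {z w : Circle} {t : ℝ} (h : ((1 - t) * z + t * w : ℂ) ≠ 0) :
    (circLine z w t : ℂ) = ((1 - t) * z + t * w : ℂ) / ‖((1 - t) * z + t * w : ℂ)‖ := by
  rw [circLine, Circle.coe_exp, eq_div_iff (Complex.ofReal_ne_zero.2 (norm_ne_zero_iff.2 h)),
    mul_comm, Complex.norm_mul_exp_arg_mul_I]

theorem HH.pull_eq_of_ne_neg [CompactSpace X] {f g : X → Circle} (hf : UniformContinuous f)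
    (hg : UniformContinuous g) (h : ∀ x, (f x : ℂ) ≠ -g x) (a : HH k Circle) :
    HH.pull f hf a = HH.pull g hg a := by
  have key : ∀ (x : X) (t : ℝ), 0 ≤ t → t ≤ 1 → ((1 - t) * f x + t * g x : ℂ) ≠ 0 := by
    intro x t h0 h1 he
    have e : ((1 - t : ℝ) : ℂ) * f x = -((t : ℝ) * g x) := by
      push_cast
      linear_combination he
    have e1 := congrArg norm e
    rw [norm_neg, norm_mul, norm_mul, Circle.norm_coe, Circle.norm_coe, mul_one, mul_one,
      Complex.norm_real, Complex.norm_real, Real.norm_of_nonneg h0,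
      Real.norm_of_nonneg (by linarith)] at e1
    have e2 : t = 1 / 2 := by linarith
    subst e2
    apply h x
    push_cast at he
    linear_combination 2 * he
  have hc : Continuous fun y : X × unitInterval => circLine (f y.1) (g y.1) y.2 := by
    refine Continuous.subtype_mk (f := fun y : X × unitInterval =>
      ((1 - (y.2 : ℝ)) * f y.1 + (y.2 : ℝ) * g y.1 : ℂ) /
        ‖((1 - (y.2 : ℝ)) * f y.1 + (y.2 : ℝ) * g y.1 : ℂ)‖) ?_ ?_ |>.congr ?_
    · have h1 := hf.continuous
      have h2 := hg.continuous
      refine Continuous.div (by fun_prop) (by fun_prop) fun y => ?_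
      exact Complex.ofReal_ne_zero.2 (norm_ne_zero_iff.2 (key _ _ y.2.2.1 y.2.2.2))
    · intro y
      exact mem_sphere_zero_iff_norm.2 (by simp [key _ _ y.2.2.1 y.2.2.2])
    · intro y
      have := key y.1 y.2 y.2.2.1 y.2.2.2
      exact Subtype.ext (coe_circLine this).symm
  have hu := CompactSpace.uniformContinuous_of_continuous hc
  have := HH.homotopy (HH.pull _ hu a) (0 : unitInterval) 1
  rw [HH.pull_pull, HH.pull_pull] at this
  refine (HH.pull_congr ?_ _ _).trans (this.trans (HH.pull_congr ?_ _ _).symm)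
  · funext x
    apply Subtype.ext
    simp [circLine]
  · funext x
    apply Subtype.ext
    simp [circLine]

theorem HH.circle_eq {q : ℕ} [NeZero q] (c : HH (ZMod q) Circle) :
    ∃ m n : ℕ, c = m + tau (ZMod q) (fun z : Circle => z) uniformContinuous_id * n := by
  let F : HH (ZMod q) Circle →+* HH (ZMod q) (Circle × Circle) := HH.fst
  let G : HH (ZMod q) Circle →+* HH (ZMod q) (Circle × Circle) := HH.snd
  let t := tau (ZMod q) (fun z : Circle => z) uniformContinuous_id
  have key : ∀ c : HH (ZMod q) Circle, (F c - G c) * (F t - G t) = 0 := by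
    intro c
    have hcov : UCover ![{x : Circle × Circle | 1 / 2 ≤ ‖(x.1 : ℂ) + x.2‖},
        {x : Circle × Circle | 1 / 2 ≤ ‖(x.1 : ℂ) - x.2‖}] := by
      have := UCover.of_fun (X := Circle × Circle) (ι := Fin 2)
        (f := ![fun x => ‖(x.1 : ℂ) + x.2‖, fun x => ‖(x.1 : ℂ) - x.2‖]) (r := 1 / 2) (r' := 1)
        (by
          refine Fin.forall_fin_two.2 ⟨?_, ?_⟩ <;>
          · refine CompactSpace.uniformContinuous_of_continuous ?_
            simp only [Matrix.cons_val_zero, Matrix.cons_val_one]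
            fun_prop) (by norm_num) (by
          intro x
          by_contra! hx
          have h0 := hx 0
          have h1 := hx 1
          simp only [Matrix.cons_val_zero, Matrix.cons_val_one] at h0 h1
          have h2 : ‖((x.1 : ℂ) + x.2) + (x.1 - x.2)‖ = 2 := by
            rw [show ((x.1 : ℂ) + x.2) + (x.1 - x.2) = 2 * x.1 by ring, norm_mul,
              Circle.norm_coe]
            simp
          have := norm_add_le ((x.1 : ℂ) + x.2) (x.1 - x.2)
          linarith)
      refine this.imp fun V h => ⟨h.1, fun A hA hAV => ?_⟩
      obtain ⟨i, hi⟩ := h.2 A hA hAV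
      refine ⟨i, ?_⟩
      fin_cases i <;> exact hi
    refine HH.mul_eq_zero_of_cover hcov ?_ ?_
    · have hc : IsClosed {x : Circle × Circle | 1 / 2 ≤ ‖(x.1 : ℂ) + x.2‖} :=
        isClosed_le continuous_const (by fun_prop)
      have := isCompact_iff_compactSpace.1 hc.isCompact
      rw [map_sub, sub_eq_zero]
      change HH.pull _ _ (HH.pull _ _ _) = HH.pull _ _ (HH.pull _ _ _)
      rw [HH.pull_pull, HH.pull_pull]
      refine HH.pull_eq_of_ne_neg _ _ ?_ _
      rintro ⟨x, hx⟩ he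
      have hx : 1 / 2 ≤ ‖(x.1 : ℂ) + x.2‖ := hx
      change (x.1 : ℂ) = -x.2 at he
      rw [he] at hx
      norm_num at hx
    · have hc : IsClosed {x : Circle × Circle | 1 / 2 ≤ ‖(x.1 : ℂ) - x.2‖} :=
        isClosed_le continuous_const (by fun_prop)
      have := isCompact_iff_compactSpace.1 hc.isCompact
      let S := {x : Circle × Circle | 1 / 2 ≤ ‖(x.1 : ℂ) - x.2‖}
      have h1 : Continuous fun x : S => x.1.2⁻¹ * x.1.1 := by fun_prop
      have hu := CompactSpace.uniformContinuous_of_continuous h1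
      have h2 : tau (ZMod q) _ hu = 0 := by
        rw [← tau_const (Circle.exp Real.pi)]
        have e1 := pull_tau (ZMod q) (l := fun z : Circle => z) uniformContinuous_id hu
        have e2 := pull_tau (ZMod q) (l := fun z : Circle => z) uniformContinuous_id
          (f := fun _ : S => Circle.exp Real.pi) uniformContinuous_const
        refine e1.symm.trans (Eq.trans ?_ e2)
        refine HH.pull_eq_of_ne_neg _ _ ?_ _
        rintro ⟨x, hx⟩ he
        have hx : 1 / 2 ≤ ‖(x.1 : ℂ) - x.2‖ := hx
        have he : x.2⁻¹ * x.1 = 1 := by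
          apply Subtype.ext
          rw [he, Circle.coe_exp, Complex.exp_pi_mul_I]
          simp
        rw [inv_mul_eq_one.1 he] at hx
        norm_num at hx
      rw [map_sub, sub_eq_zero]
      have e1 : HH.res S (F t) = tau (ZMod q) (fun x : S => x.1.1)
          (uniformContinuous_fst.comp uniformContinuous_subtype_val) := by
        change HH.pull _ _ (HH.pull _ _ (tau _ _ _)) = _
        rw [HH.pull_pull, pull_tau]
        rfl
      have e2 : HH.res S (G t) = tau (ZMod q) (fun x : S => x.1.2)
          (uniformContinuous_snd.comp uniformContinuous_subtype_val) := by
        change HH.pull _ _ (HH.pull _ _ (tau _ _ _)) = _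
        rw [HH.pull_pull, pull_tau]
        rfl
      have e3 := tau_mul (k := ZMod q) (l := fun x : S => x.1.2) (uniformContinuous_snd.comp
        uniformContinuous_subtype_val) hu (CompactSpace.uniformContinuous_of_continuous (by fun_prop))
      rw [h2, add_zero] at e3
      change HH.res S (F t) = HH.res S (G t)
      rw [e1, e2, ← e3]
      refine tau_congr (funext fun x => ?_) _
      rw [mul_inv_cancel_left]
  obtain ⟨c', hc'⟩ : ∃ c', G c * F t = F t * G c' := by
    obtain ⟨a, ha, rfl⟩ := cls_surj c
    refine ⟨cls _ (d_bar_eq_zero ha), ?_⟩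
    have : F t = tau (ZMod q) (fun x : Circle × Circle => x.1) uniformContinuous_fst :=
      pull_tau _ uniformContinuous_id uniformContinuous_fst
    rw [this]
    change HH.pull _ _ _ * _ = _ * HH.pull _ _ _
    rw [HH.pull_cls, HH.pull_cls, tau_mul_cls]
    congr 1
    refine cls_congr ?_ _
    rw [← Germ.pull_bar, DGRing.bar_bar]
  have h0 := key c
  rw [mul_sub, sub_mul, sub_mul, hc', ← map_mul, ← map_mul] at h0
  obtain ⟨b, hb⟩ := HH.circle_rel (k := ZMod q) (f := fun _ : Circle => ()) uniformContinuous_const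
    (c := c) (e := -(c * t)) (u := ![t, 1])
    (D := ![-HH.snd c', HH.snd (c * t)]) (by
      simp only [Fin.sum_univ_two, Matrix.cons_val_zero, Matrix.cons_val_one, map_neg,
        HH.pull_pull, map_one]
      have e := pull_tau (ZMod q) (l := fun z : Circle => z) uniformContinuous_id
        (uniformContinuous_snd (α := Circle) (β := Circle))
      rw [← e, one_mul]
      change F c * G t + -F (c * t) = F t * -G c' + G (c * t)
      rw [mul_neg]
      rw [← sub_eq_zero, ← neg_eq_zero, ← h0]
      abel)
  obtain ⟨m, hm⟩ := HH.unit_eq (b 1)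
  obtain ⟨n, hn⟩ := HH.unit_eq (b 0)
  refine ⟨m, n, hb.trans ?_⟩
  rw [Fin.sum_univ_two, hm, hn, map_natCast, map_natCast, add_comm]
  simp only [Matrix.cons_val_zero, Matrix.cons_val_one, one_mul]
  rfl

end

end

section

open Uniformity DGRing

namespace LS

variable {k X : Type*} [CommRing k] [UniformSpace X] {n : ℕ} {h r : Germ k X} {α β : Fin n → Germ k X}

theorem add_prim (H : LS h α) (hr : (bar : Germ k X →+* _) r = -r) :
    LS (h + d r) fun i => α i + r where
  d_h := by rw [map_add, H.d_h, DGRing.d_d, add_zero]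
  bar_h := by
    have := DGRing.d_bar r
    rw [hr, map_neg] at this
    rw [map_add, H.bar_h, ← neg_injective this]
  bar_α i := by rw [map_add, H.bar_α, hr]; abel
  cover := by
    obtain ⟨U, hU, e⟩ := H.cover
    refine ⟨U, hU, fun i => ?_⟩
    rw [map_add, add_sub_add_right_eq_sub, e]

theorem dif_add_prim (H : LS h α) (H' : LS h β) (hr : (bar : Germ k X →+* _) r = -r) :
    dif H H' = dif (H.add_prim hr) (H'.add_prim hr) := by
  have hp : UniformContinuous (Prod.fst : X × unitInterval → X) := uniformContinuous_fst
  have hj : (bar : Germ k (X × unitInterval) →+* _) (jump * Germ.pull Prod.fst hp r) =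
      -(jump * Germ.pull Prod.fst hp r) := by
    rw [map_mul, ← Germ.pull_bar, hr, map_neg, mul_neg]
    congr 2
    exact Germ.bar_mk_zero (Coch.isHom_c0 _)
  have K := (H.comap hp).add_prim hj
  have K' := (H'.comap hp).add_prim hj
  have hom := HH.homotopy (dif K K') (0 : unitInterval) 1
  have hid : ∀ (t : unitInterval) (ht : UniformContinuous fun x : X => (x, t)) (a : Germ k X),
      Germ.pull (fun x => (x, t)) ht (Germ.pull Prod.fst hp a) = a := by
    intro t ht a
    rw [Germ.pull_pull]
    exact Germ.pull_id a
  rw [pull_dif, pull_dif] at hom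
  have j0 := pull_jump_zero (k := k) (HH.uc_inc (X := X) (0 : unitInterval))
  have j1 := pull_jump_one (k := k) (HH.uc_inc (X := X) (1 : unitInterval))
  have z : dif (K.comap (HH.uc_inc (0 : unitInterval))) (K'.comap (HH.uc_inc (0 : unitInterval)))
      = dif H H' := by
    refine dif_congr _ _ _ _ ?_ (funext fun i => ?_) (funext fun i => ?_)
    · rw [map_add, hid, Germ.pull_d, map_mul, j0, zero_mul, map_zero, add_zero]
    · rw [map_add, hid, map_mul, j0, zero_mul, add_zero]
    · rw [map_add, hid, map_mul, j0, zero_mul, add_zero]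
  have o : dif (K.comap (HH.uc_inc (1 : unitInterval))) (K'.comap (HH.uc_inc (1 : unitInterval)))
      = dif (H.add_prim hr) (H'.add_prim hr) := by
    refine dif_congr _ _ _ _ ?_ (funext fun i => ?_) (funext fun i => ?_)
    · rw [map_add, hid, Germ.pull_d, map_mul, j1, one_mul, hid]
    · rw [map_add, hid, map_mul, j1, one_mul, hid]
    · rw [map_add, hid, map_mul, j1, one_mul, hid]
  rw [← z, hom, o]

end LS

section PhaseChange

open Coch Germ Sec

variable {B : Type*} [UniformSpace B] (k : Type*) [CommRing k] {φ ψ : B → B → ℝ} {n : ℕ}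
  {s s' : B → Fin n → ℂ}

theorem Sec.nearInt_sub (S : Sec φ s) (S' : Sec ψ s) : NearInt 1 (c1 fun x y => ψ x y - φ x y) := by
  refine nearInt_c1 fun ε hε => ?_
  obtain ⟨δ, hδ, hs⟩ := S.nz
  obtain ⟨V, hV, h⟩ := S.near (δ * ε / 2) (by positivity)
  obtain ⟨V', hV', h'⟩ := S'.near (δ * ε / 2) (by positivity)
  refine ⟨_, Filter.inter_mem hV hV', fun x y hxy => ?_⟩
  obtain ⟨i, hi⟩ := hs x
  have h1 := h x y hxy.1 i
  have h2 := h' x y hxy.2 i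
  have e : ‖ee (ψ x y - φ x y) - 1‖ * ‖s x i‖ < δ * ε := by
    calc _ = ‖(s y i - ee (φ x y) * s x i) - (s y i - ee (ψ x y) * s x i)‖ := by
          rw [← mul_one ‖ee _ - 1‖, ← norm_ee (φ x y), ← norm_mul, ← norm_mul, sub_mul, ee_sub_mul]
          congr 1
          ring
      _ ≤ _ := norm_sub_le _ _
      _ < _ := by linarith
  have := norm_nonneg (ee (ψ x y - φ x y) - 1)
  by_contra hcon
  push Not at hcon
  nlinarith

theorem Sec.res_big_sub (S : Sec φ s) (H : NearInt 1 (c1 fun x y => ψ x y - φ x y)) {δ : ℝ}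
    (hδ : 0 < δ) (i : Fin n) :
    res (big s δ i) (al k ψ s i - (al k φ s i + rd k (c1 fun x y => ψ x y - φ x y))) = 0 := by
  rw [map_sub, map_add, al, al, pull_rd, pull_rd, pull_rd,
    ← rd_add (S.nearInt_big hδ i) (NearInt.pull H uniformContinuous_subtype_val), ← map_add,
    sub_eq_zero]
  congr 2
  rw [← c1_sub]
  abel

theorem Delta_phase (S : Sec φ s) (S' : Sec φ s') (R : Sec ψ s) (R' : Sec ψ s') :
    Delta k φ s s' = Delta k ψ s s' := by
  have H := S.nearInt_sub R
  have hr : (bar : Germ k B →+* _) (rd k (c1 fun x y => ψ x y - φ x y)) = -_ :=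
    bar_rd_one (isHom_c1 _)
  have eh : hh k ψ = hh k φ + DGRing.d (rd k (c1 fun x y => ψ x y - φ x y)) := by
    rw [d_rd H, hh, hh, ← rd_add S.phase H.d, ← map_add, ← c1_sub]
    congr 2
    abel
  have key : ∀ {t : B → Fin n → ℂ} (S : Sec φ t) (R : Sec ψ t),
      LS.dif ((S.ls k).add_prim hr) (eh ▸ R.ls k) = 0 := by
    intro t S R
    obtain ⟨δ, hδ, hU⟩ := S.exists_ucover
    refine LS.dif_eq_zero _ _ hU (fun _ => 0) (fun i => map_zero _) (fun i => ?_) fun i => ?_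
    · rw [map_add, add_sub_add_right_eq_sub]
      exact S.res_big k hδ i
    · rw [map_zero, sub_zero]
      exact S.res_big_sub k H hδ i
  have e1 := LS.dif_add ((S.ls k).add_prim hr) (eh ▸ R.ls k) (eh ▸ R'.ls k)
  have e2 := LS.dif_add ((S.ls k).add_prim hr) ((S'.ls k).add_prim hr) (eh ▸ R'.ls k)
  rw [key S R, zero_add] at e1
  rw [key S' R', add_zero] at e2
  rw [Delta_eq k S S', Delta_eq k R R', LS.dif_add_prim _ _ hr, e2, ← e1]
  exact LS.dif_congr _ _ _ _ eh.symm rfl rfl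

end PhaseChange

end

section

open Uniformity DGRing Matrix

/-- The unitary group. -/
abbrev UG (n : ℕ) := Matrix.unitaryGroup (Fin n) ℂ

theorem UG.star_mulVec_dotProduct {n : ℕ} (U : UG n) (v w : Fin n → ℂ) :
    star (U.1 *ᵥ v) ⬝ᵥ (U.1 *ᵥ w) = star v ⬝ᵥ w := by
  rw [Matrix.star_mulVec, Matrix.dotProduct_mulVec, Matrix.vecMul_vecMul, ← Matrix.star_eq_conjTranspose,
    Matrix.UnitaryGroup.star_mul_self, Matrix.vecMul_one]

theorem sum_norm_sq_eq_dotProduct {n : ℕ} (v : Fin n → ℂ) :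
    ((∑ i, ‖v i‖ ^ 2 : ℝ) : ℂ) = star v ⬝ᵥ v := by
  push_cast
  refine Finset.sum_congr rfl fun i _ => ?_
  rw [← Complex.conj_mul']
  rfl

theorem UG.norm_mulVec {n : ℕ} (U : UG n) (v : Fin n → ℂ) :
    ∑ i, ‖(U.1 *ᵥ v) i‖ ^ 2 = ∑ i, ‖v i‖ ^ 2 := by
  have := UG.star_mulVec_dotProduct U v v
  rw [← sum_norm_sq_eq_dotProduct, ← sum_norm_sq_eq_dotProduct] at this
  exact_mod_cast this

section PM

variable {A B : Type*} [UniformSpace A] [UniformSpace B] {n : ℕ} {φ ψ : A → A → ℝ} {g G : A → UG n}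

/-- A map to the unitary group, uniformly continuous up to the transition phases `φ`. -/
def PM (φ : A → A → ℝ) (g : A → UG n) : Prop := ∀ i j, PS φ fun x => (g x).1 i j

namespace PM

theorem congr (h : PM φ g) (H : ∀ x y, φ x y = ψ x y) : PM ψ g := fun i j => (h i j).congr H

theorem comap (h : PM φ g) {f : B → A} (hf : UniformContinuous f) :
    PM (fun x y => φ (f x) (f y)) fun x => g (f x) := fun i j => (h i j).comap hf

theorem const (c : UG n) : PM (fun _ _ : A => 0) fun _ => c := fun _ _ => PS.const _

theorem mul (h : PM φ g) (h' : PM ψ G) : PM (fun x y => φ x y + ψ x y) fun x => g x * G x := by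
  intro i j
  exact (PS.sum Finset.univ fun l _ => (h i l).mul (h' l j)).congr_fun fun x => rfl

theorem mul_zero' (h : PM (fun _ _ => 0) g) (h' : PM (fun _ _ => 0) G) :
    PM (fun _ _ => 0) fun x => g x * G x := (h.mul h').congr fun _ _ => add_zero 0

theorem inv (h : PM φ g) : PM (fun x y => -φ x y) fun x => (g x)⁻¹ := fun i j =>
  (h j i).conj.congr_fun fun x => by
    rw [Matrix.UnitaryGroup.inv_val, Matrix.star_apply]

theorem inv_zero (h : PM (fun _ _ => 0) g) : PM (fun _ _ => 0) fun x => (g x)⁻¹ :=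
  h.inv.congr fun _ _ => neg_zero

theorem pow (h : PM φ g) (m : ℕ) : PM (fun x y => m * φ x y) fun x => g x ^ m := by
  induction m with
  | zero =>
    simp only [pow_zero]
    exact (const 1).congr fun _ _ => by simp
  | succ m ih =>
    simp only [pow_succ]
    exact (ih.mul h).congr fun x y => by push_cast; ring

theorem zpow (h : PM φ g) (m : ℤ) : PM (fun x y => m * φ x y) fun x => g x ^ m := by
  obtain ⟨m, rfl | rfl⟩ := m.eq_nat_or_neg
  · simpa using h.pow m
  · simpa using (h.pow m).inv

theorem conj (h : PM φ G) (h' : PM (fun _ _ => 0) g) :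
    PM (fun _ _ => 0) fun x => G x * g x * (G x)⁻¹ :=
  ((h.mul h').mul h.inv).congr fun _ _ => by ring

theorem vsec (h : PM φ g) {s : A → Fin n → ℂ} (S : VSec ψ s) :
    VSec (fun x y => φ x y + ψ x y) fun x => (g x).1 *ᵥ s x where
  ps i := (PS.sum Finset.univ fun l _ => (h i l).mul (S.ps l)).congr_fun fun x => rfl
  low := by
    obtain ⟨c, hc, H⟩ := S.low
    exact ⟨c, hc, fun x => by rw [UG.norm_mulVec]; exact H x⟩

theorem vsec_zero (h : PM (fun _ _ => 0) g) {s : A → Fin n → ℂ} (S : VSec ψ s) :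
    VSec ψ fun x => (g x).1 *ᵥ s x := by
  have := h.vsec S
  simpa using this

theorem vsec_snd (h : PM (fun _ _ => 0) g) :
    VSec (fun x y : A × PVec n => pph n x.2 y.2) fun x => (g x.1).1 *ᵥ x.2.v :=
  (h.comap uniformContinuous_fst).vsec_zero (PVec.vsec.comap uniformContinuous_snd)

end PM

end PM

section dg

variable {A B : Type*} [UniformSpace A] [UniformSpace B] {n : ℕ} {g G : A → UG n}
  (k : Type*) [CommRing k]

theorem PVec.vsec_snd : VSec (fun x y : A × PVec n => pph n x.2 y.2) fun x => x.2.v :=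
  PVec.vsec.comap uniformContinuous_snd

/-- The characteristic class of a family of unitary matrices: the obstruction to deforming
the family to the identity through nowhere vanishing sections. -/
noncomputable def dg (g : A → UG n) : HH k (A × PVec n) :=
  Delta k (fun x y => pph n x.2 y.2) (fun x => (g x.1).1 *ᵥ x.2.v) fun x => x.2.v

theorem dg_congr (h : ∀ x, g x = G x) : dg k g = dg k G := by rw [funext h]

theorem dg_one : dg k (fun _ : A => (1 : UG n)) = 0 := by
  have : (fun x : A × PVec n => ((1 : UG n)).1 *ᵥ x.2.v) = fun x => x.2.v :=
    funext fun x => Matrix.one_mulVec _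
  rw [dg, this, Delta_self]

theorem pull_dg (hg : PM (fun _ _ => 0) g) {f : B → A} (hf : UniformContinuous f) :
    HH.pull (fun x : B × PVec n => (f x.1, x.2))
      ((hf.comp uniformContinuous_fst).prodMk uniformContinuous_snd) (dg k g) =
    dg k fun x => g (f x) :=
  pull_Delta k hg.vsec_snd.sec PVec.vsec_snd.sec _

theorem HH.pull_eq_self {k} [CommRing k] {N : ℕ} (hN : ∀ i, 0 < i → i ≤ N → NInv k i)
    {F : A × PVec (N + 1) → PVec (N + 1)} (hF : UniformContinuous F)
    (h : hL k F hF = HH.snd (hP k (N + 1))) (c : HH k (A × PVec (N + 1))) :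
    HH.pull (fun x => (x.1, F x)) (uniformContinuous_fst.prodMk hF) c = c := by
  obtain ⟨a, rfl⟩ := HH.exists_repr N hN c
  rw [map_sum]
  refine Finset.sum_congr rfl fun j _ => ?_
  rw [map_mul, map_pow, HH.fst, HH.snd, HH.pull_pull, HH.pull_pull]
  congr 2

theorem dg_mul {N : ℕ} (hN : ∀ i, 0 < i → i ≤ N → NInv k i) {g G : A → UG (N + 1)}
    (hg : PM (fun _ _ => 0) g) (hG : PM (fun _ _ => 0) G) :
    dg k (fun x => g x * G x) = dg k g + dg k G := by
  have S := hG.vsec_snd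
  have hT := uniformContinuous_fst.prodMk S.map_uc
  have hv : ∀ x, (S.map x).v = (G x.1).1 *ᵥ x.2.v := fun x =>
    S.map_v_of_unit x (by rw [UG.norm_mulVec]; exact x.2.norm_sq)
  have e1 := HH.pull_eq_self (k := k) hN S.map_uc
    (S.hL_map.trans (pull_cc k PVec.phase uniformContinuous_snd).symm) (dg k g)
  have e2 := pull_Delta k hg.vsec_snd.sec PVec.vsec_snd.sec hT
  have gG := (hg.mul_zero' hG).vsec_snd
  have hgG : (fun x : A × PVec (N + 1) => (g x.1).1 *ᵥ (S.map x).v) =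
      fun x => (g x.1 * G x.1).1 *ᵥ x.2.v := by
    funext x
    rw [hv, Matrix.mulVec_mulVec]
    rfl
  have hG' : (fun x => (S.map x).v) = fun x : A × PVec (N + 1) => (G x.1).1 *ᵥ x.2.v := funext hv
  have R := hg.vsec_snd.sec.comap hT
  have R' := PVec.vsec_snd.sec.comap hT
  simp only [hgG, hG'] at R R' e2
  rw [dg, ← Delta_add k gG.sec S.sec PVec.vsec_snd.sec, Delta_phase k gG.sec S.sec R R', ← e2]
  congr 1

theorem dg_inv {N : ℕ} (hN : ∀ i, 0 < i → i ≤ N → NInv k i) {g : A → UG (N + 1)}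
    (hg : PM (fun _ _ => 0) g) : dg k (fun x => (g x)⁻¹) = -dg k g := by
  rw [eq_neg_iff_add_eq_zero, ← dg_mul k hN hg.inv_zero hg, dg_congr k fun x => inv_mul_cancel (g x),
    dg_one]

theorem lineSec_zero (s s' : A → Fin n → ℂ) (x : A) : lineSec s s' (x, 0) = s x := by
  funext i; simp [lineSec]

theorem lineSec_one (s s' : A → Fin n → ℂ) (x : A) : lineSec s s' (x, 1) = s' x := by
  funext i; simp [lineSec]

theorem Delta_line {φ : A → A → ℝ} {s s' : A → Fin n → ℂ} (S : VSec φ s) (S' : VSec φ s')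
    (h : ∀ x, 0 ≤ (∑ i, s' x i * star (s x i)).re) : Delta k φ s s' = 0 := by
  have := Delta_eq_zero k (S.line S' h).sec 0 1
  simpa only [lineSec_zero, lineSec_one] using this

end dg

end

section

open Uniformity DGRing Matrix

theorem Set.Infinite.sphere_complex : (Metric.sphere (0 : ℂ) 1).Infinite := by
  have h : Set.InjOn (fun t : ℝ => Complex.exp (t * Complex.I)) (Set.Ioc (-Real.pi) Real.pi) := by
    intro t ht t' ht' e
    have e1 := Complex.arg_exp_mul_I t
    have e2 := Complex.arg_exp_mul_I t'
    simp only at e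
    rw [e, e2] at e1
    rwa [(toIocMod_eq_self _).2, (toIocMod_eq_self _).2, eq_comm] at e1
    · rwa [show -Real.pi + 2 * Real.pi = Real.pi by ring]
    · rwa [show -Real.pi + 2 * Real.pi = Real.pi by ring]
  refine ((Set.Ioc_infinite (by linarith [Real.pi_pos])).image h).mono ?_
  rintro _ ⟨t, -, rfl⟩
  simp [Complex.norm_exp_ofReal_mul_I]

/-- A unit scalar which is not an eigenvalue. -/
theorem exists_circle_mulVec_ne {n : ℕ} (c : Matrix (Fin n) (Fin n) ℂ) :
    ∃ w : Circle, ∀ v : Fin n → ℂ, c *ᵥ v = (w : ℂ) • v → v = 0 := by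
  obtain ⟨w, hw, h⟩ := Set.Infinite.sphere_complex.exists_notMem_finset c.charpoly.roots.toFinset
  refine ⟨⟨w, hw⟩, fun v hv => ?_⟩
  by_contra hne
  refine h (Multiset.mem_toFinset.2 ((Polynomial.mem_roots c.charpoly_monic.ne_zero).2 ?_))
  rw [Polynomial.IsRoot, Matrix.eval_charpoly, ← Matrix.exists_mulVec_eq_zero_iff]
  refine ⟨v, hne, ?_⟩
  rw [Matrix.sub_mulVec, hv]
  ext i
  simp [Matrix.scalar, Matrix.mulVec_diagonal]

section

variable {A B : Type*} [UniformSpace A] [UniformSpace B] {n : ℕ} (k : Type*) [CommRing k]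

theorem Delta_scalar {φ : A → A → ℝ} {s : A → Fin n → ℂ} (S : VSec φ s) (z : Circle) :
    Delta k φ (fun x i => z * s x i) s = 0 := by
  have R : VSec (fun x y : A × unitInterval => φ x.1 y.1)
      fun x i => (Circle.exp (x.2 * Complex.arg z) : ℂ) * s x.1 i := by
    refine ⟨fun i => PS.uc_mul (.of_uc ?_ ⟨1, fun x => (Circle.norm_coe _).le⟩) ((S.ps i).comap uniformContinuous_fst), ?_⟩
    · have : UniformContinuous fun t : unitInterval => (Circle.exp (t * Complex.arg z) : ℂ) :=
        CompactSpace.uniformContinuous_of_continuous (by fun_prop)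
      exact this.comp uniformContinuous_snd
    · obtain ⟨c, hc, H⟩ := S.low
      exact ⟨c, hc, fun x => by simpa only [norm_mul, Circle.norm_coe, one_mul] using H x.1⟩
  have := Delta_eq_zero k R.sec 1 0
  simpa [Circle.exp_arg] using this

theorem dg_conj_const {φ : A → A → ℝ} {b : A → UG n} (hb : PM φ b) (c : UG n) :
    dg k (fun x => b x * c * (b x)⁻¹) = 0 := by
  obtain ⟨w, hw⟩ := exists_circle_mulVec_ne c.1
  have S := (hb.conj (PM.const c)).vsec_snd
  have hneg : ‖-(w : ℂ)‖ = 1 := by rw [norm_neg, Circle.norm_coe]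
  set z : Circle := ⟨-(w : ℂ), mem_sphere_zero_iff_norm.2 hneg⟩ with hz
  have hzw : (z : ℂ) = -(w : ℂ) := rfl
  have V : VSec (fun x y : A × PVec n => pph n x.2 y.2) fun x => x.2.v := PVec.vsec_snd
  have S' : VSec (fun x y : A × PVec n => pph n x.2 y.2) fun x i => (z : ℂ) * x.2.v i :=
    ⟨fun i => (V.ps i).const_mul _, 1, one_pos, fun x => by
      simp only [norm_mul, Circle.norm_coe, one_mul]; exact x.2.norm_sq.ge⟩
  have low : ∃ δ > 0, ∀ t : unitInterval, ∀ u : Fin n → ℂ, ∑ i, ‖u i‖ ^ 2 = 1 →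
      δ ≤ ∑ i, ‖((1 - t : ℝ) : ℂ) * (c.1 *ᵥ u) i + (t : ℝ) * (z * u i)‖ ^ 2 := by
    obtain ⟨δ, hδ, H⟩ := (isCompact_univ.prod (isCompact_usphere n)).exists_forall_le'
      (f := fun x : unitInterval × (Fin n → ℂ) =>
        ∑ i, ‖((1 - x.1 : ℝ) : ℂ) * (c.1 *ᵥ x.2) i + (x.1 : ℝ) * (z * x.2 i)‖ ^ 2) (a := 0)
      (Continuous.continuousOn (by
        simp only [Matrix.mulVec, dotProduct]
        fun_prop)) (by
        rintro ⟨t, u⟩ ⟨-, hu⟩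
        refine lt_of_le_of_ne (Finset.sum_nonneg fun i _ => sq_nonneg _) fun h0 => ?_
        rw [eq_comm, Finset.sum_eq_zero_iff_of_nonneg fun i _ => sq_nonneg _] at h0
        have h1 : ∀ i, ((1 - t : ℝ) : ℂ) * (c.1 *ᵥ u) i = (t : ℝ) * (w * u i) := fun i => by
          have := h0 i (Finset.mem_univ i)
          rw [sq_eq_zero_iff, norm_eq_zero] at this
          simp only [hzw] at this
          rw [← sub_eq_zero, ← this]; ring
        have hu' : ∑ i, ‖u i‖ ^ 2 = 1 := hu
        have h2 : (1 - t : ℝ) ^ 2 = (t : ℝ) ^ 2 := by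
          have e := Finset.sum_congr rfl fun i (_ : i ∈ Finset.univ) =>
            congrArg (fun z : ℂ => ‖z‖ ^ 2) (h1 i)
          simp only [norm_mul, mul_pow, Circle.norm_coe, one_mul, ← Finset.mul_sum,
            Complex.norm_real, Real.norm_eq_abs, sq_abs] at e
          rwa [UG.norm_mulVec c, hu', mul_one, mul_one] at e
        have h3 : (t : ℝ) = 1 / 2 := by nlinarith
        have h4 : c.1 *ᵥ u = (w : ℂ) • u := by
          ext i
          have := h1 i
          rw [h3] at this
          norm_num at this
          simpa using this
        have := hw u h4
        simp [this] at hu')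
    exact ⟨δ, hδ, fun t u hu => H (t, u) ⟨trivial, hu⟩⟩
  have L : VSec (fun x y : (A × PVec n) × unitInterval => pph n x.1.2 y.1.2)
      (lineSec (fun x : A × PVec n => (b x.1 * c * (b x.1)⁻¹).1 *ᵥ x.2.v)
        fun x i => (z : ℂ) * x.2.v i) := by
    refine ⟨S.lineSec_ps S', ?_⟩
    obtain ⟨δ, hδ, H⟩ := low
    refine ⟨δ, hδ, fun x => ?_⟩
    set u := ((b x.1.1)⁻¹).1 *ᵥ x.1.2.v with hu
    have hu1 : ∑ i, ‖u i‖ ^ 2 = 1 := by rw [hu, UG.norm_mulVec]; exact x.1.2.norm_sq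
    have hbu : (b x.1.1).1 *ᵥ u = x.1.2.v := by
      rw [hu, Matrix.mulVec_mulVec]
      have : (b x.1.1).1 * ((b x.1.1)⁻¹).1 = 1 := congrArg Subtype.val (mul_inv_cancel (b x.1.1))
      rw [this, Matrix.one_mulVec]
    have := H x.2 u hu1
    rw [← UG.norm_mulVec (b x.1.1)] at this
    refine this.trans_eq (Finset.sum_congr rfl fun i _ => ?_)
    congr 2
    have e : (fun i => ((1 - x.2 : ℝ) : ℂ) * (c.1 *ᵥ u) i + (x.2 : ℝ) * (z * u i)) =
        ((1 - x.2 : ℝ) : ℂ) • (c.1 *ᵥ u) + ((x.2 : ℝ) * z : ℂ) • u := by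
      ext i; simp [mul_assoc]
    have e2 : (b x.1.1 * c * (b x.1.1)⁻¹).1 *ᵥ x.1.2.v = (b x.1.1).1 *ᵥ c.1 *ᵥ u := by
      rw [hu, Matrix.mulVec_mulVec, Matrix.mulVec_mulVec]; rfl
    rw [e, Matrix.mulVec_add, Matrix.mulVec_smul, Matrix.mulVec_smul, hbu, lineSec, e2]
    simp [mul_assoc]
  have e1 := Delta_eq_zero (T := unitInterval) (φ := fun x y : A × PVec n => pph n x.2 y.2) k
    L.sec 0 1
  have e2 := Delta_scalar k V z
  simp only [lineSec_zero, lineSec_one] at e1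
  rw [dg, ← Delta_add k S.sec S'.sec V.sec, e2, add_zero]
  exact e1

end

end

section

open Uniformity DGRing Matrix

section Reflection

variable {n : ℕ}

theorem PVec.star_dotProduct (ℓ : PVec n) : star ℓ.v ⬝ᵥ ℓ.v = 1 := by
  rw [← sum_norm_sq_eq_dotProduct, ℓ.norm_sq, Complex.ofReal_one]

/-- The matrix scaling the line of `ℓ` by `a` and fixing its orthogonal complement. -/
def reflM (a : ℂ) (ℓ : PVec n) : Matrix (Fin n) (Fin n) ℂ := 1 + (a - 1) • vecMulVec ℓ.v (star ℓ.v)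

theorem reflM_one (ℓ : PVec n) : reflM 1 ℓ = 1 := by simp [reflM]

theorem reflM_mul (a b : ℂ) (ℓ : PVec n) : reflM a ℓ * reflM b ℓ = reflM (a * b) ℓ := by
  have h : vecMulVec ℓ.v (star ℓ.v) * vecMulVec ℓ.v (star ℓ.v) = vecMulVec ℓ.v (star ℓ.v) := by
    rw [Matrix.vecMulVec_mul_vecMulVec, ℓ.star_dotProduct, one_smul]
  simp only [reflM, mul_add, add_mul, one_mul, mul_one, smul_mul_assoc, mul_smul_comm, h]
  module

theorem star_reflM (a : ℂ) (ℓ : PVec n) : star (reflM a ℓ) = reflM (star a) ℓ := by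
  rw [reflM, reflM, star_add, star_smul, star_one, Matrix.star_eq_conjTranspose,
    Matrix.conjTranspose_vecMulVec, star_star, star_sub, star_one]

theorem reflM_mulVec (a : ℂ) (ℓ : PVec n) (v : Fin n → ℂ) :
    reflM a ℓ *ᵥ v = v + ((a - 1) * (star ℓ.v ⬝ᵥ v)) • ℓ.v := by
  rw [reflM, Matrix.add_mulVec, Matrix.one_mulVec, Matrix.smul_mulVec, Matrix.vecMulVec_mulVec]
  ext i
  simp
  ring

theorem det_reflM (a : ℂ) (ℓ : PVec n) : (reflM a ℓ).det = a := by
  have h : reflM a ℓ = 1 + replicateCol Unit ((a - 1) • ℓ.v) * replicateRow Unit (star ℓ.v) := by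
    rw [reflM, ← Matrix.vecMulVec_eq]
    ext i j
    simp [vecMulVec, mul_assoc]
  rw [h, Matrix.det_one_add_replicateCol_mul_replicateRow, dotProduct_smul, ℓ.star_dotProduct]
  simp

/-- The complex reflection with eigenvalue `l` on the line of `ℓ`. -/
def rfn (l : Circle) (ℓ : PVec n) : UG n :=
  ⟨reflM l ℓ, Matrix.mem_unitaryGroup_iff.2 (by
    rw [star_reflM, reflM_mul]
    have : (l : ℂ) * star (l : ℂ) = 1 := by
      rw [← starRingEnd_apply, Complex.mul_conj', Circle.norm_coe]; simp
    rw [this, reflM_one])⟩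

theorem rfn_one (ℓ : PVec n) : rfn 1 ℓ = 1 := Subtype.ext (reflM_one ℓ)

theorem rfn_mul (l m : Circle) (ℓ : PVec n) : rfn l ℓ * rfn m ℓ = rfn (l * m) ℓ :=
  Subtype.ext (reflM_mul _ _ ℓ)

theorem rfn_mulVec (l : Circle) (ℓ : PVec n) (v : Fin n → ℂ) :
    (rfn l ℓ).1 *ᵥ v = v + (((l : ℂ) - 1) * (star ℓ.v ⬝ᵥ v)) • ℓ.v := reflM_mulVec _ _ _

theorem conj_rfn (b : UG n) (l : Circle) {ℓ ℓ' : PVec n} (h : ℓ'.v = b.1 *ᵥ ℓ.v) :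
    b * rfn l ℓ * b⁻¹ = rfn l ℓ' := by
  rw [mul_inv_eq_iff_eq_mul]
  refine Subtype.ext ?_
  change b.1 * (1 + ((l : ℂ) - 1) • vecMulVec ℓ.v (star ℓ.v)) =
    (1 + ((l : ℂ) - 1) • vecMulVec ℓ'.v (star ℓ'.v)) * b.1
  have hb : star b.1 * b.1 = 1 := Matrix.UnitaryGroup.star_mul_self b
  rw [mul_add, add_mul, mul_one, one_mul, mul_smul_comm, smul_mul_assoc, Matrix.mul_vecMulVec,
    Matrix.vecMulVec_mul, h, Matrix.star_mulVec, Matrix.vecMul_vecMul, ← Matrix.star_eq_conjTranspose,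
    hb, Matrix.vecMul_one]

variable {A : Type*} [UniformSpace A] {l : A → Circle} {L : A → PVec n}

theorem Circle.uc_coe {l : A → Circle} (hl : UniformContinuous l) :
    PS (fun _ _ => 0) fun x => (l x : ℂ) :=
  .of_uc (uniformContinuous_subtype_val.comp hl) ⟨1, fun _ => (Circle.norm_coe _).le⟩

theorem PM.rfn (hl : UniformContinuous l) (hL : UniformContinuous L) :
    PM (fun _ _ => 0) fun x => rfn (l x) (L x) := by
  intro i j
  have h1 : PS (fun _ _ : A => 0) fun x => (L x).v i * star ((L x).v j) :=
    (((PVec.ps i).comap hL).mul ((PVec.ps j).comap hL).conj).congr fun _ _ => add_neg_cancel _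
  refine ((PS.const ((1 : Matrix (Fin n) (Fin n) ℂ) i j)).add
    (((Circle.uc_coe hl).sub (PS.const 1)).mul_uc h1)).congr_fun fun x => ?_
  simp [_root_.rfn, reflM, vecMulVec]

/-- The inner product of two unit vectors. -/
noncomputable def ip (x : PVec n × PVec n) : ℂ := star x.1.v ⬝ᵥ x.2.v

theorem ip_ps : PS (fun x y : PVec n × PVec n => -pph n x.1 y.1 + pph n x.2 y.2) ip :=
  (PS.sum Finset.univ fun i _ => ((PVec.ps i).comap uniformContinuous_fst).conj.mul
    ((PVec.ps i).comap uniformContinuous_snd)).congr_fun fun _ => rfl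

theorem ip_uc : UniformContinuous fun x : PVec n × PVec n => ‖ip x‖ ^ 2 := by
  simpa using PS.normSq (s := fun (x : PVec n × PVec n) (_ : Fin 1) => ip x) fun _ => ip_ps

theorem re_rfn_mulVec (l : Circle) (ℓ v : PVec n) (h : ‖ip (ℓ, v)‖ ^ 2 ≤ 1 / 2) :
    0 ≤ (∑ i, v.v i * star (((rfn l ℓ).1 *ᵥ v.v) i)).re := by
  have e : ∑ i, v.v i * star (((rfn l ℓ).1 *ᵥ v.v) i) =
      1 + (star (l : ℂ) - 1) * ((‖ip (ℓ, v)‖ ^ 2 : ℝ) : ℂ) := by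
    have h1 : ∑ i, v.v i * star (((rfn l ℓ).1 *ᵥ v.v) i) = star ((rfn l ℓ).1 *ᵥ v.v) ⬝ᵥ v.v :=
      Finset.sum_congr rfl fun i _ => mul_comm _ _
    have h2 : star (star ℓ.v ⬝ᵥ v.v) * (star ℓ.v ⬝ᵥ v.v) = ((‖ip (ℓ, v)‖ ^ 2 : ℝ) : ℂ) := by
      push_cast
      exact Complex.conj_mul' _
    rw [h1, rfn_mulVec, star_add, add_dotProduct, v.star_dotProduct, star_smul, smul_dotProduct,
      smul_eq_mul, star_mul', star_sub, star_one, mul_assoc, h2]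
  have h3 : (star (l : ℂ)).re = (l : ℂ).re := rfl
  have h4 : -1 ≤ (l : ℂ).re := by
    have := (abs_le.1 (Complex.abs_re_le_norm (l : ℂ))).1
    rwa [Circle.norm_coe] at this
  rw [e, Complex.add_re, Complex.re_mul_ofReal, Complex.sub_re, h3, Complex.one_re]
  nlinarith [sq_nonneg ‖ip (ℓ, v)‖]

end Reflection

section

variable (k : Type*) [CommRing k] {n : ℕ}

/-- The universal reflection. -/
def urefl (n : ℕ) (x : Circle × PVec n) : UG n := rfn x.1 x.2

theorem urefl_pm : PM (fun _ _ => 0) (urefl n) := PM.rfn uniformContinuous_fst uniformContinuous_snd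

/-- The line bundle of the reflected lines. -/
noncomputable def xx (n : ℕ) : HH k (Circle × PVec n) := HH.snd (hP k n)

theorem sub_mul_dg_urefl :
    (HH.fst (xx k n) - HH.snd (hP k n)) * dg k (urefl n) = 0 := by
  have hf : UniformContinuous fun x : (Circle × PVec n) × PVec n => (x.1.2, x.2) :=
    (uniformContinuous_snd.comp uniformContinuous_fst).prodMk uniformContinuous_snd
  have hip := ip_uc.comp hf
  have hU : UCover fun i : Fin 2 => {x : (Circle × PVec n) × PVec n |
      -(1 / 2 : ℝ) ≤ ![‖ip (x.1.2, x.2)‖ ^ 2 - 3 / 4, -‖ip (x.1.2, x.2)‖ ^ 2] i} := by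
    refine UCover.of_fun (f := fun (i : Fin 2) (x : (Circle × PVec n) × PVec n) =>
      ![‖ip (x.1.2, x.2)‖ ^ 2 - 3 / 4, -‖ip (x.1.2, x.2)‖ ^ 2] i)
      (Fin.forall_fin_two.2 ⟨?_, ?_⟩) (show -(1 / 2 : ℝ) < -(3 / 8) by norm_num) fun x => ?_
    · exact hip.sub uniformContinuous_const
    · exact hip.neg
    · rcases le_total (3 / 8) (‖ip (x.1.2, x.2)‖ ^ 2) with h | h
      · exact ⟨0, show -(3 / 8 : ℝ) ≤ ‖ip (x.1.2, x.2)‖ ^ 2 - 3 / 4 by linarith⟩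
      · exact ⟨1, neg_le_neg h⟩
  have hcov : UCover ![{x : (Circle × PVec n) × PVec n | -(1 / 2 : ℝ) ≤ ‖ip (x.1.2, x.2)‖ ^ 2 - 3 / 4},
      {x | -(1 / 2 : ℝ) ≤ -‖ip (x.1.2, x.2)‖ ^ 2}] := by
    convert hU using 1
    funext i
    fin_cases i <;> rfl
  refine HH.mul_eq_zero_of_cover hcov ?_ ?_
  · set S := {x : (Circle × PVec n) × PVec n | -(1 / 2 : ℝ) ≤ ‖ip (x.1.2, x.2)‖ ^ 2 - 3 / 4} with hS
    have hval : UniformContinuous (Subtype.val : S → _) := uniformContinuous_subtype_val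
    have h1 : UniformContinuous fun x : S => x.1.1.2 := (uniformContinuous_fst.comp hf).comp hval
    have h2 : UniformContinuous fun x : S => x.1.2 := uniformContinuous_snd.comp hval
    have e := cc_eq_zero k ((ip_ps.comap hf).comap hval) ⟨1 / 2, by norm_num, fun x => by
      have : -(1 / 2 : ℝ) ≤ ‖ip (x.1.1.2, x.1.2)‖ ^ 2 - 3 / 4 := x.2
      nlinarith [norm_nonneg (ip (x.1.1.2, x.1.2))]⟩
    rw [cc_add k (PVec.phase.comap h1).neg (PVec.phase.comap h2), cc_neg k (PVec.phase.comap h1),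
      ← pull_cc k PVec.phase h1, ← pull_cc k PVec.phase h2] at e
    rw [HH.res, map_sub, HH.fst, HH.snd, xx, HH.snd, HH.pull_pull, HH.pull_pull, HH.pull_pull,
      ← neg_eq_zero, neg_sub, sub_eq_neg_add]
    exact e
  · rw [HH.res, dg, pull_Delta k urefl_pm.vsec_snd.sec PVec.vsec_snd.sec]
    refine Delta_line k (urefl_pm.vsec_snd.comap uniformContinuous_subtype_val)
      (PVec.vsec_snd.comap uniformContinuous_subtype_val) fun x => ?_
    have h : -(1 / 2 : ℝ) ≤ -‖ip (x.1.1.2, x.1.2)‖ ^ 2 := x.2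
    have := re_rfn_mulVec x.1.1.1 x.1.1.2 x.1.2 (neg_le_neg_iff.1 h)
    exact this

end

end

section

open Uniformity DGRing Matrix

/-- The standard basis vectors. -/
noncomputable def eb (n : ℕ) (j : Fin n) : PVec n := ⟨Pi.single j 1, by
  rw [Finset.sum_eq_single j (fun i _ h => by simp [h]) (by simp)]
  simp⟩

section

variable {q N : ℕ} [Fact q.Prime]

theorem HH.int_of_pull_unit {X : Type*} [UniformSpace X] {m : ℕ}
    (h : (m : HH (ZMod q) Unit) = 0) : (m : HH (ZMod q) X) = 0 := by
  have : HH.pull (fun _ : X => ()) uniformContinuous_const (m : HH (ZMod q) Unit) = 0 := by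
    rw [h, map_zero]
  rwa [map_natCast] at this

theorem pull_urefl {A : Type*} [UniformSpace A] {l : A → Circle} (hl : UniformContinuous l) {n : ℕ}
    {L : A → PVec n} (hL : UniformContinuous L) (k : Type*) [CommRing k] :
    HH.pull (fun x : A × PVec n => ((l x.1, L x.1), x.2))
      (((hl.prodMk hL).comp uniformContinuous_fst).prodMk uniformContinuous_snd) (dg k (urefl n)) =
    dg k fun a => rfn (l a) (L a) :=
  pull_dg k urefl_pm (hl.prodMk hL)

theorem HH.pull_repr {k : Type*} [CommRing k] {A B : Type*} [UniformSpace A] [UniformSpace B]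
    {f : B → A} (hf : UniformContinuous f) (z : Fin (N + 1) → HH k A) :
    HH.pull (fun x : B × PVec (N + 1) => (f x.1, x.2))
      ((hf.comp uniformContinuous_fst).prodMk uniformContinuous_snd)
      (∑ j : Fin (N + 1), HH.fst (z j) * HH.snd (hP k (N + 1)) ^ (j : ℕ)) =
    ∑ j : Fin (N + 1), HH.fst (HH.pull f hf (z j)) * HH.snd (hP k (N + 1)) ^ (j : ℕ) := by
  rw [map_sum]
  refine Finset.sum_congr rfl fun j _ => ?_
  rw [map_mul, map_pow, HH.fst, HH.snd, HH.pull_pull, HH.pull_pull, HH.fst, HH.pull_pull]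
  rfl

theorem HH.coeff_shift {k : Type*} [CommRing k] {A : Type*} [UniformSpace A]
    (hN : ∀ i, 0 < i → i ≤ N → NInv k i) (z : Fin (N + 1) → HH k A) {x : HH k A}
    (h : (HH.fst x - HH.snd (hP k (N + 1))) *
      ∑ j : Fin (N + 1), HH.fst (z j) * HH.snd (hP k (N + 1)) ^ (j : ℕ) = 0) (j : Fin (N + 1)) :
    z j = x ^ (N - j : ℕ) * z (Fin.last N) := by
  set H := HH.snd (A := A) (hP k (N + 1)) with hH
  have hpow : H ^ (N + 1) = 0 := by rw [hH, ← map_pow, hP_pow, map_zero]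
  have e : ∑ j : Fin (N + 1), HH.fst (x * z j - Fin.cons (α := fun _ => HH k A) 0 (fun i : Fin N => z i.castSucc) j) * H ^ (j : ℕ) = 0 := by
    rw [sub_mul, sub_eq_zero] at h
    have h2 : H * ∑ j : Fin (N + 1), HH.fst (z j) * H ^ (j : ℕ) =
        ∑ j : Fin (N + 1), HH.fst (Fin.cons (α := fun _ => HH k A) 0 (fun i : Fin N => z i.castSucc) j) * H ^ (j : ℕ) := by
      have hc : ∀ a : HH k (A × PVec (N + 1)), H * a = a * H := fun a => HH.snd_hP_commute a
      rw [hc, Finset.sum_mul, Fin.sum_univ_castSucc, Fin.sum_univ_succ]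
      simp only [Fin.cons_zero, Fin.cons_succ, map_zero, zero_mul, zero_add, Fin.val_last, mul_assoc,
        ← pow_succ, hpow, mul_zero, add_zero, Fin.val_castSucc, Fin.val_succ]
    simp only [map_sub, sub_mul, Finset.sum_sub_distrib, map_mul, mul_assoc, ← Finset.mul_sum]
    rw [h, ← h2, sub_self]
  have c := HH.coeff_eq_zero hN _ e
  have c' : ∀ i : Fin N, z i.castSucc = x * z i.succ := fun i => by
    have := c i.succ
    rw [Fin.cons_succ, sub_eq_zero] at this
    exact this.symm
  induction j using Fin.reverseInduction with
  | last => simp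
  | cast i ih =>
    rw [c', ih, ← mul_assoc, ← pow_succ']
    congr 2
    simp only [Fin.val_succ, Fin.val_castSucc]
    omega

theorem dg_rfn_zero {A : Type*} [UniformSpace A] {l : A → Circle} (hl : UniformContinuous l)
    (k : Type*) [CommRing k] :
    dg k (fun a => rfn (l a) (eb (N + 1) 0)) =
      HH.fst (-tau k l hl) * HH.snd (hP k (N + 1)) ^ N := by
  have h : ∀ (x : A × PVec (N + 1)) i, ((rfn (l x.1) (eb (N + 1) 0)).1 *ᵥ x.2.v) i =
      if i = 0 then l x.1 * x.2.v i else x.2.v i := fun x i => by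
    have e : star (eb (N + 1) 0).v ⬝ᵥ x.2.v = x.2.v 0 := by
      simp [eb]
    rw [rfn_mulVec, e]
    by_cases h : i = 0
    · subst h; simp [eb]; ring
    · simp [h, eb]
  rw [dg, Delta_shift k PVec.vsec_snd.sec
    ((PM.rfn hl (uniformContinuous_const (b := eb (N + 1) 0))).vsec_snd).sec (l := fun x => l x.1)
    (hl.comp uniformContinuous_fst) (fun x => by simp [h]) (fun x i => by simp [h]),
    ← cc_eq k PVec.vsec_snd.sec.phase, ← pull_cc k PVec.phase uniformContinuous_snd, map_neg, HH.fst,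
    pull_tau]
  rfl

open Polynomial in
theorem exists_beta (hN : ∀ i, 0 < i → i ≤ N → NInv (ZMod q) i) :
    ∃ β : ℤ[X], β.coeff 0 = -1 ∧ ∀ (A : Type) [UniformSpace A] (l : A → Circle)
      (hl : UniformContinuous l) (L : A → PVec (N + 1)) (hU : UniformContinuous L),
      dg (ZMod q) (fun a => rfn (l a) (L a)) =
        ∑ j : Fin (N + 1), HH.fst (tau (ZMod q) l hl *
          aeval (hL (ZMod q) L hU) ((X : ℤ[X]) ^ (N - j : ℕ) * β)) * HH.snd (hP (ZMod q) (N + 1)) ^ (j : ℕ) := by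
  have : NeZero q := ⟨(Fact.out : q.Prime).ne_zero⟩
  obtain ⟨z, hz⟩ := HH.exists_repr N hN (dg (ZMod q) (urefl (N + 1)))
  have hrel := sub_mul_dg_urefl (ZMod q) (n := N + 1)
  rw [hz] at hrel
  have hz' := HH.coeff_shift hN z hrel
  obtain ⟨s, hs⟩ := HH.exists_repr N hN (z (Fin.last N))
  choose m n hmn using fun l => HH.circle_eq (s l)
  have key : ∀ (A : Type) [UniformSpace A] (l : A → Circle) (hl : UniformContinuous l)
      (L : A → PVec (N + 1)) (hU : UniformContinuous L),
      dg (ZMod q) (fun a => rfn (l a) (L a)) = ∑ j : Fin (N + 1), HH.fst (hL (ZMod q) L hU ^ (N - j : ℕ) *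
        ∑ i : Fin (N + 1), ((m i : HH (ZMod q) A) + tau (ZMod q) l hl * (n i : HH (ZMod q) A)) *
          hL (ZMod q) L hU ^ (i : ℕ)) * HH.snd (hP (ZMod q) (N + 1)) ^ (j : ℕ) := by
    intro A _ l hl L hU
    rw [← pull_urefl hl hU, hz, HH.pull_repr (hl.prodMk hU)]
    refine Finset.sum_congr rfl fun j _ => ?_
    have e : ∀ i, HH.pull (fun a => (l a, L a)) (hl.prodMk hU) (HH.fst (s i)) =
        (m i : HH (ZMod q) A) + tau (ZMod q) l hl * (n i : HH (ZMod q) A) := fun i => by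
      rw [hmn, HH.fst, HH.pull_pull, map_add, map_mul, map_natCast, map_natCast, pull_tau]
      rfl
    have hx : HH.pull (fun a => (l a, L a)) (hl.prodMk hU) (xx (ZMod q) (N + 1)) =
        hL (ZMod q) L hU := HH.pull_pull _ _ _ _ _
    have hx' : HH.pull (fun a => (l a, L a)) (hl.prodMk hU) (HH.snd (hP (ZMod q) (N + 1))) =
        hL (ZMod q) L hU := hx
    rw [hz', hs, map_mul, map_pow, hx, map_sum]
    simp only [map_mul _ (HH.fst (s _)), map_pow, e, hx']
  have hm : ∀ i, ∀ (X : Type) [UniformSpace X], (m i : HH (ZMod q) X) = 0 := by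
    intro i X _
    refine HH.int_of_pull_unit ?_
    have h0 := key (Unit × PVec (N + 1)) (fun _ => 1) uniformContinuous_const Prod.snd uniformContinuous_snd
    simp only [rfn_one, dg_one, tau_const, zero_mul, add_zero] at h0
    have h1 := HH.coeff_eq_zero hN _ h0.symm (Fin.last N)
    simp only [Fin.val_last, Nat.sub_self, pow_zero, one_mul] at h1
    have h2 : ∑ i : Fin (N + 1), HH.fst (m i : HH (ZMod q) Unit) *
        HH.snd (hP (ZMod q) (N + 1)) ^ (i : ℕ) = 0 := by
      rw [← h1]
      refine Finset.sum_congr rfl fun i _ => ?_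
      rw [map_natCast]
      rfl
    exact HH.coeff_eq_zero hN _ h2 i
  have hn0 : ∀ (A : Type) [UniformSpace A] (l : A → Circle) (hl : UniformContinuous l),
      tau (ZMod q) l hl * (n 0 : HH (ZMod q) A) = -tau (ZMod q) l hl := by
    intro A _ l hl
    have h0 := key A l hl (fun _ => eb (N + 1) 0) uniformContinuous_const
    have h1 : hL (ZMod q) (fun _ : A => eb (N + 1) 0) uniformContinuous_const = 0 := by
      rw [hL_eq]
      exact cc_eq_zero _ (((PS.const (1 : ℂ))).congr fun _ _ => (pph_self _).symm)
        ⟨1, one_pos, fun _ => by simp⟩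
    rw [dg_rfn_zero hl, h1, ← sub_eq_zero] at h0
    set a : Fin (N + 1) → HH (ZMod q) A := fun j => (0 : HH (ZMod q) A) ^ (N - j : ℕ) *
        ∑ i : Fin (N + 1), ((m i : HH (ZMod q) A) + tau (ZMod q) l hl * (n i : HH (ZMod q) A)) *
          (0 : HH (ZMod q) A) ^ (i : ℕ) with ha
    have h2 : ∑ j : Fin (N + 1), HH.fst ((Pi.single (Fin.last N) (-tau (ZMod q) l hl) : Fin (N + 1) → _) j - a j) *
        HH.snd (hP (ZMod q) (N + 1)) ^ (j : ℕ) = 0 := by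
      rw [← h0]
      simp only [map_sub, sub_mul, Finset.sum_sub_distrib]
      congr 1
      rw [Finset.sum_eq_single (Fin.last N) (fun j _ hj => by simp [hj]) (by simp)]
      simp
    have h3 := HH.coeff_eq_zero hN _ h2 (Fin.last N)
    rw [Pi.single_eq_same, sub_eq_zero, ha] at h3
    rw [h3]
    simp only [Fin.val_last, Nat.sub_self, pow_zero, one_mul]
    rw [Finset.sum_eq_single 0 (fun i _ hi => by
      rw [zero_pow (fun h => hi (Fin.ext h)), mul_zero]) (by simp)]
    simp [hm]
  refine ⟨∑ i : Fin (N + 1), C (if (i : ℕ) = 0 then -1 else (n i : ℤ)) * X ^ (i : ℕ), ?_, ?_⟩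
  · rw [finsetSum_coeff, Finset.sum_eq_single 0 (fun i _ hi => by
      rw [coeff_C_mul_X_pow, if_neg fun h => hi (Fin.ext h.symm)]) (by simp)]
    simp
  · intro A _ l hl L hU
    rw [key A l hl L hU]
    refine Finset.sum_congr rfl fun j _ => ?_
    congr 2
    rw [map_mul (aeval _), map_pow (aeval _), aeval_X, map_sum (aeval _), ← mul_assoc,
      ← ((hL_commute L hU (tau (ZMod q) l hl)).pow_left _).eq, mul_assoc]
    congr 1
    rw [Finset.mul_sum]
    refine Finset.sum_congr rfl fun i _ => ?_
    rw [hm, zero_add, map_mul, map_pow, aeval_X, aeval_C, ← mul_assoc]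
    congr 1
    by_cases hi : i = 0
    · subst hi
      simp [hn0]
    · have : (i : ℕ) ≠ 0 := fun h => hi (Fin.ext h)
      simp [this]

end

end

section

open Uniformity DGRing Matrix

section Estimates

variable {E : Type*} [NormedAddCommGroup E] [InnerProductSpace ℂ E]

open scoped InnerProductSpace

theorem re_one_sub_inner {w e : E} (hw : ‖w‖ = 1) (he : ‖e‖ = 1) :
    1 - (⟪w, e⟫_ℂ).re = ‖w - e‖ ^ 2 / 2 := by
  have := norm_sub_sq (𝕜 := ℂ) w e
  rw [this, hw, he]
  simp
  ring

variable {V W e w : E} {a : ℂ} {η : ℝ}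

theorem line_estimate_one (hV : ⟪V, e⟫_ℂ = 0) (hW : ⟪W, w⟫_ℂ = 0) (hw : ‖w‖ = 1) (he : ‖e‖ = 1)
    (ha : ‖V‖ ^ 2 + ‖a‖ ^ 2 = 1) (hη : ‖W - V‖ ≤ η) (hu : 24 * η ≤ ‖w - e‖ ^ 2) :
    ‖w - e‖ ^ 2 / 8 ≤ (⟪W + a • w, V + a • (w - e)⟫_ℂ).re := by
  have hV1 : ‖V‖ ≤ 1 := by nlinarith [norm_nonneg V, sq_nonneg ‖a‖]
  have ha1 : ‖a‖ ≤ 1 := by nlinarith [norm_nonneg a, sq_nonneg ‖V‖]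
  have hη0 : 0 ≤ η := (norm_nonneg _).trans hη
  have e1 : ⟪W + a • w, V + a • (w - e)⟫_ℂ =
      ((‖V‖ ^ 2 : ℝ) : ℂ) + ⟪W - V, V⟫_ℂ - a * ⟪W - V, e⟫_ℂ - star a * ⟪w, W - V⟫_ℂ +
        ((‖a‖ ^ 2 : ℝ) : ℂ) * (1 - ⟪w, e⟫_ℂ) := by
    have h1 : ⟪w, w⟫_ℂ = 1 := by rw [inner_self_eq_norm_sq_to_K, hw]; simp
    have h2 : ⟪V, V⟫_ℂ = ((‖V‖ ^ 2 : ℝ) : ℂ) := by rw [inner_self_eq_norm_sq_to_K]; norm_cast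
    have h3 : ⟪w, W⟫_ℂ = 0 := inner_eq_zero_symm.1 hW
    have h4 : ((‖a‖ ^ 2 : ℝ) : ℂ) = star a * a := by push_cast; exact (Complex.conj_mul' a).symm
    rw [h4, ← h2]
    simp only [inner_add_left, inner_add_right, inner_smul_left, inner_smul_right, inner_sub_left,
      inner_sub_right, h1, h3, hW, hV, starRingEnd_apply]
    ring
  have b1 : |(⟪W - V, V⟫_ℂ).re| ≤ η := (Complex.abs_re_le_norm _).trans
    ((norm_inner_le_norm _ _).trans (by nlinarith [norm_nonneg V, norm_nonneg (W - V)]))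
  have b2 : |(a * ⟪W - V, e⟫_ℂ).re| ≤ η := (Complex.abs_re_le_norm _).trans (by
    have := norm_inner_le_norm (𝕜 := ℂ) (W - V) e
    rw [norm_mul]
    rw [he, mul_one] at this
    nlinarith [norm_nonneg a, norm_nonneg (⟪W - V, e⟫_ℂ)])
  have b3 : |(star a * ⟪w, W - V⟫_ℂ).re| ≤ η := (Complex.abs_re_le_norm _).trans (by
    have := norm_inner_le_norm (𝕜 := ℂ) w (W - V)
    rw [norm_mul, norm_star]
    rw [hw, one_mul] at this
    nlinarith [norm_nonneg a, norm_nonneg (⟪w, W - V⟫_ℂ)])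
  have b4 : ‖w - e‖ ≤ 2 := (norm_sub_le _ _).trans (by rw [hw, he]; norm_num)
  have b5 := re_one_sub_inner hw he
  rw [e1, Complex.add_re, Complex.sub_re, Complex.sub_re, Complex.add_re, Complex.ofReal_re,
    Complex.re_ofReal_mul, Complex.sub_re, Complex.one_re, b5]
  rw [abs_le] at b1 b2 b3
  have b6 : ‖w - e‖ ^ 2 ≤ 4 := by nlinarith [norm_nonneg (w - e)]
  have : 0 ≤ ‖V‖ ^ 2 * (1 - ‖w - e‖ ^ 2 / 4) := mul_nonneg (sq_nonneg _) (by linarith)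
  nlinarith [sq_nonneg ‖a‖, sq_nonneg ‖w - e‖, mul_nonneg (sq_nonneg ‖a‖) (sq_nonneg ‖w - e‖)]

theorem line_estimate_two (hV : ⟪V, e⟫_ℂ = 0) (hW : ⟪W, w⟫_ℂ = 0) (hw : ‖w‖ = 1) (he : ‖e‖ = 1)
    (ha : ‖V‖ ^ 2 + ‖a‖ ^ 2 = 1) (hη : ‖W - V‖ ≤ η) (hu : 24 * η ≤ ‖w - e‖ ^ 2) :
    0 ≤ (⟪V + a • (w - e), V + a • (-e)⟫_ℂ).re := by
  have ha1 : ‖a‖ ≤ 1 := by nlinarith [norm_nonneg a, sq_nonneg ‖V‖]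
  have hη0 : 0 ≤ η := (norm_nonneg _).trans hη
  have e1 : ⟪V + a • (w - e), V + a • (-e)⟫_ℂ =
      ((‖V‖ ^ 2 : ℝ) : ℂ) - star a * ⟪w, W - V⟫_ℂ + ((‖a‖ ^ 2 : ℝ) : ℂ) * (1 - ⟪w, e⟫_ℂ) := by
    have h1 : ⟪e, e⟫_ℂ = 1 := by rw [inner_self_eq_norm_sq_to_K, he]; simp
    have h2 : ⟪V, V⟫_ℂ = ((‖V‖ ^ 2 : ℝ) : ℂ) := by rw [inner_self_eq_norm_sq_to_K]; norm_cast
    have h3 : ⟪w, W⟫_ℂ = 0 := inner_eq_zero_symm.1 hW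
    have h5 : ⟪e, V⟫_ℂ = 0 := inner_eq_zero_symm.1 hV
    have h4 : ((‖a‖ ^ 2 : ℝ) : ℂ) = star a * a := by push_cast; exact (Complex.conj_mul' a).symm
    rw [h4, ← h2]
    simp only [inner_add_left, inner_add_right, inner_smul_left, inner_smul_right, inner_sub_left,
      inner_sub_right, inner_neg_right, h1, h3, h5, hV, starRingEnd_apply]
    ring
  have b3 : |(star a * ⟪w, W - V⟫_ℂ).re| ≤ η := (Complex.abs_re_le_norm _).trans (by
    have := norm_inner_le_norm (𝕜 := ℂ) w (W - V)
    rw [norm_mul, norm_star]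
    rw [hw, one_mul] at this
    nlinarith [norm_nonneg a, norm_nonneg (⟪w, W - V⟫_ℂ)])
  have b4 : ‖w - e‖ ≤ 2 := (norm_sub_le _ _).trans (by rw [hw, he]; norm_num)
  have b5 := re_one_sub_inner hw he
  rw [e1, Complex.add_re, Complex.sub_re, Complex.ofReal_re,
    Complex.re_ofReal_mul, Complex.sub_re, Complex.one_re, b5]
  rw [abs_le] at b3
  have b6 : ‖w - e‖ ^ 2 ≤ 4 := by nlinarith [norm_nonneg (w - e)]
  have : 0 ≤ ‖V‖ ^ 2 * (1 - ‖w - e‖ ^ 2 / 4) := mul_nonneg (sq_nonneg _) (by linarith)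
  nlinarith [sq_nonneg ‖a‖, sq_nonneg ‖w - e‖, mul_nonneg (sq_nonneg ‖a‖) (sq_nonneg ‖w - e‖)]

theorem inner_add_smul_smul (hV : ⟪V, e⟫_ℂ = 0) (he : ‖e‖ = 1) (y z : ℂ) :
    ⟪V + a • (y • e), V + a • (z • e)⟫_ℂ = ((‖V‖ ^ 2 : ℝ) : ℂ) + ((‖a‖ ^ 2 : ℝ) : ℂ) * (star y * z) := by
  have h1 : ⟪e, e⟫_ℂ = 1 := by rw [inner_self_eq_norm_sq_to_K, he]; simp
  have h2 : ⟪V, V⟫_ℂ = ((‖V‖ ^ 2 : ℝ) : ℂ) := by rw [inner_self_eq_norm_sq_to_K]; norm_cast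
  have h5 : ⟪e, V⟫_ℂ = 0 := inner_eq_zero_symm.1 hV
  have h4 : ((‖a‖ ^ 2 : ℝ) : ℂ) = star a * a := by push_cast; exact (Complex.conj_mul' a).symm
  rw [h4, ← h2]
  simp only [inner_add_left, inner_add_right, inner_smul_left, inner_smul_right, h1, h5, hV,
    starRingEnd_apply]
  ring

theorem norm_add_smul_sq (hV : ⟪V, e⟫_ℂ = 0) : ‖V + a • e‖ ^ 2 = ‖V‖ ^ 2 + ‖a‖ ^ 2 * ‖e‖ ^ 2 := by
  rw [norm_add_sq (𝕜 := ℂ), inner_smul_right, hV, norm_smul, mul_pow]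
  simp

end Estimates

section Cover

theorem UCover.of_first_large {X : Type*} [UniformSpace X] {n : ℕ} {u : Fin n → X → ℝ}
    (hu : ∀ i, UniformContinuous (u i)) {t : Fin n → ℝ} (ht : ∀ i, 0 < t i)
    (h : ∀ x, ∃ i, t i ≤ u i x) :
    UCover fun j => {x | t j / 2 ≤ u j x ∧ ∀ i < j, u i x ≤ 3 / 2 * t i} := by
  refine ⟨⋂ i, {z : X × X | |u i z.1 - u i z.2| < t i / 2}, ?_, ?_⟩
  · refine Filter.iInter_mem.2 fun i => ?_
    exact (hu i) (Metric.dist_mem_uniformity (half_pos (ht i)))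
  · rintro A ⟨x, hx⟩ hA
    have hlt : ∀ y ∈ A, ∀ i, |u i x - u i y| < t i / 2 := fun y hy i =>
      Set.mem_iInter.1 (hA (Set.mk_mem_prod hx hy)) i
    classical
    obtain ⟨j, hj, hmin⟩ := WellFounded.has_min (wellFounded_lt (α := Fin n)) {i | t i ≤ u i x} (h x)
    refine ⟨j, fun y hy => ⟨?_, fun i hi => ?_⟩⟩
    · have := abs_lt.1 (hlt y hy j)
      have hj : t j ≤ u j x := hj
      linarith
    · have := abs_lt.1 (hlt y hy i)
      have : ¬ t i ≤ u i x := fun h => hmin i h hi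
      linarith

theorem exists_thresholds (n : ℕ) {c K : ℝ} (hc : 0 < c) (hK : 0 < K) :
    ∃ t : Fin n → ℝ, (∀ i, 0 < t i) ∧ (∀ i, t i ≤ c) ∧ ∀ i j, i < j → K * t i ≤ t j ^ 2 := by
  set δ := min (min c 1) K⁻¹ with hδ
  have h0 : 0 < δ := lt_min (lt_min hc one_pos) (inv_pos.2 hK)
  have h1 : δ ≤ 1 := (min_le_left _ _).trans (min_le_right _ _)
  refine ⟨fun i => δ ^ 3 ^ (n - i : ℕ), fun i => pow_pos h0 _, fun i => ?_, fun i j hij => ?_⟩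
  · exact (pow_le_of_le_one h0.le h1 (by positivity)).trans ((min_le_left _ _).trans (min_le_left _ _))
  · have e : 2 * 3 ^ (n - j : ℕ) + 1 ≤ 3 ^ (n - i : ℕ) := by
      have : 3 ^ (n - j : ℕ) * 3 ≤ 3 ^ (n - i : ℕ) := by
        rw [← pow_succ]
        exact Nat.pow_le_pow_right (by norm_num) (by have := j.2; omega)
      have : 0 < 3 ^ (n - j : ℕ) := by positivity
      omega
    have : δ ^ 3 ^ (n - i : ℕ) ≤ δ ^ (2 * 3 ^ (n - j : ℕ) + 1) := pow_le_pow_of_le_one h0.le h1 e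
    calc K * δ ^ 3 ^ (n - i : ℕ) ≤ K * δ ^ (2 * 3 ^ (n - j : ℕ) + 1) := by gcongr
      _ = K * δ * (δ ^ 3 ^ (n - j : ℕ)) ^ 2 := by rw [pow_succ, mul_comm 2, pow_mul]; ring
      _ ≤ 1 * (δ ^ 3 ^ (n - j : ℕ)) ^ 2 := by
        gcongr
        calc K * δ ≤ K * K⁻¹ := by gcongr; exact min_le_right _ _
          _ = 1 := mul_inv_cancel₀ hK.ne'
      _ = _ := one_mul _

end Cover

end

section

open Uniformity DGRing Matrix

section

variable {A : Type*} [UniformSpace A] {m n : ℕ}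

theorem inner_toLp (s s' : Fin n → ℂ) : inner ℂ (WithLp.toLp 2 s) (WithLp.toLp 2 s') = ∑ i, s' i * star (s i) := by
  rw [PiLp.inner_apply]
  rfl

theorem norm_toLp_sq (s : Fin n → ℂ) : ‖WithLp.toLp 2 s‖ ^ 2 = ∑ i, ‖s i‖ ^ 2 := EuclideanSpace.norm_sq_eq _

/-- The linear combination of vectors with the coefficients of a point of projective space. -/
def comb (c : Fin m → A → Fin n → ℂ) (x : A × PVec m) : Fin n → ℂ := ∑ i, x.2.v i • c i x.1

theorem comb_ps {c : Fin m → A → Fin n → ℂ} (hc : ∀ i l, PS (fun _ _ => 0) fun x => c i x l) (l : Fin n) :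
    PS (fun x y : A × PVec m => pph m x.2 y.2) fun x => comb c x l := by
  refine (PS.sum Finset.univ fun i _ => (((PVec.ps i).comap uniformContinuous_snd).mul
    ((hc i l).comap uniformContinuous_fst)).congr fun _ _ => add_zero _).congr_fun fun x => ?_
  simp [comb, Finset.sum_apply]

/-- The line combination of a frame with a last vector. -/
def snocFrame (b : Fin m → Fin n → ℂ) (d : A → Fin n → ℂ) : Fin (m + 1) → A → Fin n → ℂ :=
  Fin.snoc (α := fun _ => A → Fin n → ℂ) (fun i _ => b i) d

theorem comb_snocFrame (b : Fin m → Fin n → ℂ) (d : A → Fin n → ℂ) (x : A × PVec (m + 1)) :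
    comb (snocFrame b d) x = ∑ i : Fin m, x.2.v i.castSucc • b i + x.2.v (Fin.last m) • d x.1 := by
  simp [comb, snocFrame, Fin.sum_univ_castSucc]

theorem snocFrame_ps (b : Fin m → Fin n → ℂ) {d : A → Fin n → ℂ}
    (hd : ∀ l, PS (fun _ _ => 0) fun x => d x l) (i : Fin (m + 1)) (l : Fin n) :
    PS (fun _ _ => 0) fun x => snocFrame b d i x l := by
  induction i using Fin.lastCases with
  | last => simpa [snocFrame] using hd l
  | cast i => simpa [snocFrame] using PS.const (b i l)

theorem sum_smul_norm_sq {E : Type*} [NormedAddCommGroup E] [InnerProductSpace ℂ E] {b : Fin m → E}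
    (hb : Orthonormal ℂ b) (v : Fin m → ℂ) : ‖∑ i, v i • b i‖ ^ 2 = ∑ i, ‖v i‖ ^ 2 := by
  rw [← inner_self_eq_norm_sq (𝕜 := ℂ), hb.inner_sum, map_sum]
  refine Finset.sum_congr rfl fun i _ => ?_
  rw [RCLike.conj_mul]
  norm_cast

theorem Delta_frame (k : Type*) [CommRing k] (b : Fin (m + 1) → Fin n → ℂ)
    (c : Fin (m + 1) → A → Fin n → ℂ) (hc : ∀ i l, PS (fun _ _ => 0) fun x => c i x l)
    (hb : Orthonormal ℂ fun i => WithLp.toLp 2 (b i)) (hcx : ∀ x, Orthonormal ℂ fun i => WithLp.toLp 2 (c i x))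
    {ρ : ℝ} (hρ : 0 < ρ) (h1 : ∀ x, ρ ≤ ‖WithLp.toLp 2 (c (Fin.last m) x - b (Fin.last m))‖ ^ 2)
    (h2 : ∀ x, 24 * ∑ i : Fin m, ‖WithLp.toLp 2 (c i.castSucc x - b i.castSucc)‖ ≤
      ‖WithLp.toLp 2 (c (Fin.last m) x - b (Fin.last m))‖ ^ 2) :
    VSec (fun x y : A × PVec (m + 1) => pph (m + 1) x.2 y.2) (comb c) ∧
    VSec (fun x y : A × PVec (m + 1) => pph (m + 1) x.2 y.2) (comb fun i _ => b i) ∧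
    Delta k (fun x y : A × PVec (m + 1) => pph (m + 1) x.2 y.2) (comb c) (comb fun i _ => b i) = 0 := by
  set e := b (Fin.last m) with he
  set b' : Fin m → Fin n → ℂ := fun i => b i.castSucc with hb'
  have hb'T : Orthonormal ℂ fun i => WithLp.toLp 2 (b' i) := hb.comp _ (Fin.castSucc_injective m)
  have hlast : (comb fun i (_ : A) => b i) = comb (snocFrame b' fun _ => (1 : ℂ) • e) := by
    congr 1
    funext i
    induction i using Fin.lastCases <;> simp [snocFrame, hb', he]
  have nT : ∀ y : ℂ, ∀ x : A × PVec (m + 1), WithLp.toLp 2 (comb (snocFrame b' fun _ => y • e) x) =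
      WithLp.toLp 2 (∑ i : Fin m, x.2.v i.castSucc • b' i) + x.2.v (Fin.last m) • (y • WithLp.toLp 2 e) := fun y x => by
    rw [comb_snocFrame]; rfl
  have hTV : ∀ x : A × PVec (m + 1), WithLp.toLp 2 (∑ i : Fin m, x.2.v i.castSucc • b' i) =
      ∑ i : Fin m, x.2.v i.castSucc • WithLp.toLp 2 (b' i) := fun x => by
    simp
  have hnV : ∀ x : A × PVec (m + 1), ‖WithLp.toLp 2 (∑ i : Fin m, x.2.v i.castSucc • b' i)‖ ^ 2 +
      ‖x.2.v (Fin.last m)‖ ^ 2 = 1 := fun x => by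
    rw [hTV, sum_smul_norm_sq hb'T, ← Fin.sum_univ_castSucc fun i => ‖x.2.v i‖ ^ 2]
    exact x.2.norm_sq
  have hVe : ∀ x : A × PVec (m + 1), inner ℂ (WithLp.toLp 2 (∑ i : Fin m, x.2.v i.castSucc • b' i)) (WithLp.toLp 2 e) = 0 := fun x => by
    rw [hTV, sum_inner]
    refine Finset.sum_eq_zero fun i _ => ?_
    rw [inner_smul_left, hb.2 (i := i.castSucc) (j := Fin.last m) (Fin.castSucc_lt_last i).ne, mul_zero]
  have hne : ‖WithLp.toLp 2 e‖ = 1 := hb.1 _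
  have V : ∀ y : ℂ, ‖y‖ = 1 → VSec (fun x z : A × PVec (m + 1) => pph (m + 1) x.2 z.2)
      (comb (snocFrame b' fun _ => y • e)) := fun y hy =>
    ⟨comb_ps (snocFrame_ps b' fun l => PS.const _), 1, one_pos, fun x => by
      rw [← norm_toLp_sq, nT]
      have hy' : inner ℂ (WithLp.toLp 2 (∑ i : Fin m, x.2.v i.castSucc • b' i)) (y • WithLp.toLp 2 e) = 0 := by
        rw [inner_smul_right, hVe, mul_zero]
      rw [norm_add_smul_sq hy', norm_smul, hy, hne, mul_one, one_pow, mul_one, hnV]⟩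
  have hFn : ∀ x : A × PVec (m + 1), WithLp.toLp 2 (comb c x) =
      WithLp.toLp 2 (∑ i : Fin m, x.2.v i.castSucc • c i.castSucc x.1) + x.2.v (Fin.last m) • WithLp.toLp 2 (c (Fin.last m) x.1) :=
    fun x => by
      rw [comb, Fin.sum_univ_castSucc]; rfl
  have S0 : VSec (fun x z : A × PVec (m + 1) => pph (m + 1) x.2 z.2) (comb c) :=
    ⟨comb_ps hc, 1, one_pos, fun x => by
      have h := sum_smul_norm_sq (hcx x.1) x.2.v
      rw [x.2.norm_sq] at h
      rw [← norm_toLp_sq, ← h]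
      refine le_of_eq ?_
      congr 2
      simp [comb]⟩
  have hWV : ∀ x : A × PVec (m + 1), ‖WithLp.toLp 2 (∑ i : Fin m, x.2.v i.castSucc • c i.castSucc x.1) -
      WithLp.toLp 2 (∑ i : Fin m, x.2.v i.castSucc • b' i)‖ ≤ ∑ i : Fin m, ‖WithLp.toLp 2 (c i.castSucc x.1 - b i.castSucc)‖ := by
    intro x
    have e1 : WithLp.toLp 2 (∑ i : Fin m, x.2.v i.castSucc • c i.castSucc x.1) -
      WithLp.toLp 2 (∑ i : Fin m, x.2.v i.castSucc • b' i) =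
      ∑ i : Fin m, x.2.v i.castSucc • WithLp.toLp 2 (c i.castSucc x.1 - b i.castSucc) := by
      simp [← Finset.sum_sub_distrib, smul_sub, hb']
    rw [e1]
    refine (norm_sum_le _ _).trans (Finset.sum_le_sum fun i _ => ?_)
    rw [norm_smul]
    have : ‖x.2.v i.castSucc‖ ^ 2 ≤ 1 := by
      rw [← x.2.norm_sq]
      exact Finset.single_le_sum (f := fun i => ‖x.2.v i‖ ^ 2) (fun i _ => sq_nonneg _) (Finset.mem_univ _)
    have : ‖x.2.v i.castSucc‖ ≤ 1 := by nlinarith [norm_nonneg (x.2.v i.castSucc)]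
    exact mul_le_of_le_one_left (norm_nonneg _) this
  have hWw : ∀ x : A × PVec (m + 1), inner ℂ (WithLp.toLp 2 (∑ i : Fin m, x.2.v i.castSucc • c i.castSucc x.1))
      (WithLp.toLp 2 (c (Fin.last m) x.1)) = 0 := fun x => by
    have : WithLp.toLp 2 (∑ i : Fin m, x.2.v i.castSucc • c i.castSucc x.1) =
        ∑ i : Fin m, x.2.v i.castSucc • WithLp.toLp 2 (c i.castSucc x.1) := by simp
    rw [this, sum_inner]
    refine Finset.sum_eq_zero fun i _ => ?_
    rw [inner_smul_left, (hcx x.1).2 (i := i.castSucc) (j := Fin.last m) (Fin.castSucc_lt_last i).ne, mul_zero]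
  have hT2 : ∀ x : A × PVec (m + 1), WithLp.toLp 2 (comb (snocFrame b' fun x => c (Fin.last m) x - e) x) =
      WithLp.toLp 2 (∑ i : Fin m, x.2.v i.castSucc • b' i) + x.2.v (Fin.last m) • (WithLp.toLp 2 (c (Fin.last m) x.1) - WithLp.toLp 2 e) := fun x => by
    rw [comb_snocFrame]; rfl
  have est1 := fun x : A × PVec (m + 1) => line_estimate_one (hVe x) (hWw x) ((hcx x.1).1 _) hne (hnV x) (hWV x) (h2 x.1)
  have est2 := fun x : A × PVec (m + 1) => line_estimate_two (hVe x) (hWw x) ((hcx x.1).1 _) hne (hnV x) (hWV x) (h2 x.1)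
  have S2 : VSec (fun x z : A × PVec (m + 1) => pph (m + 1) x.2 z.2)
      (comb (snocFrame b' fun x => c (Fin.last m) x - e)) := by
    refine ⟨comb_ps (snocFrame_ps b' fun l => ?_), (ρ / 8) ^ 2, by positivity, fun x => ?_⟩
    · exact ((hc (Fin.last m) l).sub (PS.const (e l)))
    · rw [← norm_toLp_sq, hT2]
      refine pow_le_pow_left₀ (by positivity) ?_ 2
      have h := (est1 x).trans ((Complex.re_le_norm _).trans (norm_inner_le_norm _ _))
      rw [← hFn] at h
      have h3 : ‖WithLp.toLp 2 (comb c x)‖ = 1 := by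
        have : ‖WithLp.toLp 2 (comb c x)‖ ^ 2 = 1 := by
          rw [← x.2.norm_sq, ← sum_smul_norm_sq (hcx x.1) x.2.v]
          congr 2
          simp [comb]
        rwa [pow_eq_one_iff_of_nonneg (norm_nonneg _) two_ne_zero] at this
      rw [h3, one_mul] at h
      refine le_trans ?_ h
      have := h1 x.1
      rw [WithLp.toLp_sub] at this
      linarith
  have hre : ∀ y z : ℂ, (star y * z).re = 0 ∨ star y * z = 1 → ∀ x : A × PVec (m + 1),
      0 ≤ (inner ℂ (WithLp.toLp 2 (comb (snocFrame b' fun _ => y • e) x)) (WithLp.toLp 2 (comb (snocFrame b' fun _ => z • e) x))).re := by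
    intro y z hyz x
    rw [nT, nT, inner_add_smul_smul (hVe x) hne, Complex.add_re, Complex.ofReal_re, Complex.re_ofReal_mul]
    rcases hyz with h | h <;> rw [h] <;> simp <;> positivity
  have L1 := Delta_line k S0 S2 fun x => by
    rw [← inner_toLp, hFn, hT2]
    exact le_trans (by positivity) (est1 x)
  have L2 := Delta_line k S2 (V (-1) (by simp)) fun x => by
    rw [← inner_toLp, nT, hT2, neg_smul, one_smul]
    exact est2 x
  have L3 := Delta_line k (V (-1) (by simp)) (V Complex.I (by simp)) fun x => by
    rw [← inner_toLp]
    exact hre _ _ (Or.inl (by simp)) x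
  have L4 := Delta_line k (V Complex.I (by simp)) (V 1 (by simp)) fun x => by
    rw [← inner_toLp]
    exact hre _ _ (Or.inl (by simp)) x
  rw [hlast]
  refine ⟨S0, V 1 (by simp), ?_⟩
  rw [← Delta_add k S0.sec S2.sec (V 1 (by simp)).sec, L1,
    ← Delta_add k S2.sec (V (-1) (by simp)).sec (V 1 (by simp)).sec, L2,
    ← Delta_add k (V (-1) (by simp)).sec (V Complex.I (by simp)).sec (V 1 (by simp)).sec, L3, L4]
  simp

end

section

variable {A : Type*} [UniformSpace A] {m N : ℕ} {k : Type*} [CommRing k]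

/-- The images of the basis vectors. -/
def PM.col {n : ℕ} (f : A → UG n) (i : Fin n) (x : A) : Fin n → ℂ := (f x).1 *ᵥ Pi.single i 1

theorem PM.col_apply {n : ℕ} (f : A → UG n) (i : Fin n) (x : A) (l : Fin n) :
    PM.col f i x l = (f x).1 l i := by simp [PM.col]

theorem UG.orthonormal_col {n : ℕ} (U : UG n) :
    Orthonormal ℂ fun i => WithLp.toLp 2 (U.1 *ᵥ (Pi.single i 1 : Fin n → ℂ)) := by
  rw [orthonormal_iff_ite]
  intro i j
  rw [inner_toLp]
  have : ∑ l, (U.1 *ᵥ Pi.single j 1) l * star ((U.1 *ᵥ Pi.single i 1) l) =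
      star (U.1 *ᵥ Pi.single i 1) ⬝ᵥ (U.1 *ᵥ (Pi.single j 1 : Fin n → ℂ)) :=
    Finset.sum_congr rfl fun i _ => mul_comm _ _
  rw [this, UG.star_mulVec_dotProduct]
  by_cases h : i = j
  · subst h; simp [Pi.star_single]
  · simp [h, Pi.star_single]

theorem HH.coeff_eq_zero_of_fix (hN : ∀ i, 0 < i → i ≤ N → NInv k i) {f : A → UG (N + 1)}
    (hf : PM (fun _ _ => 0) f) (z : Fin (N + 1) → HH k A)
    (hz : dg k f = ∑ j : Fin (N + 1), HH.fst (z j) * HH.snd (hP k (N + 1)) ^ (j : ℕ))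
    (hm : m + 1 ≤ N + 1) {ρ : ℝ} (hρ : 0 < ρ)
    (h1 : ∀ x, ρ ≤ ‖WithLp.toLp 2 (PM.col f (Fin.castLE hm (Fin.last m)) x - Pi.single (Fin.castLE hm (Fin.last m)) 1)‖ ^ 2)
    (h2 : ∀ x, 24 * ∑ i : Fin m, ‖WithLp.toLp 2 (PM.col f (Fin.castLE hm i.castSucc) x - Pi.single (Fin.castLE hm i.castSucc) 1)‖ ≤
      ‖WithLp.toLp 2 (PM.col f (Fin.castLE hm (Fin.last m)) x - Pi.single (Fin.castLE hm (Fin.last m)) 1)‖ ^ 2) :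
    z (Fin.castLE hm (Fin.last m)) = 0 := by
  have hb : Orthonormal ℂ fun i : Fin (m + 1) => WithLp.toLp 2 (Pi.single (Fin.castLE hm i) 1 : Fin (N + 1) → ℂ) := by
    have := (UG.orthonormal_col (1 : UG (N + 1))).comp _ (Fin.castLE_injective hm)
    convert this using 2 with i
    exact congrArg (WithLp.toLp 2) (Matrix.one_mulVec _).symm
  have hc : ∀ x, Orthonormal ℂ fun i : Fin (m + 1) => WithLp.toLp 2 (PM.col f (Fin.castLE hm i) x) := fun x =>
    (UG.orthonormal_col (f x)).comp _ (Fin.castLE_injective hm)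
  obtain ⟨S0, S5, hD⟩ := Delta_frame k (fun i : Fin (m + 1) => (Pi.single (Fin.castLE hm i) 1 : Fin (N + 1) → ℂ))
    (fun i => PM.col f (Fin.castLE hm i)) (fun i l => (hf l (Fin.castLE hm i)).congr_fun fun x => (PM.col_apply f _ x l).symm)
    hb hc hρ h1 h2
  have hunit : ∀ x : A × PVec (m + 1), ∑ l, ‖comb (fun i (_ : A) => (Pi.single (Fin.castLE hm i) 1 : Fin (N + 1) → ℂ)) x l‖ ^ 2 = 1 := by
    intro x
    rw [← norm_toLp_sq, ← x.2.norm_sq, ← sum_smul_norm_sq hb x.2.v]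
    congr 2
    simp [comb]
  have hv := fun x => S5.map_v_of_unit x (hunit x)
  have hF := uniformContinuous_fst.prodMk S5.map_uc
  have hx : HH.pull S5.map S5.map_uc (hP k (N + 1)) = HH.snd (hP k (m + 1)) :=
    S5.hL_map.trans (pull_cc k PVec.phase uniformContinuous_snd).symm
  have hsnd : HH.pull _ hF (HH.snd (hP k (N + 1))) = HH.snd (hP k (m + 1)) :=
    (HH.pull_pull _ _ _ _ _).trans hx
  have e1 : HH.pull _ hF (dg k f) = 0 := by
    have R := hf.vsec_snd.sec.comap hF
    have R' := PVec.vsec_snd.sec.comap hF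
    have e2 := pull_Delta k hf.vsec_snd.sec PVec.vsec_snd.sec hF
    have g5 : (fun x => (S5.map x).v) = comb fun i (_ : A) => (Pi.single (Fin.castLE hm i) 1 : Fin (N + 1) → ℂ) :=
      funext hv
    have g0 : (fun x : A × PVec (m + 1) => (f x.1).1 *ᵥ (S5.map x).v) = comb fun i => PM.col f (Fin.castLE hm i) := by
      funext x
      rw [hv, comb, comb, ← Matrix.mulVecLin_apply, map_sum]
      simp only [map_smul]
      rfl
    simp only [g5, g0] at R R' e2
    rw [dg, e2, ← Delta_phase k S0.sec S5.sec R R', hD]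
  have e3 : ∑ i : Fin (m + 1), HH.fst (z (Fin.castLE hm i)) * HH.snd (A := A) (hP k (m + 1)) ^ (i : ℕ) = 0 := by
    rw [← e1, hz, map_sum]
    refine Fintype.sum_of_injective _ (Fin.castLE_injective hm) _ _ (fun j hj => ?_) fun i => ?_
    · have hj' : m + 1 ≤ (j : ℕ) := by
        by_contra h
        exact hj ⟨⟨j, by omega⟩, rfl⟩
      rw [map_mul, map_pow, hsnd, ← map_pow, pow_eq_zero_of_le hj' (hP_pow k (m + 1)), map_zero, mul_zero]
    · rw [map_mul, map_pow, hsnd, HH.fst, HH.pull_pull]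
      rfl
  exact HH.coeff_eq_zero (fun i h0 hi => hN i h0 (by omega)) _ e3 (Fin.last m)

end

end

section

open Uniformity DGRing Matrix

section

variable {A : Type*} [UniformSpace A] {N : ℕ} {k : Type*} [CommRing k]

theorem UCover.rev {n : ℕ} {U : Fin n → Set A} (h : UCover U) : UCover fun i : Fin n => U i.rev := by
  obtain ⟨V, hV, H⟩ := h
  refine ⟨V, hV, fun S hS hSV => ?_⟩
  obtain ⟨i, hi⟩ := H S hS hSV
  exact ⟨i.rev, by simpa using hi⟩

/-- How far a family of matrices is from fixing a basis vector. -/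
noncomputable def PM.dev {n : ℕ} (f : A → UG n) (i : Fin n) (x : A) : ℝ :=
  ‖WithLp.toLp 2 (PM.col f i x - Pi.single i 1)‖

theorem PM.dev_uc {n : ℕ} {f : A → UG n} (hf : PM (fun _ _ => 0) f) (i : Fin n) :
    UniformContinuous (PM.dev f i) := by
  refine uniformContinuous_norm.comp ((PiLp.uniformContinuous_toLp 2 _).comp ?_)
  rw [uniformContinuous_pi]
  intro l
  have := ((hf l i).sub (PS.const ((Pi.single i 1 : Fin n → ℂ) l))).uc
  exact this.of_eq fun x => by simp [PM.col_apply]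

theorem HH.prod_coeff_eq_zero (hN : ∀ i, 0 < i → i ≤ N → NInv k i) {f : A → UG (N + 1)}
    (hf : PM (fun _ _ => 0) f) (z : Fin (N + 1) → HH k A)
    (hz : dg k f = ∑ j : Fin (N + 1), HH.fst (z j) * HH.snd (hP k (N + 1)) ^ (j : ℕ))
    {c : ℝ} (hc : 0 < c) (hfix : ∀ x, ∃ i : Fin N, c ≤ PM.dev f i.castSucc x) :
    (List.ofFn fun m : Fin N => z m.rev.castSucc).prod = 0 := by
  obtain ⟨t, ht0, htc, htt⟩ := exists_thresholds N hc (K := 144 * (N + 1)) (by positivity)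
  have hU := (UCover.of_first_large (u := fun i : Fin N => PM.dev f i.castSucc)
    (fun i => PM.dev_uc hf _) ht0 fun x => (hfix x).imp fun i hi => (htc i).trans hi).rev
  refine HH.prod_eq_zero hU fun i => ?_
  set j := i.rev
  set S := {x | t j / 2 ≤ PM.dev f j.castSucc x ∧ ∀ i < j, PM.dev f i.castSucc x ≤ 3 / 2 * t i} with hS
  have hval : UniformContinuous (Subtype.val : S → A) := uniformContinuous_subtype_val
  have hz' := pull_dg k hf hval
  rw [hz, HH.pull_repr hval] at hz'
  have hm : (j : ℕ) + 1 ≤ N + 1 := by omega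
  have hl : ∀ x : S, t j / 2 ≤ PM.dev f j.castSucc x := fun x => x.2.1
  refine HH.coeff_eq_zero_of_fix (m := j) hN (hf.comap hval) _ hz'.symm hm
    (ρ := (t j / 2) ^ 2) (by have := ht0 j; positivity) (fun x => ?_) (fun x => ?_)
  · exact pow_le_pow_left₀ (by have := ht0 j; positivity) (hl x) 2
  · have h1 : ∑ i : Fin j, PM.dev f (Fin.castLE hm i.castSucc) x.1 ≤
        ∑ i : Fin j, 3 / 2 * (t j ^ 2 / (144 * (N + 1))) := Finset.sum_le_sum fun i _ => by
      have hi : (⟨i, i.2.trans j.2⟩ : Fin N) < j := i.2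
      have := x.2.2 _ hi
      refine this.trans (mul_le_mul_of_nonneg_left ?_ (by norm_num))
      rw [le_div_iff₀ (by positivity), mul_comm]
      exact htt _ _ hi
    have h2 : (t j / 2) ^ 2 ≤ PM.dev f j.castSucc x.1 ^ 2 :=
      pow_le_pow_left₀ (by have := ht0 j; positivity) (hl x) 2
    rw [Finset.sum_const, Finset.card_univ, Fintype.card_fin, nsmul_eq_mul] at h1
    have h3 : (j : ℝ) * (3 / 2 * (t j ^ 2 / (144 * (N + 1)))) ≤ t j ^ 2 / 96 := by
      have hj : (j : ℝ) ≤ N + 1 := by exact_mod_cast (by omega : (j : ℕ) ≤ N + 1)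
      calc (j : ℝ) * (3 / 2 * (t j ^ 2 / (144 * (N + 1)))) ≤
          (N + 1 : ℝ) * (3 / 2 * (t j ^ 2 / (144 * (N + 1)))) := by gcongr
        _ = t j ^ 2 / 96 := by field_simp; ring
    refine le_trans ?_ h2
    refine le_trans (mul_le_mul_of_nonneg_left (h1.trans h3) (by norm_num)) ?_
    linarith

end

end

section

open Uniformity DGRing Matrix Polynomial

theorem Polynomial.exists_aeval_add {R : Type*} [Ring R] (x : R) {z : R} (hz : ∀ a, Commute z a) (P : ℤ[X]) :
    ∃ r, aeval (x + z) P = aeval x P + z * aeval x (derivative P) + z ^ 2 * r := by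
  induction P using Polynomial.induction_on with
  | C a => exact ⟨0, by simp⟩
  | add P Q hP hQ =>
    obtain ⟨r, hr⟩ := hP
    obtain ⟨r', hr'⟩ := hQ
    refine ⟨r + r', ?_⟩
    rw [map_add, map_add, map_add, map_add, hr, hr']
    noncomm_ring
  | monomial n a h =>
    obtain ⟨r, hr⟩ := h
    set P : ℤ[X] := C a * X ^ n with hP
    have e : (C a * X ^ (n + 1) : ℤ[X]) = P * X := by rw [hP, pow_succ, mul_assoc]
    refine ⟨aeval x (derivative P) + r * (x + z), ?_⟩
    have hd : derivative (P * X) = derivative P * X + P := by rw [derivative_mul, derivative_X, mul_one]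
    clear_value P
    have c1 : aeval x P * z = z * aeval x P := ((hz _).eq).symm
    have c2 : aeval x (derivative P) * z = z * aeval x (derivative P) := ((hz _).eq).symm
    have c3 : aeval x P * x * z = z * aeval x P * x := by rw [mul_assoc, ← (hz x).eq, ← mul_assoc, c1]
    simp only [e, map_mul, hr, hd, map_add, aeval_X, add_mul, mul_add, mul_assoc, c1, c2, sq]
    abel

section

variable {B D : Type*} [UniformSpace B] [UniformSpace D] {k : Type*} [CommRing k] {q : ℕ} [Fact q.Prime]

theorem cc_zsmul {φ : B → B → ℝ} (h : Phase φ) (m : ℤ) :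
    (cc k fun x y => m * φ x y) = (m : HH k B) * cc k φ := by
  obtain ⟨m, rfl | rfl⟩ := m.eq_nat_or_neg
  · simpa using cc_nsmul h m
  · have := cc_neg k (h.nsmul m)
    rw [cc_nsmul h] at this
    simpa using this

theorem Phase.zsmul {φ : B → B → ℝ} (h : Phase φ) (m : ℤ) : Phase fun x y => m * φ x y := by
  obtain ⟨m, rfl | rfl⟩ := m.eq_nat_or_neg
  · simpa using h.nsmul m
  · simpa using (h.nsmul m).neg

theorem HH.eq_zero_of_intCast_mul {z : ℤ} (hz : ¬ (q : ℤ) ∣ z) {a : HH (ZMod q) B}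
    (h : (z : HH (ZMod q) B) * a = 0) : a = 0 := by
  obtain ⟨u, v, e⟩ := ((Nat.prime_iff_prime_int.1 (Fact.out : q.Prime)).coprime_iff_not_dvd).2 hz
  have hq : ((q : ℕ) : HH (ZMod q) B) = 0 := by
    have := HH.natCast_eq (k := ZMod q) B (i := q) (j := 0) (by simp)
    simpa using this
  have e' : ((u * q + v * z : ℤ) : HH (ZMod q) B) = 1 := by rw [e, Int.cast_one]
  rw [Int.cast_add, Int.cast_mul, Int.cast_mul, Int.cast_natCast, hq, mul_zero, zero_add] at e'
  rw [← one_mul a, ← e', mul_assoc, h, mul_zero]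

theorem PM.phase {N : ℕ} {φ : B → B → ℝ} {b : B → UG (N + 1)} (h : PM φ b) : Phase φ := by
  have V : VSec (fun _ _ : B => 0) fun _ => (eb (N + 1) 0).v :=
    ⟨fun i => PS.const _, 1, one_pos, fun _ => (eb (N + 1) 0).norm_sq.ge⟩
  simpa using (h.vsec V).sec.phase

/-- A class all of whose pullbacks anticommute with the classes of circle valued functions. -/
def HH.Odd {D : Type} [UniformSpace D] (c : HH k D) : Prop :=
  ∀ (C : Type) [UniformSpace C] (g : C → D) (hg : UniformContinuous g) (l : C → Circle)
    (hl : UniformContinuous l), HH.pull g hg c * tau k l hl = -(tau k l hl * HH.pull g hg c)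

theorem prod_add_mul_tau {R ι : Type*} [Ring R] {t : R} (ht : t * t = 0) {a g : ι → R}
    (ha : ∀ i, a i * t = -(t * a i)) (hg : ∀ i x, Commute (g i) x) (l : List ι) :
    (l.map fun i => a i + t * g i).prod * t = (l.map a).prod * t := by
  have h1 : ∀ l : List ι, t * ((l.map a).prod * t) = 0 := fun l => by
    induction l with
    | nil => simpa using ht
    | cons i l ih =>
      rw [List.map_cons, List.prod_cons, mul_assoc, ← mul_assoc t, ← neg_eq_iff_eq_neg.2 (ha i), neg_mul,
        mul_assoc, ih, mul_zero, neg_zero]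
  induction l with
  | nil => rfl
  | cons i l ih =>
    simp only [List.map_cons, List.prod_cons]
    rw [mul_assoc, ih, add_mul, mul_assoc t, (hg i _).eq, ← mul_assoc t, ← mul_assoc, h1, zero_mul,
      add_zero, mul_assoc]

end

end

section

open Uniformity DGRing Matrix Polynomial

/-- The inclusion of a coordinate subspace. -/
def PVec.incl {m n : ℕ} (h : m ≤ n) (x : PVec m) : PVec n where
  v i := if hi : i.1 < m then x.v ⟨i, hi⟩ else 0
  norm_sq := by
    obtain ⟨r, rfl⟩ := Nat.exists_eq_add_of_le h
    rw [Fin.sum_univ_add, ← x.norm_sq]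
    simp

theorem PVec.incl_uc {m n : ℕ} (h : m ≤ n) : UniformContinuous (PVec.incl h) := by
  refine PVec.uc_iff.2 fun i j => ?_
  by_cases hi : i.1 < m
  · by_cases hj : j.1 < m
    · simpa [PVec.incl, hi, hj] using PVec.uc_entry _ _
    · simpa [PVec.incl, hi, hj] using uniformContinuous_const
  · simpa [PVec.incl, hi] using uniformContinuous_const

theorem pph_incl {m n : ℕ} (h : m ≤ n) (x y : PVec m) : pph n (x.incl h) (y.incl h) = pph m x y := by
  obtain ⟨r, rfl⟩ := Nat.exists_eq_add_of_le h
  simp only [pph, lph]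
  rw [Fin.sum_univ_add]
  simp [PVec.incl]

theorem Polynomial.commute_aeval {R : Type*} [Ring R] {x : R} (hx : ∀ a, Commute x a) (P : ℤ[X]) (a : R) :
    Commute (aeval x P) a := by
  induction P using Polynomial.induction_on' with
  | add P Q hP hQ => rw [map_add]; exact hP.add_left hQ
  | monomial n c =>
    rw [aeval_monomial]
    exact Commute.mul_left (Algebra.commutes c a) ((hx a).pow_left n)

section

variable {B : Type} [UniformSpace B] {q : ℕ} [Fact q.Prime]

/-- A tower of products of reflections over `B`, whose characteristic classes, and those of the
conjugates by powers of `b`, are known, and whose classes have a nonzero product. -/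
structure Peel (q : ℕ) {N : ℕ} (b : B → UG (N + 1)) (y : HH (ZMod q) B) (β : ℤ[X]) (s i : ℕ) where
  D : Type
  inst : UniformSpace D
  π : D → B
  hπ : UniformContinuous π
  u : D → UG (N + 1)
  hu : PM (fun _ _ => 0) u
  L : ℤ[X] →+ HH (ZMod q) D
  dg_eq : ∀ e : ℤ, ∃ R : Fin (N + 1) → HH (ZMod q) D,
    dg (ZMod q) (fun x => b (π x) ^ e * u x * (b (π x) ^ e)⁻¹) = ∑ j : Fin (N + 1),
      HH.fst (L (X ^ (N - j : ℕ) * β) + (e : HH (ZMod q) D) *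
        (HH.pull π hπ y * L (derivative (X ^ (N - j : ℕ) * β))) + HH.pull π hπ y ^ 2 * R j) *
      HH.snd (hP (ZMod q) (N + 1)) ^ (j : ℕ)
  L_zero : ∀ m Q, i + s ≤ m → L (X ^ m * Q) = 0
  odd : ∀ P, HH.Odd (L P)
  inj : ∀ (Q : Fin i → ℤ[X]) (_ : ∀ m, ¬ (q : ℤ) ∣ (Q m).coeff 0) (e : HH (ZMod q) B),
    HH.pull π hπ e * (List.ofFn fun m : Fin i => L (X ^ (m + s : ℕ) * Q m)).prod = 0 → e = 0

theorem Peel.nonempty_zero {N : ℕ} (b : B → UG (N + 1)) (y : HH (ZMod q) B) (β : ℤ[X]) (s : ℕ) :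
    Nonempty (Peel q b y β s 0) := ⟨{
  D := B
  inst := inferInstance
  π := id
  hπ := uniformContinuous_id
  u := fun _ => 1
  hu := PM.const 1
  L := 0
  dg_eq := fun e => ⟨0, by
    rw [dg_congr (G := fun _ => 1) _ fun x => by rw [mul_one, mul_inv_cancel], dg_one]
    simp⟩
  L_zero := fun _ _ _ => rfl
  odd := fun P C _ g hg l hl => by simp
  inj := fun Q _ e h => by
    rw [List.ofFn_zero, List.prod_nil, mul_one] at h
    exact (HH.pull_id e).symm.trans h }⟩

theorem Peel.nonempty_succ {N : ℕ} (hN : ∀ i, 0 < i → i ≤ N → NInv (ZMod q) i) {φ : B → B → ℝ}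
    {b : B → UG (N + 1)} (hb : PM φ b) {β : ℤ[X]}
    (hβ : ∀ (A : Type) [UniformSpace A] (l : A → Circle)
      (hl : UniformContinuous l) (L : A → PVec (N + 1)) (hU : UniformContinuous L),
      dg (ZMod q) (fun a => rfn (l a) (L a)) = ∑ j : Fin (N + 1), HH.fst (tau (ZMod q) l hl *
        aeval (hL (ZMod q) L hU) ((X : ℤ[X]) ^ (N - j : ℕ) * β)) * HH.snd (hP (ZMod q) (N + 1)) ^ (j : ℕ))
    {s i : ℕ} (hi : i + s ≤ N) (P : Peel q b (cc (ZMod q) φ) β s i) :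
    Nonempty (Peel q b (cc (ZMod q) φ) β s (i + 1)) := by
  obtain ⟨D, _, π, hπ, u, hu, L, hdg, hL0, hodd, hinj⟩ := P
  set y := cc (ZMod q) φ with hy
  have hφ : Phase φ := hb.phase
  let D' := (D × Circle) × PVec (i + s + 1)
  let π' : D' → B := fun x => π x.1.1
  have h1 : UniformContinuous fun x : D' => x.1.1 := uniformContinuous_fst.comp uniformContinuous_fst
  have hlam : UniformContinuous fun x : D' => x.1.2 := uniformContinuous_snd.comp uniformContinuous_fst
  have hπ' : UniformContinuous π' := hπ.comp h1
  have hin : i + s + 1 ≤ N + 1 := by omega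
  let ℓ : D' → PVec (N + 1) := fun x => x.2.incl hin
  have hℓ : UniformContinuous ℓ := (PVec.incl_uc hin).comp uniformContinuous_snd
  have hL1 : hL (ZMod q) ℓ hℓ = HH.snd (hP (ZMod q) (i + s + 1)) := by
    rw [hL_eq (ZMod q) ℓ hℓ]
    simp only [ℓ, pph_incl]
    rw [hP, pull_cc _ PVec.phase]
  set x : HH (ZMod q) D' := HH.snd (hP (ZMod q) (i + s + 1)) with hx
  have hxc : ∀ a, Commute x a := fun a => HH.snd_hP_commute (k := ZMod q) a
  have hxp : x ^ (i + s + 1) = 0 := by rw [hx, ← map_pow, hP_pow, map_zero]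
  set t : HH (ZMod q) D' := tau (ZMod q) (fun x : D' => x.1.2) hlam with ht
  set y' : HH (ZMod q) D' := HH.pull π' hπ' y with hy'
  have hyc : ∀ a, Commute y' a := fun a => by rw [hy', hy, pull_cc _ hφ]; exact cc_commute _ _ a
  have hpp : ∀ a : HH (ZMod q) B, HH.pull (fun x : D' => x.1.1) h1 (HH.pull π hπ a) = HH.pull π' hπ' a := fun a =>
    HH.pull_pull _ _ _ _ _
  let L' : ℤ[X] →+ HH (ZMod q) D' :=
    (HH.pull (fun x : D' => x.1.1) h1).toAddMonoidHom.comp L +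
      (AddMonoidHom.mulLeft t).comp (aeval x : ℤ[X] →ₐ[ℤ] HH (ZMod q) D').toRingHom.toAddMonoidHom
  have hL' : ∀ P, L' P = HH.pull (fun x : D' => x.1.1) h1 (L P) + t * aeval x P := fun P => rfl
  clear_value L'
  have hac : ∀ P : ℤ[X], ∀ a, Commute (aeval x P) a := fun P a =>
    Polynomial.commute_aeval hxc P a
  refine ⟨⟨D', inferInstance, π', hπ', fun x => u x.1.1 * rfn x.1.2 (ℓ x),
    (hu.comap h1).mul_zero' (PM.rfn hlam hℓ), L', fun e => ?_, fun m Q hm => ?_, fun P C _ g hg l hl => ?_,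
    fun Q hQ e he => ?_⟩⟩
  · obtain ⟨R, hR⟩ := hdg e
    have hbe := (hb.comap hπ').zpow e
    have S := hbe.vsec (PVec.vsec.comap hℓ)
    obtain ⟨ℓ', hℓ', hv, hc⟩ : ∃ (ℓ' : D' → PVec (N + 1)) (hℓ' : UniformContinuous ℓ'),
        (∀ x, (ℓ' x).v = (b (π' x) ^ e).1 *ᵥ (ℓ x).v) ∧ hL (ZMod q) ℓ' hℓ' = x + e * y' := by
      refine ⟨S.map, S.map_uc, fun x => S.map_v_of_unit x ?_, ?_⟩
      · rw [UG.norm_mulVec]; exact (ℓ x).norm_sq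
      · have e1 := S.hL_map (k := ZMod q)
        rw [cc_add _ ((hφ.comap hπ').zsmul e) (PVec.phase.comap hℓ), cc_zsmul (hφ.comap hπ'),
          ← hL_eq _ ℓ hℓ, hL1, ← pull_cc _ hφ hπ'] at e1
        exact e1.trans (add_comm _ _)
    have hsplit : ∀ x : D', b (π' x) ^ e * (u x.1.1 * rfn x.1.2 (ℓ x)) * (b (π' x) ^ e)⁻¹ =
        (b (π x.1.1) ^ e * u x.1.1 * (b (π x.1.1) ^ e)⁻¹) * rfn x.1.2 (ℓ' x) := fun x => by
      rw [← conj_rfn _ _ (hv x)]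
      simp only [π']
      group
    have hpm : PM (fun _ _ => 0) fun x => b (π x) ^ e * u x * (b (π x) ^ e)⁻¹ :=
      ((hb.comap hπ).zpow e).conj hu
    have hzc : ∀ a, Commute ((e : HH (ZMod q) D') * y') a := fun a =>
      (Int.cast_commute e a).mul_left (hyc a)
    choose r hr using fun j : Fin (N + 1) => Polynomial.exists_aeval_add x hzc (X ^ (N - j : ℕ) * β)
    refine ⟨fun j => HH.pull (fun x : D' => x.1.1) h1 (R j) + (e : HH (ZMod q) D') ^ 2 * (t * r j), ?_⟩
    rw [dg_congr _ hsplit, dg_mul _ hN (hpm.comap h1) (PM.rfn hlam hℓ'), ← pull_dg _ hpm h1, hR,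
      HH.pull_repr h1, hβ D' _ hlam ℓ' hℓ', ← Finset.sum_add_distrib]
    refine Finset.sum_congr rfl fun j _ => ?_
    rw [← add_mul, ← map_add, hc, hr, hL', hL', map_add (HH.pull _ h1),
      map_add (HH.pull _ h1), map_mul (HH.pull _ h1), map_mul (HH.pull _ h1), map_mul (HH.pull _ h1), map_pow (HH.pull _ h1), hpp,
      map_intCast (HH.pull _ h1)]
    have c1 : ∀ a, t * ((e : HH (ZMod q) D') * y' * a) = e * (y' * (t * a)) := fun a => by
      rw [← mul_assoc, ← (hzc t).eq, mul_assoc, mul_assoc]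
    have c2 : ∀ a, t * (((e : HH (ZMod q) D') * y') ^ 2 * a) = y' ^ 2 * (e ^ 2 * (t * a)) := fun a => by
      rw [← mul_assoc, ← ((hzc t).pow_left 2).eq, mul_assoc, ((Int.cast_commute e y').mul_pow 2),
        ((Int.cast_commute e y').pow_pow 2 2).eq, mul_assoc]
    congr 2
    rw [mul_add, mul_add, c1, c2, mul_add y', mul_add (e : HH (ZMod q) D'), mul_add (y' ^ 2)]
    abel
  · have e1 : m = (i + s + 1) + (m - (i + s + 1)) := by omega
    rw [hL', hL0 m Q (by omega), map_zero, zero_add, map_mul, map_pow, aeval_X, e1, pow_add, hxp,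
      zero_mul, zero_mul, mul_zero]
  · have h2 : HH.pull g hg (HH.pull (fun x : D' => x.1.1) h1 (L P)) * tau (ZMod q) l hl =
        -(tau (ZMod q) l hl * HH.pull g hg (HH.pull (fun x : D' => x.1.1) h1 (L P))) := by
      rw [HH.pull_pull]
      exact hodd P C _ (h1.comp hg) l hl
    have hgc : ∀ a, Commute (HH.pull g hg x) a := fun a => by
      rw [hx, HH.pull_pull]
      exact hL_commute _ _ a
    have h3 : HH.pull g hg (aeval x P) = aeval (HH.pull g hg x) P :=
      (aeval_algHom_apply (HH.pull g hg).toIntAlgHom x P).symm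
    rw [hL', map_add, map_mul, h3, ht, pull_tau, add_mul, mul_add, h2, neg_add, mul_assoc,
      (Polynomial.commute_aeval hgc P _).eq, ← mul_assoc, tau_anticomm _ _ hl, neg_mul, mul_assoc]
  · have hlast : L' (X ^ (i + s : ℕ) * Q (Fin.last i)) =
        t * (((Q (Fin.last i)).coeff 0 : ℤ) : HH (ZMod q) D') * x ^ (i + s) := by
      have e1 : Q (Fin.last i) = X * (Q (Fin.last i)).divX + C ((Q (Fin.last i)).coeff 0) := by
        rw [mul_comm, divX_mul_X_add]
      rw [hL', hL0 _ _ le_rfl, map_zero, zero_add, map_mul, map_pow, aeval_X]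
      conv_lhs => rw [e1]
      rw [map_add, map_mul, aeval_X, aeval_C, mul_add, ← mul_assoc, ← pow_succ, hxp, zero_mul, zero_add,
        ((hxc _).pow_left _).eq, mul_assoc]
      rfl
    rw [List.ofFn_succ', List.concat_eq_append, List.prod_append, List.prod_singleton] at he
    simp only [Fin.val_castSucc, Fin.val_last, hlast, hL'] at he
    have htt : t * t = 0 := by rw [← sq, ht, tau_sq]
    have h2 := prod_add_mul_tau htt (a := fun m : Fin i => HH.pull (fun x : D' => x.1.1) h1 (L (X ^ (m + s : ℕ) * Q m.castSucc)))
      (fun m => hodd _ D' _ h1 _ hlam)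
      (fun m => Polynomial.commute_aeval hxc (X ^ (m + s : ℕ) * Q m.castSucc)) (List.finRange i)
    rw [← List.ofFn_eq_map, ← List.ofFn_eq_map] at h2
    rw [mul_assoc t, ← mul_assoc _ t, h2] at he
    set a : HH (ZMod q) D := HH.pull π hπ e * (List.ofFn fun m : Fin i => L (X ^ (m + s : ℕ) * Q m.castSucc)).prod with ha
    have h4 : HH.pull (fun x : D' => x.1.1) h1 a = HH.pull π' hπ' e *
        (List.ofFn fun m : Fin i => HH.pull (fun x : D' => x.1.1) h1 (L (X ^ (m + s : ℕ) * Q m.castSucc))).prod := by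
      rw [ha, map_mul, hpp, map_list_prod, List.map_ofFn]
      rfl
    rw [← mul_assoc, ← mul_assoc, ← mul_assoc, ← h4] at he
    have h5 : HH.fst (HH.fst a * tau (ZMod q) (fun x : D × Circle => x.2) uniformContinuous_snd *
        (((Q (Fin.last i)).coeff 0 : ℤ) : HH (ZMod q) (D × Circle))) * x ^ (i + s) = 0 := by
      rw [map_mul, map_mul, HH.pull_pull, pull_tau, map_intCast]
      exact he
    have h6 := HH.eq_zero_of_mul_hP_pow (i + s) (fun j h h' => hN j h (h'.trans hi)) h5
    rw [← (Int.cast_commute _ _).eq] at h6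
    have hq : ((q : ℕ) : ZMod q) = 0 := by simp
    exact hinj _ (fun m => hQ _) e
      (HH.eq_zero_of_mul_tau hq (Fact.out : q.Prime).ne_zero (HH.eq_zero_of_intCast_mul (hQ _) h6))

end

end

section

open Uniformity DGRing Matrix Polynomial
open scoped commutatorElement

/-- The integral Heisenberg group. -/
@[ext]
structure Heis where
  x : ℤ
  y : ℤ
  z : ℤ

namespace Heis

instance : Group Heis where
  mul a b := ⟨a.x + b.x, a.y + b.y, a.z + b.z + a.y * b.x⟩
  one := ⟨0, 0, 0⟩
  inv a := ⟨-a.x, -a.y, -a.z + a.y * a.x⟩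
  mul_assoc a b c := Heis.ext (add_assoc _ _ _) (add_assoc _ _ _)
    (show a.z + b.z + a.y * b.x + c.z + (a.y + b.y) * c.x =
      a.z + (b.z + c.z + b.y * c.x) + a.y * (b.x + c.x) by ring)
  one_mul a := Heis.ext (zero_add _) (zero_add _) (show 0 + a.z + 0 * a.x = a.z by ring)
  mul_one a := Heis.ext (add_zero _) (add_zero _) (show a.z + 0 + a.y * 0 = a.z by ring)
  inv_mul_cancel a := Heis.ext (neg_add_cancel _) (neg_add_cancel _)
    (show -a.z + a.y * a.x + a.z + -a.y * a.x = 0 by ring)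

@[simp] theorem mul_x (a b : Heis) : (a * b).x = a.x + b.x := rfl
@[simp] theorem mul_y (a b : Heis) : (a * b).y = a.y + b.y := rfl
@[simp] theorem mul_z (a b : Heis) : (a * b).z = a.z + b.z + a.y * b.x := rfl
@[simp] theorem one_x : (1 : Heis).x = 0 := rfl
@[simp] theorem one_y : (1 : Heis).y = 0 := rfl
@[simp] theorem one_z : (1 : Heis).z = 0 := rfl
@[simp] theorem inv_x (a : Heis) : a⁻¹.x = -a.x := rfl
@[simp] theorem inv_y (a : Heis) : a⁻¹.y = -a.y := rfl
@[simp] theorem inv_z (a : Heis) : a⁻¹.z = -a.z + a.y * a.x := rfl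

/-- The abelianization coordinates and the commutator coordinate of a word. -/
def ofFree : FreeGroup (Fin 2) →* Heis := FreeGroup.lift ![⟨1, 0, 0⟩, ⟨0, 1, 0⟩]

theorem zpow_mul_zpow {Q : Type*} [Group Q] {X Y Z : Q} (hZ : ∀ g, Commute Z g) (h : Y * X = X * Y * Z)
    (b a : ℤ) : Y ^ b * X ^ a = X ^ a * Y ^ b * Z ^ (b * a) := by
  have h1 : Y * X * Y⁻¹ = X * Z := by rw [h, mul_assoc _ Y Z, ← (hZ Y).eq, mul_assoc, mul_assoc, mul_inv_cancel, mul_one]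
  have h2 : Y * X ^ a * Y⁻¹ = X ^ a * Z ^ a := by rw [← conj_zpow, h1, (hZ X).symm.mul_zpow]
  have hZ' : ∀ g, Commute (Z ^ a) g := fun g => (hZ g).zpow_left a
  have h3 : (X ^ a)⁻¹ * Y * (X ^ a)⁻¹⁻¹ = Y * Z ^ a := by
    rw [inv_inv, mul_assoc, inv_mul_eq_iff_eq_mul, ← (hZ' Y).eq, ← mul_assoc, ← h2]
    group
  have h4 := conj_zpow (i := b) (a := (X ^ a)⁻¹) (b := Y)
  rw [h3, (hZ' Y).symm.mul_zpow, ← _root_.zpow_mul, inv_inv, mul_comm a b] at h4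
  rw [mul_assoc, h4]
  group

/-- The homomorphism from the Heisenberg group determined by two elements with central
commutator. -/
def lift {Q : Type*} [Group Q] (X Y Z : Q) (hZ : ∀ g, Commute Z g) (h : Y * X = X * Y * Z) : Heis →* Q :=
  MonoidHom.mk' (fun a => X ^ a.x * Y ^ a.y * Z ^ a.z) fun a b => by
    have hZ' : ∀ (m : ℤ) g, Commute (Z ^ m) g := fun m g => (hZ g).zpow_left m
    simp only [mul_x, mul_y, mul_z, _root_.zpow_add]
    calc X ^ a.x * X ^ b.x * (Y ^ a.y * Y ^ b.y) * (Z ^ a.z * Z ^ b.z * Z ^ (a.y * b.x))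
        = X ^ a.x * (X ^ b.x * Y ^ a.y) * Y ^ b.y * (Z ^ (a.y * b.x) * (Z ^ a.z * Z ^ b.z)) := by
          rw [(hZ' (a.y * b.x) _).eq]; simp only [mul_assoc]
      _ = X ^ a.x * (X ^ b.x * Y ^ a.y * Z ^ (a.y * b.x)) * Y ^ b.y * (Z ^ a.z * Z ^ b.z) := by
          simp only [mul_assoc]; rw [← mul_assoc (Z ^ (a.y * b.x)) (Y ^ b.y), (hZ' _ (Y ^ b.y)).eq, mul_assoc]
      _ = X ^ a.x * (Y ^ a.y * X ^ b.x) * Y ^ b.y * (Z ^ a.z * Z ^ b.z) := by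
          rw [zpow_mul_zpow hZ h]
      _ = X ^ a.x * Y ^ a.y * Z ^ a.z * (X ^ b.x * Y ^ b.y * Z ^ b.z) := by
          simp only [mul_assoc]
          rw [← mul_assoc (Z ^ a.z) (X ^ b.x), (hZ' _ (X ^ b.x)).eq, mul_assoc, ← mul_assoc (Z ^ a.z) (Y ^ b.y), (hZ' _ (Y ^ b.y)).eq, mul_assoc]

theorem mem_closure_of_ofFree {p : ℕ} {v : FreeGroup (Fin 2)} (hx : (ofFree v).x = 0) (hy : (ofFree v).y = 0)
    (hz : (p : ℤ) ∣ (ofFree v).z) :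
    v ∈ Subgroup.closure (((fun x : FreeGroup (Fin 2) => x ^ p) ''
          (commutator (FreeGroup (Fin 2)) : Set (FreeGroup (Fin 2)))) ∪
         (⁅(⊤ : Subgroup (FreeGroup (Fin 2))), commutator (FreeGroup (Fin 2))⁆ :
          Subgroup (FreeGroup (Fin 2)))) := by
  set M : Subgroup (FreeGroup (Fin 2)) := ⁅(⊤ : Subgroup (FreeGroup (Fin 2))), commutator (FreeGroup (Fin 2))⁆
  let X : FreeGroup (Fin 2) := .of 0
  let Y : FreeGroup (Fin 2) := .of 1
  let Z : FreeGroup (Fin 2) := ⁅Y⁻¹, X⁻¹⁆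
  have hZm : Z ∈ commutator (FreeGroup (Fin 2)) :=
    Subgroup.commutator_mem_commutator (Subgroup.mem_top _) (Subgroup.mem_top _)
  let π := QuotientGroup.mk' M
  have hZ : ∀ g, Commute (π Z) g := fun g => by
    obtain ⟨g, rfl⟩ := QuotientGroup.mk'_surjective M g
    have : ⁅g, Z⁆ ∈ M := Subgroup.commutator_mem_commutator (Subgroup.mem_top _) hZm
    have h1 : π ⁅g, Z⁆ = 1 := (QuotientGroup.eq_one_iff _).2 this
    rw [map_commutatorElement, commutatorElement_eq_one_iff_commute] at h1
    exact h1.symm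
  have hXY : π Y * π X = π X * π Y * π Z := by
    rw [← map_mul, ← map_mul, ← map_mul]
    congr 1
    simp only [Z, commutatorElement_def]
    group
  have e : (lift _ _ _ hZ hXY).comp ofFree = π := by
    refine FreeGroup.ext_hom _ _ fun i => ?_
    fin_cases i
    · simp [ofFree, lift, X]
    · simp [ofFree, lift, Y]
  obtain ⟨m, hm⟩ := hz
  have e1 : π v = π ((Z ^ m) ^ p) := by
    rw [mul_comm] at hm
    have := DFunLike.congr_fun e v
    rw [← this, MonoidHom.comp_apply]
    simp only [lift, MonoidHom.mk'_apply, hx, hy, zpow_zero, one_mul, map_pow, map_zpow, hm]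
    rw [_root_.zpow_mul, zpow_natCast]
  have e2 : ((Z ^ m) ^ p)⁻¹ * v ∈ M := (QuotientGroup.eq_one_iff _).1 (by
    have : π (((Z ^ m) ^ p)⁻¹ * v) = 1 := by rw [map_mul, map_inv, e1, inv_mul_cancel]
    exact this)
  rw [← mul_inv_cancel_left ((Z ^ m) ^ p) v]
  exact Subgroup.mul_mem _ (Subgroup.subset_closure (Or.inl ⟨Z ^ m, Subgroup.zpow_mem _ hZm m, rfl⟩))
    (Subgroup.subset_closure (Or.inr e2))

end Heis

end

section

open Uniformity DGRing Matrix Polynomial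

section

variable {D : Type*} [UniformSpace D] {k : Type*} [CommRing k] {N : ℕ} {φ : D → D → ℝ}
  {b : D → UG (N + 1)} {Y : HH k D} {a a' : Fin (N + 1) → HH k D}

/-- The first order description of the characteristic classes of a family of unitary matrices
`g`, corrected by a power of `b` prescribed by `n`, and conjugated by powers of `b`. -/
def WordData (b : D → UG (N + 1)) (Y : HH k D) (a a' : Fin (N + 1) → HH k D) (g : D → UG (N + 1)) (n : Heis) : Prop :=
  (PM (fun _ _ => 0) fun x => g x * (b x ^ n.y)⁻¹) ∧ ∀ e : ℤ, ∃ R : Fin (N + 1) → HH k D,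
    dg k (fun x => b x ^ e * (g x * (b x ^ n.y)⁻¹) * (b x ^ e)⁻¹) = ∑ j : Fin (N + 1),
      HH.fst ((n.x : HH k D) * a j + ((n.z + e * n.x : ℤ) : HH k D) * (Y * a' j) + Y ^ 2 * R j) *
      HH.snd (hP k (N + 1)) ^ (j : ℕ)

theorem WordData.mul (hN : ∀ i, 0 < i → i ≤ N → NInv k i) (hb : PM φ b) {g h : D → UG (N + 1)} {n m : Heis}
    (hg : WordData b Y a a' g n) (hh : WordData b Y a a' h m) :
    WordData b Y a a' (fun x => g x * h x) (n * m) := by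
  have key : ∀ x, g x * h x * (b x ^ (n * m).y)⁻¹ =
      (g x * (b x ^ n.y)⁻¹) * (b x ^ n.y * (h x * (b x ^ m.y)⁻¹) * (b x ^ n.y)⁻¹) := fun x => by
    rw [Heis.mul_y, _root_.zpow_add]; group
  refine ⟨?_, fun e => ?_⟩
  · simp only [key]
    exact hg.1.mul_zero' ((hb.zpow n.y).conj hh.1)
  · obtain ⟨R, hR⟩ := hg.2 e
    obtain ⟨S, hS⟩ := hh.2 (e + n.y)
    refine ⟨fun j => R j + S j, ?_⟩
    rw [dg_congr (G := fun x => (b x ^ e * (g x * (b x ^ n.y)⁻¹) * (b x ^ e)⁻¹) *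
      (b x ^ (e + n.y) * (h x * (b x ^ m.y)⁻¹) * (b x ^ (e + n.y))⁻¹)) k fun x => by
        rw [key, _root_.zpow_add]; group, dg_mul k hN ((hb.zpow e).conj hg.1) ((hb.zpow _).conj hh.1), hR, hS,
      ← Finset.sum_add_distrib]
    refine Finset.sum_congr rfl fun j _ => ?_
    rw [← add_mul, ← map_add]
    congr 2
    simp only [Heis.mul_x, Heis.mul_z]
    push_cast
    noncomm_ring

theorem WordData.inv (hN : ∀ i, 0 < i → i ≤ N → NInv k i) (hb : PM φ b) {g : D → UG (N + 1)} {n : Heis}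
    (hg : WordData b Y a a' g n) : WordData b Y a a' (fun x => (g x)⁻¹) n⁻¹ := by
  have key : ∀ x, (g x)⁻¹ * (b x ^ n⁻¹.y)⁻¹ =
      b x ^ (-n.y) * (g x * (b x ^ n.y)⁻¹)⁻¹ * (b x ^ (-n.y))⁻¹ := fun x => by
    rw [Heis.inv_y]; group
  refine ⟨?_, fun e => ?_⟩
  · simp only [key]
    exact (hb.zpow _).conj hg.1.inv_zero
  · obtain ⟨R, hR⟩ := hg.2 (e - n.y)
    refine ⟨fun j => -R j, ?_⟩
    rw [dg_congr (G := fun x => (b x ^ (e - n.y) * (g x * (b x ^ n.y)⁻¹) * (b x ^ (e - n.y))⁻¹)⁻¹) k fun x => by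
        rw [key, sub_eq_add_neg, _root_.zpow_add]; group, dg_inv k hN ((hb.zpow _).conj hg.1), hR,
      ← Finset.sum_neg_distrib]
    refine Finset.sum_congr rfl fun j _ => ?_
    rw [← neg_mul, ← map_neg]
    congr 2
    simp only [Heis.inv_x, Heis.inv_z]
    push_cast
    noncomm_ring

theorem WordData.const (hb : PM φ b) (c : UG (N + 1)) : WordData b Y a a' (fun _ => c) 1 := by
  refine ⟨?_, fun e => ⟨0, ?_⟩⟩
  · simpa using PM.const c
  · have := dg_conj_const k (hb.zpow e) c
    simpa using this

theorem WordData.self (hb : PM φ b) : WordData b Y a a' b ⟨0, 1, 0⟩ := by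
  refine ⟨?_, fun e => ⟨0, ?_⟩⟩
  · simpa using PM.const 1
  · simpa using dg_one k

/-- The evaluation of words with coefficients in the special unitary group. -/
def evW {p : ℕ} (u b : UG p) : Monoid.Coprod (SU p) (FreeGroup (Fin 2)) →* UG p :=
  Monoid.Coprod.lift (SU p).subtype (FreeGroup.lift ![u, b])

theorem WordData.word (hN : ∀ i, 0 < i → i ≤ N → NInv k i) (hb : PM φ b) {u : D → UG (N + 1)}
    (hu : WordData b Y a a' u ⟨1, 0, 0⟩) (w : Monoid.Coprod (SU (N + 1)) (FreeGroup (Fin 2))) :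
    WordData b Y a a' (fun x => evW (u x) (b x) w) (Heis.ofFree (contentHom _ w)) := by
  induction w using Monoid.Coprod.induction_on with
  | inl c => simpa [evW, contentHom] using WordData.const hb c.1
  | inr v =>
    simp only [evW, contentHom, Monoid.Coprod.lift_apply_inr, MonoidHom.id_apply]
    have hg : ∀ i, WordData b Y a a' (fun x => FreeGroup.lift ![u x, b x] (FreeGroup.of i)) (Heis.ofFree (FreeGroup.of i)) := fun i => by
      fin_cases i
      · simpa [Heis.ofFree] using hu
      · simpa [Heis.ofFree] using WordData.self hb
    induction v using FreeGroup.induction_on with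
    | C1 => simpa using WordData.const hb 1
    | of i => exact hg i
    | inv_of i _ => simpa only [map_inv] using (hg i).inv hN hb
    | mul v w hv hw => simpa only [map_mul] using hv.mul hN hb hw
  | mul v w hv hw => simpa only [map_mul] using hv.mul hN hb hw

end

end

section

open Uniformity DGRing Matrix Polynomial

instance {n : ℕ} : CompactSpace (UG n) := by
  have hc : IsClosed ((unitaryGroup (Fin n) ℂ : Submonoid (Matrix (Fin n) (Fin n) ℂ)) : Set (Matrix (Fin n) (Fin n) ℂ)) :=
    isClosed_unitary
  have hs : ((unitaryGroup (Fin n) ℂ : Submonoid (Matrix (Fin n) (Fin n) ℂ)) : Set (Matrix (Fin n) (Fin n) ℂ)) ⊆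
      Set.univ.pi fun _ => Set.univ.pi fun _ => Metric.closedBall 0 1 := fun U hU i _ j _ => by
    simpa using entry_norm_bound_of_unitary hU i j
  have hK : IsCompact (Set.univ.pi fun _ : Fin n => Set.univ.pi fun _ : Fin n => Metric.closedBall (0 : ℂ) 1) :=
    isCompact_univ_pi fun _ => isCompact_univ_pi fun _ => isCompact_closedBall 0 1
  exact isCompact_iff_compactSpace.1 (hK.of_isClosed_subset hc hs)

theorem evW_continuous {p : ℕ} (w : Monoid.Coprod (SU p) (FreeGroup (Fin 2))) :
    Continuous fun x : UG p × UG p => evW x.1 x.2 w := by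
  induction w using Monoid.Coprod.induction_on with
  | inl c => simpa [evW] using continuous_const
  | inr v =>
    simp only [evW, Monoid.Coprod.lift_apply_inr]
    have hg : ∀ i, Continuous fun x : UG p × UG p => FreeGroup.lift ![x.1, x.2] (FreeGroup.of i) := fun i => by
      fin_cases i
      · simpa using continuous_fst
      · simpa using continuous_snd
    induction v using FreeGroup.induction_on with
    | C1 => simpa using continuous_const
    | of i => exact hg i
    | inv_of i _ => simp only [map_inv]; exact (hg i).inv
    | mul v w hv hw => simp only [map_mul]; exact hv.mul hw
  | mul v w hv hw => simp only [map_mul]; exact hv.mul hw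

theorem evW_coe {p : ℕ} (a b : SU p) (w : Monoid.Coprod (SU p) (FreeGroup (Fin 2))) :
    evW a.1 b.1 w = (Monoid.Coprod.lift (MonoidHom.id (SU p)) (FreeGroup.lift ![a, b]) w).1 := by
  have : evW a.1 b.1 = (SU p).subtype.comp (Monoid.Coprod.lift (MonoidHom.id (SU p)) (FreeGroup.lift ![a, b])) := by
    refine Monoid.Coprod.hom_ext ?_ (FreeGroup.ext_hom _ _ fun i => ?_)
    · ext1 c; simp [evW]
    · fin_cases i <;> simp [evW]
  rw [this]; rfl

theorem evW_smul {p : ℕ} {l m : UG p} (hl : ∀ g, Commute l g) (hm : ∀ g, Commute m g) (u b : UG p)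
    (w : Monoid.Coprod (SU p) (FreeGroup (Fin 2))) :
    evW (l * u) (m * b) w = l ^ (Heis.ofFree (contentHom _ w)).x * m ^ (Heis.ofFree (contentHom _ w)).y * evW u b w := by
  have hlm : ∀ i j : ℤ, ∀ g, Commute (l ^ i * m ^ j) g := fun i j g => ((hl g).zpow_left i).mul_left ((hm g).zpow_left j)
  let F : Monoid.Coprod (SU p) (FreeGroup (Fin 2)) →* UG p := MonoidHom.mk'
    (fun w => l ^ (Heis.ofFree (contentHom _ w)).x * m ^ (Heis.ofFree (contentHom _ w)).y * evW u b w) fun v w => by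
      simp only [map_mul, Heis.mul_x, Heis.mul_y, _root_.zpow_add]
      rw [((hl _).zpow_left _).mul_mul_mul_comm, (hlm _ _ _).symm.mul_mul_mul_comm]
  have : evW (l * u) (m * b) = F := by
    refine Monoid.Coprod.hom_ext ?_ (FreeGroup.ext_hom _ _ fun i => ?_)
    · ext1 c; simp [evW, F, contentHom]
    · fin_cases i <;> simp [evW, F, contentHom, Heis.ofFree]
  rw [this]; rfl

/-- The scalar unitary matrices. -/
def UG.scalar (n : ℕ) (z : Circle) : UG n :=
  ⟨(z : ℂ) • 1, mem_unitaryGroup_iff.2 (by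
    rw [star_smul, star_one, smul_mul_smul_comm, mul_one, RCLike.star_def, Complex.mul_conj, Complex.normSq_eq_norm_sq, Circle.norm_coe]; simp)⟩

theorem UG.scalar_commute {n : ℕ} (z : Circle) (g : UG n) : Commute (UG.scalar n z) g :=
  Subtype.ext (by simp [UG.scalar])

theorem UG.exists_scalar_mul_mem {n : ℕ} (hn : n ≠ 0) (g : UG n) : ∃ z : Circle, UG.scalar n z * g ∈ SU n := by
  obtain ⟨w, hw⟩ := IsAlgClosed.exists_pow_nat_eq (star (g.1.det)) (Nat.pos_of_ne_zero hn)
  have hd : g.1.det * star g.1.det = 1 := by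
    rw [← Matrix.det_conjTranspose, ← Matrix.det_mul]
    have := mem_unitaryGroup_iff.1 g.2
    rw [Matrix.star_eq_conjTranspose] at this
    rw [this, Matrix.det_one]
  have hn1 : ‖g.1.det‖ = 1 := by
    have := congrArg norm hd
    rw [norm_mul, norm_star, norm_one, ← pow_two] at this
    exact (pow_eq_one_iff_of_nonneg (norm_nonneg _) two_ne_zero).1 this
  have hw1 : ‖w‖ = 1 := by
    have := congrArg norm hw
    rw [norm_pow, norm_star, hn1] at this
    exact (pow_eq_one_iff_of_nonneg (norm_nonneg _) hn).1 this
  refine ⟨⟨w, mem_sphere_zero_iff_norm.2 hw1⟩, ?_⟩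
  show ((w • (1 : Matrix (Fin n) (Fin n) ℂ)) * g.1).det = 1
  rw [smul_mul_assoc, one_mul, Matrix.det_smul, Fintype.card_fin, hw, mul_comm, hd]

theorem UG.eq_one_of_dev {N : ℕ} {g : UG (N + 1)} (hg : g ∈ SU (N + 1))
    (h : ∀ i : Fin N, PM.dev (fun _ : Unit => g) i.castSucc () = 0) : g = 1 := by
  have hcol : ∀ (i : Fin N) l, g.1 l i.castSucc = (1 : Matrix _ _ ℂ) l i.castSucc := fun i l => by
    have := h i
    rw [PM.dev, norm_eq_zero, WithLp.toLp_eq_zero, sub_eq_zero] at this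
    have := congrFun this l
    rw [PM.col_apply] at this
    rw [this, Matrix.one_apply, Pi.single_apply]
  have hlast : ∀ i : Fin N, g.1 i.castSucc (Fin.last N) = 0 := fun i => by
    have := congrFun (congrFun (mem_unitaryGroup_iff'.1 g.2) i.castSucc) (Fin.last N)
    rw [Matrix.mul_apply, Matrix.one_apply_ne (Fin.castSucc_lt_last i).ne] at this
    simpa [Matrix.star_apply, hcol, Matrix.one_apply] using this
  have hdiag : g.1 = Matrix.diagonal (Fin.lastCases (g.1 (Fin.last N) (Fin.last N)) fun _ => 1) := by
    ext l i
    induction i using Fin.lastCases with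
    | last =>
      induction l using Fin.lastCases with
      | last => simp
      | cast l => rw [hlast, Matrix.diagonal_apply_ne _ (Fin.castSucc_lt_last l).ne]
    | cast i =>
      rw [hcol, Matrix.diagonal_apply, Matrix.one_apply]
      split_ifs with hl
      · subst hl; simp
      · rfl
  have hdet : g.1.det = 1 := hg
  rw [hdiag, Matrix.det_diagonal, Fin.prod_univ_castSucc] at hdet
  simp only [Fin.lastCases_castSucc, Finset.prod_const_one, one_mul, Fin.lastCases_last] at hdet
  refine Subtype.ext (hdiag.trans ?_)
  rw [hdet, UnitaryGroup.one_val, ← Matrix.diagonal_one]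
  congr 1
  ext i
  induction i using Fin.lastCases <;> simp

/-- If an equation has no solution, its values stay away from the identity. -/
theorem exists_dev_lower {N : ℕ} (w : Monoid.Coprod (SU (N + 1)) (FreeGroup (Fin 2)))
    (h : ¬ ∃ a b : SU (N + 1), Monoid.Coprod.lift (MonoidHom.id (SU (N + 1))) (FreeGroup.lift ![a, b]) w = 1) :
    ∃ c > 0, ∀ u ∈ SU (N + 1), ∀ b ∈ SU (N + 1), ∃ i : Fin N,
      c ≤ PM.dev (fun _ : Unit => evW u b w) i.castSucc () := by
  let F : UG (N + 1) × UG (N + 1) → ℝ := fun x => ∑ i : Fin N, PM.dev (fun _ : Unit => evW x.1 x.2 w) i.castSucc ()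
  have hF : Continuous F := by
    refine continuous_finsetSum _ fun i _ => ?_
    refine continuous_norm.comp ((PiLp.continuous_toLp 2 _).comp ?_)
    refine continuous_pi fun l => ?_
    simp only [Pi.sub_apply, PM.col_apply]
    refine Continuous.sub ?_ continuous_const
    exact (continuous_subtype_val.comp (evW_continuous w)).matrix_elem l _
  have hcl : IsClosed {x : UG (N + 1) × UG (N + 1) | x.1 ∈ SU (N + 1) ∧ x.2 ∈ SU (N + 1)} := by
    refine IsClosed.and ?_ ?_
    · exact isClosed_eq (continuous_subtype_val.comp continuous_fst).matrix_det continuous_const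
    · exact isClosed_eq (continuous_subtype_val.comp continuous_snd).matrix_det continuous_const
  obtain ⟨x, ⟨hx1, hx2⟩, hx⟩ := hcl.isCompact.exists_isMinOn ⟨(1, 1), one_mem _, one_mem _⟩ hF.continuousOn
  have h0 : ∀ (y : UG (N + 1) × UG (N + 1)) (i : Fin N), 0 ≤ PM.dev (fun _ : Unit => evW y.1 y.2 w) i.castSucc () := fun y i => norm_nonneg _
  have hpos : 0 < F x := by
    refine lt_of_le_of_ne (Finset.sum_nonneg fun i _ => h0 x i) fun he => h ⟨⟨x.1, hx1⟩, ⟨x.2, hx2⟩, ?_⟩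
    have := (Finset.sum_eq_zero_iff_of_nonneg fun i _ => h0 x i).1 he.symm
    have hval := evW_coe ⟨x.1, hx1⟩ ⟨x.2, hx2⟩ w
    refine Subtype.ext (hval.symm.trans (UG.eq_one_of_dev ?_ fun i => this i (Finset.mem_univ _)))
    dsimp only at hval
    rw [hval]
    exact Subtype.property _
  refine ⟨F x / (N + 1), by positivity, fun u hu b hb => ?_⟩
  by_contra! hlt
  have h1 : F x ≤ F (u, b) := hx (show (u, b) ∈ _ from ⟨hu, hb⟩)
  have h2 : F (u, b) ≤ ∑ i : Fin N, F x / (N + 1) := Finset.sum_le_sum fun i _ => (hlt i).le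
  rw [Finset.sum_const, Finset.card_univ, Fintype.card_fin, nsmul_eq_mul] at h2
  have h3 : (N : ℝ) * (F x / (N + 1)) < F x := by
    rw [mul_div_assoc', div_lt_iff₀ (by positivity)]
    nlinarith
  linarith

theorem exists_dev_lower_of_scalar {N : ℕ} {w : Monoid.Coprod (SU (N + 1)) (FreeGroup (Fin 2))} {c : ℝ}
    (h : ∀ u ∈ SU (N + 1), ∀ b ∈ SU (N + 1), ∃ i : Fin N,
      c ≤ PM.dev (fun _ : Unit => evW u b w) i.castSucc ())
    (hx : (Heis.ofFree (contentHom _ w)).x = 0) (hy : (Heis.ofFree (contentHom _ w)).y = 0) (u b : UG (N + 1)) :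
    ∃ i : Fin N, c ≤ PM.dev (fun _ : Unit => evW u b w) i.castSucc () := by
  obtain ⟨l, hl⟩ := UG.exists_scalar_mul_mem N.succ_ne_zero u
  obtain ⟨m, hm⟩ := UG.exists_scalar_mul_mem N.succ_ne_zero b
  have := h _ hl _ hm
  rw [evW_smul (UG.scalar_commute l) (UG.scalar_commute m), hx, hy] at this
  simpa using this

end

section

open Uniformity DGRing Matrix Polynomial

theorem NInv.zmod {q : ℕ} [Fact q.Prime] {i : ℕ} (h0 : 0 < i) (hi : i < q) : NInv (ZMod q) i := by
  refine ⟨((i : ZMod q)⁻¹).val, ?_⟩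
  have : (i : ZMod q) ≠ 0 := fun h => Nat.not_dvd_of_pos_of_lt h0 hi ((ZMod.natCast_eq_zero_iff _ _).1 h)
  rw [Nat.cast_mul, ZMod.natCast_zmod_val, inv_mul_cancel₀ this]

theorem Peel.nonempty {q : ℕ} [Fact q.Prime] {B : Type} [UniformSpace B] {N : ℕ}
    (hN : ∀ i, 0 < i → i ≤ N → NInv (ZMod q) i) {φ : B → B → ℝ}
    {b : B → UG (N + 1)} (hb : PM φ b) {β : ℤ[X]}
    (hβ : ∀ (A : Type) [UniformSpace A] (l : A → Circle)
      (hl : UniformContinuous l) (L : A → PVec (N + 1)) (hU : UniformContinuous L),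
      dg (ZMod q) (fun a => rfn (l a) (L a)) = ∑ j : Fin (N + 1), HH.fst (tau (ZMod q) l hl *
        aeval (hL (ZMod q) L hU) ((X : ℤ[X]) ^ (N - j : ℕ) * β)) * HH.snd (hP (ZMod q) (N + 1)) ^ (j : ℕ))
    (s i : ℕ) (hi : i + s ≤ N + 1) : Nonempty (Peel q b (cc (ZMod q) φ) β s i) := by
  induction i with
  | zero => exact Peel.nonempty_zero b _ β s
  | succ i ih =>
    obtain ⟨P⟩ := ih (by omega)
    exact P.nonempty_succ hN hb hβ (by omega)

section

variable {A : Type*} [UniformSpace A]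

theorem PS.zero_mul {f g : A → ℂ} (hf : PS (fun _ _ => 0) f) (hg : PS (fun _ _ => 0) g) :
    PS (fun _ _ => 0) fun x => f x * g x := (hf.mul hg).congr fun _ _ => add_zero 0

theorem PS.zero_prod {ι : Type*} (s : Finset ι) {f : ι → A → ℂ} (hf : ∀ i ∈ s, PS (fun _ _ => 0) (f i)) :
    PS (fun _ _ => 0) fun x => ∏ i ∈ s, f i x := by
  classical
  induction s using Finset.induction_on with
  | empty => simpa using PS.const 1
  | insert i s hi ih =>
    simp only [Finset.prod_insert hi]
    exact (hf i (Finset.mem_insert_self i s)).zero_mul (ih fun j hj => hf j (Finset.mem_insert_of_mem hj))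

theorem PM.det {n : ℕ} {u : A → UG n} (hu : PM (fun _ _ => 0) u) : PS (fun _ _ => 0) fun x => (u x).1.det := by
  simp only [Matrix.det_apply']
  exact PS.sum _ fun σ _ => (PS.const _).zero_mul (PS.zero_prod _ fun i _ => hu _ _)

/-- The determinant of a unitary matrix. -/
noncomputable def UG.detC {n : ℕ} (g : UG n) : Circle := ⟨g.1.det, by
  rw [Submonoid.unitSphere, Submonoid.mem_mk, Subsemigroup.mem_mk]
  have := Matrix.det_of_mem_unitary g.2
  simpa using CStarRing.norm_of_mem_unitary this⟩

theorem PM.detC_uc {n : ℕ} {u : A → UG n} (hu : PM (fun _ _ => 0) u) : UniformContinuous fun x => UG.detC (u x) :=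
  uniformContinuous_comap' hu.det.uc

end

theorem exists_solution_of_x_ne_zero {N : ℕ} (w : Monoid.Coprod (SU (N + 1)) (FreeGroup (Fin 2)))
    (hx : (Heis.ofFree (contentHom _ w)).x ≠ 0) :
    ∃ a b : SU (N + 1), Monoid.Coprod.lift (MonoidHom.id (SU (N + 1))) (FreeGroup.lift ![a, b]) w = 1 := by
  by_contra hno
  obtain ⟨c, hc, H⟩ := exists_dev_lower w hno
  set n := Heis.ofFree (contentHom _ w) with hn
  obtain ⟨q, hq, hqp⟩ := Nat.exists_infinite_primes (N + n.x.natAbs + 1)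
  have : Fact q.Prime := ⟨hqp⟩
  have hqx : ¬ (q : ℤ) ∣ n.x := fun h => by
    have := Int.natAbs_dvd_natAbs.2 h
    rw [Int.natAbs_natCast] at this
    have := Nat.le_of_dvd (Int.natAbs_pos.2 hx) this
    omega
  have hN : ∀ i, 0 < i → i ≤ N → NInv (ZMod q) i := fun i h0 hi => .zmod h0 (by omega)
  obtain ⟨β, hβ0, hβ⟩ := exists_beta (q := q) hN
  have hb : PM (fun _ _ : Unit => 0) (fun _ => (1 : UG (N + 1))) := PM.const 1
  obtain ⟨⟨D, _, π, hπ, u, hu, L, hdg, -, -, hinj⟩⟩ := Peel.nonempty hN hb hβ 1 N le_rfl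
  have hl := hu.inv_zero.detC_uc
  set l : D → Circle := fun x => UG.detC (u x)⁻¹ with hldef
  set u' : D → UG (N + 1) := fun x => u x * rfn (l x) (eb (N + 1) 0) with hu'
  have hrf : PM (fun _ _ => 0) fun x => rfn (l x) (eb (N + 1) 0) := PM.rfn hl uniformContinuous_const
  have hsu : ∀ x, u' x ∈ SU (N + 1) := fun x => by
    show ((u x).1 * reflM (l x) _).det = 1
    rw [Matrix.det_mul, det_reflM]
    show (u x).1.det * (u x)⁻¹.1.det = 1
    rw [← Matrix.det_mul, ← UnitaryGroup.mul_val, mul_inv_cancel]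
    simp
  have hcc : cc (ZMod q) (fun _ _ : Unit => (0 : ℝ)) = 0 :=
    cc_eq_zero _ (PS.const 1) ⟨1, one_pos, fun _ => by simp⟩
  let a : Fin (N + 1) → HH (ZMod q) D := fun j => L (X ^ (N - j : ℕ) * β) +
    if j = Fin.last N then -tau (ZMod q) l hl else 0
  have hdu : dg (ZMod q) u' = ∑ j : Fin (N + 1), HH.fst (a j) * HH.snd (hP (ZMod q) (N + 1)) ^ (j : ℕ) := by
    obtain ⟨R, hR⟩ := hdg 0
    rw [dg_congr (G := u) _ fun x => by simp] at hR
    rw [hu', dg_mul (ZMod q) hN hu hrf, hR, dg_rfn_zero hl]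
    simp only [a, map_add, add_mul, Finset.sum_add_distrib]
    congr 1
    · simp [hcc]
    · rw [Fin.sum_univ_castSucc]
      simp [(Fin.castSucc_lt_last _).ne]
  have hD : WordData (fun _ : D => (1 : UG (N + 1))) 0 a 0 u' ⟨1, 0, 0⟩ := by
    refine ⟨by simpa using hu.mul_zero' hrf, fun e => ⟨0, ?_⟩⟩
    simpa using hdu
  obtain ⟨hw1, hw2⟩ := WordData.word hN (PM.const 1) hD w
  obtain ⟨R, hR⟩ := hw2 0
  simp only [_root_.one_zpow, inv_one, mul_one] at hw1
  have hz : dg (ZMod q) (fun x => evW (u' x) 1 w) = ∑ j : Fin (N + 1), HH.fst ((n.x : HH (ZMod q) D) * a j) *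
      HH.snd (hP (ZMod q) (N + 1)) ^ (j : ℕ) := by
    simpa using hR
  have key := HH.prod_coeff_eq_zero hN hw1 _ hz hc fun x => H (u' x) (hsu x) 1 (one_mem _)
  have h1 := hinj (fun _ => C n.x * β) (fun m => ?_) 1 ?_
  · exact HH.one_ne_zero' h1
  · rw [coeff_C_mul, hβ0]
    simpa using hqx
  · rw [map_one, one_mul, ← key]
    congr 2
    funext m
    have e1 : N - ((m.rev.castSucc : Fin (N + 1)) : ℕ) = m + 1 := by
      simp [Fin.val_rev]; omega
    simp only [a, e1]
    rw [if_neg (Fin.castSucc_lt_last _).ne, add_zero, show (X : ℤ[X]) ^ (m + 1 : ℕ) * (C n.x * β) = n.x • (X ^ (m + 1 : ℕ) * β) by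
      rw [zsmul_eq_mul, ← map_intCast (C : ℤ →+* ℤ[X])]; simp; ring, map_zsmul, zsmul_eq_mul]

theorem exists_solution_of_y_ne_zero {N : ℕ} (w : Monoid.Coprod (SU (N + 1)) (FreeGroup (Fin 2)))
    (hy : (Heis.ofFree (contentHom _ w)).y ≠ 0) :
    ∃ a b : SU (N + 1), Monoid.Coprod.lift (MonoidHom.id (SU (N + 1))) (FreeGroup.lift ![a, b]) w = 1 := by
  let σ : FreeGroup (Fin 2) →* FreeGroup (Fin 2) := FreeGroup.lift ![.of 1, .of 0]
  let S : Monoid.Coprod (SU (N + 1)) (FreeGroup (Fin 2)) →* Monoid.Coprod (SU (N + 1)) (FreeGroup (Fin 2)) :=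
    Monoid.Coprod.map (MonoidHom.id _) σ
  have hS : ∀ w, contentHom _ (S w) = σ (contentHom _ w) := fun w => by
    have : (contentHom (SU (N + 1))).comp S = σ.comp (contentHom _) := by
      refine Monoid.Coprod.hom_ext ?_ (FreeGroup.ext_hom _ _ fun i => ?_)
      · ext1 c; simp [S, contentHom]
      · simp [S, contentHom]
    exact DFunLike.congr_fun this w
  have hσ : ∀ v, (Heis.ofFree (σ v)).x = (Heis.ofFree v).y := fun v => by
    have hg : ∀ i, (Heis.ofFree (σ (.of i))).x = (Heis.ofFree (.of i)).y := fun i => by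
      fin_cases i <;> simp [σ, Heis.ofFree]
    induction v using FreeGroup.induction_on with
    | C1 => simp
    | of i => exact hg i
    | inv_of i _ => simp [hg]
    | mul v w hv hw => simp [hv, hw]
  obtain ⟨a, b, hab⟩ := exists_solution_of_x_ne_zero (S w) (by rwa [hS, hσ])
  refine ⟨b, a, ?_⟩
  have : (Monoid.Coprod.lift (MonoidHom.id (SU (N + 1))) (FreeGroup.lift ![a, b])).comp S =
      Monoid.Coprod.lift (MonoidHom.id (SU (N + 1))) (FreeGroup.lift ![b, a]) := by
    refine Monoid.Coprod.hom_ext ?_ (FreeGroup.ext_hom _ _ fun i => ?_)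
    · ext1 c; simp [S]
    · fin_cases i <;> simp [S, σ]
  rw [← this]; exact hab

end

section

open Uniformity DGRing Matrix Polynomial

section

variable {M : ℕ}

/-- Diagonal unitary matrices. -/
noncomputable def UG.diag (n : ℕ) : (Fin n → Circle) →* UG n := MonoidHom.mk'
  (fun z => ⟨diagonal fun i => (z i : ℂ), mem_unitaryGroup_iff.2 (by
    rw [Matrix.star_eq_conjTranspose, Matrix.diagonal_conjTranspose, Matrix.diagonal_mul_diagonal, ← Matrix.diagonal_one]
    congr 1
    ext i
    rw [Pi.star_apply, RCLike.star_def, Complex.mul_conj, Complex.normSq_eq_norm_sq, Circle.norm_coe]; simp)⟩)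
  fun z w => Subtype.ext (by simp)

theorem UG.diag_mulSingle {n : ℕ} (j : Fin n) (l : Circle) : UG.diag n (Pi.mulSingle j l) = rfn l (eb n j) := by
  refine Subtype.ext ?_
  ext a b
  show diagonal (fun i => ((Pi.mulSingle j l : Fin n → Circle) i : ℂ)) a b = reflM _ _ a b
  simp only [reflM, eb, Matrix.add_apply, Matrix.smul_apply, vecMulVec_apply, Pi.star_apply, Matrix.one_apply, Matrix.diagonal_apply,
    Pi.mulSingle_apply, Pi.single_apply]
  by_cases h : a = b
  · subst h; by_cases h' : a = j <;> simp [h']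
  · by_cases h' : a = j
    · subst h'; simp [h, Ne.symm h]
    · simp [h, h']

theorem UG.sum_norm_sq {n : ℕ} (g : UG n) : ∑ a : Fin n × Fin n, ‖g.1 a.1 a.2‖ ^ 2 = n := by
  rw [Fintype.sum_prod_type_right]
  have : ∀ j, ∑ i, ‖g.1 i j‖ ^ 2 = 1 := fun j => by
    have := UG.norm_mulVec g (eb n j).v
    rw [(eb n j).norm_sq] at this
    simpa [eb] using this
  simp [this]

/-- Unitary matrices sending the second basis vector into the span of the first two, up to
scalars. -/
structure YM (M : ℕ) where
  g : UG (M + 2)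
  low : ∀ i : Fin M, g.1 i.succ.succ 1 = 0

noncomputable instance : UniformSpace (YM M) :=
  UniformSpace.comap (fun y (a b : Fin (M + 2) × Fin (M + 2)) => y.g.1 a.1 a.2 * star (y.g.1 b.1 b.2))
    (inferInstanceAs (UniformSpace (Fin (M + 2) × Fin (M + 2) → Fin (M + 2) × Fin (M + 2) → ℂ)))

/-- The transition phases of the line bundle over `YM M`. -/
noncomputable def yph (M : ℕ) : YM M → YM M → ℝ :=
  lph fun y (a : Fin (M + 2) × Fin (M + 2)) => y.g.1 a.1 a.2

theorem YM.uc_iff {C : Type*} [UniformSpace C] {f : C → YM M} : UniformContinuous f ↔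
    ∀ a b : Fin (M + 2) × Fin (M + 2), UniformContinuous fun x => (f x).g.1 a.1 a.2 * star ((f x).g.1 b.1 b.2) := by
  have h : IsUniformInducing fun (y : YM M) (a b : Fin (M + 2) × Fin (M + 2)) => y.g.1 a.1 a.2 * star (y.g.1 b.1 b.2) := ⟨rfl⟩
  rw [h.uniformContinuous_iff]
  simp only [uniformContinuous_pi]
  rfl

theorem YM.pm : PM (yph M) YM.g := fun i j =>
  lph_ps (c := (M + 2 : ℕ)) (by positivity) (fun y => by exact_mod_cast UG.sum_norm_sq y.g) (YM.uc_iff.1 uniformContinuous_id) (i, j)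

theorem yph_self (y : YM M) : yph M y y = 0 := by
  rw [yph, lph, sum_mul_star (c := (M + 2 : ℕ)) (UG.sum_norm_sq y.g), ph, Complex.ofReal_natCast, Complex.natCast_arg, zero_div]

theorem YM.phase : Phase (yph M) := YM.pm.phase

theorem YM.norm_sq_add (y : YM M) : ‖y.g.1 0 1‖ ^ 2 + ‖y.g.1 1 1‖ ^ 2 = 1 := by
  have := UG.norm_mulVec y.g (eb (M + 2) 1).v
  rw [(eb (M + 2) 1).norm_sq, Fin.sum_univ_succ, Fin.sum_univ_succ] at this
  simpa [eb, y.low] using this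

theorem YM.cc_sq (k : Type*) [CommRing k] : cc k (yph M) ^ 2 = 0 := by
  refine cc_pow_eq_zero k (s := fun (y : YM M) (i : Fin 2) => y.g.1 (Fin.castLE (by omega) i) 1) (VSec.sec ⟨fun i => YM.pm _ _, 1, one_pos, fun y => ?_⟩)
  rw [Fin.sum_univ_two]
  exact (YM.norm_sq_add y).ge

theorem YM.lift_ps {C : Type*} [UniformSpace C] {f : C → YM M} {F : C → UG (M + 2)} (hF : PM (fun _ _ => 0) F)
    {s : C → Circle} (hs : ∀ x a b, (f x).g.1 a b = s x * (F x).1 a b) :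
    UniformContinuous f ∧ PS (fun x y => yph M (f x) (f y)) fun x => (s x : ℂ) := by
  have h1 : ∀ z : Circle, (z : ℂ) * star (z : ℂ) = 1 := fun z => by
    rw [RCLike.star_def, Complex.mul_conj, Complex.normSq_eq_norm_sq, Circle.norm_coe]; simp
  have huc : UniformContinuous f := YM.uc_iff.2 fun a b =>
    ((hF a.1 a.2).zero_mul ((hF b.1 b.2).conj.congr fun _ _ => neg_zero)).uc.of_eq fun x => by
      rw [hs, hs, star_mul', mul_mul_mul_comm, h1, one_mul]
  refine ⟨huc, ?_⟩
  have := (PS.sum Finset.univ fun (a : Fin (M + 2) × Fin (M + 2)) _ => ((YM.pm a.1 a.2).comap huc).mul_uc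
    ((hF a.1 a.2).conj.congr fun _ _ => neg_zero)).const_mul (((M + 2 : ℕ) : ℂ)⁻¹)
  refine this.congr_fun fun x => ?_
  simp only [hs, mul_assoc]
  rw [← Finset.mul_sum, sum_mul_star (UG.sum_norm_sq (F x))]
  rw [Complex.ofReal_natCast, mul_left_comm, inv_mul_cancel₀ (by exact_mod_cast (by omega : M + 2 ≠ 0)), mul_one]

end

end

section

open Uniformity DGRing Matrix Polynomial

section

variable {M : ℕ}

/-- A path of unit vectors from the basis vector `e i` to the basis vector `e 0`. -/
noncomputable def arc (M : ℕ) (i : Fin (M + 1)) (t : unitInterval) : PVec (M + 2) :=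
  ⟨fun l => if l = i.succ then (Real.cos (Real.pi / 2 * t) : ℂ) else if l = 0 then (Real.sin (Real.pi / 2 * t) : ℂ) else 0, by
    rw [Fin.sum_univ_succ, Finset.sum_eq_single i (fun l _ h => by simp [h]) (by simp)]
    rw [if_neg (Fin.succ_ne_zero i).symm, if_pos rfl, if_pos rfl, Complex.norm_real, Complex.norm_real, Real.norm_eq_abs, Real.norm_eq_abs, sq_abs, sq_abs]
    exact Real.sin_sq_add_cos_sq _⟩

theorem arc_apply (i : Fin (M + 1)) (t : unitInterval) (l : Fin (M + 2)) : (arc M i t).v l =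
    if l = i.succ then (Real.cos (Real.pi / 2 * t) : ℂ) else if l = 0 then (Real.sin (Real.pi / 2 * t) : ℂ) else 0 := rfl

theorem arc_zero (i : Fin (M + 1)) : arc M i 0 = eb (M + 2) i.succ := by
  refine PVec.ext (funext fun l => ?_)
  simp [arc, eb, Pi.single_apply]

theorem arc_one (i : Fin (M + 1)) : arc M i 1 = eb (M + 2) 0 := by
  refine PVec.ext (funext fun l => ?_)
  simp only [arc, eb, Pi.single_apply, Set.Icc.coe_one, mul_one, Real.cos_pi_div_two, Real.sin_pi_div_two]
  by_cases h : l = 0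
  · subst h; simp [(Fin.succ_ne_zero i).symm]
  · simp [h]

theorem arc_uc (i : Fin (M + 1)) : UniformContinuous (arc M i) := by
  refine PVec.uc_iff.2 fun a b => CompactSpace.uniformContinuous_of_continuous ?_
  have h : ∀ a, Continuous fun t => (arc M i t).v a := fun a => by
    simp only [arc]
    split_ifs <;> fun_prop
  exact (h a).mul (h b).star

/-- A disc of unitary matrices, constant at the centre up to scalars and winding around the
boundary `M + 2` times. -/
noncomputable def disc (M : ℕ) (x : Circle × unitInterval) : UG (M + 2) :=
  rfn x.1⁻¹ (arc M 0 x.2) * rfn x.1⁻¹ (eb (M + 2) 0) * (List.ofFn fun i : Fin M => rfn x.1⁻¹ (arc M i.succ x.2)).prod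

theorem PM.list_prod {A : Type*} [UniformSpace A] {n : ℕ} (l : List (A → UG n)) (h : ∀ f ∈ l, PM (fun _ _ => 0) f) :
    PM (fun _ _ => 0) fun x => (l.map fun f => f x).prod := by
  induction l with
  | nil => simpa using PM.const 1
  | cons f l ih =>
    simp only [List.map_cons, List.prod_cons]
    exact (h f (by simp)).mul_zero' (ih fun g hg => h g (by simp [hg]))

theorem uc_circle_inv : UniformContinuous fun z : Circle => z⁻¹ :=
  CompactSpace.uniformContinuous_of_continuous continuous_inv

theorem disc_pm : PM (fun _ _ => 0) (disc M) := by
  have h1 : UniformContinuous fun x : Circle × unitInterval => x.1⁻¹ := uc_circle_inv.comp uniformContinuous_fst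
  have h2 : ∀ i, PM (fun _ _ => 0) fun x : Circle × unitInterval => rfn x.1⁻¹ (arc M i x.2) := fun i =>
    PM.rfn h1 ((arc_uc i).comp uniformContinuous_snd)
  have h3 := PM.list_prod (List.ofFn fun (i : Fin M) (x : Circle × unitInterval) => rfn x.1⁻¹ (arc M i.succ x.2)) fun f hf => by
    obtain ⟨i, rfl⟩ := List.mem_ofFn.1 hf
    exact h2 _
  simp only [List.map_ofFn] at h3
  exact ((h2 0).mul_zero' (PM.rfn h1 uniformContinuous_const)).mul_zero' h3

theorem disc_zero (z : Circle) : disc M (z, 0) = UG.scalar (M + 2) z⁻¹ := by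
  simp only [disc, arc_zero, ← UG.diag_mulSingle]
  rw [show (fun i : Fin M => UG.diag (M + 2) (Pi.mulSingle i.succ.succ z⁻¹)) = (UG.diag (M + 2)) ∘ fun i => Pi.mulSingle i.succ.succ z⁻¹ from rfl,
    ← List.map_ofFn, ← map_list_prod, ← map_mul, ← map_mul, List.prod_ofFn]
  have : Pi.mulSingle (0 : Fin (M + 1)).succ z⁻¹ * Pi.mulSingle 0 z⁻¹ * ∏ i : Fin M, Pi.mulSingle i.succ.succ z⁻¹ =
      (fun _ => z⁻¹ : Fin (M + 2) → Circle) := by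
    rw [← Finset.univ_prod_mulSingle (fun _ => z⁻¹ : Fin (M + 2) → Circle), Fin.prod_univ_succ, Fin.prod_univ_succ, mul_comm (Pi.mulSingle _ _), mul_assoc]
  rw [this]
  refine Subtype.ext ?_
  show diagonal _ = _ • 1
  rw [Matrix.smul_one_eq_diagonal]

theorem disc_one (z : Circle) : disc M (z, 1) = rfn (z ^ (M + 2))⁻¹ (eb (M + 2) 0) := by
  simp only [disc, arc_one]
  have h : ∀ m, rfn z⁻¹ (eb (M + 2) 0) ^ m = rfn (z⁻¹ ^ m) (eb (M + 2) 0) := fun m => by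
    induction m with
    | zero => simp [rfn_one]
    | succ m ih => rw [pow_succ, ih, rfn_mul, pow_succ]
  rw [List.ofFn_const, List.prod_replicate, ← sq, ← pow_add, h, inv_pow, show z ^ (2 + M) = z ^ (M + 2) from congrArg _ (Nat.add_comm 2 M)]

theorem rfn_mulVec_low {l : Circle} {ℓ : PVec (M + 2)} (hℓ : ∀ i : Fin M, ℓ.v i.succ.succ = 0) {v : Fin (M + 2) → ℂ}
    (hv : ∀ i : Fin M, v i.succ.succ = 0) (i : Fin M) : ((rfn l ℓ).1 *ᵥ v) i.succ.succ = 0 := by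
  rw [rfn_mulVec]
  simp [hℓ, hv]

theorem succ_succ_ne_one (i : Fin M) : i.succ.succ ≠ (1 : Fin (M + 2)) := fun h =>
  Fin.succ_ne_zero i (Fin.succ_injective _ (h.trans Fin.succ_zero_eq_one.symm))

theorem disc_low (x : Circle × unitInterval) (i : Fin M) : (disc M x).1 i.succ.succ 1 = 0 := by
  have h1 : ∀ i : Fin M, (eb (M + 2) 1).v i.succ.succ = 0 := fun i => Pi.single_eq_of_ne (succ_succ_ne_one i) (1 : ℂ)
  have h0 : ∀ i : Fin M, (eb (M + 2) 0).v i.succ.succ = 0 := fun i => Pi.single_eq_of_ne (Fin.succ_ne_zero _) (1 : ℂ)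
  have ha : ∀ i : Fin M, (arc M 0 x.2).v i.succ.succ = 0 := fun i => by
    rw [arc_apply, if_neg (by rw [Fin.succ_zero_eq_one]; exact succ_succ_ne_one i), if_neg (Fin.succ_ne_zero _)]
  have hfix : ∀ (i : Fin M), (rfn x.1⁻¹ (arc M i.succ x.2)).1 *ᵥ (eb (M + 2) 1).v = (eb (M + 2) 1).v := fun i => by
    rw [rfn_mulVec]
    have : star (arc M i.succ x.2).v ⬝ᵥ (eb (M + 2) 1).v = 0 := by
      rw [eb, dotProduct_single, mul_one, Pi.star_apply, arc_apply, if_neg (succ_succ_ne_one i).symm,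
        if_neg one_ne_zero, star_zero]
    rw [this, mul_zero, zero_smul, add_zero]
  have hprod : (List.ofFn fun i : Fin M => rfn x.1⁻¹ (arc M i.succ x.2)).prod.1 *ᵥ (eb (M + 2) 1).v = (eb (M + 2) 1).v := by
    refine List.prod_induction (fun g : UG (M + 2) => g.1 *ᵥ (eb (M + 2) 1).v = (eb (M + 2) 1).v) ?_ (Matrix.one_mulVec _) ?_
    · intro a b ha hb
      rw [UnitaryGroup.mul_val, ← Matrix.mulVec_mulVec, hb, ha]
    · intro g hg
      obtain ⟨i, rfl⟩ := List.mem_ofFn.1 hg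
      exact hfix i
  have hcol : (disc M x).1 i.succ.succ 1 = ((disc M x).1 *ᵥ (eb (M + 2) 1).v) i.succ.succ := by simp [eb]
  rw [hcol, disc, UnitaryGroup.mul_val, UnitaryGroup.mul_val, ← Matrix.mulVec_mulVec, hprod, ← Matrix.mulVec_mulVec]
  exact rfn_mulVec_low ha (rfn_mulVec_low h0 h1) i

open Classical in
/-- The trivialisation of the tautological line bundle over the disc. -/
noncomputable def discSec (x : Circle × unitInterval) : Circle := if x.2 = 0 then x.1 else 1

theorem YM.eq_zero_of_mul_cc {k : Type*} [CommRing k] (hk : ((M + 2 : ℕ) : k) = 0) {A : Type*} [UniformSpace A]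
    {a : HH k A} (h : HH.pull Prod.fst uniformContinuous_fst a *
      HH.pull Prod.snd uniformContinuous_snd (cc k (yph M)) = 0) : a = 0 := by
  let γ : Circle × unitInterval → YM M := fun x => ⟨UG.scalar _ (discSec x) * disc M x, fun i => by
    show ((discSec x : ℂ) • 1 * (disc M x).1) i.succ.succ 1 = 0
    rw [smul_mul_assoc, one_mul, Matrix.smul_apply, disc_low, smul_zero]⟩
  have hsc : ∀ (z : Circle) (g : UG (M + 2)) a b, (UG.scalar _ z * g).1 a b = z * g.1 a b := fun z g a b => by
    show ((z : ℂ) • 1 * g.1) a b = _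
    rw [smul_mul_assoc, one_mul, Matrix.smul_apply, smul_eq_mul]
  obtain ⟨hγ, hs⟩ := YM.lift_ps (f := γ) disc_pm fun x => hsc (discSec x) (disc M x)
  let γ₁ : Circle → YM M := fun z => ⟨rfn z⁻¹ (eb (M + 2) 0), fun i => by
    simp [rfn, reflM, eb, vecMulVec_apply, Matrix.one_apply_ne (succ_succ_ne_one i)]⟩
  obtain ⟨hγ₁, hs₁⟩ := YM.lift_ps (f := γ₁) (PM.rfn uc_circle_inv (L := fun _ => eb (M + 2) 0) uniformContinuous_const) (s := fun _ => 1) fun z a b => by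
    simp [γ₁]
  have hext : ∀ {x y : YM M}, x.g = y.g → x = y := fun {x y} h => by cases x; cases y; simp_all
  refine HH.eq_zero_of_mul_cc hk (by omega) YM.phase hγ hs (fun _ => Circle.norm_coe _) (x₀ := γ (1, 0)) (yph_self _)
    (fun z => hext ?_) (fun z => ?_) hγ₁ (fun z => hext ?_) (fun z => ?_) (by simpa using hs₁) h
  · have : ∀ z, (γ (z, 0)).g = 1 := fun z => by
      show UG.scalar _ (discSec (z, 0)) * disc M (z, 0) = 1
      rw [disc_zero, discSec, if_pos rfl]
      refine Subtype.ext ?_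
      ext a b
      rw [hsc]
      simp [UG.scalar]
    rw [this, this]
  · rw [discSec, if_pos rfl]
  · show UG.scalar _ (discSec (z, 1)) * disc M (z, 1) = rfn _ _
    rw [disc_one, discSec, if_neg (by simp)]
    refine Subtype.ext ?_
    ext a b
    rw [hsc]
    simp
  · rw [discSec, if_neg (by simp)]; simp

/-- Over a prime field there are families of matrices twisted by line bundles with as nontrivial
powers of the characteristic class as possible. -/
theorem exists_twisted_family {p : ℕ} [Fact p.Prime] (hp : M + 2 = p) (i : ℕ) (hi : i ≤ M + 1) :
    ∃ (B : Type) (_ : UniformSpace B) (b : B → UG (M + 2)) (φ : B → B → ℝ), PM φ b ∧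
      cc (ZMod p) φ ^ i ≠ 0 ∧ cc (ZMod p) φ ^ (i + 1) = 0 := by
  induction i with
  | zero =>
    refine ⟨Unit, inferInstance, fun _ => 1, fun _ _ => 0, PM.const 1, ?_, ?_⟩
    · rw [pow_zero]; exact HH.one_ne_zero'
    · rw [zero_add, pow_one]
      exact cc_eq_zero _ (PS.const 1) ⟨1, one_pos, fun _ => by simp⟩
  | succ i ih =>
    obtain ⟨B, _, b, φ, hb, h1, h2⟩ := ih (by omega)
    have hcc : cc (ZMod p) (fun x y : B × YM M => φ x.1 y.1 + yph M x.2 y.2) =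
        HH.pull Prod.snd uniformContinuous_snd (cc (ZMod p) (yph M)) + HH.pull Prod.fst uniformContinuous_fst (cc (ZMod p) φ) := by
      rw [pull_cc _ YM.phase, pull_cc _ hb.phase, cc_add (φ := fun x y : B × YM M => φ x.1 y.1) _ (hb.phase.comap uniformContinuous_fst) (YM.phase.comap uniformContinuous_snd), add_comm]
    have hsq : HH.pull (Prod.snd : B × YM M → YM M) uniformContinuous_snd (cc (ZMod p) (yph M)) ^ 2 = 0 := by
      rw [← map_pow, YM.cc_sq, map_zero]
    have hcomm : ∀ a : HH (ZMod p) (B × YM M), Commute (HH.pull Prod.snd uniformContinuous_snd (cc (ZMod p) (yph M))) a := fun a => by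
      rw [pull_cc _ YM.phase]; exact cc_commute _ _ _
    refine ⟨B × YM M, inferInstance, fun x => b x.1 * x.2.g, fun x y => φ x.1 y.1 + yph M x.2 y.2,
      (hb.comap uniformContinuous_fst).mul (YM.pm.comap uniformContinuous_snd), ?_, ?_⟩
    · rw [hcc, add_pow_of_sq_zero hsq (hcomm _), ← map_pow, h2, map_zero, zero_add]
      intro h
      have h3 := (NInv.zmod (q := p) (Nat.succ_pos i) (by omega)).cancel h
      rw [(hcomm _).eq, ← map_pow] at h3
      exact h1 (YM.eq_zero_of_mul_cc (by rw [hp]; exact ZMod.natCast_self p) h3)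
    · rw [hcc, add_pow_of_sq_zero hsq (hcomm _), ← map_pow, ← map_pow, h2, pow_succ, h2]
      simp

end

end

section

open Uniformity DGRing Matrix Polynomial

theorem exists_prod_eq {R : Type*} [Ring R] {y : R} (hy : ∀ a, Commute y a) {n : ℕ} (A r : Fin n → R) :
    ∃ S, (List.ofFn fun m => y * (A m + y * r m)).prod = y ^ n * (List.ofFn A).prod + y ^ (n + 1) * S := by
  induction n with
  | zero => exact ⟨0, by simp⟩
  | succ n ih =>
    obtain ⟨S, hS⟩ := ih (fun m => A m.succ) fun m => r m.succ
    refine ⟨A 0 * S + r 0 * ((List.ofFn fun m => A m.succ).prod + y * S), ?_⟩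
    rw [List.ofFn_succ, List.prod_cons, hS, List.ofFn_succ, List.prod_cons]
    have h1 : ∀ j (a b : R), a * (y ^ j * b) = y ^ j * (a * b) := fun j a b => by
      rw [← mul_assoc, ← ((hy a).pow_left j).eq, mul_assoc]
    generalize (List.ofFn fun m => A m.succ).prod = P
    have h2 : A 0 * (y * S) = y * (A 0 * S) := by simpa using h1 1 (A 0) S
    have h3 : y * (A 0 + y * r 0) * (P + y * S) = y * (A 0 * P) + y * (y * (A 0 * S + r 0 * (P + y * S))) := by
      rw [mul_assoc, add_mul, mul_add (A 0), h2]
      noncomm_ring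
    rw [pow_succ y n, mul_assoc (y ^ n), ← mul_add, h1, h3]
    simp only [pow_succ, mul_add, mul_assoc]

theorem exists_solution_of_not_dvd_z {M : ℕ} [Fact (M + 2).Prime] (w : Monoid.Coprod (SU (M + 2)) (FreeGroup (Fin 2)))
    (hx : (Heis.ofFree (contentHom _ w)).x = 0) (hy : (Heis.ofFree (contentHom _ w)).y = 0)
    (hz : ¬ ((M + 2 : ℕ) : ℤ) ∣ (Heis.ofFree (contentHom _ w)).z) :
    ∃ a b : SU (M + 2), Monoid.Coprod.lift (MonoidHom.id (SU (M + 2))) (FreeGroup.lift ![a, b]) w = 1 := by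
  by_contra hno
  obtain ⟨c, hc, H⟩ := exists_dev_lower w hno
  have H' := exists_dev_lower_of_scalar H hx hy
  obtain ⟨B, _, b, φ, hb, hy1, hy2⟩ := exists_twisted_family (M := M) (p := M + 2) rfl (M + 1) le_rfl
  have hN : ∀ i, 0 < i → i ≤ M + 1 → NInv (ZMod (M + 2)) i := fun i h0 hi => .zmod h0 (by omega)
  obtain ⟨β, hβ0, hβ⟩ := exists_beta (q := M + 2) hN
  obtain ⟨⟨D, _, π, hπ, u, hu, L, hdg, -, -, hinj⟩⟩ := Peel.nonempty hN hb hβ 0 (M + 1) (by omega)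
  set Y : HH (ZMod (M + 2)) D := HH.pull π hπ (cc (ZMod (M + 2)) φ) with hY
  have hYc : ∀ a, Commute Y a := fun a => by rw [hY, pull_cc _ hb.phase]; exact cc_commute _ _ _
  have hD : WordData (fun x => b (π x)) Y (fun j => L (X ^ (M + 1 - j : ℕ) * β))
      (fun j => L (derivative (X ^ (M + 1 - j : ℕ) * β))) u ⟨1, 0, 0⟩ := by
    refine ⟨by simpa using hu, fun e => ?_⟩
    simpa using hdg e
  obtain ⟨hw1, hw2⟩ := WordData.word hN (hb.comap hπ) hD w
  obtain ⟨R, hR⟩ := hw2 0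
  rw [hy] at hw1
  simp only [_root_.zpow_zero, inv_one, mul_one] at hw1
  set z := (Heis.ofFree (contentHom _ w)).z with hzdef
  simp only [hx, hy, _root_.zpow_zero, inv_one, mul_one, one_mul, Int.cast_zero, zero_mul, zero_add, add_zero] at hR
  have key := HH.prod_coeff_eq_zero hN hw1 _ hR hc fun x => H' (u x) (b (π x))
  let Q : Fin (M + 1) → ℤ[X] := fun m => C z * (C (m + 1 : ℤ) * β + X * derivative β)
  have hterm : ∀ m : Fin (M + 1), (z : HH (ZMod (M + 2)) D) * (Y * L (derivative (X ^ (M + 1 - (m.rev.castSucc : Fin (M + 2)) : ℕ) * β))) +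
      Y ^ 2 * R m.rev.castSucc = Y * (L (X ^ (m + 0 : ℕ) * Q m) + Y * R m.rev.castSucc) := fun m => by
    have e1 : M + 1 - ((m.rev.castSucc : Fin (M + 2)) : ℕ) = m + 1 := by
      simp [Fin.val_rev]; omega
    have e2 : X ^ (m + 0 : ℕ) * Q m = z • derivative (X ^ (m + 1 : ℕ) * β) := by
      rw [zsmul_eq_mul, ← map_intCast (C : ℤ →+* ℤ[X]), derivative_mul, derivative_X_pow]
      simp [Q]; ring
    rw [e1, e2, map_zsmul, zsmul_eq_mul, mul_add, ← mul_assoc Y Y, ← sq, ← mul_assoc, ← mul_assoc, ((hYc _).eq)]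
  simp only [hterm] at key
  obtain ⟨S, hS⟩ := exists_prod_eq hYc (fun m : Fin (M + 1) => L (X ^ (m + 0 : ℕ) * Q m)) fun m => R m.rev.castSucc
  rw [hS, hY, ← map_pow, ← map_pow, hy2, map_zero, zero_mul, add_zero] at key
  refine hy1 (hinj Q (fun m => ?_) _ key)
  have hcoef : (Q m).coeff 0 = -(z * (m + 1)) := by
    simp [Q, hβ0]
    ring
  rw [hcoef, dvd_neg, (Nat.prime_iff_prime_int.1 Fact.out).dvd_mul]
  rintro (h | h)
  · exact hz h
  · have := Int.le_of_dvd (by positivity) h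
    push_cast at this
    omega

/-- If `p` is prime and `w ∈ SU(p) ∗ F₂` is an equation in two variables with
coefficients in `SU(p)` whose content does not lie in `[F₂,F₂]^p·[F₂,[F₂,F₂]]`,
then `w(a,b) = 1` can be solved in `SU(p)`. -/
theorem equation_solvable_in_SU_of_prime
    (p : ℕ) (hp : p.Prime)
    (w : Monoid.Coprod (SU p) (FreeGroup (Fin 2)))
    (hw : contentHom (SU p) w ∉
      Subgroup.closure
        (((fun x : FreeGroup (Fin 2) => x ^ p) ''
          (commutator (FreeGroup (Fin 2)) : Set (FreeGroup (Fin 2)))) ∪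
         (⁅(⊤ : Subgroup (FreeGroup (Fin 2))), commutator (FreeGroup (Fin 2))⁆ :
          Subgroup (FreeGroup (Fin 2))))) :
    ∃ a b : SU p,
      Monoid.Coprod.lift (MonoidHom.id (SU p)) (FreeGroup.lift ![a, b]) w = 1 := by
  obtain ⟨M, rfl⟩ := Nat.exists_eq_add_of_le' hp.two_le
  have : Fact (M + 2).Prime := ⟨hp⟩
  by_cases hx : (Heis.ofFree (contentHom _ w)).x = 0
  · by_cases hy : (Heis.ofFree (contentHom _ w)).y = 0
    · exact exists_solution_of_not_dvd_z w hx hy fun hz => hw (Heis.mem_closure_of_ofFree hx hy hz)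
    · exact exists_solution_of_y_ne_zero w hy
  · exact exists_solution_of_x_ne_zero w hx

end
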